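/- For any partitions λ₁,…,λ_k, there exists a polynomial Q ∈ ℚ[X,Y] in two variables with rational coefficients such that for every integer m ≥ 0 the m-th derivative at q = 0 of the function q ↦ Q(q, tanh q)/cosh q equals s^odd_{λ₁,…,λ_k}(m). In other words, the exponential generating series F^odd_{λ₁,…,λ_k}(q) = Σ_m s^odd(m) q^m/m! of s-numbers of odd-degree real polynomials equals g(q) = 1/cosh(q) multiplied by a polynomial in q and f(q) = tanh(q) with rational coefficients. -/

import Mathlib

open Polynomial
open scoped Classical

/-- The ramification type of `w` for a real polynomial `P`: the multiset of
multiplicities of the complex roots of `P - w`. -/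
noncomputable def ramType (P : Polynomial ℝ) (w : ℝ) : Multiset ℕ :=
  ((P.map (algebraMap ℝ ℂ) - Polynomial.C (w : ℂ)).roots.toFinset.val).map
    fun z => (P.map (algebraMap ℝ ℂ) - Polynomial.C (w : ℂ)).rootMultiplicity z

/-- A disorder of `P`: a pair `x₁ < x₂` with `P x₁ = P x₂` and the multiplicity of `x₁`
as a root of `P - P x₁` strictly greater than that of `x₂`. -/
def disorders (P : Polynomial ℝ) : Set (ℝ × ℝ) :=
  {p | p.1 < p.2 ∧ P.eval p.1 = P.eval p.2 ∧
    (P - Polynomial.C (P.eval p.2)).rootMultiplicity p.2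
      < (P - Polynomial.C (P.eval p.1)).rootMultiplicity p.1}

/-- The sign `ε(P) = (-1)^{number of disorders}`. -/
noncomputable def epsilonP (P : Polynomial ℝ) : ℤ := (-1) ^ Nat.card (disorders P)

/-- `P = X^n + a₂ X^(n-2) + ⋯ + a_n`: monic of degree `n` with vanishing coefficient
of `X^(n-1)`. -/
def IsNormalized (n : ℕ) (P : Polynomial ℝ) : Prop :=
  P.natDegree = n ∧ P.Monic ∧ P.coeff (n - 1) = 0

/-- A multiset of positive integers summing to `n`. -/
def IsPartitionOf (n : ℕ) (Λ : Multiset ℕ) : Prop := Λ.sum = n ∧ 0 ∉ Λ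

/-- The reduced ramification type: subtract 1 from every part of the ramification type
and delete the zeros. -/
noncomputable def redRamType (P : Polynomial ℝ) (w : ℝ) : Multiset ℕ :=
  ((ramType P w).map fun a => a - 1).filter fun a => a ≠ 0

/-- The s-number of normalized real polynomials of degree `n = m + Σ|λᵢ| + 1` with
reduced ramification type `λ i` at the point `-(i+1)` for `i = 0,…,k-1`, and a simple
branch point at `-(k+j+1)` for `j = 0,…,m-1`. -/
noncomputable def sNum {k : ℕ} (lam : Fin k → Multiset ℕ) (m : ℕ) : ℤ :=
  ∑ᶠ P ∈ {P : Polynomial ℝ |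
      IsNormalized (m + (∑ i, (lam i).sum) + 1) P ∧
      (∀ i : Fin k, redRamType P (-(((i : ℕ) + 1 : ℕ) : ℝ)) = lam i) ∧
      ∀ j : Fin m, redRamType P (-((k + (j : ℕ) + 1 : ℕ) : ℝ)) = ({1} : Multiset ℕ)},
    epsilonP P

/-- `s^even(m)`: the s-number if the degree `n = m + Σ|λᵢ| + 1` is even, `0` otherwise. -/
noncomputable def sEven {k : ℕ} (lam : Fin k → Multiset ℕ) (m : ℕ) : ℤ :=
  if Even (m + (∑ i, (lam i).sum) + 1) then sNum lam m else 0

/-- `s^odd(m)`: the s-number if the degree `n = m + Σ|λᵢ| + 1` is odd, `0` otherwise. -/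
noncomputable def sOdd {k : ℕ} (lam : Fin k → Multiset ℕ) (m : ℕ) : ℤ :=
  if Odd (m + (∑ i, (lam i).sum) + 1) then sNum lam m else 0

open Polynomial
open scoped Classical
set_option linter.all false
namespace FO

/-! ## Algebra: differential algebra in `ℚ[x,t]` with derivation x to 1, t to 1 - t^2 -/

abbrev PP := MvPolynomial (Fin 2) ℚ

noncomputable def tt : PP := MvPolynomial.X 1
noncomputable def xx : PP := MvPolynomial.X 0

noncomputable def dl : Derivation ℚ PP PP := MvPolynomial.mkDerivation ℚ ![1, 1 - tt ^ 2]

noncomputable def evz : PP →+* ℚ := (MvPolynomial.aeval (fun _ => (0 : ℚ)) : PP →ₐ[ℚ] ℚ).toRingHom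

lemma dl_tt : dl tt = 1 - tt ^ 2 := by
  simp [dl, tt, MvPolynomial.mkDerivation_X]

lemma dl_xx : dl xx = 1 := by
  simp [dl, xx, MvPolynomial.mkDerivation_X]

lemma evz_tt : evz tt = 0 := by simp [evz, tt]
lemma evz_xx : evz xx = 0 := by simp [evz, xx]
lemma evz_C (c : ℚ) : evz (MvPolynomial.C c) = c := by simp [evz]

/-- embedding of `ℚ[X]` -/
noncomputable def em (p : ℚ[X]) : PP := Polynomial.aeval xx p

lemma em_add (p q : ℚ[X]) : em (p + q) = em p + em q := by simp [em]
lemma em_sub (p q : ℚ[X]) : em (p - q) = em p - em q := by simp [em]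
lemma em_C (c : ℚ) : em (C c) = MvPolynomial.C c := by simp [em]
lemma dl_em (p : ℚ[X]) : dl (em p) = em (derivative p) := by
  unfold em
  rw [Derivation.map_aeval, dl_xx]
  simp
lemma evz_em (p : ℚ[X]) : evz (em p) = p.eval 0 := by
  induction p using Polynomial.induction_on' with
  | add p q hp hq => rw [em_add, map_add, hp, hq, eval_add]
  | monomial n a =>
    rcases n with _ | n
    · simp [em, evz]
    · simp [em, evz_xx]

lemma surj_D (c : ℚ) (hc : c ≠ 0) (g : ℚ[X]) :
    ∃ z : ℚ[X], derivative (derivative z) + C c * derivative z = g := by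
  have key : ∀ n : ℕ, ∃ z : ℚ[X], derivative (derivative z) + C c * derivative z = X ^ n := by
    intro n
    induction n with
    | zero => exact ⟨C (1 / c) * X, by simp [← C_mul, hc]⟩
    | succ n ih =>
      obtain ⟨z, hz⟩ := ih
      refine ⟨C (1 / (c * (n + 2))) * X ^ (n + 2) - C ((n + 1) / c) * z, ?_⟩
      have h2 : (n + 2 : ℚ) ≠ 0 := by positivity
      have e : derivative (derivative (C (1 / (c * (n + 2))) * X ^ (n + 2) - C ((n + 1) / c) * z))
          + C c * derivative (C (1 / (c * (n + 2))) * X ^ (n + 2) - C ((n + 1) / c) * z)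
          = C (1 / (c * (n + 2))) * C ((n : ℚ) + 2) * C ((n : ℚ) + 1) * X ^ n
            + C c * C (1 / (c * (n + 2))) * C ((n : ℚ) + 2) * X ^ (n + 1)
            - C ((n + 1) / c) * (derivative (derivative z) + C c * derivative z) := by
        simp only [derivative_sub, derivative_C_mul, derivative_X_pow]
        simp
        ring
      rw [e, hz, ← C_mul, ← C_mul, ← C_mul, ← C_mul]
      have e1 : 1 / (c * (n + 2)) * ((n : ℚ) + 2) * (n + 1) = (n + 1) / c := by field_simp
      have e2 : c * (1 / (c * (n + 2))) * ((n : ℚ) + 2) = 1 := by field_simp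
      rw [e1, e2]; simp
  induction g using Polynomial.induction_on' with
  | add p q hp hq =>
    obtain ⟨z1, h1⟩ := hp
    obtain ⟨z2, h2⟩ := hq
    exact ⟨z1 + z2, by rw [← h1, ← h2]; simp; ring⟩
  | monomial n a =>
    obtain ⟨z, hz⟩ := key n
    refine ⟨C a * z, ?_⟩
    rw [← C_mul_X_pow_eq_monomial, ← hz]; simp; ring

noncomputable def LL (y : PP) : PP := dl (dl y) + 2 * tt * dl y

lemma LL_form (p r : ℚ[X]) : LL (em p + em r * tt) =
    em (derivative (derivative p) + 2 * derivative r)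
      + em (derivative (derivative r) + 2 * derivative p) * tt := by
  have h2 : ∀ q : ℚ[X], em (2 * q) = 2 * em q := by intro q; rw [two_mul, two_mul, em_add]
  simp only [LL, map_add, Derivation.leibniz, dl_em, dl_tt, smul_eq_mul, map_sub, em_add, h2,
    Derivation.leibniz_pow, Derivation.map_one_eq_zero]
  simp [dl_tt]
  ring

lemma LL_surj (p0 r0 : ℚ[X]) (v w : ℚ) : ∃ p r : ℚ[X],
    LL (em p + em r * tt) = em p0 + em r0 * tt ∧ evz (em p + em r * tt) = v ∧
      evz (dl (em p + em r * tt)) = w := by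
  obtain ⟨α, hα⟩ := surj_D 2 (by norm_num) (p0 + r0)
  obtain ⟨β, hβ⟩ := surj_D (-2) (by norm_num) (p0 - r0)
  let c1 : ℚ := v - (C (1/2) * (α + β)).eval 0
  let c2 : ℚ := w - ((C (1/2) * (α - β)).eval 0 + (derivative (C (1/2) * (α + β))).eval 0)
  refine ⟨C (1/2) * (α + β) + C c1, C (1/2) * (α - β) + C c2, ?_, ?_, ?_⟩
  · rw [LL_form]
    have hh : (C (1/2) : ℚ[X]) * 2 = 1 := by
      rw [show (2 : ℚ[X]) = C 2 from rfl, ← C_mul]; norm_num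
    have e2 : (C 2 : ℚ[X]) = 2 := rfl
    have e3 : (C (-2) : ℚ[X]) = -2 := by rw [C_neg]; rfl
    rw [e2] at hα; rw [e3] at hβ
    refine congr_arg₂ (· + ·) (congr_arg em ?_) (congr_arg (· * tt) (congr_arg em ?_))
    · simp only [derivative_add, derivative_C_mul, derivative_sub, derivative_C, add_zero]
      linear_combination (C (1/2)) * hα + C (1/2) * hβ + p0 * hh
    · simp only [derivative_add, derivative_C_mul, derivative_sub, derivative_C, add_zero]
      linear_combination (C (1/2)) * hα - C (1/2) * hβ + r0 * hh
  · rw [map_add, map_mul, evz_tt, evz_em, eval_add, eval_C]; simp [c1]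
  · rw [map_add, Derivation.leibniz, dl_em, dl_em, dl_tt]
    simp only [smul_eq_mul, map_add, map_mul, evz_em, evz_tt, map_sub, map_one, map_pow]
    simp only [c2, derivative_add, derivative_C, eval_add, eval_C]; simp; ring

/-- the tower `y_k` with `L y_{k+1} = y_k` -/
lemma tower (p0 r0 : ℚ[X]) : ∃ y : ℕ → PP, y 0 = em p0 + em r0 * tt ∧
    ∀ k, LL (y (k + 1)) = y k ∧ evz (y (k + 1)) = 0 ∧ evz (dl (y (k + 1))) = 0 := by
  choose P R h1 h2 h3 using fun x : ℚ[X] × ℚ[X] => LL_surj x.1 x.2 0 0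
  let s : ℕ → ℚ[X] × ℚ[X] := fun k => Nat.rec (p0, r0) (fun _ x => (P x, R x)) k
  exact ⟨fun k => em (s k).1 + em (s k).2 * tt, rfl, fun k => ⟨h1 _, h2 _, h3 _⟩⟩

section mat
variable {X : Type*} [Fintype X]

/-- entrywise derivation of matrices -/
noncomputable def dM {Y Z : Type*} (A : Matrix Y Z PP) : Matrix Y Z PP := A.map dl

lemma dM_mul {Y Z : Type*} (A : Matrix Y X PP) (B : Matrix X Z PP) :
    dM (A * B) = dM A * B + A * dM B := by
  ext i j
  simp only [dM, Matrix.map_apply, Matrix.mul_apply, map_sum, Derivation.leibniz, smul_eq_mul,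
    Matrix.add_apply, Finset.sum_add_distrib]
  rw [add_comm]
  have e : ∑ x, B x j * dl (A i x) = ∑ x, dl (A i x) * B x j :=
    Finset.sum_congr rfl fun k _ => mul_comm (B k j) (dl (A i k))
  rw [e]

lemma dM_add {Y Z : Type*} (A B : Matrix Y Z PP) : dM (A + B) = dM A + dM B := by
  ext; simp [dM]

lemma dM_neg {Y Z : Type*} (A : Matrix Y Z PP) : dM (-A) = -dM A := by
  ext; simp [dM]

lemma dM_one : dM (1 : Matrix X X PP) = 0 := by
  ext i j
  by_cases h : i = j <;> simp [dM, h, Matrix.one_apply]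

/-- constants -/
noncomputable def cM {Y Z : Type*} (A : Matrix Y Z ℚ) : Matrix Y Z PP := A.map MvPolynomial.C

lemma dM_cM {Y Z : Type*} (A : Matrix Y Z ℚ) : dM (cM A) = 0 := by
  ext i j; simp [dM, cM]

lemma dM_smul {Y Z : Type*} (p : PP) (A : Matrix Y Z PP) : dM (p • A) = dl p • A + p • dM A := by
  ext i j
  simp only [dM, Matrix.map_apply, Matrix.smul_apply, Matrix.add_apply, smul_eq_mul,
    Derivation.leibniz]
  rw [add_comm, mul_comm (A i j)]

/-- strictly triangular -/
def STri {R : Type*} [Zero R] (rk : X → ℕ) (A : Matrix X X R) : Prop :=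
  ∀ i j, A i j ≠ 0 → rk j < rk i
def WTri {R : Type*} [Zero R] (rk : X → ℕ) (A : Matrix X X R) : Prop :=
  ∀ i j, A i j ≠ 0 → rk j ≤ rk i

lemma STri.mulW {R : Type*} [Semiring R] {rk : X → ℕ} {A B : Matrix X X R} (hA : STri rk A)
    (hB : WTri rk B) : STri rk (A * B) := by
  intro i j h
  rw [Matrix.mul_apply] at h
  obtain ⟨k, _, hk⟩ := Finset.exists_ne_zero_of_sum_ne_zero h
  exact lt_of_le_of_lt (hB k j (right_ne_zero_of_mul hk)) (hA i k (left_ne_zero_of_mul hk))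

lemma STri.weak {R : Type*} [Zero R] {rk : X → ℕ} {A : Matrix X X R} (hA : STri rk A) :
    WTri rk A := fun i j h => (hA i j h).le

lemma STri.pow {R : Type*} [Semiring R] {rk : X → ℕ} {A : Matrix X X R} (hA : STri rk A) (k : ℕ) :
    ∀ i j, (A ^ k) i j ≠ 0 → rk j + k ≤ rk i := by
  induction k with
  | zero =>
    intro i j h
    by_cases hij : i = j
    · simp [hij]
    · simp [Matrix.one_apply, hij] at h
  | succ k ih =>
    intro i j h
    rw [pow_succ, Matrix.mul_apply] at h
    obtain ⟨l, _, hl⟩ := Finset.exists_ne_zero_of_sum_ne_zero h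
    have h1 := ih i l (left_ne_zero_of_mul hl)
    have h2 := hA l j (right_ne_zero_of_mul hl)
    omega

lemma STri.nilp {R : Type*} [Semiring R] {rk : X → ℕ} {A : Matrix X X R} (hA : STri rk A) :
    ∃ K, A ^ (K + 1) = 0 := by
  refine ⟨∑ x, rk x, ?_⟩
  ext i j
  by_contra h
  have := hA.pow _ i j h
  have h2 : rk i ≤ ∑ x, rk x := Finset.single_le_sum (f := rk) (fun _ _ => Nat.zero_le _) (Finset.mem_univ i)
  omega

lemma STri.add {R : Type*} [Semiring R] {rk : X → ℕ} {A B : Matrix X X R} (hA : STri rk A)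
    (hB : STri rk B) : STri rk (A + B) := by
  intro i j h
  by_cases h1 : A i j = 0
  · exact hB i j (by simpa [h1] using h)
  · exact hA i j h1

lemma STri.sum {R : Type*} [Semiring R] {rk : X → ℕ} {s : Finset ℕ} {A : ℕ → Matrix X X R}
    (hA : ∀ k ∈ s, STri rk (A k)) : STri rk (∑ k ∈ s, A k) := by
  intro i j h
  rw [Matrix.sum_apply] at h
  obtain ⟨k, hks, hk⟩ := Finset.exists_ne_zero_of_sum_ne_zero h
  exact hA k hks i j hk

/-- Existence of the fundamental matrix. -/
lemma exists_V (rk : X → ℕ) (η M0 : Matrix X X ℚ) (hη : STri rk η) (hM0 : STri rk M0) :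
    ∃ V V' : Matrix X X PP, V * V' = 1 ∧ V' * V = 1 ∧
      dM (dM V) + (2 * tt) • dM V = V * cM η ∧
      V.map evz = 1 ∧ (dM V).map evz = M0 := by
  obtain ⟨c, hc0, hc⟩ := tower 1 0
  obtain ⟨s, hs0, hs⟩ := tower 0 1
  have e1 : em 1 = 1 := by simp [em]
  have e0 : em 0 = 0 := by simp [em]
  rw [e1, e0, zero_mul, add_zero] at hc0
  rw [e1, e0, one_mul, zero_add] at hs0
  have hηc : STri rk (cM η) := fun i j h => hη i j (by
    intro h0; exact h (by simp [cM, h0]))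
  have hMc : STri rk (cM M0) := fun i j h => hM0 i j (by
    intro h0; exact h (by simp [cM, h0]))
  obtain ⟨K, hK⟩ := hηc.nilp
  -- general sum
  let G : (ℕ → PP) → Matrix X X PP := fun y => ∑ k ∈ Finset.range (K + 1), y k • (cM η) ^ k
  have hdpow : ∀ k, dM ((cM η) ^ k) = 0 := by
    intro k
    have : (cM η) ^ k = cM (η ^ k) := by
      unfold cM
      exact (Matrix.map_pow (M := η) (f := (MvPolynomial.C : ℚ →+* PP)) k).symm
    rw [this, dM_cM]
  have hdsum : ∀ f : ℕ → Matrix X X PP, ∀ n, dM (∑ k ∈ Finset.range n, f k) =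
      ∑ k ∈ Finset.range n, dM (f k) := by
    intro f n
    ext i j
    simp [dM, Matrix.sum_apply]
  have hdG : ∀ y, dM (G y) = G (fun k => dl (y k)) := by
    intro y
    simp only [G, hdsum, dM_smul, hdpow, smul_zero, add_zero]
  have hLG : ∀ y : ℕ → PP, LL (y 0) = 0 → (∀ k, LL (y (k + 1)) = y k) →
      dM (dM (G y)) + (2 * tt) • dM (G y) = G y * cM η := by
    intro y h0 hk
    rw [hdG, hdG]
    simp only [G, Finset.smul_sum, smul_smul, ← Finset.sum_add_distrib, ← add_smul]
    rw [Finset.sum_range_succ', show dl (dl (y 0)) + 2 * tt * dl (y 0) = 0 from h0, zero_smul,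
      add_zero, Finset.sum_mul, Finset.sum_range_succ, smul_mul_assoc, ← pow_succ, hK, smul_zero,
      add_zero]
    refine Finset.sum_congr rfl fun k _ => ?_
    rw [show dl (dl (y (k+1))) + 2 * tt * dl (y (k+1)) = y k from hk k, smul_mul_assoc, ← pow_succ]
  have hevG : ∀ y : ℕ → PP, (∀ k, evz (y (k+1)) = 0) → ∀ i j, evz (G y i j) = evz (y 0) * (1 : Matrix X X ℚ) i j := by
    intro y hy i j
    simp only [G, Matrix.sum_apply, map_sum, Matrix.smul_apply, smul_eq_mul, map_mul]
    rw [Finset.sum_range_succ', Finset.sum_eq_zero, zero_add]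
    · congr 1
      by_cases hij : i = j <;> simp [hij, Matrix.one_apply]
    · intro k _; rw [hy k, zero_mul]
  let V := G c + cM M0 * G s
  have hLc : LL (c 0) = 0 := by rw [hc0]; simp [LL]
  have hLs : LL (s 0) = 0 := by
    rw [hs0]; simp only [LL, dl_tt, map_sub, Derivation.leibniz_pow, Derivation.map_one_eq_zero]
    simp [dl_tt]; ring
  have hunip : ∃ N, STri rk N ∧ V = 1 + N := by
    refine ⟨(∑ k ∈ Finset.range K, c (k+1) • (cM η)^(k+1)) + cM M0 * G s, ?_, ?_⟩
    · refine STri.add (STri.sum ?_) (STri.mulW hMc ?_)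
      · intro k _ i j h
        have := hηc.pow (k+1) i j (by intro h0; exact h (by simp [h0]))
        omega
      · intro i j h
        simp only [G, Matrix.sum_apply] at h
        obtain ⟨k, _, hk⟩ := Finset.exists_ne_zero_of_sum_ne_zero h
        have := hηc.pow k i j (by intro h0; exact hk (by simp [h0]))
        omega
    · simp only [V, G]
      rw [Finset.sum_range_succ', hc0]; simp; abel
  obtain ⟨N, hN, hVN⟩ := hunip
  have hu : IsUnit V := by
    rw [hVN]
    obtain ⟨K', hK'⟩ := hN.nilp
    exact IsNilpotent.isUnit_one_add ⟨_, hK'⟩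
  obtain ⟨u, hu⟩ := hu
  refine ⟨V, (↑u⁻¹ : Matrix X X PP), by rw [← hu]; simp, by rw [← hu]; simp, ?_, ?_, ?_⟩
  · simp only [V, dM_add, dM_mul, dM_cM, zero_mul, zero_add, smul_add]
    rw [add_mul, mul_assoc, ← hLG c hLc (fun k => (hc k).1), ← hLG s hLs (fun k => (hs k).1)]
    rw [mul_add, mul_smul_comm]; abel
  · ext i j
    simp only [V, Matrix.map_apply, Matrix.add_apply, map_add, Matrix.mul_apply, map_sum, map_mul]
    rw [hevG c (fun k => (hc k).2.1), hc0, map_one, one_mul, Finset.sum_eq_zero, add_zero]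
    intro k _
    rw [hevG s (fun k => (hs k).2.1), hs0, evz_tt]; simp
  · ext i j
    simp only [V, dM_add, dM_mul, dM_cM, zero_mul, zero_add, hdG, Matrix.map_apply,
      Matrix.add_apply, map_add]
    rw [hevG (fun k => dl (c k)) (fun k => (hc k).2.2)]
    simp only [Matrix.mul_apply, map_sum, map_mul]
    have : ∀ x, evz (G (fun k => dl (s k)) x j) = (1 : Matrix X X ℚ) x j := by
      intro x
      rw [hevG (fun k => dl (s k)) (fun k => (hs k).2.2)]
      simp only [hs0, dl_tt]; simp [evz_tt]
    simp only [this, hc0, cM, Matrix.map_apply, evz_C]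
    simp [Matrix.one_apply]

end mat

end FO

open Polynomial
open scoped Classical
set_option linter.all false
namespace FO

lemma leib {A B M : Type*} [AddCommGroup M] (μ : A → B → M) (D1 : A → A) (D2 : B → B)
    (D3 : M →+ M) (h : ∀ a b, D3 (μ a b) = μ (D1 a) b + μ a (D2 b)) (n : ℕ) (a : A) (b : B) :
    D3^[n] (μ a b) = ∑ ij ∈ Finset.HasAntidiagonal.antidiagonal n,
      n.choose ij.1 • μ (D1^[ij.1] a) (D2^[ij.2] b) := by
  induction n with
  | zero => simp
  | succ n ih =>
    rw [Finset.sum_antidiagonal_choose_succ_nsmul (M := M) (fun i j => μ (D1^[i] a) (D2^[j] b)) n]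
    simp only [Function.iterate_succ_apply', ih, map_sum, map_nsmul, h, smul_add,
      Finset.sum_add_distrib]
    rw [add_comm]
    congr 1
    refine Finset.sum_congr rfl fun ⟨i, j⟩ hij => ?_
    rw [n.choose_symm_of_eq_add (Finset.HasAntidiagonal.mem_antidiagonal.1 hij).symm]

noncomputable def evq (q : ℝ) : PP →ₐ[ℚ] ℝ := MvPolynomial.aeval ![q, Real.tanh q]

lemma hasDerivAt_tanh (q : ℝ) : HasDerivAt Real.tanh (1 - Real.tanh q ^ 2) q := by
  have h := (Real.hasDerivAt_sinh q).div (Real.hasDerivAt_cosh q) (Real.cosh_pos q).ne'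
  have e : Real.tanh = fun x => Real.sinh x / Real.cosh x := funext Real.tanh_eq_sinh_div_cosh
  rw [Real.tanh_eq_sinh_div_cosh q, e]
  refine h.congr_deriv ?_
  have := (Real.cosh_pos q).ne'
  field_simp

lemma hasDerivAt_evq (p : PP) (q : ℝ) : HasDerivAt (fun q => evq q p) (evq q (dl p)) q := by
  induction p using MvPolynomial.induction_on with
  | C a => simpa [evq] using hasDerivAt_const q (a : ℝ)
  | add p r hp hr => simp only [map_add]; exact hp.add hr
  | mul_X p i hp =>
    have hX : HasDerivAt (fun q => evq q (MvPolynomial.X i)) (evq q (dl (MvPolynomial.X i))) q := by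
      fin_cases i
      · have : dl (MvPolynomial.X 0) = 1 := dl_xx
        simp only [Fin.zero_eta, Fin.isValue, this, map_one]
        simp only [evq, MvPolynomial.aeval_X]; exact hasDerivAt_id q
      · have : dl (MvPolynomial.X 1) = 1 - tt ^ 2 := dl_tt
        simp only [Fin.mk_one, Fin.isValue, this]
        simpa [evq, tt] using hasDerivAt_tanh q
    have := hp.mul hX
    simp only [map_mul, Derivation.leibniz, smul_eq_mul, map_add]
    refine this.congr_deriv ?_
    ring

noncomputable def nab (p : PP) : PP := dl p - tt * p

lemma evq_tt (q : ℝ) : evq q tt = Real.tanh q := by simp [evq, tt]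

lemma iter_nab (p : PP) (m : ℕ) : iteratedDeriv m (fun q => evq q p / Real.cosh q) =
    fun q => evq q (nab^[m] p) / Real.cosh q := by
  induction m with
  | zero => simp
  | succ m ih =>
    rw [iteratedDeriv_succ, ih]
    funext q
    have h := (hasDerivAt_evq (nab^[m] p) q).div (Real.hasDerivAt_cosh q) (Real.cosh_pos q).ne'
    have := h.deriv
    simp only [Pi.div_def] at this
    rw [this, Function.iterate_succ_apply', nab, map_sub, map_mul, evq_tt,
      Real.tanh_eq_sinh_div_cosh]
    have := (Real.cosh_pos q).ne'
    field_simp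

lemma evq_zero (p : PP) : evq 0 p = (evz p : ℝ) := by
  induction p using MvPolynomial.induction_on with
  | C a => simp [evq, evz]
  | add p r hp hr => simp [hp, hr]
  | mul_X p i hp =>
    rw [map_mul, map_mul, hp]
    fin_cases i <;> simp [evq, evz]

lemma alg_main {X : Type*} [Fintype X] (rk : X → ℕ) (M : ℕ → Matrix X X ℚ) (f : ℕ → X → ℚ)
    (hM : ∀ m, M (m + 2) = - ∑ ij ∈ Finset.HasAntidiagonal.antidiagonal (m + 1),
      (m + 1).choose ij.1 • (M ij.1 * M ij.2))
    (hf : ∀ m, f (m + 1) = - ∑ ij ∈ Finset.HasAntidiagonal.antidiagonal m,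
      m.choose ij.1 • (Matrix.mulVec (M ij.1) (f ij.2)))
    (h0 : STri rk (M 0)) (h1 : STri rk (M 1 - 1)) (x : X) :
    ∃ Q : MvPolynomial (Fin 2) ℚ, ∀ m : ℕ,
        iteratedDeriv m
            (fun q : ℝ => (MvPolynomial.aeval ![q, Real.tanh q]) Q / Real.cosh q) 0
          = (f m x : ℝ) := by
  have hη : STri rk (M 1 - 1 + M 0 * M 0) := h1.add (h0.mulW h0.weak)
  obtain ⟨V, V', hVV', hV'V, hV2, hVe, hdVe⟩ := exists_V rk _ _ hη h0
  set η := M 1 - 1 + M 0 * M 0 with hηd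
  have hV'e : V'.map evz = 1 := by
    have : (V * V').map evz = 1 := by rw [hVV']; exact Matrix.map_one _ (map_zero _) (map_one _)
    rw [Matrix.map_mul, hVe, one_mul] at this
    exact this
  have hdV' : dM V' = -(V' * dM V * V') := by
    have : dM (V' * V) = 0 := by rw [hV'V, dM_one]
    rw [dM_mul] at this
    have h2 : dM V' = dM V' * V * V' := by rw [mul_assoc, hVV', mul_one]
    rw [h2, eq_neg_of_add_eq_zero_left this]
    rw [neg_mul]
  let N := V' * dM V
  let G : Matrix X X PP := tt • 1 + N
  have hdN : dM N = - (N * N) + cM η - (2 * tt) • N := by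
    have e : dM (dM V) = V * cM η - (2 * tt) • dM V := eq_sub_of_add_eq hV2
    simp only [N]
    rw [dM_mul, hdV', e, mul_sub, ← mul_assoc, hV'V, one_mul, mul_smul_comm, neg_mul]
    simp only [mul_assoc]
    abel
  have hG : dM G = (1 + cM η) - G * G := by
    simp only [G]
    rw [dM_add, dM_smul, dM_one, smul_zero, add_zero, dl_tt, hdN]
    simp only [add_mul, mul_add, smul_mul_assoc, mul_smul_comm, one_mul, mul_one, sub_smul,
      one_smul, pow_two, two_mul, add_smul, mul_smul, smul_add]
    abel
  have hev : ∀ (A : Matrix X X PP) (B : Matrix X X PP), (A * B).map evz = A.map evz * B.map evz :=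
    fun A B => Matrix.map_mul
  let dMh : Matrix X X PP →+ Matrix X X PP := AddMonoidHom.mk' dM dM_add
  have hdMh : ∀ n, dM^[n] = (dMh : Matrix X X PP → Matrix X X PP)^[n] := fun n => rfl
  have hGm : ∀ m, (dM^[m] G).map evz = M m := by
    intro m
    induction m using Nat.strong_induction_on with
    | _ m ih =>
      have hG0 : G.map evz = M 0 := by
        ext i j
        simp only [G, Matrix.map_apply, Matrix.add_apply, Matrix.smul_apply, smul_eq_mul, map_add,
          map_mul, evz_tt, zero_mul, zero_add]
        have : N.map evz = M 0 := by
          simp only [N]; rw [Matrix.map_mul, hV'e, hdVe, one_mul]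
        rw [← this]; rfl
      rcases m with _ | _ | m
      · exact hG0
      · have e1 : (dM^[0 + 1] G) = (1 + cM η) - G * G := hG
        rw [e1]
        have e2 : ((1 + cM η) - G * G).map evz = 1 + η - G.map evz * G.map evz := by
          rw [← hev]
          ext i j
          by_cases hij : i = j <;>
            simp [cM, evz_C, hij, Matrix.one_apply, -Matrix.map_mul]
        rw [e2, hG0, hηd]; abel
      · rw [Function.iterate_succ_apply, Function.iterate_succ_apply, hG]
        have e3 : dM ((1 + cM η) - G * G) = -(dM (G * G)) := by
          rw [sub_eq_add_neg, dM_add, dM_add, dM_one, dM_cM, dM_neg]; simp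
        have e4 : dM^[m] (-(dM (G * G))) = dM^[m + 1] (-(G * G)) := by
          rw [Function.iterate_succ_apply, dM_neg]
        rw [e3, e4]
        have e5 := leib (fun a b : Matrix X X PP => -(a * b)) dM dM dMh
          (by intro a b; show dM (-(a * b)) = _; rw [dM_neg, dM_mul, neg_add]) (m + 1) G G
        have e6 : (dMh : Matrix X X PP → Matrix X X PP) = dM := rfl
        rw [e6] at e5
        rw [e5, hM, ← Finset.sum_neg_distrib]
        ext i j
        simp only [Matrix.map_apply, Matrix.sum_apply, map_sum]
        refine Finset.sum_congr rfl fun ij hij => ?_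
        have hij' := Finset.HasAntidiagonal.mem_antidiagonal.1 hij
        rw [← ih ij.1 (by omega), ← ih ij.2 (by omega), ← hev]
        simp only [Matrix.smul_apply, Matrix.neg_apply, map_nsmul, map_neg, smul_neg, Matrix.map_apply]
  let f0 : Matrix X Unit PP := fun i _ => MvPolynomial.C (f 0 i)
  let φ : Matrix X Unit PP := V' * f0
  let nM : Matrix X Unit PP → Matrix X Unit PP := fun A => A.map nab
  let nMh : Matrix X Unit PP →+ Matrix X Unit PP := AddMonoidHom.mk' nM (by
    intro a b; refine Matrix.ext fun i j => ?_; simp only [nM, nab, Matrix.map_apply, Matrix.add_apply, map_add]; ring)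
  have hnM : ∀ A, nM A = dM A - tt • A := by
    intro A; refine Matrix.ext fun i j => ?_; simp [nM, nab, dM]
  have hdf0 : dM f0 = 0 := by
    refine Matrix.ext fun i j => ?_; show dl (MvPolynomial.C (f 0 i)) = 0; simp
  have hφ : nM φ = -(G * φ) := by
    rw [hnM]
    simp only [φ, G]
    rw [dM_mul, hdf0, hdV', Matrix.add_mul]
    simp only [N, Matrix.mul_zero, add_zero, Matrix.mul_assoc, Matrix.neg_mul, Matrix.smul_mul,
      Matrix.one_mul]
    rw [neg_add]; abel
  have hφm : ∀ m i, evz ((nM^[m] φ) i ()) = f m i := by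
    intro m
    induction m using Nat.strong_induction_on with
    | _ m ih =>
      intro i
      rcases m with _ | m
      · have : φ.map evz = (V'.map evz) * f0.map evz := Matrix.map_mul
        rw [hV'e, Matrix.one_mul] at this
        have := congrFun (congrFun this i) ()
        rw [Matrix.map_apply, Matrix.map_apply] at this; exact this.trans (evz_C _)
      · rw [Function.iterate_succ_apply, hφ]
        have e5 := leib (fun (a : Matrix X X PP) (b : Matrix X Unit PP) => -(a * b)) dM nM nMh
          (by
            intro a b; show nM (-(a * b)) = _; rw [hnM, hnM, dM_neg, dM_mul, Matrix.mul_sub,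
              Matrix.mul_smul, smul_neg]; abel) m G φ
        have e6 : (nMh : Matrix X Unit PP → Matrix X Unit PP) = nM := rfl
        rw [e6] at e5
        rw [e5, hf]
        simp only [Matrix.sum_apply, map_sum, Pi.neg_apply, Finset.sum_apply]
        rw [← Finset.sum_neg_distrib]
        refine Finset.sum_congr rfl fun ij hij => ?_
        have hij' := Finset.HasAntidiagonal.mem_antidiagonal.1 hij
        simp only [Matrix.smul_apply, Matrix.neg_apply, map_nsmul, map_neg, Pi.smul_apply,
          smul_neg, Matrix.mul_apply, map_sum, map_mul, Matrix.mulVec, dotProduct]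
        congr 2
        refine Finset.sum_congr rfl fun k _ => ?_
        rw [ih ij.2 (by omega), ← hGm ij.1]; rfl
  refine ⟨φ x (), fun m => ?_⟩
  have h1 := congrFun (iter_nab (φ x ()) m) 0
  have h2 : ∀ m, (nM^[m] φ) x () = nab^[m] (φ x ()) := by
    intro m
    induction m with
    | zero => rfl
    | succ m ih => rw [Function.iterate_succ_apply', Function.iterate_succ_apply', ← ih]; rfl
  rw [← hφm m x, h2]
  simp only [Real.cosh_zero, div_one, evq_zero] at h1
  exact h1

end FO

open Polynomial
open scoped Classical
set_option linter.all false
namespace FO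
open Filter Topology

/-! ## Polynomials with prescribed critical points -/

noncomputable def cp {ι : Type*} [Fintype ι] (a : ι → ℕ) (ξ : ι → ℂ) : ℂ[X] :=
  ∏ j, (X - C (ξ j)) ^ (a j)

section cp
variable {ι : Type*} [Fintype ι] (a : ι → ℕ) (ξ : ι → ℂ)

lemma cp_monic : (cp a ξ).Monic := monic_prod_of_monic _ _ fun j _ => (monic_X_sub_C _).pow _

lemma cp_natDegree : (cp a ξ).natDegree = ∑ j, a j := by
  unfold cp
  rw [natDegree_prod_of_monic _ _ fun j _ => (monic_X_sub_C _).pow _]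
  simp

lemma cp_eval (x : ℂ) : (cp a ξ).eval x = ∏ j, (x - ξ j) ^ a j := by
  simp [cp, eval_prod]

lemma cp_rootMult (w : ℂ) : (cp a ξ).rootMultiplicity w = ∑ j, if ξ j = w then a j else 0 := by
  unfold cp
  have key : ∀ s : Finset ι, (∏ j ∈ s, (X - C (ξ j)) ^ (a j)).rootMultiplicity w
      = ∑ j ∈ s, if ξ j = w then a j else 0 := by
    intro s
    induction s using Finset.induction_on with
    | empty => simp
    | insert j s hj ih =>
      have hne : ∀ t : Finset ι, (∏ j ∈ t, (X - C (ξ j)) ^ (a j)) ≠ 0 := fun t =>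
        (monic_prod_of_monic _ _ fun j _ => (monic_X_sub_C _).pow _).ne_zero
      rw [Finset.sum_insert hj, ← ih]
      have h0 := hne (insert j s)
      rw [Finset.prod_insert hj] at h0 ⊢
      rw [rootMultiplicity_mul h0, ← count_roots ((X - C (ξ j)) ^ a j), roots_pow, roots_X_sub_C, Multiset.count_nsmul,
        Multiset.count_singleton]
      by_cases h : ξ j = w
      · simp [h]
      · simp [h, Ne.symm h]
  exact key _

/-- All critical points at the same level coincide. -/
lemma one_lem (ha : ∀ j, 1 ≤ a j) (e0 : ℂ) (he : e0 ≠ 0) (f : ℂ[X])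
    (hf : derivative f = C e0 * cp a ξ) (hv : ∀ j k, f.eval (ξ j) = f.eval (ξ k)) :
    ∀ j k, ξ j = ξ k := by
  intro j0
  set g := f - C (f.eval (ξ j0)) with hg
  have hg' : derivative g = C e0 * cp a ξ := by simp [hg, hf]
  have hcp0 : C e0 * cp a ξ ≠ 0 := mul_ne_zero (C_ne_zero.2 he) (cp_monic a ξ).ne_zero
  have hg0 : g ≠ 0 := by
    intro h; rw [h, derivative_zero] at hg'; exact hcp0 hg'.symm
  have hroot : ∀ j, g.IsRoot (ξ j) := by intro j; simp [hg, hv j j0]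
  have hm : ∀ w ∈ Finset.univ.image ξ, g.rootMultiplicity w = 1 + ∑ j, if ξ j = w then a j else 0 := by
    intro w hw
    obtain ⟨j, _, rfl⟩ := Finset.mem_image.1 hw
    have h1 := derivative_rootMultiplicity_of_root (hroot j)
    rw [hg', rootMultiplicity_mul hcp0, rootMultiplicity_C, zero_add, cp_rootMult] at h1
    have h2 : 0 < g.rootMultiplicity (ξ j) := (rootMultiplicity_pos hg0).2 (hroot j)
    omega
  have hdeg : g.natDegree ≤ ∑ j, a j + 1 := by
    have h3 : (derivative g).natDegree = ∑ j, a j := by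
      rw [hg', natDegree_C_mul he, cp_natDegree]
    rcases Nat.eq_zero_or_pos g.natDegree with h | h
    · omega
    · have := natDegree_derivative g
      omega
  have hsum : ∑ w ∈ Finset.univ.image ξ, g.rootMultiplicity w ≤ g.natDegree := by
    calc ∑ w ∈ Finset.univ.image ξ, g.rootMultiplicity w
        ≤ ∑ w ∈ g.roots.toFinset, g.roots.count w := by
          simp only [← count_roots]
          refine Finset.sum_le_sum_of_subset ?_
          intro w hw
          obtain ⟨j, _, rfl⟩ := Finset.mem_image.1 hw
          simp [hg0]; exact hroot j
      _ = Multiset.card g.roots := Multiset.toFinset_sum_count_eq _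
      _ ≤ _ := card_roots' g
  rw [Finset.sum_congr rfl hm, Finset.sum_add_distrib, Finset.sum_comm] at hsum
  have : ∀ j, (∑ w ∈ Finset.univ.image ξ, if ξ j = w then a j else 0) = a j := by
    intro j; rw [Finset.sum_ite_eq]; simp
  simp only [this] at hsum
  have hcard : (Finset.univ.image ξ).card ≤ 1 := by
    have : ∑ w ∈ Finset.univ.image ξ, 1 = (Finset.univ.image ξ).card := by simp
    omega
  intro k
  exact Finset.card_le_one.1 hcard _ (by simp) _ (by simp)

end cp

/-! ## antiderivative -/

noncomputable def ad (p : ℂ[X]) : ℂ[X] := p.sum fun k c => C (c / (k + 1)) * X ^ (k + 1)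

lemma ad_eq (p : ℂ[X]) (N : ℕ) (h : p.natDegree < N) :
    ad p = ∑ k ∈ Finset.range N, C (p.coeff k / (k + 1)) * X ^ (k + 1) := by
  unfold ad
  rw [sum_over_range' _ _ N h]
  intro n; simp

lemma derivative_ad (p : ℂ[X]) : derivative (ad p) = p := by
  rw [ad_eq p _ (Nat.lt_succ_self _)]
  conv_rhs => rw [p.as_sum_range_C_mul_X_pow]
  rw [derivative_sum]
  refine Finset.sum_congr rfl fun k _ => ?_
  rw [derivative_C_mul_X_pow]
  have : (k : ℂ) + 1 ≠ 0 := by exact_mod_cast Nat.succ_ne_zero k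
  simp only [Nat.cast_add, Nat.cast_one, Nat.add_sub_cancel]
  congr 1
  congr 1; field_simp

lemma coeff_ad (p : ℂ[X]) (k : ℕ) : (ad p).coeff (k + 1) = p.coeff k / (k + 1) := by
  have h := coeff_derivative (ad p) k
  rw [derivative_ad] at h
  have : (k : ℂ) + 1 ≠ 0 := by exact_mod_cast Nat.succ_ne_zero k
  rw [h]; field_simp

lemma coeff_ad_zero (p : ℂ[X]) : (ad p).coeff 0 = 0 := by
  rw [ad_eq p _ (Nat.lt_succ_self _), finset_sum_coeff]
  exact Finset.sum_eq_zero fun k _ => by simp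

lemma natDegree_ad (p : ℂ[X]) : (ad p).natDegree ≤ p.natDegree + 1 := by
  rw [natDegree_le_iff_coeff_eq_zero]
  intro k hk
  rcases k with _ | k
  · omega
  · rw [coeff_ad, coeff_eq_zero_of_natDegree_lt (by omega)]; simp

/-- two antiderivatives differ by a constant -/
lemma eval_sub_eq {p q : ℂ[X]} (h : derivative p = derivative q) (x y : ℂ) :
    p.eval x - p.eval y = q.eval x - q.eval y := by
  have h1 : derivative (p - q) = 0 := by simp [h]
  have h2 := natDegree_eq_zero_of_derivative_eq_zero h1
  obtain ⟨c, hc⟩ := natDegree_eq_zero.1 h2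
  have h3 : p = q + C c := by rw [hc]; ring
  rw [h3]; simp

lemma eq_add_C {p q : ℂ[X]} (h : derivative p = derivative q) : ∃ c, p = q + C c := by
  have h1 : derivative (p - q) = 0 := by simp [h]
  have h2 := natDegree_eq_zero_of_derivative_eq_zero h1
  obtain ⟨c, hc⟩ := natDegree_eq_zero.1 h2
  exact ⟨c, by rw [hc]; ring⟩

/-! ## coefficientwise convergence -/

def PT {I : Type*} (l : Filter I) (p : I → ℂ[X]) (q : ℂ[X]) : Prop :=
  (∃ N, ∀ᶠ i in l, (p i).natDegree ≤ N) ∧ ∀ k, Tendsto (fun i => (p i).coeff k) l (𝓝 (q.coeff k))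

section PT
variable {I : Type*} {l : Filter I}

lemma PT.const (q : ℂ[X]) : PT l (fun _ => q) q :=
  ⟨⟨q.natDegree, Eventually.of_forall fun _ => le_rfl⟩, fun _ => tendsto_const_nhds⟩

lemma PT.C {c : I → ℂ} {c0 : ℂ} (h : Tendsto c l (𝓝 c0)) :
    PT l (fun i => Polynomial.C (c i)) (Polynomial.C c0) := by
  refine ⟨⟨0, Eventually.of_forall fun _ => by simp⟩, fun k => ?_⟩
  simp only [coeff_C]
  by_cases hk : k = 0
  · simpa [hk] using h
  · simpa [hk] using tendsto_const_nhds

lemma PT.congr {p p' : I → ℂ[X]} {q : ℂ[X]} (h : PT l p q) (he : ∀ᶠ i in l, p i = p' i) :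
    PT l p' q := by
  obtain ⟨⟨N, hN⟩, h2⟩ := h
  refine ⟨⟨N, ?_⟩, fun k => (h2 k).congr' ?_⟩
  · filter_upwards [hN, he] with i h1 h2
    rwa [← h2]
  · filter_upwards [he] with i hi; rw [hi]

lemma PT.add {p p' : I → ℂ[X]} {q q' : ℂ[X]} (h : PT l p q) (h' : PT l p' q') :
    PT l (fun i => p i + p' i) (q + q') := by
  obtain ⟨⟨N, hN⟩, h2⟩ := h
  obtain ⟨⟨N', hN'⟩, h2'⟩ := h'
  refine ⟨⟨max N N', ?_⟩, fun k => ?_⟩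
  · filter_upwards [hN, hN'] with i h1 h2
    exact (natDegree_add_le _ _).trans (max_le_max h1 h2)
  · simpa using (h2 k).add (h2' k)

lemma PT.mul {p p' : I → ℂ[X]} {q q' : ℂ[X]} (h : PT l p q) (h' : PT l p' q') :
    PT l (fun i => p i * p' i) (q * q') := by
  obtain ⟨⟨N, hN⟩, h2⟩ := h
  obtain ⟨⟨N', hN'⟩, h2'⟩ := h'
  refine ⟨⟨N + N', ?_⟩, fun k => ?_⟩
  · filter_upwards [hN, hN'] with i h1 h2
    exact natDegree_mul_le.trans (add_le_add h1 h2)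
  · simp only [coeff_mul]
    exact tendsto_finset_sum _ fun x _ => (h2 x.1).mul (h2' x.2)

lemma PT.neg {p : I → ℂ[X]} {q : ℂ[X]} (h : PT l p q) : PT l (fun i => - p i) (-q) := by
  simpa using (PT.const (l := l) (Polynomial.C (-1))).mul h

lemma PT.sub {p p' : I → ℂ[X]} {q q' : ℂ[X]} (h : PT l p q) (h' : PT l p' q') :
    PT l (fun i => p i - p' i) (q - q') := by
  simpa [sub_eq_add_neg] using h.add h'.neg

lemma PT.pow {p : I → ℂ[X]} {q : ℂ[X]} (h : PT l p q) (n : ℕ) : PT l (fun i => p i ^ n) (q ^ n) := by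
  induction n with
  | zero => simpa using PT.const 1
  | succ n ih => simpa [pow_succ] using ih.mul h

lemma PT.prod {ι : Type*} (s : Finset ι) {p : ι → I → ℂ[X]} {q : ι → ℂ[X]}
    (h : ∀ j ∈ s, PT l (p j) (q j)) : PT l (fun i => ∏ j ∈ s, p j i) (∏ j ∈ s, q j) := by
  induction s using Finset.induction_on with
  | empty => simpa using PT.const 1
  | insert j s hj ih =>
    simp only [Finset.prod_insert hj]
    exact (h j (by simp)).mul (ih fun k hk => h k (by simp [hk]))

lemma PT.sum {ι : Type*} (s : Finset ι) {p : ι → I → ℂ[X]} {q : ι → ℂ[X]}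
    (h : ∀ j ∈ s, PT l (p j) (q j)) : PT l (fun i => ∑ j ∈ s, p j i) (∑ j ∈ s, q j) := by
  induction s using Finset.induction_on with
  | empty => simpa using PT.const 0
  | insert j s hj ih =>
    simp only [Finset.sum_insert hj]
    exact (h j (by simp)).add (ih fun k hk => h k (by simp [hk]))

lemma PT.X_sub {c : I → ℂ} {c0 : ℂ} (h : Tendsto c l (𝓝 c0)) :
    PT l (fun i => X - Polynomial.C (c i)) (X - Polynomial.C c0) := (PT.const X).sub (PT.C h)

lemma PT.cp {ι : Type*} [Fintype ι] (a : ι → ℕ) {y : I → ι → ℂ} {y0 : ι → ℂ}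
    (h : ∀ j, Tendsto (fun i => y i j) l (𝓝 (y0 j))) : PT l (fun i => cp a (y i)) (cp a y0) :=
  PT.prod _ fun j _ => (PT.X_sub (h j)).pow _

lemma PT.degree [l.NeBot] {p : I → ℂ[X]} {q : ℂ[X]} (h : PT l p q) :
    ∃ N, (∀ᶠ i in l, (p i).natDegree ≤ N) ∧ q.natDegree ≤ N := by
  obtain ⟨⟨N, hN⟩, h2⟩ := h
  refine ⟨N, hN, natDegree_le_iff_coeff_eq_zero.2 fun k hk => ?_⟩
  refine tendsto_nhds_unique (h2 k) (tendsto_const_nhds.congr' ?_)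
  filter_upwards [hN] with i hi
  rw [coeff_eq_zero_of_natDegree_lt (by omega)]

lemma PT.comp [l.NeBot] {p p' : I → ℂ[X]} {q q' : ℂ[X]} (h : PT l p q) (h' : PT l p' q') :
    PT l (fun i => (p i).comp (p' i)) (q.comp q') := by
  obtain ⟨N, hN, hq⟩ := h.degree
  have e : ∀ r s : ℂ[X], r.natDegree ≤ N →
      r.comp s = ∑ k ∈ Finset.range (N + 1), Polynomial.C (r.coeff k) * s ^ k := by
    intro r s hr
    rw [comp_eq_sum_left, sum_over_range' _ _ (N + 1) (by omega)]
    intro n; simp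
  rw [e q q' hq]
  refine PT.congr (PT.sum (p := fun k i => Polynomial.C ((p i).coeff k) * (p' i) ^ k) _
    fun k _ => (PT.C (h.2 k)).mul (h'.pow k)) ?_
  filter_upwards [hN] with i hi
  rw [e _ _ hi]

lemma PT.eval [l.NeBot] {p : I → ℂ[X]} {q : ℂ[X]} (h : PT l p q) {x : I → ℂ} {x0 : ℂ}
    (hx : Tendsto x l (𝓝 x0)) : Tendsto (fun i => (p i).eval (x i)) l (𝓝 (q.eval x0)) := by
  have := (h.comp (PT.C hx)).2 0
  simpa [comp_C] using this

lemma PT.ad [l.NeBot] {p : I → ℂ[X]} {q : ℂ[X]} (h : PT l p q) :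
    PT l (fun i => ad (p i)) (ad q) := by
  obtain ⟨⟨N, hN⟩, h2⟩ := h
  refine ⟨⟨N + 1, ?_⟩, fun k => ?_⟩
  · filter_upwards [hN] with i hi
    exact (natDegree_ad _).trans (by omega)
  · rcases k with _ | k
    · simp only [coeff_ad_zero]; exact tendsto_const_nhds
    · simp only [coeff_ad]; exact (h2 k).div_const _

lemma PT.unique [l.NeBot] {p : I → ℂ[X]} {q q' : ℂ[X]} (h : PT l p q) (h' : PT l p q') : q = q' :=
  Polynomial.ext fun k => tendsto_nhds_unique (h.2 k) (h'.2 k)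

/-- limit of critical points at asymptotically equal levels -/
lemma scale_key [l.NeBot] {A : Type*} [Fintype A] (a : A → ℕ) (ha : ∀ j, 1 ≤ a j)
    {y : I → A → ℂ} {y0 : A → ℂ} (hy : ∀ j, Tendsto (fun i => y i j) l (𝓝 (y0 j)))
    {E : I → ℂ[X]} {e0 : ℂ} (he : e0 ≠ 0) (hE : PT l E (Polynomial.C e0)) {h : I → ℂ[X]}
    (hh : ∀ᶠ i in l, derivative (h i) = E i * FO.cp a (y i))
    (hv : ∀ j k, Tendsto (fun i => (h i).eval (y i j) - (h i).eval (y i k)) l (𝓝 0)) :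
    ∀ j k, y0 j = y0 k := by
  have h1 : PT l (fun i => FO.ad (E i * FO.cp a (y i))) (FO.ad (Polynomial.C e0 * FO.cp a y0)) :=
    (hE.mul (PT.cp a hy)).ad
  refine one_lem a y0 ha e0 he (FO.ad (Polynomial.C e0 * FO.cp a y0)) (derivative_ad _) ?_
  intro j k
  rw [← sub_eq_zero]
  refine tendsto_nhds_unique ((h1.eval (hy j)).sub (h1.eval (hy k))) ((hv j k).congr' ?_)
  filter_upwards [hh] with i hi
  exact eval_sub_eq (by rw [hi, derivative_ad]) _ _

end PT

end FO

open Polynomial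
open scoped Classical
set_option linter.all false
namespace FO
open Filter Topology

lemma cp_comp {ι : Type*} [Fintype ι] (a : ι → ℕ) (y : ι → ℂ) (b σ : ℂ) (hσ : σ ≠ 0) :
    (cp a y).comp (C b + C σ * X) = C (σ ^ (∑ j, a j)) * cp a (fun j => (y j - b) / σ) := by
  unfold cp
  rw [prod_comp, ← Finset.prod_pow_eq_pow_sum, map_prod, ← Finset.prod_mul_distrib]
  refine Finset.prod_congr rfl fun j _ => ?_
  simp only [pow_comp, sub_comp, X_comp, C_comp, C_pow]
  rw [← mul_pow]
  congr 1
  rw [mul_sub, ← C_mul, mul_div_cancel₀ _ hσ, C_sub]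
  ring

/-- convergence of a bounded vector family along an ultrafilter -/
lemma ultra_bdd {I : Type*} (U : Ultrafilter I) {ι : Type*} [Fintype ι] (y : I → ι → ℂ) (R : ℝ)
    (h : ∀ᶠ i in U, ‖y i‖ ≤ R) : ∃ y0, Tendsto y U (𝓝 y0) := by
  have := (isCompact_closedBall (0 : ι → ℂ) R).ultrafilter_le_nhds (U.map y) (by
    simp only [le_principal_iff]
    change ∀ᶠ i in U, y i ∈ Metric.closedBall (0 : ι → ℂ) R
    filter_upwards [h] with i hi
    simpa using hi)
  obtain ⟨y0, _, h0⟩ := this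
  exact ⟨y0, h0⟩

lemma ultra_dich {I : Type*} (U : Ultrafilter I) (f : I → ℝ) :
    (∃ R, ∀ᶠ i in U, f i ≤ R) ∨ Tendsto f U atTop := by
  by_cases h : ∃ R, ∀ᶠ i in U, f i ≤ R
  · exact Or.inl h
  · right
    rw [tendsto_atTop]
    intro R
    by_contra h2
    refine h ⟨R, ?_⟩
    have h3 := (Ultrafilter.eventually_not (f := U)).2 h2
    filter_upwards [h3] with i hi
    exact (not_le.1 hi).le

lemma scaled_deriv {ι : Type*} [Fintype ι] (a : ι → ℕ) (y : ι → ℂ) (b σ : ℂ) (hσ : σ ≠ 0)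
    (K E : ℂ[X]) (hK : derivative K = E * cp a y) :
    derivative (C ((σ ^ (∑ j, a j + 1))⁻¹) * K.comp (C b + C σ * X)) =
      E.comp (C b + C σ * X) * cp a (fun j => (y j - b) / σ) := by
  rw [derivative_C_mul, derivative_comp, hK, mul_comp, cp_comp a y b σ hσ]
  have h1 : derivative (C b + C σ * X : ℂ[X]) = C σ := by simp
  rw [h1]
  have h2 : C ((σ ^ (∑ j, a j + 1))⁻¹) * (C σ * C (σ ^ (∑ j, a j))) = (1 : ℂ[X]) := by
    rw [← C_mul, ← C_mul, ← C_1]; congr 1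
    rw [← pow_succ']; exact inv_mul_cancel₀ (pow_ne_zero _ hσ)
  linear_combination (E.comp (C b + C σ * X) * cp a (fun j => (y j - b) / σ)) * h2

/-- Boundedness. -/
lemma BD {I : Type*} (U : Ultrafilter I) {ι : Type*} [Fintype ι] (a : ι → ℕ) (ha : ∀ j, 1 ≤ a j)
    (y : I → ι → ℂ) (hc : ∀ᶠ i in U, ∑ j, (a j : ℂ) * y i j = 0)
    (K G : I → ℂ[X]) (τ : I → ℂ) (G0 : ℂ[X]) (hG : PT (U : Filter I) G G0) (hG0 : G0.eval 0 ≠ 0)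
    (hτ : ∀ j, Tendsto (fun i => τ i * y i j) U (𝓝 0))
    (hK : ∀ᶠ i in U, derivative (K i) = ((G i).comp (C (τ i) * X)) * cp a (y i))
    (hv : ∃ B : ℝ, ∀ j, ∀ᶠ i in U, ‖(K i).eval (y i j)‖ ≤ B) :
    ∃ y0, Tendsto y U (𝓝 y0) := by
  rcases ultra_dich U (fun i => ‖y i‖) with ⟨R, hR⟩ | hinf
  · exact ultra_bdd U y R hR
  exfalso
  rcases isEmpty_or_nonempty ι with he | hne
  · have h1 := hinf.eventually (eventually_gt_atTop 0)
    obtain ⟨i, hi⟩ := h1.exists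
    have : y i = 0 := Subsingleton.elim _ _
    simp [this] at hi
  set σ : I → ℂ := fun i => ((‖y i‖ : ℝ) : ℂ) with hσ
  have hpos : ∀ᶠ i in U, 0 < ‖y i‖ := hinf.eventually (eventually_gt_atTop 0)
  set yh : I → ι → ℂ := fun i j => (y i j - 0) / σ i with hyh
  have hnorm : ∀ᶠ i in U, ‖yh i‖ = 1 := by
    filter_upwards [hpos] with i hi
    have : yh i = (σ i)⁻¹ • y i := by ext j; simp [hyh, div_eq_inv_mul]
    rw [this, norm_smul]; simp [hσ]; field_simp
  obtain ⟨y0, hy0⟩ := ultra_bdd U yh 1 (hnorm.mono fun i hi => hi.le)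
  have hy0j : ∀ j, Tendsto (fun i => yh i j) U (𝓝 (y0 j)) := fun j => (tendsto_pi_nhds.1 hy0) j
  have hn0 : ‖y0‖ = 1 := tendsto_nhds_unique hy0.norm (tendsto_const_nhds.congr' (hnorm.mono fun i hi => hi.symm))
  have hτσ : Tendsto (fun i => τ i * σ i) U (𝓝 0) := by
    have h1 : Tendsto (fun i => fun j => τ i * y i j) U (𝓝 (0 : ι → ℂ)) := tendsto_pi_nhds.2 hτ
    have h2 := h1.norm
    rw [norm_zero] at h2
    rw [tendsto_zero_iff_norm_tendsto_zero]
    refine h2.congr fun i => ?_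
    have : (fun j => τ i * y i j) = τ i • y i := by ext j; simp
    rw [this, norm_smul]; simp [hσ]
  obtain ⟨B, hB⟩ := hv
  have hall : ∀ j k, y0 j = y0 k := by
    refine scale_key (l := (U : Filter I)) a ha hy0j hG0 (E := fun i => ((G i).comp (C (τ i) * X)).comp (C 0 + C (σ i) * X))
      (h := fun i => C ((σ i ^ (∑ j, a j + 1))⁻¹) * (K i).comp (C 0 + C (σ i) * X)) ?_ ?_ ?_
    · have h3 : PT (U : Filter I) (fun i => C (τ i * σ i) * X) (C 0 * X) := (PT.C hτσ).mul (PT.const X)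
      have h4 := hG.comp h3
      have h5 : G0.comp (C 0 * X) = C (G0.eval 0) := by simp
      rw [h5] at h4
      refine h4.congr (Eventually.of_forall fun i => ?_)
      rw [comp_assoc]; simp [mul_assoc]
    · filter_upwards [hK, hpos] with i hi hp
      exact scaled_deriv a (y i) 0 (σ i) (by simpa [hσ] using norm_pos_iff.1 hp) (K i) _ hi
    · have hz : ∀ j, Tendsto (fun i => (C ((σ i ^ (∑ j, a j + 1))⁻¹) * (K i).comp (C 0 + C (σ i) * X)).eval (yh i j)) U (𝓝 0) := by
        intro j
        have h6 : Tendsto (fun i => (‖y i‖ ^ (∑ j, a j + 1))⁻¹ * B) U (𝓝 0) := by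
          have h7 : Tendsto (fun i => ‖y i‖ ^ (∑ j, a j + 1)) U atTop :=
            (tendsto_pow_atTop (by omega)).comp hinf
          simpa using h7.inv_tendsto_atTop.mul_const B
        refine squeeze_zero_norm' ?_ h6
        filter_upwards [hB j, hpos] with i hi hp
        have hs : σ i ≠ 0 := by simpa [hσ] using norm_pos_iff.1 hp
        have h8 : 0 + σ i * yh i j = y i j := by simp [hyh]; field_simp
        simp only [eval_mul, eval_C, eval_comp, eval_add, eval_X, h8, norm_mul]
        gcongr
        simp [hσ]
      intro j k
      simpa using (hz j).sub (hz k)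
  have hsum : ∑ j, (a j : ℂ) * y0 j = 0 := by
    have h9 : Tendsto (fun i => ∑ j, (a j : ℂ) * yh i j) U (𝓝 (∑ j, (a j : ℂ) * y0 j)) :=
      tendsto_finset_sum _ fun j _ => (hy0j j).const_mul _
    refine tendsto_nhds_unique h9 (tendsto_const_nhds.congr' ?_)
    filter_upwards [hc] with i hi
    have : ∑ j, (a j : ℂ) * yh i j = (∑ j, (a j : ℂ) * y i j) / σ i := by
      rw [Finset.sum_div]; refine Finset.sum_congr rfl fun j _ => ?_
      simp [hyh]; ring
    rw [this, hi, zero_div]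
  obtain ⟨j0⟩ := hne
  have hz : y0 j0 = 0 := by
    have : ∑ j, (a j : ℂ) * y0 j = (∑ j, (a j : ℂ)) * y0 j0 := by
      rw [Finset.sum_mul]; exact Finset.sum_congr rfl fun j _ => by rw [hall j j0]
    rw [this] at hsum
    rcases mul_eq_zero.1 hsum with h | h
    · exfalso
      have h1 : ∑ j, a j = 0 := by exact_mod_cast h
      have := Finset.single_le_sum (f := a) (fun j _ => Nat.zero_le _) (Finset.mem_univ j0)
      have := ha j0; omega
    · exact h
  have : y0 = 0 := by ext j; rw [hall j j0, hz]; rfl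
  simp [this] at hn0

lemma cp_split {ι : Type*} [Fintype ι] (a : ι → ℕ) (y : ι → ℂ) (p : ι → Prop) :
    cp a y = cp (fun j : {j // p j} => a j) (fun j => y j) * cp (fun j : {j // ¬ p j} => a j) (fun j => y j) := by
  unfold cp
  rw [← Fintype.prod_subtype_mul_prod_subtype p]

/-- Critical points do not collide. -/
lemma INJ {I : Type*} (U : Ultrafilter I) {ι : Type*} [Fintype ι] (a : ι → ℕ) (ha : ∀ j, 1 ≤ a j)
    (y : I → ι → ℂ) (y0 : ι → ℂ) (hy : Tendsto y U (𝓝 y0))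
    (K E : I → ℂ[X]) (E0 : ℂ[X]) (hE : PT (U : Filter I) E E0) (hE0 : ∀ j, E0.eval (y0 j) ≠ 0)
    (hinj : ∀ᶠ i in U, Function.Injective (y i))
    (hK : ∀ᶠ i in U, derivative (K i) = E i * cp a (y i))
    (hv : ∀ j k, y0 j = y0 k → ∀ᶠ i in U, (K i).eval (y i j) = (K i).eval (y i k)) :
    Function.Injective y0 := by
  intro p q hpq
  by_contra hne
  set A := {j // y0 j = y0 p} with hA
  have hyj : ∀ j, Tendsto (fun i => y i j) U (𝓝 (y0 j)) := tendsto_pi_nhds.1 hy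
  set σ : I → ℂ := fun i => ((‖(fun j : A => y i j - y i p)‖ : ℝ) : ℂ) with hσ
  have hσ0 : Tendsto σ U (𝓝 0) := by
    have h1 : Tendsto (fun i => (fun j : A => y i j - y i p)) U (𝓝 0) := by
      rw [tendsto_pi_nhds]; intro j
      simpa [j.2] using (hyj j).sub (hyj p)
    have := h1.norm
    rw [norm_zero] at this
    exact_mod_cast (Complex.continuous_ofReal.tendsto 0).comp this
  have hpos : ∀ᶠ i in U, σ i ≠ 0 := by
    filter_upwards [hinj] with i hi
    simp only [hσ, ne_eq, Complex.ofReal_eq_zero, norm_eq_zero]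
    intro h
    have := congrFun (norm_eq_zero.1 h) ⟨q, hpq.symm⟩
    simp only [Pi.zero_apply, sub_eq_zero] at this
    exact hne (hi this).symm
  set yh : I → A → ℂ := fun i j => (y i j - y i p) / σ i with hyh
  have hnorm : ∀ᶠ i in U, ‖yh i‖ = 1 := by
    filter_upwards [hpos] with i hi
    have : yh i = (σ i)⁻¹ • (fun j : A => y i j - y i p) := by ext j; simp [hyh, div_eq_inv_mul]
    rw [this, norm_smul]; simp [hσ] at hi ⊢
    exact inv_mul_cancel₀ (by simpa using hi)
  obtain ⟨z0, hz0⟩ := ultra_bdd U yh 1 (hnorm.mono fun i hi => hi.le)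
  have hz0j : ∀ j, Tendsto (fun i => yh i j) U (𝓝 (z0 j)) := fun j => (tendsto_pi_nhds.1 hz0) j
  have hn0 : ‖z0‖ = 1 := tendsto_nhds_unique hz0.norm (tendsto_const_nhds.congr' (hnorm.mono fun i hi => hi.symm))
  set cB : (ι → ℂ) → ℂ[X] := fun y => cp (fun j : {j // ¬ y0 j = y0 p} => a j) (fun j => y j) with hcB
  have hl : PT (U : Filter I) (fun i => C (y i p) + C (σ i) * X) (C (y0 p) + C 0 * X) :=
    (PT.C (hyj p)).add ((PT.C hσ0).mul (PT.const X))
  have hEc : PT (U : Filter I) (fun i => (E i * cB (y i)).comp (C (y i p) + C (σ i) * X))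
      (C ((E0 * cB y0).eval (y0 p))) := by
    have := (hE.mul (PT.cp (fun j : {j // ¬ y0 j = y0 p} => a j) (y := fun i j => y i j) (y0 := fun j => y0 j)
      (fun j => hyj j))).comp hl
    have e : (E0 * cB y0).comp (C (y0 p) + C 0 * X) = C ((E0 * cB y0).eval (y0 p)) := by
      simp [comp_C]
    rw [← e]; exact this
  have he : (E0 * cB y0).eval (y0 p) ≠ 0 := by
    rw [eval_mul]
    refine mul_ne_zero (hE0 p) ?_
    rw [hcB]; simp only [cp_eval]
    rw [Finset.prod_ne_zero_iff]
    intro j _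
    exact pow_ne_zero _ (sub_ne_zero.2 (fun h => j.2 h.symm))
  have hall := scale_key (l := (U : Filter I)) (fun j : A => a j) (fun j => ha j) hz0j he hEc
    (h := fun i => C ((σ i ^ (∑ j : A, a j + 1))⁻¹) * (K i).comp (C (y i p) + C (σ i) * X)) ?_ ?_
  · have hp : z0 ⟨p, rfl⟩ = 0 := by
      refine tendsto_nhds_unique (hz0j ⟨p, rfl⟩) ?_
      simp only [hyh, sub_self, zero_div]; exact tendsto_const_nhds
    have : z0 = 0 := by ext j; rw [hall j ⟨p, rfl⟩, hp]; rfl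
    simp [this] at hn0
  · filter_upwards [hK, hpos] with i hi hp
    refine scaled_deriv (fun j : A => a j) (fun j : A => y i j) (y i p) (σ i) hp (K i) _ ?_
    rw [hi, cp_split a (y i) (fun j => y0 j = y0 p)]
    ring
  · intro j k
    refine tendsto_const_nhds.congr' ?_
    filter_upwards [hv j k (j.2.trans k.2.symm), hpos] with i hi hp
    have h8 : ∀ j : A, y i p + σ i * yh i j = y i j := by intro j; simp [hyh]; field_simp; ring
    simp only [eval_mul, eval_C, eval_comp, eval_add, eval_X, h8, hi, sub_self]

lemma COMPACT {I : Type*} (U : Ultrafilter I) {ι : Type*} [Fintype ι] (a : ι → ℕ) (ha : ∀ j, 1 ≤ a j)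
    (y : I → ι → ℂ) (hc : ∀ᶠ i in U, ∑ j, (a j : ℂ) * y i j = 0)
    (K G : I → ℂ[X]) (τ : I → ℂ) (G0 : ℂ[X]) (hG : PT (U : Filter I) G G0) (hG0 : G0.eval 0 ≠ 0)
    (hτ0 : Tendsto τ U (𝓝 0))
    (hτ : ∀ j, Tendsto (fun i => τ i * y i j) U (𝓝 0))
    (hK : ∀ᶠ i in U, derivative (K i) = ((G i).comp (C (τ i) * X)) * cp a (y i))
    (hinj : ∀ᶠ i in U, Function.Injective (y i))
    (u : I → ι → ℂ) (u0 : ι → ℂ) (hu : ∀ j, Tendsto (fun i => u i j) U (𝓝 (u0 j)))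
    (hv : ∀ᶠ i in U, ∀ j, (K i).eval (y i j) = u i j)
    (huu : ∀ j k, u0 j = u0 k → ∀ᶠ i in U, u i j = u i k) :
    ∃ y0, Tendsto y U (𝓝 y0) ∧ Function.Injective y0 ∧ ∑ j, (a j : ℂ) * y0 j = 0 ∧
      ∃ K0 : ℂ[X], derivative K0 = C (G0.eval 0) * cp a y0 ∧ (∀ j, K0.eval (y0 j) = u0 j) := by
  have hb : ∃ B : ℝ, ∀ j, ∀ᶠ i in U, ‖(K i).eval (y i j)‖ ≤ B := by
    refine ⟨∑ j, (‖u0 j‖ + 1), fun j => ?_⟩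
    have h1 := (hu j).norm.eventually (ge_mem_nhds (lt_add_one _))
    filter_upwards [hv, h1] with i hi h2
    rw [hi]
    refine h2.trans (Finset.single_le_sum (f := fun j => ‖u0 j‖ + 1) (fun j _ => by positivity) (Finset.mem_univ j))
  obtain ⟨y0, hy0⟩ := BD U a ha y hc K G τ G0 hG hG0 hτ hK hb
  have hyj : ∀ j, Tendsto (fun i => y i j) U (𝓝 (y0 j)) := tendsto_pi_nhds.1 hy0
  have hE : PT (U : Filter I) (fun i => (G i).comp (C (τ i) * X)) (C (G0.eval 0)) := by
    have h3 : PT (U : Filter I) (fun i => C (τ i) * X) (C 0 * X) := (PT.C hτ0).mul (PT.const X)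
    have h4 := hG.comp h3
    have h5 : G0.comp (C 0 * X) = C (G0.eval 0) := by simp
    rwa [h5] at h4
  have hA := (hE.mul (PT.cp a hyj)).ad
  -- levels pass to limit
  have hdiff : ∀ j k, (ad (C (G0.eval 0) * cp a y0)).eval (y0 j) - (ad (C (G0.eval 0) * cp a y0)).eval (y0 k) = u0 j - u0 k := by
    intro j k
    refine tendsto_nhds_unique ((hA.eval (hyj j)).sub (hA.eval (hyj k))) (((hu j).sub (hu k)).congr' ?_)
    filter_upwards [hK, hv] with i hi hv
    rw [← hv j, ← hv k]
    exact eval_sub_eq (by rw [hi, derivative_ad]) _ _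
  refine ⟨y0, hy0, ?_, ?_, ?_⟩
  · refine INJ U a ha y y0 hy0 K _ _ hE (fun j => by simpa using hG0) hinj hK ?_
    intro j k hjk
    have : u0 j = u0 k := by
      have := hdiff j k
      rw [hjk, sub_self] at this
      exact (sub_eq_zero.1 this.symm)
    filter_upwards [hv, huu j k this] with i h1 h2
    rw [h1, h1, h2]
  · have h9 : Tendsto (fun i => ∑ j, (a j : ℂ) * y i j) U (𝓝 (∑ j, (a j : ℂ) * y0 j)) :=
      tendsto_finset_sum _ fun j _ => (hyj j).const_mul _
    exact tendsto_nhds_unique h9 (tendsto_const_nhds.congr' (hc.mono fun i hi => hi.symm))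
  · rcases isEmpty_or_nonempty ι with he | ⟨⟨j0⟩⟩
    · exact ⟨ad (C (G0.eval 0) * cp a y0), derivative_ad _, fun j => he.elim j⟩
    · refine ⟨ad (C (G0.eval 0) * cp a y0) + C (u0 j0 - (ad (C (G0.eval 0) * cp a y0)).eval (y0 j0)), ?_, ?_⟩
      · simp [derivative_ad]
      · intro j
        have := hdiff j j0
        rw [eval_add, eval_C]; linear_combination this

end FO

open Polynomial
open scoped Classical
set_option linter.all false
namespace FO
open Filter Topology

/-! ## Implicit function theorem -/

lemma IFT {E : Type*} [NormedAddCommGroup E] [NormedSpace ℂ E] [FiniteDimensional ℂ E]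
    (Φ : ℂ × E → E) (t0 : ℂ) (x0 : E) (hΦ : ContDiff ℂ 1 Φ) (h0 : Φ (t0, x0) = 0)
    (hker : ∀ v : E, HasDerivAt (fun ε : ℂ => Φ (t0, x0 + ε • v)) 0 0 → v = 0) :
    ∃ ψ : ℂ → E, Tendsto ψ (𝓝 t0) (𝓝 x0) ∧ (∀ᶠ p in 𝓝 (t0, x0), Φ p = 0 ↔ ψ p.1 = p.2) ∧
      ∀ᶠ t in 𝓝 t0, Φ (t, ψ t) = 0 := by
  haveI : CompleteSpace E := FiniteDimensional.complete ℂ E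
  have hs : HasStrictFDerivAt Φ (fderiv ℂ Φ (t0, x0)) (t0, x0) :=
    hΦ.contDiffAt.hasStrictFDerivAt (by norm_num)
  set L : E →L[ℂ] E := (fderiv ℂ Φ (t0, x0)) ∘L (ContinuousLinearMap.inr ℂ ℂ E) with hL
  have hinj : Function.Injective L := by
    rw [injective_iff_map_eq_zero]
    intro v hv
    apply hker
    have h1 : HasDerivAt (fun ε : ℂ => ((t0, x0 + ε • v) : ℂ × E)) ((0, v) : ℂ × E) 0 := by
      refine HasDerivAt.prodMk (hasDerivAt_const _ _) ?_
      simpa using ((hasDerivAt_id (0 : ℂ)).smul_const v).const_add x0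
    have h2 : HasFDerivAt Φ (fderiv ℂ Φ (t0, x0)) (t0, x0 + (0 : ℂ) • v) := by
      simpa using hs.hasFDerivAt
    have h3 := h2.comp_hasDerivAt (0 : ℂ) h1
    have h4 : (fderiv ℂ Φ (t0, x0)) ((0, v) : ℂ × E) = 0 := by simpa [hL] using hv
    rw [h4] at h3
    exact h3
  have hinv : L.IsInvertible := by
    have e := (LinearEquiv.ofInjectiveEndo (L : E →ₗ[ℂ] E) hinj).toContinuousLinearEquiv
    refine ⟨(LinearEquiv.ofInjectiveEndo (L : E →ₗ[ℂ] E) hinj).toContinuousLinearEquiv, ?_⟩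
    ext v; simp
  refine ⟨hs.implicitFunctionOfProdDomain hinv, hs.tendsto_implicitFunctionOfProdDomain hinv, ?_, ?_⟩
  · have := hs.eventually_apply_eq_iff_implicitFunctionOfProdDomain hinv
    rw [h0] at this; exact this
  · have := hs.eventually_apply_implicitFunctionOfProdDomain hinv
    rw [h0] at this; exact this

/-! ## smooth families of polynomials -/

def CP {V : Type*} [NormedAddCommGroup V] [NormedSpace ℂ V] (p : V → ℂ[X]) : Prop :=
  (∃ N, ∀ x, (p x).natDegree ≤ N) ∧ ∀ k, ContDiff ℂ 1 (fun x => (p x).coeff k)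

section CP
variable {V : Type*} [NormedAddCommGroup V] [NormedSpace ℂ V]

lemma CP.const (q : ℂ[X]) : CP (fun _ : V => q) := ⟨⟨_, fun _ => le_rfl⟩, fun _ => contDiff_const⟩

lemma CP.C {c : V → ℂ} (h : ContDiff ℂ 1 c) : CP (fun x => Polynomial.C (c x)) := by
  refine ⟨⟨0, fun _ => by simp⟩, fun k => ?_⟩
  simp only [coeff_C]
  by_cases hk : k = 0
  · simpa [hk] using h
  · simpa [hk] using contDiff_const

lemma CP.add {p q : V → ℂ[X]} (hp : CP p) (hq : CP q) : CP (fun x => p x + q x) := by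
  obtain ⟨⟨N, hN⟩, h2⟩ := hp
  obtain ⟨⟨N', hN'⟩, h2'⟩ := hq
  refine ⟨⟨max N N', fun x => (natDegree_add_le _ _).trans (max_le_max (hN x) (hN' x))⟩, fun k => ?_⟩
  simpa using (h2 k).add (h2' k)

lemma CP.mul {p q : V → ℂ[X]} (hp : CP p) (hq : CP q) : CP (fun x => p x * q x) := by
  obtain ⟨⟨N, hN⟩, h2⟩ := hp
  obtain ⟨⟨N', hN'⟩, h2'⟩ := hq
  refine ⟨⟨N + N', fun x => natDegree_mul_le.trans (add_le_add (hN x) (hN' x))⟩, fun k => ?_⟩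
  simp only [coeff_mul]
  exact ContDiff.sum fun i _ => (h2 _).mul (h2' _)

lemma CP.sub {p q : V → ℂ[X]} (hp : CP p) (hq : CP q) : CP (fun x => p x - q x) := by
  have := hp.add ((CP.const (V := V) (-1)).mul hq)
  simpa [sub_eq_add_neg] using this

lemma CP.pow {p : V → ℂ[X]} (hp : CP p) (n : ℕ) : CP (fun x => p x ^ n) := by
  induction n with
  | zero => simpa using CP.const 1
  | succ n ih => simpa [pow_succ] using ih.mul hp

lemma CP.prod {ι : Type*} (s : Finset ι) {p : ι → V → ℂ[X]} (h : ∀ j ∈ s, CP (p j)) :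
    CP (fun x => ∏ j ∈ s, p j x) := by
  induction s using Finset.induction_on with
  | empty => simpa using CP.const 1
  | insert j s hj ih =>
    simp only [Finset.prod_insert hj]
    exact (h j (by simp)).mul (ih fun k hk => h k (by simp [hk]))

lemma CP.cp {ι : Type*} [Fintype ι] (a : ι → ℕ) {y : ι → V → ℂ} (h : ∀ j, ContDiff ℂ 1 (y j)) :
    CP (fun x => cp a (fun j => y j x)) :=
  CP.prod _ fun j _ => ((CP.const X).sub (CP.C (h j))).pow _

lemma CP.ad {p : V → ℂ[X]} (hp : CP p) : CP (fun x => ad (p x)) := by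
  obtain ⟨⟨N, hN⟩, h2⟩ := hp
  refine ⟨⟨N + 1, fun x => (natDegree_ad _).trans (by have := hN x; omega)⟩, fun k => ?_⟩
  rcases k with _ | k
  · simp only [coeff_ad_zero]; exact contDiff_const
  · simp only [coeff_ad]; exact (h2 k).div_const _

lemma CP.eval {p : V → ℂ[X]} (hp : CP p) {y : V → ℂ} (hy : ContDiff ℂ 1 y) :
    ContDiff ℂ 1 (fun x => (p x).eval (y x)) := by
  obtain ⟨⟨N, hN⟩, h2⟩ := hp
  have : ∀ x, (p x).eval (y x) = ∑ k ∈ Finset.range (N + 1), (p x).coeff k * y x ^ k := fun x =>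
    eval_eq_sum_range' (by have := hN x; omega) _
  simp only [this]
  exact ContDiff.sum fun k _ => (h2 k).mul (hy.pow k)

end CP

/-! ## derivatives of polynomial families along a line -/

def HPD (p : ℂ → ℂ[X]) (q : ℂ[X]) : Prop :=
  (∃ N, ∀ x, (p x).natDegree ≤ N) ∧ ∀ k, HasDerivAt (fun x => (p x).coeff k) (q.coeff k) 0

lemma HPD.const (q : ℂ[X]) : HPD (fun _ => q) 0 :=
  ⟨⟨_, fun _ => le_rfl⟩, fun k => by simpa using hasDerivAt_const (0 : ℂ) (q.coeff k)⟩

lemma HPD.C {c : ℂ → ℂ} {c' : ℂ} (h : HasDerivAt c c' 0) :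
    HPD (fun x => Polynomial.C (c x)) (Polynomial.C c') := by
  refine ⟨⟨0, fun _ => by simp⟩, fun k => ?_⟩
  simp only [coeff_C]
  by_cases hk : k = 0
  · simpa [hk] using h
  · simpa [hk] using hasDerivAt_const (0 : ℂ) (0 : ℂ)

lemma HPD.add {p q : ℂ → ℂ[X]} {p' q' : ℂ[X]} (hp : HPD p p') (hq : HPD q q') :
    HPD (fun x => p x + q x) (p' + q') := by
  obtain ⟨⟨N, hN⟩, h2⟩ := hp
  obtain ⟨⟨N', hN'⟩, h2'⟩ := hq
  refine ⟨⟨max N N', fun x => (natDegree_add_le _ _).trans (max_le_max (hN x) (hN' x))⟩, fun k => ?_⟩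
  simp only [coeff_add]
  exact (h2 k).fun_add (h2' k)

lemma HPD.mul {p q : ℂ → ℂ[X]} {p' q' : ℂ[X]} (hp : HPD p p') (hq : HPD q q') :
    HPD (fun x => p x * q x) (p' * q 0 + p 0 * q') := by
  obtain ⟨⟨N, hN⟩, h2⟩ := hp
  obtain ⟨⟨N', hN'⟩, h2'⟩ := hq
  refine ⟨⟨N + N', fun x => natDegree_mul_le.trans (add_le_add (hN x) (hN' x))⟩, fun k => ?_⟩
  simp only [coeff_mul, coeff_add, ← Finset.sum_add_distrib]
  exact HasDerivAt.fun_sum fun i _ => (h2 _).mul (h2' _)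

lemma HPD.pow {p : ℂ → ℂ[X]} {p' : ℂ[X]} (hp : HPD p p') (n : ℕ) :
    HPD (fun x => p x ^ n) (Polynomial.C (n : ℂ) * p 0 ^ (n - 1) * p') := by
  induction n with
  | zero => simpa using HPD.const 1
  | succ n ih =>
    have := ih.mul hp
    simp only [← pow_succ] at this
    convert this using 1
    rcases n with _ | n
    · simp
    · simp only [Nat.add_sub_cancel, pow_succ]
      push_cast; simp only [map_add, map_natCast, map_one]; ring

lemma HPD.prod {ι : Type*} (s : Finset ι) {p : ι → ℂ → ℂ[X]} {p' : ι → ℂ[X]}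
    (h : ∀ j ∈ s, HPD (p j) (p' j)) :
    HPD (fun x => ∏ j ∈ s, p j x) (∑ j ∈ s, (∏ k ∈ s.erase j, p k 0) * p' j) := by
  induction s using Finset.induction_on with
  | empty => simpa using HPD.const 1
  | insert j s hj ih =>
    have := (h j (by simp)).mul (ih fun k hk => h k (by simp [hk]))
    simp only [Finset.prod_insert hj]
    convert this using 1
    rw [Finset.sum_insert hj, Finset.erase_insert hj, mul_comm, Finset.mul_sum]
    congr 1
    refine Finset.sum_congr rfl fun i hi => ?_
    have hne : j ≠ i := fun h => hj (h ▸ hi)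
    rw [Finset.erase_insert_of_ne hne, Finset.prod_insert (fun h => hj (Finset.mem_of_mem_erase h))]
    ring

noncomputable def dcp {ι : Type*} [Fintype ι] (a : ι → ℕ) (ξ v : ι → ℂ) : ℂ[X] :=
  ∑ j, (∏ k ∈ Finset.univ.erase j, (X - C (ξ k)) ^ a k) * (C (a j : ℂ) * (X - C (ξ j)) ^ (a j - 1) * C (-(v j)))

lemma HPD.cp {ι : Type*} [Fintype ι] (a : ι → ℕ) (ξ v : ι → ℂ) :
    HPD (fun ε => cp a (ξ + ε • v)) (dcp a ξ v) := by
  unfold FO.cp dcp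
  have := HPD.prod (Finset.univ : Finset ι) (p := fun j ε => (X - Polynomial.C ((ξ + ε • v) j)) ^ a j)
    (p' := fun j => (Polynomial.C (a j : ℂ) * (X - Polynomial.C (ξ j)) ^ (a j - 1) * Polynomial.C (-(v j)))) ?_
  · simpa using this
  · intro j _
    have h1 : HasDerivAt (fun ε : ℂ => -((ξ + ε • v) j)) (-(v j)) 0 := by
      have := ((hasDerivAt_id (0 : ℂ)).mul_const (v j)).const_add (ξ j)
      rw [one_mul] at this
      exact this.fun_neg
    have h2 := ((HPD.const X).add (HPD.C h1)).pow (a j)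
    simpa [sub_eq_add_neg] using h2

lemma HPD.ad {p : ℂ → ℂ[X]} {p' : ℂ[X]} (hp : HPD p p') : HPD (fun x => ad (p x)) (ad p') := by
  obtain ⟨⟨N, hN⟩, h2⟩ := hp
  refine ⟨⟨N + 1, fun x => (natDegree_ad _).trans (by have := hN x; omega)⟩, fun k => ?_⟩
  rcases k with _ | k
  · simp only [coeff_ad_zero]; exact hasDerivAt_const _ _
  · simp only [coeff_ad]; exact (h2 k).div_const _

lemma HPD.natDegree {p : ℂ → ℂ[X]} {p' : ℂ[X]} (hp : HPD p p') (N : ℕ) (hN : ∀ x, (p x).natDegree ≤ N) :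
    p'.natDegree ≤ N := by
  rw [natDegree_le_iff_coeff_eq_zero]
  intro k hk
  have h1 := hp.2 k
  have h2 : (fun x => (p x).coeff k) = fun _ => 0 := by
    ext x; exact coeff_eq_zero_of_natDegree_lt ((hN x).trans_lt hk)
  rw [h2] at h1
  exact h1.unique (hasDerivAt_const _ _)

lemma HPD.eval {p : ℂ → ℂ[X]} {p' : ℂ[X]} (hp : HPD p p') {y : ℂ → ℂ} {y' : ℂ} (hy : HasDerivAt y y' 0) :
    HasDerivAt (fun x => (p x).eval (y x)) (p'.eval (y 0) + (derivative (p 0)).eval (y 0) * y') 0 := by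
  have hp' := hp
  obtain ⟨⟨N, hN⟩, h2⟩ := hp
  have e1 : ∀ x, (p x).eval (y x) = ∑ k ∈ Finset.range (N + 1), (p x).coeff k * y x ^ k := fun x =>
    eval_eq_sum_range' (by have := hN x; omega) _
  simp only [e1]
  have e2 : p'.eval (y 0) = ∑ k ∈ Finset.range (N + 1), p'.coeff k * y 0 ^ k :=
    eval_eq_sum_range' (by have := hp'.natDegree N hN; omega) _
  have e3 : (derivative (p 0)).eval (y 0) = ∑ k ∈ Finset.range (N + 1), (p 0).coeff k * (k * y 0 ^ (k - 1)) := by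
    rw [derivative_eval, sum_over_range' _ _ (N + 1) (by have := hN 0; omega)]
    · exact Finset.sum_congr rfl fun k _ => by ring
    · intro n; simp
  rw [e2, e3, Finset.sum_mul, ← Finset.sum_add_distrib]
  refine HasDerivAt.fun_sum fun k _ => ?_
  refine ((h2 k).fun_mul (hy.fun_pow k)).congr_deriv ?_
  ring

/-! ## kernel -/

lemma dcp_rootMult {ι : Type*} [Fintype ι] (a : ι → ℕ) (ξ v : ι → ℂ) (j : ι) :
    (X - C (ξ j)) ^ (a j - 1) ∣ dcp a ξ v := by
  unfold dcp
  refine Finset.dvd_sum fun i _ => ?_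
  by_cases h : j = i
  · subst h
    exact Dvd.dvd.mul_left (Dvd.dvd.mul_right (dvd_mul_left _ _) _) _
  · refine Dvd.dvd.mul_right ?_ _
    exact (pow_dvd_pow _ (Nat.sub_le _ _)).trans
      (Finset.dvd_prod_of_mem (fun k => (X - C (ξ k)) ^ a k) (Finset.mem_erase.2 ⟨h, Finset.mem_univ _⟩))

lemma dcp_zero {ι : Type*} [Fintype ι] (a : ι → ℕ) (ha : ∀ j, 1 ≤ a j) (ξ v : ι → ℂ)
    (hξ : Function.Injective ξ) (h : dcp a ξ v = 0) : v = 0 := by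
  have h1 : dcp a ξ v = cp (fun j => a j - 1) ξ *
      ∑ j, (∏ k ∈ Finset.univ.erase j, (X - C (ξ k))) * C (-(a j * v j : ℂ)) := by
    unfold dcp cp
    rw [Finset.mul_sum]
    refine Finset.sum_congr rfl fun j _ => ?_
    rw [← Finset.mul_prod_erase Finset.univ (fun k => (X - C (ξ k)) ^ (a k - 1)) (Finset.mem_univ j)]
    have h2 : ∏ k ∈ Finset.univ.erase j, (X - C (ξ k)) ^ a k =
        (∏ k ∈ Finset.univ.erase j, (X - C (ξ k)) ^ (a k - 1)) * ∏ k ∈ Finset.univ.erase j, (X - C (ξ k)) := by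
      rw [← Finset.prod_mul_distrib]
      refine Finset.prod_congr rfl fun k _ => ?_
      rw [← pow_succ, Nat.sub_add_cancel (ha k)]
    rw [h2]; simp only [C_neg, C_mul]; ring
  rw [h1] at h
  have h3 := (mul_eq_zero.1 h).resolve_left (cp_monic _ ξ).ne_zero
  ext i
  have h4 := congrArg (fun p => p.eval (ξ i)) h3
  simp only [eval_finset_sum, eval_mul, eval_prod, eval_sub, eval_X, eval_C, eval_zero] at h4
  rw [Finset.sum_eq_single i] at h4
  · have h5 : ∏ k ∈ Finset.univ.erase i, (ξ i - ξ k) ≠ 0 := by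
      rw [Finset.prod_ne_zero_iff]
      intro k hk
      exact sub_ne_zero.2 fun h => (Finset.ne_of_mem_erase hk) (hξ h).symm
    have h6 := (mul_eq_zero.1 h4).resolve_left h5
    rw [neg_eq_zero] at h6
    exact (mul_eq_zero.1 h6).resolve_left (by have := ha i; exact_mod_cast (by omega : a i ≠ 0))
  · intro j _ hj
    rw [Finset.prod_eq_zero (Finset.mem_erase.2 ⟨hj.symm, Finset.mem_univ i⟩) (by ring), zero_mul]
  · simp

lemma dcp_degree {ι : Type*} [Fintype ι] (a : ι → ℕ) (ha : ∀ j, 1 ≤ a j) (ξ v : ι → ℂ)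
    (hs : ∑ j, (a j : ℂ) * v j = 0) : (dcp a ξ v).degree < ((∑ j, a j - 1 : ℕ) : WithBot ℕ) := by
  rw [degree_lt_iff_coeff_zero]
  intro m hm
  have hmon : ∀ j, ((∏ k ∈ Finset.univ.erase j, (X - C (ξ k)) ^ a k) * (X - C (ξ j)) ^ (a j - 1)).Monic ∧
      ((∏ k ∈ Finset.univ.erase j, (X - C (ξ k)) ^ a k) * (X - C (ξ j)) ^ (a j - 1)).natDegree = ∑ j, a j - 1 := by
    intro j
    have h1 : (∏ k ∈ Finset.univ.erase j, (X - C (ξ k)) ^ a k).Monic :=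
      monic_prod_of_monic _ _ fun j _ => (monic_X_sub_C _).pow _
    have h2 : ((X - C (ξ j)) ^ (a j - 1)).Monic := (monic_X_sub_C _).pow _
    refine ⟨h1.mul h2, ?_⟩
    rw [h1.natDegree_mul h2, natDegree_prod_of_monic _ _ fun j _ => (monic_X_sub_C _).pow _]
    simp only [natDegree_pow, natDegree_X_sub_C, mul_one]
    have := Finset.add_sum_erase Finset.univ a (Finset.mem_univ j)
    have := ha j
    omega
  have hform : dcp a ξ v = ∑ j, C (-(a j * v j : ℂ)) * ((∏ k ∈ Finset.univ.erase j, (X - C (ξ k)) ^ a k) * (X - C (ξ j)) ^ (a j - 1)) := by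
    unfold dcp
    refine Finset.sum_congr rfl fun j _ => ?_
    simp only [C_neg, C_mul]; ring
  rw [hform, finset_sum_coeff]
  simp only [coeff_C_mul]
  rcases hm.lt_or_eq with h | h
  · refine Finset.sum_eq_zero fun j _ => ?_
    rw [coeff_eq_zero_of_natDegree_lt (by rw [(hmon j).2]; omega), mul_zero]
  · have : ∀ j, ((∏ k ∈ Finset.univ.erase j, (X - C (ξ k)) ^ a k) * (X - C (ξ j)) ^ (a j - 1)).coeff m = 1 := by
      intro j
      rw [← h, ← (hmon j).2]; exact (hmon j).1.coeff_natDegree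
    simp only [this, mul_one, Finset.sum_neg_distrib, hs, neg_zero]

lemma KER {ι : Type*} [Fintype ι] (a : ι → ℕ) (ha : ∀ j, 1 ≤ a j) (ξ v : ι → ℂ)
    (hξ : Function.Injective ξ) (c δ : ℂ) (hc : c ≠ 0)
    (hq : ∀ j, (C δ + ad (C c * dcp a ξ v)).eval (ξ j) = 0) (hs : ∑ j, (a j : ℂ) * v j = 0)
    (hE : IsEmpty ι → δ = 0) : v = 0 ∧ δ = 0 := by
  rcases isEmpty_or_nonempty ι with he | hne
  · exact ⟨Subsingleton.elim _ _, hE he⟩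
  set q := C δ + ad (C c * dcp a ξ v) with hqd
  have hder : derivative q = C c * dcp a ξ v := by simp [hqd, derivative_ad]
  obtain ⟨j0⟩ := hne
  have hd1 : 1 ≤ ∑ j, a j := (ha j0).trans (Finset.single_le_sum (f := a) (fun j _ => Nat.zero_le _) (Finset.mem_univ j0))
  have hfin : q = 0 → v = 0 ∧ δ = 0 := by
    intro h
    rw [h, derivative_zero] at hder
    have h1 := (mul_eq_zero.1 hder.symm).resolve_left (C_ne_zero.2 hc)
    refine ⟨dcp_zero a ha ξ v hξ h1, ?_⟩
    have h2 := congrArg (fun p => p.coeff 0) h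
    simpa [hqd, coeff_ad_zero] using h2
  apply hfin
  by_contra hq0
  have hd : dcp a ξ v ≠ 0 := by
    intro h
    rw [h, mul_zero] at hder
    obtain ⟨e, he⟩ := natDegree_eq_zero.1 (natDegree_eq_zero_of_derivative_eq_zero hder)
    have := hq j0
    rw [← he, eval_C] at this
    rw [this, C_0] at he
    exact hq0 he.symm
  have hdeg : q.natDegree < ∑ j, a j := by
    have h1 := natDegree_derivative q
    rw [hder, natDegree_C_mul hc] at h1
    have h2 := dcp_degree a ha ξ v hs
    rw [degree_eq_natDegree hd] at h2
    have h3 : (dcp a ξ v).natDegree < ∑ j, a j - 1 := by exact_mod_cast h2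
    omega
  have hm : ∀ j, a j ≤ q.rootMultiplicity (ξ j) := by
    intro j
    have h1 := derivative_rootMultiplicity_of_root (p := q) (t := ξ j) (hq j)
    have h2 : a j - 1 ≤ (derivative q).rootMultiplicity (ξ j) := by
      rw [hder, le_rootMultiplicity_iff (mul_ne_zero (C_ne_zero.2 hc) hd)]
      exact Dvd.dvd.mul_left (dcp_rootMult a ξ v j) _
    have h3 : 0 < q.rootMultiplicity (ξ j) := (rootMultiplicity_pos hq0).2 (hq j)
    omega
  have hsum : ∑ j, a j ≤ q.natDegree := by
    calc ∑ j, a j ≤ ∑ j, q.roots.count (ξ j) := by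
          refine Finset.sum_le_sum fun j _ => ?_
          rw [count_roots]; exact hm j
      _ = ∑ w ∈ Finset.univ.image ξ, q.roots.count w := (Finset.sum_image (f := fun w => q.roots.count w) (fun x _ y _ h => hξ h)).symm
      _ ≤ ∑ w ∈ q.roots.toFinset, q.roots.count w := by
          refine Finset.sum_le_sum_of_subset ?_
          intro w hw
          obtain ⟨j, _, rfl⟩ := Finset.mem_image.1 hw
          simp [hq0]; exact hq j
      _ = Multiset.card q.roots := Multiset.toFinset_sum_count_eq _
      _ ≤ _ := card_roots' q
  omega

/-- Kernel of one block. -/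
lemma BLOCK {ι : Type*} [Fintype ι] (a : ι → ℕ) (ha : ∀ j, 1 ≤ a j) (ξ v : ι → ℂ)
    (hξ : Function.Injective ξ) (e c0 δ : ℂ) (he : e ≠ 0)
    (h1 : ∀ j (w : ℂ), HasDerivAt (fun ε : ℂ => (C (c0 + ε * δ) + ad (C e * cp a (ξ + ε • v))).eval (ξ j + ε * v j) - w) 0 0)
    (h2 : HasDerivAt (fun ε : ℂ => ∑ j, (a j : ℂ) * (ξ j + ε * v j) + if IsEmpty ι then c0 + ε * δ else 0) 0 0) :
    v = 0 ∧ δ = 0 := by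
  have lin : ∀ x y : ℂ, HasDerivAt (fun ε : ℂ => x + ε * y) y 0 := by
    intro x y
    simpa using ((hasDerivAt_id (0 : ℂ)).mul_const y).const_add x
  have hg : HasDerivAt (fun ε : ℂ => ∑ j, (a j : ℂ) * (ξ j + ε * v j) + if IsEmpty ι then c0 + ε * δ else 0)
      (∑ j, (a j : ℂ) * v j + if IsEmpty ι then δ else 0) 0 := by
    refine HasDerivAt.add (HasDerivAt.fun_sum fun j _ => (lin _ _).const_mul _) ?_
    split_ifs
    · exact lin _ _
    · exact hasDerivAt_const _ _
  have hg0 := hg.unique h2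
  have hp : HPD (fun ε => C (c0 + ε * δ) + ad (C e * cp a (ξ + ε • v))) (C δ + ad (C e * dcp a ξ v)) := by
    refine (HPD.C (lin _ _)).add ?_
    have := ((HPD.const (C e)).mul (HPD.cp a ξ v)).ad
    simpa using this
  refine KER a ha ξ v hξ e δ he ?_ ?_ ?_
  · intro j
    have h3 := (hp.eval (lin (ξ j) (v j))).sub_const 0
    have h4 := h3.unique (h1 j 0)
    have h5 : (derivative (C (c0 + 0 * δ) + ad (C e * cp a (ξ + (0:ℂ) • v)))).eval (ξ j) = 0 := by
      simp only [derivative_add, derivative_C, zero_add, derivative_ad, zero_smul, add_zero, eval_mul, cp_eval]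
      rw [Finset.prod_eq_zero (Finset.mem_univ j), mul_zero]
      rw [sub_self, zero_pow (by have := ha j; omega)]
    simp only [zero_mul, add_zero] at h4 h5
    rw [h5, zero_mul, add_zero] at h4
    exact h4
  · by_cases h : IsEmpty ι
    · simp
    · simpa [h] using hg0
  · intro h
    simpa [h] using hg0

end FO

open Polynomial
open scoped Classical
set_option linter.all false
namespace FO
open Filter Topology

lemma AL {I Y Z : Type*} [Fintype Z] (l : Filter I) (Sol : I → Set Y) (sgn : Y → ℤ) (sg0 : Z → ℤ)
    (ψ : Z → I → Y)
    (h1 : ∀ z, ∀ᶠ i in l, ψ z i ∈ Sol i ∧ sgn (ψ z i) = sg0 z)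
    (h2 : ∀ z z', z ≠ z' → ∀ᶠ i in l, ψ z i ≠ ψ z' i)
    (h3 : ∀ U : Ultrafilter I, (U : Filter I) ≤ l → ∀ y : I → Y, (∀ᶠ i in U, y i ∈ Sol i) →
      ∃ z, ∀ᶠ i in U, y i = ψ z i) :
    ∀ᶠ i in l, ∑ᶠ y ∈ Sol i, sgn y = ∑ z, sg0 z := by
  have hsub : ∀ᶠ i in l, Sol i ⊆ Set.range (fun z => ψ z i) := by
    by_contra hcon
    have hf : ∃ᶠ i in l, ∃ y ∈ Sol i, ∀ z, y ≠ ψ z i := by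
      refine (not_eventually.1 hcon).mono fun i hi => ?_
      obtain ⟨y, hy, hy2⟩ := Set.not_subset.1 hi
      exact ⟨y, hy, fun z h => hy2 ⟨z, h.symm⟩⟩
    set B : Set I := {i | ∃ y ∈ Sol i, ∀ z, y ≠ ψ z i} with hB
    have hne : (l ⊓ 𝓟 B).NeBot := by
      rw [← frequently_mem_iff_neBot]; exact hf
    obtain ⟨i0, y0, _⟩ := hf.exists
    set U := Ultrafilter.of (l ⊓ 𝓟 B)
    have hU : (U : Filter I) ≤ l ⊓ 𝓟 B := Ultrafilter.of_le _
    have hUB : ∀ᶠ i in U, i ∈ B := le_principal_iff.1 (hU.trans inf_le_right)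
    set y : I → Y := fun i => if h : ∃ y ∈ Sol i, ∀ z, y ≠ ψ z i then h.choose else y0 with hy
    have hyp : ∀ i ∈ B, y i ∈ Sol i ∧ ∀ z, y i ≠ ψ z i := by
      intro i hi
      have hi' : ∃ y ∈ Sol i, ∀ z, y ≠ ψ z i := hi
      simp only [hy, dif_pos hi']
      exact hi'.choose_spec
    obtain ⟨z, hz⟩ := h3 U (hU.trans inf_le_left) y (hUB.mono fun i hi => (hyp i hi).1)
    obtain ⟨i, hi1, hi2⟩ := (hz.and hUB).exists
    exact (hyp i hi2).2 z hi1
  have h1' := eventually_all.2 h1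
  have h2' : ∀ᶠ i in l, ∀ z z', z ≠ z' → ψ z i ≠ ψ z' i := by
    rw [eventually_all]; intro z
    rw [eventually_all]; intro z'
    by_cases h : z = z'
    · simp [h]
    · filter_upwards [h2 z z' h] with i hi _ using hi
  filter_upwards [hsub, h1', h2'] with i hi1 hi2 hi3
  have he : Sol i = Set.range (fun z => ψ z i) :=
    Set.Subset.antisymm hi1 (by rintro _ ⟨z, rfl⟩; exact (hi2 z).1)
  rw [he, finsum_mem_range (fun z z' h => by_contra fun hn => hi3 z z' hn h), finsum_eq_sum_of_fintype]
  exact Finset.sum_congr rfl fun z _ => (hi2 z).2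

lemma ultra_exists {I : Type*} (U : Ultrafilter I) {ι : Type*} [Finite ι] (p : ι → I → Prop)
    (h : ∀ᶠ i in U, ∃ j, p j i) : ∃ j, ∀ᶠ i in U, p j i := by
  by_contra hcon
  push Not at hcon
  have h2 : ∀ᶠ i in U, ∀ j, ¬ p j i := eventually_all.2 fun j => hcon j
  obtain ⟨i, ⟨j, hj⟩, hi2⟩ := (h.and h2).exists
  exact hi2 j hj

lemma IFT_conj {E : Type*} [NormedAddCommGroup E] (Φ : ℂ × E → E) (t0 : ℂ) (x0 : E) (ψ : ℂ → E)
    (h1 : Tendsto ψ (𝓝 t0) (𝓝 x0)) (h2 : ∀ᶠ p in 𝓝 (t0, x0), Φ p = 0 ↔ ψ p.1 = p.2)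
    (h3 : ∀ᶠ t in 𝓝 t0, Φ (t, ψ t) = 0) (J : E → E) (hJ : Continuous J) (hJ0 : J x0 = x0)
    (hΦ : ∀ (t : ℝ) x, Φ (t, x) = 0 → Φ (t, J x) = 0) :
    ∀ᶠ t : ℂ in 𝓝 t0, ∀ r : ℝ, t = (r : ℂ) → J (ψ t) = ψ t := by
  have h4 : Tendsto (fun t => (t, J (ψ t))) (𝓝 t0) (𝓝 (t0, x0)) := by
    rw [nhds_prod_eq]
    refine tendsto_id.prodMk ?_
    have := (hJ.tendsto x0).comp h1
    rwa [hJ0] at this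
  filter_upwards [h4.eventually h2, h3] with t ht1 ht2 r hr
  subst hr
  exact (ht1.1 (hΦ r _ ht2)).symm

/-! ## Labelled data -/

structure LD (ι : Type*) where
  a : ι → ℕ
  u : ι → ℝ
  rel : ι → ι → Prop
  κ : ι → ι → ℕ

def LD.comap {ι ι' : Type*} (D : LD ι) (f : ι' → ι) : LD ι' :=
  ⟨D.a ∘ f, D.u ∘ f, fun i j => D.rel (f i) (f j), fun i j => D.κ (f i) (f j)⟩

structure LD.Good {ι : Type*} (D : LD ι) : Prop where
  pos : ∀ i, 1 ≤ D.a i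
  rel_a : ∀ i j, D.rel i j → D.a i = D.a j
  rel_u : ∀ i j, D.rel i j → D.u i = D.u j
  func : ∀ i j k, D.rel i j → D.rel i k → j = k
  kap : ∀ i j, D.κ i j ≠ 0 → D.rel i i ∧ D.rel j j

lemma LD.Good.comap {ι ι' : Type*} {D : LD ι} (h : D.Good) (f : ι' → ι) (hf : Function.Injective f) :
    (D.comap f).Good :=
  ⟨fun i => h.pos _, fun i j => h.rel_a _ _, fun i j => h.rel_u _ _,
    fun i j k h1 h2 => hf (h.func _ _ _ h1 h2), fun i j => h.kap _ _⟩

/-- reality -/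
def Rl {ι : Type*} (D : LD ι) (ξ : ι → ℂ) : Prop := ∀ i, ∃ j, D.rel i j ∧ ξ j = (starRingEnd ℂ) (ξ i)

def IsSol {ι : Type*} [Fintype ι] (D : LD ι) (ξ : ι → ℂ) : Prop :=
  Function.Injective ξ ∧ Rl D ξ ∧ ∑ j, (D.a j : ℂ) * ξ j = 0 ∧
    ∃ P : ℂ[X], derivative P = C ((∑ j, D.a j + 1 : ℕ) : ℂ) * cp D.a ξ ∧ ∀ j, P.eval (ξ j) = (D.u j : ℂ)

noncomputable def sg {ι : Type*} [Fintype ι] (D : LD ι) (ξ : ι → ℂ) : ℤ :=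
  (-1) ^ (∑ i, ∑ j, if (ξ i).re < (ξ j).re then D.κ i j else 0)

noncomputable def SS {ι : Type*} [Fintype ι] (D : LD ι) : ℤ := ∑ᶠ ξ ∈ {ξ | IsSol D ξ}, sg D ξ

lemma Rl.real {ι : Type*} {D : LD ι} (hD : D.Good) {ξ : ι → ℂ} (h : Rl D ξ) {i : ι} (hi : D.rel i i) :
    (ξ i).im = 0 := by
  obtain ⟨j, h1, h2⟩ := h i
  have := hD.func i i j hi h1
  subst this
  exact Complex.conj_eq_iff_im.1 h2.symm

lemma inj_ev {ι : Type*} [Finite ι] {I : Type*} (l : Filter I) (y : I → ι → ℂ)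
    (y0 : ι → ℂ) (hy : ∀ j, Tendsto (fun i => y i j) l (𝓝 (y0 j)))
    (h0 : Function.Injective y0) : ∀ᶠ i in l, Function.Injective (y i) := by
  have : ∀ p q, ∀ᶠ i in l, p ≠ q → y i p ≠ y i q := by
    intro p q
    by_cases hpq : p = q
    · simp [hpq]
    · have h1 := ((hy p).sub (hy q)).eventually_ne (sub_ne_zero.2 fun e => hpq (h0 e))
      filter_upwards [h1] with t ht _ using sub_ne_zero.1 ht
  filter_upwards [eventually_all.2 fun i => eventually_all.2 (this i)] with t ht i j hij
  by_contra hne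
  exact ht i j hne hij

lemma sg_ev {ι : Type*} [Fintype ι] {D : LD ι} (hD : D.Good) {I : Type*} (l : Filter I) (y : I → ι → ℂ)
    (y0 : ι → ℂ) (hy : ∀ j, Tendsto (fun i => y i j) l (𝓝 (y0 j)))
    (h0 : Function.Injective y0) (hr0 : Rl D y0) : ∀ᶠ i in l, sg D (y i) = sg D y0 := by
  have key : ∀ p q, ∀ᶠ i in l, (if (y i p).re < (y i q).re then D.κ p q else 0) =
      (if (y0 p).re < (y0 q).re then D.κ p q else 0) := by
    intro p q
    by_cases hk : D.κ p q = 0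
    · simp [hk]
    obtain ⟨hp, hq⟩ := hD.kap p q hk
    by_cases hpq : p = q
    · subst hpq; simp
    have hre : ∀ p, Tendsto (fun i => (y i p).re) l (𝓝 (y0 p).re) := fun p =>
      (Complex.continuous_re.tendsto _).comp (hy p)
    have hne : (y0 p).re ≠ (y0 q).re := fun h => hpq (h0 (Complex.ext h (by
      rw [hr0.real hD hp, hr0.real hD hq])))
    rcases lt_or_gt_of_ne hne with h | h
    · filter_upwards [(hre p).eventually_lt (hre q) h] with i hi
      simp [hi, h]
    · filter_upwards [(hre q).eventually_lt (hre p) h] with i hi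
      simp [not_lt.2 hi.le, not_lt.2 h.le]
  have := eventually_all.2 fun p => eventually_all.2 (key p)
  filter_upwards [this] with i hi
  unfold sg
  congr 1
  exact Finset.sum_congr rfl fun p _ => Finset.sum_congr rfl fun q _ => hi p q

/-! ## conjugation -/

lemma cp_map {ι : Type*} [Fintype ι] (a : ι → ℕ) (y : ι → ℂ) :
    (cp a y).map (starRingEnd ℂ) = cp a (fun j => (starRingEnd ℂ) (y j)) := by
  simp [cp, Polynomial.map_prod]

lemma ad_map (p : ℂ[X]) : (ad p).map (starRingEnd ℂ) = ad (p.map (starRingEnd ℂ)) := by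
  ext k
  rcases k with _ | k
  · simp [coeff_ad_zero]
  · simp [coeff_ad]

lemma eval_conj (p : ℂ[X]) (x : ℂ) : (p.map (starRingEnd ℂ)).eval ((starRingEnd ℂ) x) = (starRingEnd ℂ) (p.eval x) := by
  rw [eval_map, eval₂_hom]

lemma cp_perm {ι : Type*} [Fintype ι] (a : ι → ℕ) (y : ι → ℂ) (s : ι → ι) (hs : Function.Involutive s)
    (ha : ∀ j, a (s j) = a j) : cp a (fun j => y (s j)) = cp a y := by
  unfold cp
  refine Fintype.prod_equiv hs.toPerm _ _ fun j => ?_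
  simp [ha]

lemma Rl.exists_sigma {ι : Type*} {D : LD ι} (hD : D.Good) {ξ : ι → ℂ} (h : Rl D ξ) (hi : Function.Injective ξ) :
    ∃ s : ι → ι, Function.Involutive s ∧ (∀ j, D.rel j (s j)) ∧ (∀ j, D.a (s j) = D.a j) ∧
      (∀ j, D.u (s j) = D.u j) ∧ ∀ j, ξ (s j) = (starRingEnd ℂ) (ξ j) := by
  choose s h1 h2 using h
  refine ⟨s, fun j => hi ?_, h1, fun j => (hD.rel_a _ _ (h1 j)).symm, fun j => (hD.rel_u _ _ (h1 j)).symm, h2⟩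
  rw [h2, h2, Complex.conj_conj]

/-- the antiholomorphic symmetry on a block of unknowns -/
noncomputable def Jb {ι : Type*} (s : ι → ι) (y : ι → ℂ) : ι → ℂ := fun j => (starRingEnd ℂ) (y (s j))

lemma Jb_cp {ι : Type*} [Fintype ι] (a : ι → ℕ) (y : ι → ℂ) (s : ι → ι) (hs : Function.Involutive s)
    (ha : ∀ j, a (s j) = a j) : cp a (Jb s y) = (cp a y).map (starRingEnd ℂ) := by
  rw [cp_map]; exact cp_perm a (fun j => (starRingEnd ℂ) (y j)) s hs ha

lemma Jb_cont {ι : Type*} [Fintype ι] (s : ι → ι) : Continuous (Jb s) := by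
  unfold Jb
  exact continuous_pi fun j => Complex.continuous_conj.comp (continuous_apply _)

lemma Jb_sum {ι : Type*} [Fintype ι] (a : ι → ℕ) (y : ι → ℂ) (s : ι → ι) (hs : Function.Involutive s)
    (ha : ∀ j, a (s j) = a j) : ∑ j, (a j : ℂ) * Jb s y j = (starRingEnd ℂ) (∑ j, (a j : ℂ) * y j) := by
  rw [map_sum]
  refine Fintype.sum_equiv hs.toPerm _ _ fun j => ?_
  simp [Jb, ha]

/-! ## Level deformation -/

section LVsec
variable {ι : Type} [Fintype ι] (D : LD ι) (w : ι → ℝ)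

/-- linear path of levels -/
noncomputable def LD.path (t : ℝ) : LD ι := { D with u := fun j => D.u j + t * w j }

noncomputable def PhiLV : ℂ × ((ι → ℂ) × ℂ) → (ι → ℂ) × ℂ := fun p =>
  (fun j => (C p.2.2 + ad (C ((∑ j, D.a j + 1 : ℕ) : ℂ) * cp D.a p.2.1)).eval (p.2.1 j) - (D.u j + p.1 * w j),
   ∑ j, (D.a j : ℂ) * p.2.1 j + if IsEmpty ι then p.2.2 else 0)

lemma PhiLV_smooth : ContDiff ℂ 1 (PhiLV D w) := by
  unfold PhiLV
  have hy : ∀ j, ContDiff ℂ 1 (fun p : ℂ × ((ι → ℂ) × ℂ) => p.2.1 j) := fun j => by fun_prop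
  have hc : ContDiff ℂ 1 (fun p : ℂ × ((ι → ℂ) × ℂ) => p.2.2) := by fun_prop
  refine ContDiff.prodMk (contDiff_pi.2 fun j => ?_) ?_
  · have h1 : CP (fun p : ℂ × ((ι → ℂ) × ℂ) => C p.2.2 + ad (C ((∑ j, D.a j + 1 : ℕ) : ℂ) * cp D.a p.2.1)) :=
      (CP.C hc).add ((CP.const _).mul (CP.cp D.a hy)).ad
    refine (h1.eval (hy j)).sub ?_
    fun_prop
  · refine ContDiff.add (ContDiff.sum fun j _ => contDiff_const.mul (hy j)) ?_
    split_ifs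
    · exact hc
    · exact contDiff_const

variable {D}

lemma path_good (hD : D.Good) (hw : ∀ i j, D.rel i j → w i = w j) (t : ℝ) : (D.path w t).Good :=
  ⟨hD.pos, hD.rel_a, fun i j h => by simp [LD.path, hD.rel_u i j h, hw i j h], hD.func, hD.kap⟩

lemma PhiLV_sol {t : ℝ} {y : ι → ℂ} {c : ℂ} (h : PhiLV D w (t, (y, c)) = 0) (hi : Function.Injective y)
    (hr : Rl D y) : IsSol (D.path w t) y := by
  refine ⟨hi, hr, ?_, C c + ad (C ((∑ j, D.a j + 1 : ℕ) : ℂ) * cp D.a y), ?_, ?_⟩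
  · have h2 := congrArg Prod.snd h
    simp only [PhiLV, Prod.snd_zero] at h2
    by_cases he : IsEmpty ι
    · simp
    · rw [if_neg he, add_zero] at h2; exact h2
  · simp [derivative_ad, LD.path]
  · intro j
    have h1 := congrFun (congrArg Prod.fst h) j
    simp only [PhiLV, Prod.fst_zero, Pi.zero_apply, sub_eq_zero] at h1
    rw [h1]; simp [LD.path]

lemma sol_PhiLV {t : ℝ} {y : ι → ℂ} (h : IsSol (D.path w t) y) : ∃ c, PhiLV D w (t, (y, c)) = 0 := by
  obtain ⟨hi, hr, hs, P, hP1, hP2⟩ := h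
  by_cases he : IsEmpty ι
  · refine ⟨0, Prod.ext (Subsingleton.elim _ _) ?_⟩
    simp [PhiLV]
  · obtain ⟨c, hc⟩ := eq_add_C (p := P) (q := ad (C ((∑ j, D.a j + 1 : ℕ) : ℂ) * cp D.a y))
      (by rw [hP1, derivative_ad]; rfl)
    refine ⟨c, Prod.ext ?_ ?_⟩
    · ext j
      simp only [PhiLV, Prod.fst_zero, Pi.zero_apply]
      rw [add_comm (C c), ← hc, hP2 j]
      simp [LD.path]
    · simp only [PhiLV, he, if_false, add_zero]
      exact hs

lemma PhiLV_ker (hD : D.Good) {t : ℂ} {y : ι → ℂ} {c : ℂ} (hi : Function.Injective y) (v : (ι → ℂ) × ℂ)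
    (hv : HasDerivAt (fun ε : ℂ => PhiLV D w (t, (y, c) + ε • v)) 0 0) : v = 0 := by
  obtain ⟨v1, v2⟩ := v
  have h1 : HasDerivAt (fun ε : ℂ => (PhiLV D w (t, (y, c) + ε • (v1, v2))).1) 0 0 :=
    hv.fst
  have h2 : HasDerivAt (fun ε : ℂ => (PhiLV D w (t, (y, c) + ε • (v1, v2))).2) 0 0 :=
    hv.snd
  have h3 := hasDerivAt_pi.1 h1
  have := BLOCK D.a hD.pos y v1 hi ((∑ j, D.a j + 1 : ℕ) : ℂ) c v2 (Nat.cast_ne_zero.2 (Nat.succ_ne_zero _)) ?_ ?_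
  · rw [this.1, this.2]; rfl
  · intro j w'
    have h4 := (h3 j).sub_const (w' - (D.u j + t * w j))
    refine h4.congr_of_eventuallyEq (Eventually.of_forall fun ε => ?_)
    simp only [PhiLV, Prod.mk_add_mk, Prod.smul_mk, Pi.add_apply, Pi.smul_apply, smul_eq_mul, Prod.fst_add, Prod.snd_add, Prod.smul_fst, Prod.smul_snd]
    ring
  · exact h2

lemma PhiLV_conj (hD : D.Good) (hw : ∀ i j, D.rel i j → w i = w j) (s : ι → ι) (hs : Function.Involutive s) (hrel : ∀ j, D.rel j (s j)) (t : ℝ) (x : (ι → ℂ) × ℂ)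
    (h : PhiLV D w (t, x) = 0) : PhiLV D w (t, (Jb s x.1, (starRingEnd ℂ) x.2)) = 0 := by
  obtain ⟨y, c⟩ := x
  have ha : ∀ j, D.a (s j) = D.a j := fun j => (hD.rel_a _ _ (hrel j)).symm
  have hu : ∀ j, D.u (s j) = D.u j := fun j => (hD.rel_u _ _ (hrel j)).symm
  have hw' : ∀ j, w (s j) = w j := fun j => (hw _ _ (hrel j)).symm
  refine Prod.ext ?_ ?_
  · ext j
    have h1 := congrFun (congrArg Prod.fst h) (s j)
    simp only [PhiLV, Prod.fst_zero, Pi.zero_apply] at h1 ⊢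
    have e : C ((starRingEnd ℂ) c) + ad (C ((∑ j, D.a j + 1 : ℕ) : ℂ) * cp D.a (Jb s y)) =
        (C c + ad (C ((∑ j, D.a j + 1 : ℕ) : ℂ) * cp D.a y)).map (starRingEnd ℂ) := by
      rw [Jb_cp D.a y s hs ha, Polynomial.map_add, ad_map, Polynomial.map_mul, map_C, map_C]
      simp only [Complex.conj_natCast]
    rw [e]
    show eval ((starRingEnd ℂ) (y (s j))) _ - _ = _
    rw [eval_conj]
    have := congrArg (starRingEnd ℂ) h1
    simpa [hu, hw'] using this
  · have h2 := congrArg Prod.snd h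
    simp only [PhiLV, Prod.snd_zero] at h2 ⊢
    rw [Jb_sum D.a y s hs ha]
    have := congrArg (starRingEnd ℂ) h2
    split_ifs with he
    · simpa [he] using this
    · simpa [he] using this

/-- continuation of a solution -/
lemma LV_cont (hD : D.Good) (hw : ∀ i j, D.rel i j → w i = w j) (t0 : ℝ) (ξ : ι → ℂ) (h : IsSol (D.path w t0) ξ) :
    ∃ ψ : ℝ → ι → ℂ, Tendsto ψ (𝓝 t0) (𝓝 ξ) ∧ (∀ᶠ t in 𝓝 t0, IsSol (D.path w t) (ψ t)) ∧
      ∃ c0, PhiLV D w (t0, (ξ, c0)) = 0 ∧ ∀ᶠ p in 𝓝 ((t0 : ℂ), (ξ, c0)), PhiLV D w p = 0 → ∀ r : ℝ, p.1 = r → ψ r = p.2.1 := by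
  obtain ⟨c0, hc0⟩ := sol_PhiLV w h
  have hi := h.1
  have hr : Rl D ξ := h.2.1
  obtain ⟨ψ, hψ1, hψ2, hψ3⟩ := IFT (PhiLV D w) t0 (ξ, c0) (PhiLV_smooth D w) hc0
    (fun v hv => PhiLV_ker w hD hi v hv)
  obtain ⟨s, hs, hrel, ha, hu, hξs⟩ := hr.exists_sigma hD hi
  have hJξ : Jb s ξ = ξ := by
    ext j; simp [Jb, hξs]
  have hcc : (starRingEnd ℂ) c0 = c0 := by
    have h1 := PhiLV_conj w hD hw s hs hrel t0 _ hc0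
    simp only [hJξ] at h1
    by_cases he : IsEmpty ι
    · have := congrArg Prod.snd hc0
      simp [PhiLV, he] at this
      simp [this]
    · rw [not_isEmpty_iff] at he
      obtain ⟨j0⟩ := he
      have h2 := congrFun (congrArg Prod.fst h1) j0
      have h3 := congrFun (congrArg Prod.fst hc0) j0
      simp only [PhiLV, Prod.fst_zero, Pi.zero_apply, eval_add, eval_C] at h2 h3
      linear_combination h2 - h3
  have hJ := IFT_conj (PhiLV D w) t0 (ξ, c0) ψ hψ1 hψ2 hψ3 (fun x => (Jb s x.1, (starRingEnd ℂ) x.2))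
    (((Jb_cont s).comp continuous_fst).prodMk (Complex.continuous_conj.comp continuous_snd))
    (by simp [hJξ, hcc]) (PhiLV_conj w hD hw s hs hrel)
  have hof : Tendsto (fun t : ℝ => (t : ℂ)) (𝓝 t0) (𝓝 (t0 : ℂ)) := Complex.continuous_ofReal.tendsto _
  have hψr : Tendsto (fun t : ℝ => (ψ t).1) (𝓝 t0) (𝓝 ξ) := ((continuous_fst.tendsto _).comp hψ1).comp hof
  refine ⟨fun t => (ψ t).1, hψr, ?_, c0, hc0, ?_⟩
  · have hinj : ∀ᶠ t : ℝ in 𝓝 t0, Function.Injective (ψ t).1 := inj_ev _ _ _ (tendsto_pi_nhds.1 hψr) hi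
    filter_upwards [hinj, hof.eventually hJ, hof.eventually hψ3] with t h1 h2 h3
    refine PhiLV_sol w (c := (ψ t).2) h3 h1 fun i => ⟨s i, hrel i, ?_⟩
    have h4 := congrArg Prod.fst (h2 t rfl)
    have h5 := congrFun h4 (s i)
    simp only [Jb] at h5
    rw [← h5, hs i]
  · filter_upwards [hψ2] with p hp h0 r hr
    rw [← hr, hp.1 h0]

/-- compactness for a path of levels -/
lemma LV_compact (hD : D.Good) (hw : ∀ i j, D.rel i j → w i = w j) {I : Type*} (U : Ultrafilter I) (t : I → ℝ) (t0 : ℝ)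
    (ht : Tendsto t U (𝓝 t0)) (y : I → ι → ℂ) (hy : ∀ᶠ i in U, IsSol (D.path w (t i)) (y i))
    (hpat : ∀ j k, (D.path w t0).u j = (D.path w t0).u k → ∀ᶠ i in U, (D.path w (t i)).u j = (D.path w (t i)).u k) :
    ∃ y0, Tendsto y U (𝓝 y0) ∧ IsSol (D.path w t0) y0 := by
  have hn : ((∑ j, D.a j + 1 : ℕ) : ℂ) ≠ 0 := Nat.cast_ne_zero.2 (Nat.succ_ne_zero _)
  have hP : ∀ i, ∃ P : ℂ[X], IsSol (D.path w (t i)) (y i) →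
      derivative P = C ((∑ j, D.a j + 1 : ℕ) : ℂ) * cp D.a (y i) ∧ ∀ j, P.eval (y i j) = ((D.path w (t i)).u j : ℂ) := by
    intro i
    by_cases h : IsSol (D.path w (t i)) (y i)
    · obtain ⟨P, hP⟩ := h.2.2.2
      exact ⟨P, fun _ => hP⟩
    · exact ⟨0, fun h' => absurd h' h⟩
  choose P hP using hP
  obtain ⟨y0, h1, h2, h3, K0, h4, h5⟩ := COMPACT U D.a hD.pos y (hy.mono fun i hi => hi.2.2.1) P
    (fun _ => C ((∑ j, D.a j + 1 : ℕ) : ℂ)) (fun _ => 0) (C ((∑ j, D.a j + 1 : ℕ) : ℂ)) (PT.const _)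
    (by rw [eval_C]; exact hn) tendsto_const_nhds (fun j => by simp [tendsto_const_nhds])
    (hy.mono fun i hi => by rw [(hP i hi).1, C_comp]) (hy.mono fun i hi => hi.1)
    (fun i j => ((D.path w (t i)).u j : ℂ)) (fun j => ((D.path w t0).u j : ℂ))
    (fun j => by
      refine (Complex.continuous_ofReal.tendsto _).comp ?_
      simp only [LD.path]
      exact (ht.mul_const _).const_add _)
    (hy.mono fun i hi => (hP i hi).2)
    (fun j k h => (hpat j k (by exact_mod_cast h)).mono fun i hi => by rw [hi])
  refine ⟨y0, h1, h2, ?_, h3, K0, ?_, h5⟩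
  · intro i
    obtain ⟨j, hj⟩ := ultra_exists U (fun j i' => D.rel i j ∧ y i' j = (starRingEnd ℂ) (y i' i)) (hy.mono fun i' hi' => hi'.2.1 i)
    obtain ⟨i', hi', _⟩ := hj.exists
    refine ⟨j, hi', tendsto_nhds_unique ((tendsto_pi_nhds.1 h1 j).congr' (hj.mono fun _ h => h.2))
      ((Complex.continuous_conj.tendsto _).comp (tendsto_pi_nhds.1 h1 i))⟩
  · rw [h4, eval_C]; rfl

/-- uniqueness: a convergent family of solutions is eventually the continuation -/
lemma LV_unique {t0 : ℝ} {ξ : ι → ℂ} {ψ : ℝ → ι → ℂ} {c0 : ℂ} (h0 : PhiLV D w (t0, (ξ, c0)) = 0)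
    (hψ : ∀ᶠ p in 𝓝 ((t0 : ℂ), (ξ, c0)), PhiLV D w p = 0 → ∀ r : ℝ, p.1 = r → ψ r = p.2.1)
    {I : Type*} (U : Ultrafilter I) (t : I → ℝ) 
    (ht : Tendsto t U (𝓝 t0)) (y : I → ι → ℂ) (hy : ∀ᶠ i in U, IsSol (D.path w (t i)) (y i))
    (hy0 : Tendsto y U (𝓝 ξ)) : ∀ᶠ i in U, y i = ψ (t i) := by
  have hc : ∀ i, ∃ c, IsSol (D.path w (t i)) (y i) → PhiLV D w (t i, (y i, c)) = 0 := by
    intro i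
    by_cases h : IsSol (D.path w (t i)) (y i)
    · obtain ⟨c, hc⟩ := sol_PhiLV w h
      exact ⟨c, fun _ => hc⟩
    · exact ⟨0, fun h' => absurd h' h⟩
  choose c hc using hc
  have hyj := tendsto_pi_nhds.1 hy0
  have htC : Tendsto (fun i => (t i : ℂ)) U (𝓝 (t0 : ℂ)) := (Complex.continuous_ofReal.tendsto _).comp ht
  have hcl : Tendsto c U (𝓝 c0) := by
    by_cases he : IsEmpty ι
    · have e : ∀ (p : ℂ) (q : ι → ℂ) c, PhiLV D w (p, (q, c)) = 0 → c = 0 := by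
        intro p q c h
        have := congrArg Prod.snd h
        simpa [PhiLV, he] using this
      rw [e _ _ _ h0]
      exact tendsto_const_nhds.congr' (hy.mono fun i hi => (e _ _ _ (hc i hi)).symm)
    · rw [not_isEmpty_iff] at he
      obtain ⟨j⟩ := he
      have e : ∀ (p : ℂ) (q : ι → ℂ) c, PhiLV D w (p, (q, c)) = 0 →
          D.u j + p * w j - (ad (C ((∑ j, D.a j + 1 : ℕ) : ℂ) * cp D.a q)).eval (q j) = c := by
        intro p q c h
        have := congrFun (congrArg Prod.fst h) j
        simp only [PhiLV, Prod.fst_zero, Pi.zero_apply, eval_add, eval_C] at this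
        linear_combination -this
      rw [← e _ _ _ h0]
      have hA : PT (U : Filter I) (fun i => ad (C ((∑ j, D.a j + 1 : ℕ) : ℂ) * cp D.a (y i))) _ :=
        ((PT.const (C ((∑ j, D.a j + 1 : ℕ) : ℂ))).mul (PT.cp D.a hyj)).ad
      have h1 : Tendsto (fun i => (D.u j + t i * w j - (ad (C ((∑ j, D.a j + 1 : ℕ) : ℂ) * cp D.a (y i))).eval (y i j) : ℂ)) U
        (𝓝 (D.u j + t0 * w j - (ad (C ((∑ j, D.a j + 1 : ℕ) : ℂ) * cp D.a ξ)).eval (ξ j))) :=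
        ((htC.mul_const _).const_add _).sub (hA.eval (hyj j))
      exact h1.congr' (hy.mono fun i hi => e _ _ _ (hc i hi))
  have hall : Tendsto (fun i => ((t i : ℂ), (y i, c i))) U (𝓝 ((t0 : ℂ), (ξ, c0))) :=
    htC.prodMk_nhds (hy0.prodMk_nhds hcl)
  filter_upwards [hall.eventually hψ, hy] with i hi hs
  exact (hi (hc i hs) (t i) rfl).symm

lemma sol_finite (hD : D.Good) : {ξ | IsSol D ξ}.Finite := by
  by_contra hinf
  have hinf' : Set.Infinite {ξ | IsSol D ξ} := hinf
  haveI : Infinite {ξ | IsSol D ξ} := hinf'.to_subtype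
  have hp : ∀ t, D.path (0 : ι → ℝ) t = D := fun t => by simp [LD.path]
  have hw : ∀ i j, D.rel i j → (0 : ι → ℝ) i = (0 : ι → ℝ) j := fun _ _ _ => rfl
  set U := hyperfilter {ξ | IsSol D ξ} with hU
  have hy : ∀ᶠ i : {ξ | IsSol D ξ} in U, IsSol (D.path (0 : ι → ℝ) 0) i.1 :=
    Eventually.of_forall fun i => by rw [hp]; exact i.2
  obtain ⟨y0, h1, h2⟩ := LV_compact (0 : ι → ℝ) hD hw U (fun _ => 0) 0 tendsto_const_nhds (fun i => i.1) hy
    (fun j k h => Eventually.of_forall fun _ => h)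
  obtain ⟨ψ, hψ1, hψ2, c0, h0, hψ⟩ := LV_cont (0 : ι → ℝ) hD hw 0 y0 h2
  have h3 := LV_unique (0 : ι → ℝ) h0 hψ U (fun _ => 0) tendsto_const_nhds (fun i => i.1) hy h1
  have h4 : {i : {ξ | IsSol D ξ} | i.1 = ψ 0}.Finite := by
    refine Set.Subsingleton.finite ?_
    intro a ha b hb
    exact Subtype.ext (ha.trans hb.symm)
  exact (notMem_hyperfilter_of_finite h4) h3

lemma LV_local (hD : D.Good) (hw : ∀ i j, D.rel i j → w i = w j) (T : Set ℝ)
    (hpat : ∀ t ∈ T, ∀ t' ∈ T, ∀ j k, (D.path w t).u j = (D.path w t).u k → (D.path w t').u j = (D.path w t').u k)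
    (t0 : ℝ) (ht0 : t0 ∈ T) : ∀ᶠ t in 𝓝[T] t0, SS (D.path w t) = SS (D.path w t0) := by
  haveI : Fintype {ξ | IsSol (D.path w t0) ξ} := (sol_finite (path_good w hD hw t0)).fintype
  have hc : ∀ z : {ξ | IsSol (D.path w t0) ξ}, _ := fun z => LV_cont w hD hw t0 z.1 z.2
  choose ψ hψ1 hψ2 c0 h0 hψ using hc
  have hle : 𝓝[T] t0 ≤ 𝓝 t0 := nhdsWithin_le_nhds
  have key := AL (𝓝[T] t0) (fun t => {ξ | IsSol (D.path w t) ξ}) (sg D) (fun z : {ξ | IsSol (D.path w t0) ξ} => sg D z.1)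
    ψ ?_ ?_ ?_
  · have e : SS (D.path w t0) = ∑ z : {ξ | IsSol (D.path w t0) ξ}, sg D z.1 := by
      unfold SS
      rw [← finsum_set_coe_eq_finsum_mem, finsum_eq_sum_of_fintype]
      rfl
    filter_upwards [key] with t ht
    rw [e, ← ht]; rfl
  · intro z
    have h1 := sg_ev hD (𝓝 t0) (ψ z) z.1 (tendsto_pi_nhds.1 (hψ1 z)) z.2.1 z.2.2.1
    filter_upwards [hle (hψ2 z), hle h1] with t h2 h3 using ⟨h2, h3⟩
  · intro z z' hzz
    have h1 : z.1 ≠ z'.1 := fun h => hzz (Subtype.ext h)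
    have h2 : ∃ j, z.1 j ≠ z'.1 j := Function.ne_iff.1 h1
    obtain ⟨j, hj⟩ := h2
    have h3 := ((tendsto_pi_nhds.1 (hψ1 z) j).sub (tendsto_pi_nhds.1 (hψ1 z') j)).eventually_ne (sub_ne_zero.2 hj)
    filter_upwards [hle h3] with t ht h
    rw [h, sub_self] at ht
    exact ht rfl
  · intro U hU y hy
    have hT : ∀ᶠ t in U, t ∈ T := hU self_mem_nhdsWithin
    obtain ⟨y0, h1, h2⟩ := LV_compact w hD hw U (fun t => t) t0 (hU.trans hle) y hy
      (fun j k h => hT.mono fun t ht => hpat t0 ht0 t ht j k h)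
    exact ⟨⟨y0, h2⟩, LV_unique w (h0 ⟨y0, h2⟩) (hψ ⟨y0, h2⟩) U (fun t => t) (hU.trans hle) y hy h1⟩

/-- Invariance under change of levels. -/
lemma LV (hD : D.Good) (D' : LD ι) (ha : D'.a = D.a) (hr : D'.rel = D.rel) (hk : D'.κ = D.κ)
    (hpat : ∀ i j, D.u i < D.u j ↔ D'.u i < D'.u j) : SS D' = SS D := by
  set w : ι → ℝ := fun j => D'.u j - D.u j with hw
  have heq : ∀ i j, D.u i = D.u j ↔ D'.u i = D'.u j := by
    intro i j
    have h1 := hpat i j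
    have h2 := hpat j i
    constructor
    · intro h
      rw [h] at h1 h2
      simp only [lt_irrefl, false_iff, not_lt] at h1 h2
      exact le_antisymm h2 h1
    · intro h
      rw [h] at h1 h2
      simp only [lt_irrefl, iff_false, not_lt] at h1 h2
      exact le_antisymm h2 h1
  have hw' : ∀ i j, D.rel i j → w i = w j := by
    intro i j h
    have h1 := hD.rel_u i j h
    simp [hw, h1, (heq i j).1 h1]
  have hp : ∀ t ∈ Set.Icc (0:ℝ) 1, ∀ j k, (D.path w t).u j = (D.path w t).u k ↔ D.u j = D.u k := by
    intro t ht j k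
    simp only [LD.path, hw]
    constructor
    · intro h
      by_contra hne
      rcases lt_or_gt_of_ne hne with h1 | h1
      · have h2 := (hpat _ _).1 h1
        nlinarith [ht.1, ht.2, mul_nonneg ht.1 (sub_nonneg.2 h2.le), mul_nonneg (sub_nonneg.2 ht.2) (sub_nonneg.2 h1.le)]
      · have h2 := (hpat _ _).1 h1
        nlinarith [ht.1, ht.2, mul_nonneg ht.1 (sub_nonneg.2 h2.le), mul_nonneg (sub_nonneg.2 ht.2) (sub_nonneg.2 h1.le)]
    · intro h
      rw [h, (heq j k).1 h]
  have hpat' : ∀ t ∈ Set.Icc (0:ℝ) 1, ∀ t' ∈ Set.Icc (0:ℝ) 1, ∀ j k, (D.path w t).u j = (D.path w t).u k → (D.path w t').u j = (D.path w t').u k :=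
    fun t ht t' ht' j k h => (hp t' ht' j k).2 ((hp t ht j k).1 h)
  have hconst := IsPreconnected.constant (s := Set.Icc (0:ℝ) 1) isPreconnected_Icc
    (f := fun t => SS (D.path w t)) ?_ (x := 1) (y := 0) (by simp) (by simp)
  · have e0 : D.path w 0 = D := by simp [LD.path]
    have e1 : D.path w 1 = D' := by
      cases D'
      simp only at ha hr hk
      simp only [LD.path, hw]
      subst ha hr hk
      congr 1
      ext j; simp
    rw [← e0, ← e1]; simpa [e0, e1] using hconst
  · intro t ht
    have := LV_local w hD hw' (Set.Icc 0 1) hpat' t ht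
    exact tendsto_const_nhds.congr' (this.mono fun _ h => h.symm)

end LVsec

end FO

open Polynomial
open scoped Classical
set_option linter.all false
namespace FO
open Filter Topology

/-! ## Relabelling -/

lemma cp_equiv {ι ι' : Type*} [Fintype ι] [Fintype ι'] (e : ι' ≃ ι) (a : ι → ℕ) (ξ : ι → ℂ) :
    cp (a ∘ e) (ξ ∘ e) = cp a ξ := by
  unfold cp
  exact Fintype.prod_equiv e _ _ fun j => rfl

lemma isSol_equiv {ι ι' : Type*} [Fintype ι] [Fintype ι'] (e : ι' ≃ ι) (D : LD ι) (ξ : ι → ℂ) :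
    IsSol (D.comap e) (ξ ∘ e) ↔ IsSol D ξ := by
  unfold IsSol
  have h1 : Function.Injective (ξ ∘ e) ↔ Function.Injective ξ := e.injective_comp ξ
  have h2 : Rl (D.comap e) (ξ ∘ e) ↔ Rl D ξ := by
    constructor
    · intro h i
      obtain ⟨j, hj1, hj2⟩ := h (e.symm i)
      refine ⟨e j, ?_, ?_⟩
      · simpa [LD.comap] using hj1
      · simpa using hj2
    · intro h i
      obtain ⟨j, hj1, hj2⟩ := h (e i)
      refine ⟨e.symm j, ?_, ?_⟩
      · simpa [LD.comap] using hj1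
      · simpa using hj2
  have h3 : ∑ j, ((D.comap e).a j : ℂ) * (ξ ∘ e) j = ∑ j, (D.a j : ℂ) * ξ j :=
    Fintype.sum_equiv e _ _ fun j => rfl
  have h4 : ∑ j, (D.comap e).a j = ∑ j, D.a j := Fintype.sum_equiv e _ _ fun j => rfl
  have h5 : cp (D.comap e).a (ξ ∘ e) = cp D.a ξ := cp_equiv e D.a ξ
  rw [h1, h2, h3, h4, h5]
  refine and_congr_right fun _ => and_congr_right fun _ => and_congr_right fun _ => exists_congr fun P =>
    and_congr_right fun _ => ?_
  exact ⟨fun h j => by simpa [LD.comap] using h (e.symm j), fun h j => h (e j)⟩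

lemma sg_equiv {ι ι' : Type*} [Fintype ι] [Fintype ι'] (e : ι' ≃ ι) (D : LD ι) (ξ : ι → ℂ) :
    sg (D.comap e) (ξ ∘ e) = sg D ξ := by
  unfold sg
  congr 1
  refine Fintype.sum_equiv e _ _ fun i => ?_
  exact Fintype.sum_equiv e _ _ fun j => rfl

lemma SS_equiv {ι ι' : Type*} [Fintype ι] [Fintype ι'] (e : ι' ≃ ι) (D : LD ι) :
    SS (D.comap e) = SS D := by
  unfold SS
  refine (finsum_mem_eq_of_bijOn (fun ξ => ξ ∘ e) ⟨?_, ?_, ?_⟩ ?_).symm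
  · intro ξ h; exact (isSol_equiv e D ξ).2 h
  · intro ξ _ ξ' _ h
    have : (ξ ∘ e) ∘ e.symm = (ξ' ∘ e) ∘ e.symm := congrArg (fun f => f ∘ e.symm) h
    simpa [Function.comp_assoc] using this
  · intro η h
    refine ⟨η ∘ e.symm, ?_, by simp [Function.comp_assoc]⟩
    rw [Set.mem_setOf_eq, ← isSol_equiv e]
    simpa [Function.comp_assoc] using h
  · intro ξ _; exact (sg_equiv e D ξ).symm

/-! ## Blocks -/

noncomputable def cpl {ι : Type*} [Fintype ι] (a : ι → ℕ) (σ : ℂ) (ζ : ι → ℂ) : ℂ[X] :=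
  ∏ j, (C σ * X - C (ζ j)) ^ (a j)

lemma cpl_comp {ι : Type*} [Fintype ι] (a : ι → ℕ) (σ : ℂ) (ζ : ι → ℂ) :
    cpl a σ ζ = (cp a ζ).comp (C σ * X) := by
  simp [cpl, cp, prod_comp]

lemma cpl_one {ι : Type*} [Fintype ι] (a : ι → ℕ) (ζ : ι → ℂ) : cpl a 1 ζ = cp a ζ := by
  simp [cpl, cp]

lemma cpl_zero {ι : Type*} [Fintype ι] (a : ι → ℕ) (b : ℂ) : cpl a 0 (fun _ => b) = C ((-b) ^ (∑ j, a j)) := by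
  simp [cpl, Finset.prod_pow_eq_pow_sum]

noncomputable def Blk {ι κ : Type*} [Fintype ι] [Fintype κ] (n σ γ : ℂ) (a' : κ → ℕ) (ζ : κ → ℂ) (a : ι → ℕ) (y : ι → ℂ) : ℂ[X] :=
  C n * (C σ * X - C γ) * cpl a' σ ζ * cp a y

lemma CP.blk {V : Type*} [NormedAddCommGroup V] [NormedSpace ℂ V] {ι κ : Type*} [Fintype ι] [Fintype κ] (n : ℂ) {σ γ : V → ℂ} (a' : κ → ℕ) {ζ : κ → V → ℂ} (a : ι → ℕ)
    {y : ι → V → ℂ} (hσ : ContDiff ℂ 1 σ) (hγ : ContDiff ℂ 1 γ) (hζ : ∀ j, ContDiff ℂ 1 (ζ j)) (hy : ∀ j, ContDiff ℂ 1 (y j)) :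
    CP (fun x => Blk n (σ x) (γ x) a' (fun j => ζ j x) a (fun j => y j x)) := by
  unfold Blk cpl
  refine (((CP.const _).mul (((CP.C hσ).mul (CP.const X)).sub (CP.C hγ))).mul (CP.prod _ fun j _ => ?_)).mul (CP.cp a hy)
  exact (((CP.C hσ).mul (CP.const X)).sub (CP.C (hζ j))).pow _

lemma PT.blk {I : Type*} {l : Filter I} {ι κ : Type*} [Fintype ι] [Fintype κ] (n : ℂ) {σ γ : I → ℂ} {σ0 γ0 : ℂ} (a' : κ → ℕ) {ζ : I → κ → ℂ} {ζ0 : κ → ℂ} (a : ι → ℕ)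
    {y : I → ι → ℂ} {y0 : ι → ℂ} (hσ : Tendsto σ l (𝓝 σ0)) (hγ : Tendsto γ l (𝓝 γ0)) (hζ : ∀ j, Tendsto (fun i => ζ i j) l (𝓝 (ζ0 j)))
    (hy : ∀ j, Tendsto (fun i => y i j) l (𝓝 (y0 j))) :
    PT l (fun x => Blk n (σ x) (γ x) a' (ζ x) a (y x)) (Blk n σ0 γ0 a' ζ0 a y0) := by
  unfold Blk cpl
  refine (((PT.const _).mul (((PT.C hσ).mul (PT.const X)).sub (PT.C hγ))).mul (PT.prod _ fun j _ => ?_)).mul (PT.cp a hy)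
  exact (((PT.C hσ).mul (PT.const X)).sub (PT.C (hζ j))).pow _

lemma blk_map {ι κ : Type*} [Fintype ι] [Fintype κ] (n σ γ : ℂ) (a' : κ → ℕ) (ζ : κ → ℂ) (a : ι → ℕ) (y : ι → ℂ) :
    (Blk n σ γ a' ζ a y).map (starRingEnd ℂ) = Blk ((starRingEnd ℂ) n) ((starRingEnd ℂ) σ) ((starRingEnd ℂ) γ) a'
      (fun j => (starRingEnd ℂ) (ζ j)) a (fun j => (starRingEnd ℂ) (y j)) := by
  unfold Blk cpl
  rw [Polynomial.map_mul, cp_map]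
  simp [Polynomial.map_prod]

lemma cpl_perm {ι : Type*} [Fintype ι] (a : ι → ℕ) (σ : ℂ) (y : ι → ℂ) (s : ι → ι) (hs : Function.Involutive s)
    (ha : ∀ j, a (s j) = a j) : cpl a σ (fun j => y (s j)) = cpl a σ y := by
  rw [cpl_comp, cpl_comp, cp_perm a y s hs ha]

lemma blk_perm {ι κ : Type*} [Fintype ι] [Fintype κ] (n σ γ : ℂ) (a' : κ → ℕ) (ζ : κ → ℂ) (a : ι → ℕ) (y : ι → ℂ)
    (s' : κ → κ) (hs' : Function.Involutive s') (ha' : ∀ j, a' (s' j) = a' j)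
    (s : ι → ι) (hs : Function.Involutive s) (ha : ∀ j, a (s j) = a j) :
    Blk n σ γ a' (fun j => ζ (s' j)) a (fun j => y (s j)) = Blk n σ γ a' ζ a y := by
  unfold Blk
  rw [cpl_perm a' σ ζ s' hs' ha', cp_perm a y s hs ha]

/-! ## The two-block system -/

section cut
variable {L R : Type} [Fintype L] [Fintype R] (aL : L → ℕ) (aR : R → ℕ) (uL : L → ℝ) (uR : R → ℝ)

noncomputable def BL (τ γ : ℂ) (y : L → ℂ) (z : R → ℂ) : ℂ[X] :=
  Blk ((∑ j, aL j + 1 + (∑ j, aR j + 1) : ℕ) : ℂ) (τ ^ (∑ j, aR j + 1)) γ aR (fun j => 1 + τ ^ (∑ j, aL j + 1) * z j) aL y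

noncomputable def BR (τ γ : ℂ) (y : L → ℂ) (z : R → ℂ) : ℂ[X] :=
  Blk ((∑ j, aL j + 1 + (∑ j, aR j + 1) : ℕ) : ℂ) (τ ^ (∑ j, aL j + 1)) (γ - 1) aL (fun j => τ ^ (∑ j, aR j + 1) * y j - 1) aR z

noncomputable def BK (τ γ : ℂ) (y : L → ℂ) (z : R → ℂ) : ℂ[X] :=
  Blk ((∑ j, aL j + 1 + (∑ j, aR j + 1) : ℕ) : ℂ) 1 γ aR (fun j => 1 + τ ^ (∑ j, aL j + 1) * z j) aL
    (fun j => τ ^ (∑ j, aR j + 1) * y j)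

abbrev EE (L R : Type) [Fintype L] [Fintype R] := ((L → ℂ) × ℂ) × ((R → ℂ) × ℂ) × (ℂ × ℂ)

noncomputable def eL (τ γ : ℂ) (y : L → ℂ) (z : R → ℂ) (c : ℂ) : L → ℂ :=
  fun j => (C c + ad (BL aL aR τ γ y z)).eval (y j) - uL j
noncomputable def eR (τ γ : ℂ) (y : L → ℂ) (z : R → ℂ) (c : ℂ) : R → ℂ :=
  fun j => (C c + ad (BR aL aR τ γ y z)).eval (z j) - uR j
noncomputable def eS {ι : Type} [Fintype ι] (a : ι → ℕ) (y : ι → ℂ) (c : ℂ) : ℂ :=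
  ∑ j, (a j : ℂ) * y j + if IsEmpty ι then c else 0
noncomputable def eC (τ γ : ℂ) (y : L → ℂ) (z : R → ℂ) (cL cR : ℂ) : ℂ :=
  if IsEmpty L then ((∑ j, aL j + 1 + (∑ j, aR j + 1) : ℕ) : ℂ) * γ - (∑ j, aL j + 1 : ℕ) else
  (ad (BK aL aR τ γ y z)).eval 1 - τ ^ ((∑ j, aL j + 1) * (∑ j, aR j + 1)) * (cR - cL)
noncomputable def eT (τ γ θ : ℂ) (y : L → ℂ) (z : R → ℂ) (cR : ℂ) : ℂ :=
  τ ^ ((∑ j, aL j + 1) * (∑ j, aR j + 1)) * cR + (ad (BK aL aR τ γ y z)).eval γ - (ad (BK aL aR τ γ y z)).eval 1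
    - θ ^ ((∑ j, aL j + 1) * (∑ j, aR j + 1))

noncomputable def Phi (p : ℂ × EE L R) : EE L R :=
  ((eL aL aR uL (p.1 * p.2.2.2.2) p.2.2.2.1 p.2.1.1 p.2.2.1.1 p.2.1.2, eS aL p.2.1.1 p.2.1.2),
   (eR aL aR uR (p.1 * p.2.2.2.2) p.2.2.2.1 p.2.1.1 p.2.2.1.1 p.2.2.1.2, eS aR p.2.2.1.1 p.2.2.1.2),
   (eC aL aR (p.1 * p.2.2.2.2) p.2.2.2.1 p.2.1.1 p.2.2.1.1 p.2.1.2 p.2.2.1.2,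
    eT aL aR (p.1 * p.2.2.2.2) p.2.2.2.1 p.2.2.2.2 p.2.1.1 p.2.2.1.1 p.2.2.1.2))

lemma Phi_smooth : ContDiff ℂ 1 (Phi aL aR uL uR) := by
  have hτ : ContDiff ℂ 1 (fun p : ℂ × EE L R => p.1 * p.2.2.2.2) := by fun_prop
  have hτk : ∀ k : ℕ, ContDiff ℂ 1 (fun p : ℂ × EE L R => (p.1 * p.2.2.2.2) ^ k) := fun k => hτ.pow k
  have hγ : ContDiff ℂ 1 (fun p : ℂ × EE L R => p.2.2.2.1) := by fun_prop
  have hθ : ContDiff ℂ 1 (fun p : ℂ × EE L R => p.2.2.2.2) := by fun_prop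
  have hcL : ContDiff ℂ 1 (fun p : ℂ × EE L R => p.2.1.2) := by fun_prop
  have hcR : ContDiff ℂ 1 (fun p : ℂ × EE L R => p.2.2.1.2) := by fun_prop
  have hy : ∀ j, ContDiff ℂ 1 (fun p : ℂ × EE L R => p.2.1.1 j) := fun j => by fun_prop
  have hz : ∀ j, ContDiff ℂ 1 (fun p : ℂ × EE L R => p.2.2.1.1 j) := fun j => by fun_prop
  have hBL : CP (fun p : ℂ × EE L R => BL aL aR (p.1 * p.2.2.2.2) p.2.2.2.1 p.2.1.1 p.2.2.1.1) :=
    CP.blk _ aR aL (hτk _) hγ (fun j => contDiff_const.add ((hτk _).mul (hz j))) hy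
  have hBR : CP (fun p : ℂ × EE L R => BR aL aR (p.1 * p.2.2.2.2) p.2.2.2.1 p.2.1.1 p.2.2.1.1) :=
    CP.blk _ aL aR (hτk _) (hγ.sub contDiff_const) (fun j => ((hτk _).mul (hy j)).sub contDiff_const) hz
  have hBK : CP (fun p : ℂ × EE L R => BK aL aR (p.1 * p.2.2.2.2) p.2.2.2.1 p.2.1.1 p.2.2.1.1) :=
    CP.blk _ aR aL contDiff_const hγ (fun j => contDiff_const.add ((hτk _).mul (hz j))) (fun j => (hτk _).mul (hy j))
  have hS : ∀ {ι : Type} [Fintype ι] (a : ι → ℕ) (y : ι → ℂ × EE L R → ℂ) (c : ℂ × EE L R → ℂ),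
      (∀ j, ContDiff ℂ 1 (y j)) → ContDiff ℂ 1 c → ContDiff ℂ 1 (fun p => eS a (fun j => y j p) (c p)) := by
    intro ι _ a y c h1 h2
    unfold eS
    refine ContDiff.add (ContDiff.sum fun j _ => contDiff_const.mul (h1 j)) ?_
    split_ifs
    · exact h2
    · exact contDiff_const
  unfold Phi
  refine ContDiff.prodMk (ContDiff.prodMk (contDiff_pi.2 fun j => ?_) (hS aL (fun j p => p.2.1.1 j) _ hy hcL)) (ContDiff.prodMk (ContDiff.prodMk (contDiff_pi.2 fun j => ?_) (hS aR (fun j p => p.2.2.1.1 j) _ hz hcR)) (ContDiff.prodMk ?_ ?_))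
  · exact (((CP.C hcL).add hBL.ad).eval (hy j)).sub contDiff_const
  · exact (((CP.C hcR).add hBR.ad).eval (hz j)).sub contDiff_const
  · unfold eC
    split_ifs
    · exact (contDiff_const.mul hγ).sub contDiff_const
    · exact (hBK.ad.eval contDiff_const).sub ((hτk _).mul (hcR.sub hcL))
  · unfold eT
    exact ((((hτk _).mul hcR).add (hBK.ad.eval hγ)).sub (hBK.ad.eval contDiff_const)).sub (hθ.pow _)

lemma ad_add (p q : ℂ[X]) : ad (p + q) = ad p + ad q := by
  ext k
  rcases k with _ | k
  · simp [coeff_ad_zero]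
  · simp [coeff_ad, add_div]

lemma ad_C_mul (c : ℂ) (p : ℂ[X]) : ad (C c * p) = C c * ad p := by
  ext k
  rcases k with _ | k
  · simp [coeff_ad_zero]
  · simp [coeff_ad, mul_div_assoc]

lemma ad_eval_zero (p : ℂ[X]) : (ad p).eval 0 = 0 := by
  rw [← coeff_zero_eq_eval_zero, coeff_ad_zero]

lemma BL_zero (γ : ℂ) (y : L → ℂ) (z : R → ℂ) : BL aL aR 0 γ y z =
    C (((∑ j, aL j + 1 + (∑ j, aR j + 1) : ℕ) : ℂ) * (-γ) * (-1) ^ (∑ j, aR j)) * cp aL y := by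
  unfold BL Blk
  rw [zero_pow (Nat.succ_ne_zero _), zero_pow (Nat.succ_ne_zero _)]
  simp only [zero_mul, add_zero]
  rw [cpl_zero]
  simp only [map_zero, zero_mul, zero_sub, map_mul, map_neg]

lemma BR_zero (γ : ℂ) (y : L → ℂ) (z : R → ℂ) : BR aL aR 0 γ y z =
    C (((∑ j, aL j + 1 + (∑ j, aR j + 1) : ℕ) : ℂ) * (1 - γ)) * cp aR z := by
  unfold BR Blk
  rw [zero_pow (Nat.succ_ne_zero _), zero_pow (Nat.succ_ne_zero _)]
  simp only [zero_mul, zero_sub]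
  rw [cpl_zero]
  simp only [map_zero, zero_mul, zero_sub, map_mul, map_sub, neg_neg, one_pow, map_one, neg_sub]
  ring

lemma BK_zero (γ : ℂ) (y : L → ℂ) (z : R → ℂ) : BK aL aR 0 γ y z =
    C ((∑ j, aL j + 1 + (∑ j, aR j + 1) : ℕ) : ℂ) * (X - C γ) * ((X - C 1) ^ (∑ j, aR j) * X ^ (∑ j, aL j)) := by
  unfold BK Blk
  rw [zero_pow (Nat.succ_ne_zero _), zero_pow (Nat.succ_ne_zero _), cpl_one]
  simp only [zero_mul, add_zero, cp, Finset.prod_pow_eq_pow_sum, map_one, one_mul, map_zero, sub_zero]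
  ring

lemma beta_ne (p q : ℕ) (hp : p ≠ 0) (hq : q ≠ 0) :
    (ad ((X - C 1) ^ q * X ^ p : ℂ[X])).eval 1 ≠ 0 := by
  intro h
  have := one_lem (ι := Bool) (fun b => if b then p else q) (fun b => if b then 0 else 1)
    (by intro j; cases j <;> simp <;> omega) 1 one_ne_zero (ad ((X - C 1) ^ q * X ^ p)) (by
      rw [derivative_ad]; simp [cp]; ring) (by
      have h' : eval 1 (ad ((X - 1) ^ q * X ^ p : ℂ[X])) = 0 := by simpa using h
      intro j k
      cases j <;> cases k <;> simp [h', ad_eval_zero]) true false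
  simp at this

lemma K0_deriv (p q : ℕ) (γ : ℂ) (hγ : ((p + 1 + (q + 1) : ℕ) : ℂ) * γ = (p + 1 : ℕ)) :
    derivative (X ^ (p + 1) * (X - C 1) ^ (q + 1) : ℂ[X]) =
      C ((p + 1 + (q + 1) : ℕ) : ℂ) * (X - C γ) * ((X - C 1) ^ q * X ^ p) := by
  have e : C ((p + 1 + (q + 1) : ℕ) : ℂ) * (X - C γ) = C ((p + 1 + (q + 1) : ℕ) : ℂ) * X - C ((p + 1 : ℕ) : ℂ) := by
    rw [mul_sub, ← C_mul, hγ]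
  rw [e, derivative_mul, derivative_X_pow, derivative_X_sub_C_pow]
  simp only [Nat.add_sub_cancel, Nat.cast_add, Nat.cast_one, map_add, map_one, map_natCast]
  ring

lemma eT_zero (γ θ : ℂ) (y : L → ℂ) (z : R → ℂ) (c : ℂ) (hγ : ((∑ j, aL j + 1 + (∑ j, aR j + 1) : ℕ) : ℂ) * γ = (∑ j, aL j + 1 : ℕ)) :
    eT aL aR 0 γ θ y z c = γ ^ (∑ j, aL j + 1) * (γ - 1) ^ (∑ j, aR j + 1) - θ ^ ((∑ j, aL j + 1) * (∑ j, aR j + 1)) := by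
  unfold eT
  rw [zero_pow (mul_ne_zero (Nat.succ_ne_zero _) (Nat.succ_ne_zero _)), zero_mul, zero_add, BK_zero,
    eval_sub_eq (q := X ^ (∑ j, aL j + 1) * (X - C 1) ^ (∑ j, aR j + 1)) (by rw [derivative_ad, K0_deriv _ _ _ hγ])]
  simp

lemma eC_zero (γ : ℂ) (y : L → ℂ) (z : R → ℂ) (c c' : ℂ) (hγ : ((∑ j, aL j + 1 + (∑ j, aR j + 1) : ℕ) : ℂ) * γ = (∑ j, aL j + 1 : ℕ))
    (haL : ∀ j, 1 ≤ aL j) :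
    eC aL aR 0 γ y z c c' = 0 := by
  unfold eC
  split_ifs with h
  · rw [hγ, sub_self]
  · rw [zero_pow (mul_ne_zero (Nat.succ_ne_zero _) (Nat.succ_ne_zero _)), zero_mul, sub_zero, BK_zero]
    have := eval_sub_eq (p := ad (C ((∑ j, aL j + 1 + (∑ j, aR j + 1) : ℕ) : ℂ) * (X - C γ) * ((X - C 1) ^ (∑ j, aR j) * X ^ (∑ j, aL j))))
      (q := X ^ (∑ j, aL j + 1) * (X - C 1) ^ (∑ j, aR j + 1)) (by rw [derivative_ad, K0_deriv _ _ _ hγ]) 1 0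
    rw [ad_eval_zero, sub_zero] at this
    rw [this]; simp

lemma Phi_ker (haL : ∀ j, 1 ≤ aL j) (haR : ∀ j, 1 ≤ aR j) (hR : Nonempty R) (y : L → ℂ) (z : R → ℂ) (cL cR γ θ : ℂ)
    (hy : Function.Injective y) (hz : Function.Injective z) (hγ : ((∑ j, aL j + 1 + (∑ j, aR j + 1) : ℕ) : ℂ) * γ = (∑ j, aL j + 1 : ℕ))
    (hθ : θ ≠ 0) (v : EE L R)
    (hv : HasDerivAt (fun ε : ℂ => Phi aL aR uL uR (0, ((y, cL), (z, cR), (γ, θ)) + ε • v)) 0 0) : v = 0 := by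
  obtain ⟨⟨vy, vc⟩, ⟨vz, vd⟩, ⟨vγ, vθ⟩⟩ := v
  have hn : ((∑ j, aL j + 1 + (∑ j, aR j + 1) : ℕ) : ℂ) ≠ 0 := Nat.cast_ne_zero.2 (by omega)
  have hR0 : ∑ j, aR j ≠ 0 := by
    obtain ⟨j⟩ := hR
    have := Finset.single_le_sum (f := aR) (fun i _ => Nat.zero_le _) (Finset.mem_univ j)
    have := haR j
    omega
  have hcomp : ∀ ε : ℂ, Phi aL aR uL uR (0, ((y, cL), (z, cR), (γ, θ)) + ε • (((vy, vc), (vz, vd), (vγ, vθ)) : EE L R)) =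
    ((eL aL aR uL 0 (γ + ε * vγ) (y + ε • vy) (z + ε • vz) (cL + ε * vc), eS aL (y + ε • vy) (cL + ε * vc)),
     (eR aL aR uR 0 (γ + ε * vγ) (y + ε • vy) (z + ε • vz) (cR + ε * vd), eS aR (z + ε • vz) (cR + ε * vd)),
     (eC aL aR 0 (γ + ε * vγ) (y + ε • vy) (z + ε • vz) (cL + ε * vc) (cR + ε * vd),
      eT aL aR 0 (γ + ε * vγ) (θ + ε * vθ) (y + ε • vy) (z + ε • vz) (cR + ε * vd))) := by
    intro ε
    simp only [Phi, zero_mul, Prod.mk_add_mk, Prod.smul_mk, smul_eq_mul]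
  simp only [hcomp] at hv
  have hC := hv.snd.snd.fst
  have hT := hv.snd.snd.snd
  have hL1 := hasDerivAt_pi.1 hv.fst.fst
  have hL2 := hv.fst.snd
  have hR1 := hasDerivAt_pi.1 hv.snd.fst.fst
  have hR2 := hv.snd.fst.snd
  simp only [Prod.fst_zero, Prod.snd_zero] at hC hT hL1 hL2 hR1 hR2
  have hid : HasDerivAt (fun ε : ℂ => γ + ε * vγ) vγ 0 := by
    simpa using ((hasDerivAt_id (0:ℂ)).mul_const vγ).const_add γ
  have hidθ : HasDerivAt (fun ε : ℂ => θ + ε * vθ) vθ 0 := by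
    simpa using ((hasDerivAt_id (0:ℂ)).mul_const vθ).const_add θ
  have h1 : vγ = 0 := by
    unfold eC at hC
    split_ifs at hC with hE
    · have := ((hid.const_mul ((∑ j, aL j + 1 + (∑ j, aR j + 1) : ℕ) : ℂ)).sub_const ((∑ j, aL j + 1 : ℕ) : ℂ)).unique hC
      exact (mul_eq_zero.1 this).resolve_left hn
    · rw [not_isEmpty_iff] at hE
      have hL0 : ∑ j, aL j ≠ 0 := by
        obtain ⟨j⟩ := hE
        have := Finset.single_le_sum (f := aL) (fun i _ => Nat.zero_le _) (Finset.mem_univ j)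
        have := haL j
        omega
      have hB := beta_ne _ _ hL0 hR0
      set M : ℂ[X] := (X - C 1) ^ (∑ j, aR j) * X ^ (∑ j, aL j) with hM
      have e : ∀ γ' : ℂ, ad (C ((∑ j, aL j + 1 + (∑ j, aR j + 1) : ℕ) : ℂ) * (X - C γ') * M) =
          C ((∑ j, aL j + 1 + (∑ j, aR j + 1) : ℕ) : ℂ) * ad (X * M) + C (((∑ j, aL j + 1 + (∑ j, aR j + 1) : ℕ) : ℂ) * -γ') * ad M := by
        intro γ'
        rw [← ad_C_mul, ← ad_C_mul, ← ad_add, C_mul, C_neg]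
        congr 1
        ring
      simp only [BK_zero, ← hM, e, zero_pow (mul_ne_zero (Nat.succ_ne_zero (∑ j, aL j)) (Nat.succ_ne_zero (∑ j, aR j))), zero_mul, sub_zero, eval_add, eval_mul, eval_C] at hC
      have := (((hid.fun_neg.const_mul ((∑ j, aL j + 1 + (∑ j, aR j + 1) : ℕ) : ℂ)).mul_const ((ad M).eval 1)).const_add (((∑ j, aL j + 1 + (∑ j, aR j + 1) : ℕ) : ℂ) * (ad (X * M)).eval 1)).unique hC
      rcases mul_eq_zero.1 this with h | h
      · rcases mul_eq_zero.1 h with h | h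
        · exact absurd h hn
        · exact neg_eq_zero.1 h
      · exact absurd h hB
  subst h1
  simp only [mul_zero, add_zero] at hT hL1 hR1
  have h2 : vθ = 0 := by
    simp only [eT_zero aL aR γ _ _ _ _ hγ] at hT
    have := ((hidθ.fun_pow ((∑ j, aL j + 1) * (∑ j, aR j + 1))).const_sub (γ ^ (∑ j, aL j + 1) * (γ - 1) ^ (∑ j, aR j + 1))).unique hT
    have := neg_eq_zero.1 this
    rw [zero_mul, add_zero] at this
    rcases mul_eq_zero.1 this with h | h
    · rcases mul_eq_zero.1 h with h | h
      · exact absurd h (Nat.cast_ne_zero.2 (mul_ne_zero (Nat.succ_ne_zero _) (Nat.succ_ne_zero _)))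
      exact absurd h (pow_ne_zero _ hθ)
    · exact h
  have hl : ((∑ j, aL j + 1 : ℕ) : ℂ) ≠ 0 := Nat.cast_ne_zero.2 (by omega)
  have hr : ((∑ j, aR j + 1 : ℕ) : ℂ) ≠ 0 := Nat.cast_ne_zero.2 (by omega)
  have hγ0 : γ ≠ 0 := by rintro rfl; rw [mul_zero] at hγ; exact hl hγ.symm
  have hγ1 : 1 - γ ≠ 0 := by
    intro h
    rw [← sub_eq_zero.1 h] at hγ
    apply hr
    push_cast at hγ ⊢
    linear_combination hγ
  have h3 := BLOCK aL haL y vy hy (((∑ j, aL j + 1 + (∑ j, aR j + 1) : ℕ) : ℂ) * (-γ) * (-1) ^ (∑ j, aR j)) cL vc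
    (mul_ne_zero (mul_ne_zero hn (neg_ne_zero.2 hγ0)) (pow_ne_zero _ (by norm_num))) (by
      intro j w
      have h := (hL1 j).sub_const (w - uL j)
      refine h.congr_of_eventuallyEq (Eventually.of_forall fun ε => ?_)
      simp only [eL, BL_zero, Pi.add_apply, Pi.smul_apply, smul_eq_mul]
      ring) hL2
  have h4 := BLOCK aR haR z vz hz (((∑ j, aL j + 1 + (∑ j, aR j + 1) : ℕ) : ℂ) * (1 - γ)) cR vd
    (mul_ne_zero hn hγ1) (by
      intro j w
      have h := (hR1 j).sub_const (w - uR j)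
      refine h.congr_of_eventuallyEq (Eventually.of_forall fun ε => ?_)
      simp only [eR, BR_zero, Pi.add_apply, Pi.smul_apply, smul_eq_mul]
      ring) hR2
  rw [h2, h3.1, h3.2, h4.1, h4.2]
  rfl

/-- conjugation symmetry of the system -/
noncomputable def JJ (s : L → L) (t : R → R) (x : EE L R) : EE L R :=
  ((Jb s x.1.1, (starRingEnd ℂ) x.1.2), (Jb t x.2.1.1, (starRingEnd ℂ) x.2.1.2), ((starRingEnd ℂ) x.2.2.1, (starRingEnd ℂ) x.2.2.2))

lemma JJ_cont (s : L → L) (t : R → R) : Continuous (JJ s t) := by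
  unfold JJ
  have h1 := Jb_cont s
  have h2 := Jb_cont t
  have h3 := Complex.continuous_conj
  fun_prop

lemma eval_conj' (p q : ℂ[X]) (x : ℂ) (h : q = p.map (starRingEnd ℂ)) (z : ℂ) (hz : z = (starRingEnd ℂ) x) : q.eval z = (starRingEnd ℂ) (p.eval x) := by
  rw [h, hz, eval_conj]

lemma Jb_def {ι : Type} (s : ι → ι) (y : ι → ℂ) : Jb s y = fun j => (starRingEnd ℂ) (y (s j)) := rfl

lemma Phi_conj (s : L → L) (t : R → R) (hs : Function.Involutive s) (ht : Function.Involutive t)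
    (has : ∀ j, aL (s j) = aL j) (hat : ∀ j, aR (t j) = aR j) (hus : ∀ j, uL (s j) = uL j) (hut : ∀ j, uR (t j) = uR j)
    (r : ℝ) (x : EE L R) (h : Phi aL aR uL uR (r, x) = 0) : Phi aL aR uL uR (r, JJ s t x) = 0 := by
  obtain ⟨⟨y, cL⟩, ⟨z, cR⟩, ⟨γ, θ⟩⟩ := x
  simp only [Phi, JJ, Prod.mk_eq_zero] at h ⊢
  set τ : ℂ := r * θ with hτ
  have hτc : (r : ℂ) * (starRingEnd ℂ) θ = (starRingEnd ℂ) τ := by simp [hτ]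
  rw [hτc]
  obtain ⟨⟨h1, h2⟩, ⟨h3, h4⟩, h5, h6⟩ := h
  have eBL : BL aL aR ((starRingEnd ℂ) τ) ((starRingEnd ℂ) γ) (Jb s y) (Jb t z) = (BL aL aR τ γ y z).map (starRingEnd ℂ) := by
    unfold BL
    rw [blk_map, ← blk_perm _ _ _ aR _ aL _ t ht hat s hs has]
    simp only [Jb_def, map_natCast, map_pow, map_add, map_sub, map_mul, map_one, hs _, ht _]
  have eBR : BR aL aR ((starRingEnd ℂ) τ) ((starRingEnd ℂ) γ) (Jb s y) (Jb t z) = (BR aL aR τ γ y z).map (starRingEnd ℂ) := by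
    unfold BR
    rw [blk_map, ← blk_perm _ _ _ aL _ aR _ s hs has t ht hat]
    simp only [Jb_def, map_natCast, map_pow, map_add, map_sub, map_mul, map_one, hs _, ht _]
  have eBK : BK aL aR ((starRingEnd ℂ) τ) ((starRingEnd ℂ) γ) (Jb s y) (Jb t z) = (BK aL aR τ γ y z).map (starRingEnd ℂ) := by
    unfold BK
    rw [blk_map, ← blk_perm _ _ _ aR _ aL _ t ht hat s hs has]
    simp only [Jb_def, map_natCast, map_pow, map_add, map_sub, map_mul, map_one, hs _, ht _]
  have hS : ∀ {ι : Type} [Fintype ι] (a : ι → ℕ) (s : ι → ι) (hs : Function.Involutive s) (ha : ∀ j, a (s j) = a j) (y : ι → ℂ) (c : ℂ),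
      eS a y c = 0 → eS a (Jb s y) ((starRingEnd ℂ) c) = 0 := by
    intro ι _ a s hs ha y c h
    unfold eS at h ⊢
    rw [Jb_sum a y s hs ha]
    have := congrArg (starRingEnd ℂ) h
    split_ifs with he
    · simpa [he] using this
    · simpa [he] using this
  refine ⟨⟨?_, hS aL s hs has _ _ h2⟩, ⟨?_, hS aR t ht hat _ _ h4⟩, ?_, ?_⟩
  · ext j
    have := congrArg (starRingEnd ℂ) (congrFun h1 (s j))
    simp only [eL, eBL, ← ad_map, Pi.zero_apply] at this ⊢
    rw [eval_conj' (C cL + ad (BL aL aR τ γ y z)) (C ((starRingEnd ℂ) cL) + Polynomial.map (starRingEnd ℂ) (ad (BL aL aR τ γ y z))) (y (s j)) (by simp) (Jb s y j) rfl]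
    simpa [hus] using this
  · ext j
    have := congrArg (starRingEnd ℂ) (congrFun h3 (t j))
    simp only [eR, eBR, ← ad_map, Pi.zero_apply] at this ⊢
    rw [eval_conj' (C cR + ad (BR aL aR τ γ y z)) (C ((starRingEnd ℂ) cR) + Polynomial.map (starRingEnd ℂ) (ad (BR aL aR τ γ y z))) (z (t j)) (by simp) (Jb t z j) rfl]
    simpa [hut] using this
  · have := congrArg (starRingEnd ℂ) h5
    unfold eC at this ⊢
    rw [eBK, ← ad_map, eval_conj' (ad (BK aL aR τ γ y z)) _ 1 rfl _ (by simp)]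
    split_ifs at this ⊢ with he
    · simpa using this
    · simpa using this
  · have := congrArg (starRingEnd ℂ) h6
    unfold eT at this ⊢
    rw [eBK, ← ad_map, eval_conj' (ad (BK aL aR τ γ y z)) _ 1 rfl 1 (by simp), eval_conj' (ad (BK aL aR τ γ y z)) _ γ rfl _ rfl]
    simpa using this

end cut

end FO

open Polynomial
open scoped Classical
set_option linter.all false
namespace FO
open Filter Topology

/-! ## Two-block assembly and link -/

section cut2
variable {L R : Type} [Fintype L] [Fintype R] (aL : L → ℕ) (aR : R → ℕ) (uL : L → ℝ) (uR : R → ℝ)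

def aO : Option (L ⊕ R) → ℕ
  | none => 1
  | some (Sum.inl i) => aL i
  | some (Sum.inr j) => aR j

noncomputable def asm (w μ τ γ : ℂ) (y : L → ℂ) (z : R → ℂ) : Option (L ⊕ R) → ℂ
  | none => w * (γ - μ)
  | some (Sum.inl i) => w * (τ ^ (∑ j, aR j + 1) * y i - μ)
  | some (Sum.inr j) => w * (1 + τ ^ (∑ j, aL j + 1) * z j - μ)

lemma aO_sum : ∑ j, aO aL aR j + 1 = ∑ j, aL j + 1 + (∑ j, aR j + 1) := by
  simp [Fintype.sum_option, aO]; ring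

lemma asm_cp (w μ τ γ : ℂ) (y : L → ℂ) (z : R → ℂ) (q : ℂ[X]) :
    (cp (aO aL aR) (asm aL aR w μ τ γ y z)).comp (C w * (q - C μ)) =
      C (w ^ (∑ j, aL j + ∑ j, aR j + 1)) * (q - C γ) * (∏ j, (q - C (τ ^ (∑ j, aR j + 1) * y j)) ^ aL j) *
       ∏ j, (q - C (1 + τ ^ (∑ j, aL j + 1) * z j)) ^ aR j := by
  have e : ∀ x : ℂ, C w * (q - C μ) - C (w * (x - μ)) = C w * (q - C x) := by
    intro x; simp only [map_mul, map_sub]; ring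
  simp only [cp, Fintype.prod_option, Fintype.prod_sum_type, aO, asm, mul_comp, prod_comp, pow_comp, sub_comp, X_comp, C_comp,
    e]
  simp only [mul_pow, Finset.prod_mul_distrib, Finset.prod_pow_eq_pow_sum, pow_one]
  rw [C_pow, pow_add, pow_add]
  ring

lemma asm_K (w μ τ γ : ℂ) (y : L → ℂ) (z : R → ℂ) (P : ℂ[X]) 
    (hw : w ^ (∑ j, aL j + 1 + (∑ j, aR j + 1)) * τ ^ ((∑ j, aL j + 1) * (∑ j, aR j + 1)) = 1)
    (hP : derivative P = C ((∑ j, aL j + 1 + (∑ j, aR j + 1) : ℕ) : ℂ) * cp (aO aL aR) (asm aL aR w μ τ γ y z)) :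
    derivative (C (τ ^ ((∑ j, aL j + 1) * (∑ j, aR j + 1))) * P.comp (C w * (X - C μ))) = BK aL aR τ γ y z := by
  rw [derivative_mul, derivative_C, zero_mul, zero_add, derivative_comp, hP, mul_comp, asm_cp, C_comp, BK, Blk, cpl_one]
  have e : derivative (C w * (X - C μ)) = C w := by simp
  have hw' := congrArg (C : ℂ → ℂ[X]) hw
  simp only [map_mul, map_pow, map_one] at hw'
  rw [e, C_pow, C_pow]
  simp only [cp, map_one, one_mul]
  linear_combination (C ((∑ j, aL j + 1 + (∑ j, aR j + 1) : ℕ) : ℂ) * (X - C γ) * (∏ j, (X - C (τ ^ (∑ j, aR j + 1) * y j)) ^ aL j) *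
       ∏ j, (X - C (1 + τ ^ (∑ j, aL j + 1) * z j)) ^ aR j) * hw'

lemma asm_L (w μ τ γ : ℂ) (y : L → ℂ) (z : R → ℂ) (P : ℂ[X]) 
    (hw : w ^ (∑ j, aL j + 1 + (∑ j, aR j + 1)) * τ ^ ((∑ j, aL j + 1) * (∑ j, aR j + 1)) = 1)
    (hP : derivative P = C ((∑ j, aL j + 1 + (∑ j, aR j + 1) : ℕ) : ℂ) * cp (aO aL aR) (asm aL aR w μ τ γ y z)) :
    derivative (P.comp (C w * (C (τ ^ (∑ j, aR j + 1)) * X - C μ))) = BL aL aR τ γ y z := by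
  rw [derivative_comp, hP, mul_comp, asm_cp, C_comp, BL, Blk, cpl]
  have e : derivative (C w * (C (τ ^ (∑ j, aR j + 1)) * X - C μ)) = C w * C (τ ^ (∑ j, aR j + 1)) := by simp
  have e2 : ∀ x : ℂ, C (τ ^ (∑ j, aR j + 1)) * X - C (τ ^ (∑ j, aR j + 1) * x) = C (τ ^ (∑ j, aR j + 1)) * (X - C x) := by
    intro x; simp only [map_mul]; ring
  have hw' := congrArg (C : ℂ → ℂ[X]) hw
  simp only [map_mul, map_pow, map_one] at hw'
  simp only [e, e2, mul_pow, Finset.prod_mul_distrib, Finset.prod_pow_eq_pow_sum]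
  simp only [cp, C_pow, ← pow_mul]
  rw [show (∑ j, aL j + 1) * (∑ j, aR j + 1) = (∑ j, aR j + 1) * ∑ j, aL j + (∑ j, aR j + 1) by ring] at hw'
  linear_combination (C ((∑ j, aL j + 1 + (∑ j, aR j + 1) : ℕ) : ℂ) * (C τ ^ (∑ j, aR j + 1) * X - C γ) * (∏ j, (X - C (y j)) ^ aL j) *
       ∏ j, (C τ ^ (∑ j, aR j + 1) * X - C (1 + τ ^ (∑ j, aL j + 1) * z j)) ^ aR j) * hw'

lemma asm_R (w μ τ γ : ℂ) (y : L → ℂ) (z : R → ℂ) (P : ℂ[X]) 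
    (hw : w ^ (∑ j, aL j + 1 + (∑ j, aR j + 1)) * τ ^ ((∑ j, aL j + 1) * (∑ j, aR j + 1)) = 1)
    (hP : derivative P = C ((∑ j, aL j + 1 + (∑ j, aR j + 1) : ℕ) : ℂ) * cp (aO aL aR) (asm aL aR w μ τ γ y z)) :
    derivative (P.comp (C w * (C (τ ^ (∑ j, aL j + 1)) * X + 1 - C μ))) = BR aL aR τ γ y z := by
  rw [derivative_comp, hP, mul_comp, asm_cp, C_comp, BR, Blk, cpl]
  have e : derivative (C w * (C (τ ^ (∑ j, aL j + 1)) * X + 1 - C μ)) = C w * C (τ ^ (∑ j, aL j + 1)) := by simp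
  have e2 : ∀ x : ℂ, C (τ ^ (∑ j, aL j + 1)) * X + 1 - C (1 + τ ^ (∑ j, aL j + 1) * x) = C (τ ^ (∑ j, aL j + 1)) * (X - C x) := by
    intro x; simp only [map_mul, map_add, map_one]; ring
  have e3 : ∀ x : ℂ, C (τ ^ (∑ j, aL j + 1)) * X + 1 - C x = C (τ ^ (∑ j, aL j + 1)) * X - C (x - 1) := by
    intro x; simp only [map_sub, map_one]; ring
  have hw' := congrArg (C : ℂ → ℂ[X]) hw
  simp only [map_mul, map_pow, map_one] at hw'
  simp only [e, e2]
  simp only [e3, mul_pow, Finset.prod_mul_distrib, Finset.prod_pow_eq_pow_sum]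
  simp only [cp, C_pow, ← pow_mul]
  rw [show (∑ j, aL j + 1) * (∑ j, aR j + 1) = (∑ j, aL j + 1) * ∑ j, aR j + (∑ j, aL j + 1) by ring] at hw'
  linear_combination (C ((∑ j, aL j + 1 + (∑ j, aR j + 1) : ℕ) : ℂ) * (C τ ^ (∑ j, aL j + 1) * X - C (γ - 1)) * (∏ j, (X - C (z j)) ^ aR j) *
       ∏ j, (C τ ^ (∑ j, aL j + 1) * X - C (τ ^ (∑ j, aR j + 1) * y j - 1)) ^ aL j) * hw'

lemma eq_ad {K B : ℂ[X]} (h : derivative K = B) : K = C (K.eval 0) + ad B := by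
  obtain ⟨c, hc⟩ := eq_add_C (p := K) (q := ad B) (by rw [derivative_ad, h])
  have : K.eval 0 = c := by rw [hc]; simp [ad_eval_zero]
  rw [this]; rw [hc]; ring

/-- From a polynomial to a zero of the system. -/
lemma link_back (hR : Nonempty R) (w μ s γ θ T : ℂ) (y : L → ℂ) (z : R → ℂ) (P : ℂ[X]) 
    (hsT : s ^ ((∑ j, aL j + 1) * (∑ j, aR j + 1)) * T = 1)
    (hw : w ^ (∑ j, aL j + 1 + (∑ j, aR j + 1)) * (s * θ) ^ ((∑ j, aL j + 1) * (∑ j, aR j + 1)) = 1)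
    (hP : derivative P = C ((∑ j, aL j + 1 + (∑ j, aR j + 1) : ℕ) : ℂ) * cp (aO aL aR) (asm aL aR w μ (s * θ) γ y z))
    (hL : ∀ j, P.eval (asm aL aR w μ (s * θ) γ y z (some (Sum.inl j))) = uL j)
    (hRv : ∀ j, P.eval (asm aL aR w μ (s * θ) γ y z (some (Sum.inr j))) = uR j)
    (hT : P.eval (asm aL aR w μ (s * θ) γ y z none) = T)
    (hy : ∑ j, (aL j : ℂ) * y j = 0) (hz : ∑ j, (aR j : ℂ) * z j = 0) 
    (hγ : IsEmpty L → ((∑ j, aL j + 1 + (∑ j, aR j + 1) : ℕ) : ℂ) * γ = (∑ j, aL j + 1 : ℕ)) :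
    Phi aL aR uL uR (s, ((y, if IsEmpty L then 0 else P.eval (w * (0 - μ))), (z, P.eval (w * (1 - μ))), (γ, θ))) = 0 := by
  set τ := s * θ with hτ
  have hK := asm_K aL aR w μ τ γ y z P hw hP
  have hKL := eq_ad (asm_L aL aR w μ τ γ y z P hw hP)
  have hKR := eq_ad (asm_R aL aR w μ τ γ y z P hw hP)
  have hRe : ¬ IsEmpty R := not_isEmpty_iff.2 hR
  simp only [Phi, Prod.mk_eq_zero, ← hτ]
  refine ⟨⟨?_, ?_⟩, ⟨?_, ?_⟩, ?_, ?_⟩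
  · ext j
    have hLe : ¬ IsEmpty L := not_isEmpty_iff.2 ⟨j⟩
    have h1 := hL j
    simp only [asm] at h1
    have h2 := congrArg (eval (y j)) hKL
    simp only [eval_comp, eval_mul, eval_sub, eval_add, eval_C, eval_X, mul_zero, eval_pow, C_pow] at h2
    rw [h1] at h2
    simp [eL, hLe, h2]
  · simp only [eS, hy, zero_add]
    split_ifs <;> rfl
  · ext j
    have h1 := hRv j
    simp only [asm] at h1
    have h2 := congrArg (eval (z j)) hKR
    simp only [eval_comp, eval_mul, eval_sub, eval_add, eval_C, eval_X, mul_zero, eval_one, zero_add, eval_pow, C_pow] at h2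
    rw [add_comm _ (1:ℂ), h1] at h2
    simp [eR, h2]
  · simp only [eS, hz, zero_add, hRe, if_false]
  · unfold eC
    split_ifs with h
    · rw [hγ h, sub_self]
    · have h2 := congrArg (eval 1) (eq_ad hK)
      simp only [eval_comp, eval_mul, eval_sub, eval_add, eval_C, eval_X] at h2
      linear_combination -h2
  · unfold eT
    simp only [asm] at hT
    have h2 := congrArg (eval 1) (eq_ad hK)
    have h3 := congrArg (eval γ) (eq_ad hK)
    simp only [eval_comp, eval_mul, eval_sub, eval_add, eval_C, eval_X] at h2 h3
    rw [hT] at h3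
    have h4 : τ ^ ((∑ j, aL j + 1) * (∑ j, aR j + 1)) * T = θ ^ ((∑ j, aL j + 1) * (∑ j, aR j + 1)) := by
      rw [hτ, mul_pow]; linear_combination θ ^ ((∑ j, aL j + 1) * (∑ j, aR j + 1)) * hsT
    rw [h4] at h3
    linear_combination h2 - h3

lemma asm_sum (w μ τ γ : ℂ) (y : L → ℂ) (z : R → ℂ) (hy : ∑ j, (aL j : ℂ) * y j = 0) (hz : ∑ j, (aR j : ℂ) * z j = 0)
    (hμ : μ * (∑ j, aL j + (∑ j, aR j + 1) : ℕ) = γ + (∑ j, aR j : ℕ)) :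
    ∑ j, (aO aL aR j : ℂ) * asm aL aR w μ τ γ y z j = 0 := by
  simp only [Fintype.sum_option, Fintype.sum_sum_type, aO, asm]
  have e1 : ∑ j, (aL j : ℂ) * (w * (τ ^ (∑ j, aR j + 1) * y j - μ)) = w * τ ^ (∑ j, aR j + 1) * ∑ j, (aL j : ℂ) * y j - w * μ * ∑ j, (aL j : ℂ) := by
    rw [Finset.mul_sum, Finset.mul_sum, ← Finset.sum_sub_distrib]
    refine Finset.sum_congr rfl fun j _ => by ring
  have e2 : ∑ j, (aR j : ℂ) * (w * (1 + τ ^ (∑ j, aL j + 1) * z j - μ)) = w * τ ^ (∑ j, aL j + 1) * ∑ j, (aR j : ℂ) * z j + w * (1 - μ) * ∑ j, (aR j : ℂ) := by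
    rw [Finset.mul_sum, Finset.mul_sum, ← Finset.sum_add_distrib]
    refine Finset.sum_congr rfl fun j _ => by ring
  rw [e1, e2, hy, hz]
  push_cast at hμ ⊢
  linear_combination -w * hμ

/-- From a zero of the system to a polynomial. -/
lemma link_fwd (hR : Nonempty R) (w μ s γ θ T cL cR : ℂ) (y : L → ℂ) (z : R → ℂ) 
    (hsT : s ^ ((∑ j, aL j + 1) * (∑ j, aR j + 1)) * T = 1)
    (hw : w ^ (∑ j, aL j + 1 + (∑ j, aR j + 1)) * (s * θ) ^ ((∑ j, aL j + 1) * (∑ j, aR j + 1)) = 1)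
    (hPhi : Phi aL aR uL uR (s, ((y, cL), (z, cR), (γ, θ))) = 0) :
    ∃ P : ℂ[X], derivative P = C ((∑ j, aL j + 1 + (∑ j, aR j + 1) : ℕ) : ℂ) * cp (aO aL aR) (asm aL aR w μ (s * θ) γ y z) ∧
    (∀ j, P.eval (asm aL aR w μ (s * θ) γ y z (some (Sum.inl j))) = uL j) ∧
    (∀ j, P.eval (asm aL aR w μ (s * θ) γ y z (some (Sum.inr j))) = uR j) ∧
    (P.eval (asm aL aR w μ (s * θ) γ y z none) = T) := by
  set τ := s * θ with hτ
  set Q := ad (C ((∑ j, aL j + 1 + (∑ j, aR j + 1) : ℕ) : ℂ) * cp (aO aL aR) (asm aL aR w μ τ γ y z)) with hQ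
  set P := Q + C (cR - Q.eval (w * (1 - μ))) with hPd
  have hP : derivative P = C ((∑ j, aL j + 1 + (∑ j, aR j + 1) : ℕ) : ℂ) * cp (aO aL aR) (asm aL aR w μ τ γ y z) := by
    rw [hPd, derivative_add, derivative_C, add_zero, hQ, derivative_ad]
  have hPc : P.eval (w * (1 - μ)) = cR := by rw [hPd]; simp
  have hK := asm_K aL aR w μ τ γ y z P hw hP
  have hKL := eq_ad (asm_L aL aR w μ τ γ y z P hw hP)
  have hKR := eq_ad (asm_R aL aR w μ τ γ y z P hw hP)
  have hRe : ¬ IsEmpty R := not_isEmpty_iff.2 hR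
  have hτ0 : τ ^ ((∑ j, aL j + 1) * (∑ j, aR j + 1)) ≠ 0 := right_ne_zero_of_mul (hw.symm ▸ one_ne_zero)
  simp only [Phi, Prod.mk_eq_zero, ← hτ] at hPhi
  obtain ⟨⟨h1, h2⟩, ⟨h3, h4⟩, h5, h6⟩ := hPhi
  refine ⟨P, hP, fun j => ?_, fun j => ?_, ?_⟩
  · have hLe : ¬ IsEmpty L := not_isEmpty_iff.2 ⟨j⟩
    have h7 := congrArg (eval 1) (eq_ad hK)
    simp only [eval_comp, eval_mul, eval_sub, eval_add, eval_C, eval_X] at h7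
    rw [eC, if_neg hLe] at h5
    rw [hPc] at h7
    have h8 : P.eval (w * (0 - μ)) = cL := by
      apply mul_left_cancel₀ hτ0
      linear_combination -h7 - h5
    have h9 := congrArg (eval (y j)) hKL
    simp only [eval_comp, eval_mul, eval_sub, eval_add, eval_C, eval_X, mul_zero, eval_pow, C_pow] at h9
    rw [h8] at h9
    have h10 := congrFun h1 j
    simp only [eL, eval_add, eval_C, Pi.zero_apply] at h10
    simp only [asm]
    rw [h9]; linear_combination h10
  · have h9 := congrArg (eval (z j)) hKR
    simp only [eval_comp, eval_mul, eval_sub, eval_add, eval_C, eval_X, mul_zero, eval_one, zero_add, eval_pow, C_pow] at h9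
    rw [add_comm _ (1:ℂ), hPc] at h9
    have h10 := congrFun h3 j
    simp only [eR, eval_add, eval_C, Pi.zero_apply] at h10
    simp only [asm]
    rw [h9]; linear_combination h10
  · have h7 := congrArg (eval 1) (eq_ad hK)
    have h8 := congrArg (eval γ) (eq_ad hK)
    simp only [eval_comp, eval_mul, eval_sub, eval_add, eval_C, eval_X] at h7 h8
    rw [hPc] at h7
    simp only [eT] at h6
    have h4 : τ ^ ((∑ j, aL j + 1) * (∑ j, aR j + 1)) * T = θ ^ ((∑ j, aL j + 1) * (∑ j, aR j + 1)) := by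
      rw [hτ, mul_pow]; linear_combination θ ^ ((∑ j, aL j + 1) * (∑ j, aR j + 1)) * hsT
    simp only [asm]
    apply mul_left_cancel₀ hτ0
    rw [h4]
    linear_combination h8 - h7 + h6

end cut2

end FO

open Polynomial
open scoped Classical
set_option linter.all false
namespace FO
open Filter Topology

section cut3
variable {L R : Type} [Fintype L] [Fintype R]

abbrev fL (L R : Type) : L → Option (L ⊕ R) := fun i => some (Sum.inl i)
abbrev fR (L R : Type) : R → Option (L ⊕ R) := fun i => some (Sum.inr i)

lemma fL_inj : Function.Injective (fL L R) := fun i j h => by simpa using h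
lemma fR_inj : Function.Injective (fR L R) := fun i j h => by simpa using h

def LD.top {ι : Type} (D : LD (Option ι)) (T : ℝ) : LD (Option ι) :=
  { D with u := fun j => match j with
                  | none => T
                  | some k => D.u (some k) }

def crs (D : LD (Option (L ⊕ R))) : ℕ :=
  ∑ i, D.κ (fL L R i) none + ∑ j, D.κ none (fR L R j) + ∑ i, ∑ j, D.κ (fL L R i) (fR L R j)

lemma sg_order (D : LD (Option (L ⊕ R))) (ξ : Option (L ⊕ R) → ℂ) (y : L → ℂ) (z : R → ℂ)
    (h1 : ∀ i, (ξ (fL L R i)).re < (ξ none).re) (h2 : ∀ j, (ξ none).re < (ξ (fR L R j)).re)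
    (hy : ∀ i j, (ξ (fL L R i)).re < (ξ (fL L R j)).re ↔ (y i).re < (y j).re)
    (hz : ∀ i j, (ξ (fR L R i)).re < (ξ (fR L R j)).re ↔ (z i).re < (z j).re) :
    sg D ξ = (-1) ^ crs D * (sg (D.comap (fL L R)) y * sg (D.comap (fR L R)) z) := by
  have h3 : ∀ i j, (ξ (fL L R i)).re < (ξ (fR L R j)).re := fun i j => (h1 i).trans (h2 j)
  unfold sg crs
  rw [← pow_add, ← pow_add]
  congr 1
  simp only [Fintype.sum_option, Fintype.sum_sum_type, lt_irrefl, if_false, h1, h2, h3, if_true, not_lt_of_gt (h1 _), 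
    not_lt_of_gt (h2 _), not_lt_of_gt (h3 _ _), hy, hz, Finset.sum_const_zero, zero_add, add_zero, Finset.sum_add_distrib, LD.comap]
  ring

lemma aO_eq (D : LD (Option (L ⊕ R))) (h : D.a none = 1) : D.a = aO (D.comap (fL L R)).a (D.comap (fR L R)).a := by
  ext j
  rcases j with _ | j | j
  · exact h
  · rfl
  · rfl

variable (aL : L → ℕ) (aR : R → ℕ)

noncomputable def gam : ℝ := ((∑ j, aL j + 1 : ℕ) : ℝ) / ((∑ j, aL j + 1 + (∑ j, aR j + 1) : ℕ) : ℝ)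
noncomputable def tht : ℝ := ((gam aL aR) ^ (∑ j, aL j + 1) * (1 - gam aL aR) ^ (∑ j, aR j + 1)) ^ ((((∑ j, aL j + 1) * (∑ j, aR j + 1) : ℕ) : ℝ)⁻¹)

lemma gam_pos : 0 < gam aL aR := by unfold gam; positivity
lemma gam_lt : gam aL aR < 1 := by
  unfold gam
  rw [div_lt_one (by positivity)]
  exact_mod_cast (by omega)
lemma gam_mul : ((∑ j, aL j + 1 + (∑ j, aR j + 1) : ℕ) : ℝ) * gam aL aR = ((∑ j, aL j + 1 : ℕ) : ℝ) := by
  unfold gam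
  rw [mul_div_cancel₀ _ (by positivity)]
lemma gam_mulC : ((∑ j, aL j + 1 + (∑ j, aR j + 1) : ℕ) : ℂ) * (gam aL aR : ℂ) = ((∑ j, aL j + 1 : ℕ) : ℂ) := by
  exact_mod_cast congrArg (fun x : ℝ => (x : ℂ)) (gam_mul aL aR)
lemma tht_base : 0 < (gam aL aR) ^ (∑ j, aL j + 1) * (1 - gam aL aR) ^ (∑ j, aR j + 1) := 
  mul_pos (pow_pos (gam_pos _ _) _) (pow_pos (sub_pos.2 (gam_lt _ _)) _)
lemma tht_pos : 0 < tht aL aR := Real.rpow_pos_of_pos (tht_base _ _) _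
lemma tht_pow : tht aL aR ^ ((∑ j, aL j + 1) * (∑ j, aR j + 1)) = (gam aL aR) ^ (∑ j, aL j + 1) * (1 - gam aL aR) ^ (∑ j, aR j + 1) := by
  unfold tht
  rw [Real.rpow_inv_natCast_pow (tht_base _ _).le (mul_ne_zero (Nat.succ_ne_zero _) (Nat.succ_ne_zero _))]

/-- the limiting zero of the system -/
lemma cut_zero (D : LD (Option (L ⊕ R))) (hr : Odd (∑ j, (D.comap (fR L R)).a j)) (hD : D.Good) (y0 : L → ℂ) (z0 : R → ℂ)
    (hy : IsSol (D.comap (fL L R)) y0) (hz : IsSol (D.comap (fR L R)) z0) :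
    ∃ cL cR : ℂ, Phi (D.comap (fL L R)).a (D.comap (fR L R)).a (D.comap (fL L R)).u (D.comap (fR L R)).u
      (0, ((y0, cL), (z0, cR), ((gam (D.comap (fL L R)).a (D.comap (fR L R)).a : ℂ), (tht (D.comap (fL L R)).a (D.comap (fR L R)).a : ℂ)))) = 0 := by
  have hposL := (hD.comap _ (fL_inj (L := L) (R := R))).pos
  set aL := (D.comap (fL L R)).a with haL
  set aR := (D.comap (fR L R)).a with haR
  obtain ⟨P, hP1, hP2⟩ := hy.2.2.2
  obtain ⟨Q, hQ1, hQ2⟩ := hz.2.2.2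
  have hRe : ¬ IsEmpty R := by
    intro h
    rw [Fintype.sum_empty] at hr
    exact absurd hr (by decide)
  have hg := gam_mulC aL aR
  refine ⟨if IsEmpty L then 0 else P.eval 0, Q.eval 0, ?_⟩
  simp only [Phi, Prod.mk_eq_zero, zero_mul]
  refine ⟨⟨?_, ?_⟩, ⟨?_, ?_⟩, ?_, ?_⟩
  · ext j
    have hLe : ¬ IsEmpty L := not_isEmpty_iff.2 ⟨j⟩
    have h1 : derivative P = BL aL aR 0 (gam aL aR) y0 z0 := by
      rw [hP1, BL_zero, hr.neg_one_pow, mul_neg, mul_neg, neg_mul, neg_neg, mul_one, hg]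
    have h2 := congrArg (eval (y0 j)) (eq_ad h1)
    rw [hP2 j] at h2
    simp only [eL, if_neg hLe, Pi.zero_apply]
    rw [← h2, sub_self]
  · simp only [eS, hy.2.2.1, zero_add]
    have h := hy.2.2.1
    rw [← haL] at h
    rw [h]
    split_ifs <;> simp
  · ext j
    have h1 : derivative Q = BR aL aR 0 (gam aL aR) y0 z0 := by
      rw [hQ1, BR_zero, mul_sub, hg]
      push_cast
      rw [mul_one, add_sub_cancel_left]
    have h2 := congrArg (eval (z0 j)) (eq_ad h1)
    rw [hQ2 j] at h2
    simp only [eR, Pi.zero_apply]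
    rw [← h2, sub_self]
  · have h := hz.2.2.1
    rw [← haR] at h
    simp only [eS, h, zero_add, hRe, if_false]
  · exact eC_zero aL aR _ _ _ _ _ hg hposL
  · rw [eT_zero aL aR _ _ _ _ _ hg]
    have h1 := congrArg (fun x : ℝ => (x : ℂ)) (tht_pow aL aR)
    push_cast at h1
    rw [h1]
    have h2 : Even (∑ j, aR j + 1) := hr.add_one
    rw [← neg_sub (1:ℂ), h2.neg_pow, sub_self]

noncomputable def sT (N : ℕ) (T : ℝ) : ℝ := (T ^ ((N : ℝ)⁻¹))⁻¹
noncomputable def tT (n : ℕ) (T : ℝ) : ℝ := T ^ ((n : ℝ)⁻¹)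

lemma sT_pow (N : ℕ) (hN : N ≠ 0) (T : ℝ) (hT : 0 < T) : ((sT N T : ℝ) : ℂ) ^ N * T = 1 := by
  have : sT N T ^ N * T = 1 := by
    unfold sT
    rw [inv_pow, Real.rpow_inv_natCast_pow hT.le hN, inv_mul_cancel₀ hT.ne']
  exact_mod_cast this
lemma sT_pos (N : ℕ) (T : ℝ) (hT : 0 < T) : 0 < sT N T := inv_pos.2 (Real.rpow_pos_of_pos hT _)
lemma tT_pos (N : ℕ) (T : ℝ) (hT : 0 < T) : 0 < tT N T := Real.rpow_pos_of_pos hT _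
lemma tT_pow (N : ℕ) (hN : N ≠ 0) (T : ℝ) (hT : 0 < T) : ((tT N T : ℝ) : ℂ) ^ N = T := by
  have : tT N T ^ N = T := Real.rpow_inv_natCast_pow hT.le hN
  exact_mod_cast this
lemma tT_lim (N : ℕ) (hN : N ≠ 0) : Tendsto (tT N) atTop atTop := 
  tendsto_rpow_atTop (inv_pos.2 (by positivity))
lemma sT_lim (N : ℕ) (hN : N ≠ 0) : Tendsto (sT N) atTop (𝓝 0) := 
  (tT_lim N hN).inv_tendsto_atTop

/-- overall scale as a function of θ -/
noncomputable def WW (T : ℝ) (θ : ℂ) : ℂ :=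
  (tT (∑ j, aL j + 1 + (∑ j, aR j + 1)) T : ℂ) * θ ^ (-((((∑ j, aL j + 1) * (∑ j, aR j + 1) : ℕ) : ℂ) / ((∑ j, aL j + 1 + (∑ j, aR j + 1) : ℕ) : ℂ)))

noncomputable def mu (γ : ℂ) : ℂ := (γ + (∑ j, aR j : ℕ)) / (∑ j, aL j + (∑ j, aR j + 1) : ℕ)

lemma mu_mul (γ : ℂ) : mu aL aR γ * (∑ j, aL j + (∑ j, aR j + 1) : ℕ) = γ + (∑ j, aR j : ℕ) := by
  unfold mu
  rw [div_mul_cancel₀]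
  exact Nat.cast_ne_zero.2 (by omega)

lemma WW_pow (T : ℝ) (hT : 0 < T) (θ : ℂ) (hθ : θ ≠ 0) : 
   (WW aL aR T θ) ^ (∑ j, aL j + 1 + (∑ j, aR j + 1)) * ((sT ((∑ j, aL j + 1) * (∑ j, aR j + 1)) T : ℂ) * θ) ^ ((∑ j, aL j + 1) * (∑ j, aR j + 1)) = 1 := by
  have h1 := sT_pow ((∑ j, aL j + 1) * (∑ j, aR j + 1)) (mul_ne_zero (Nat.succ_ne_zero _) (Nat.succ_ne_zero _)) T hT
  have h2 := tT_pow (∑ j, aL j + 1 + (∑ j, aR j + 1)) (by omega) T hT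
  have hn : ((∑ j, aL j + 1 + (∑ j, aR j + 1) : ℕ) : ℂ) ≠ 0 := Nat.cast_ne_zero.2 (by omega)
  unfold WW
  rw [mul_pow, mul_pow, h2, ← Complex.cpow_mul_nat, neg_mul, div_mul_cancel₀ _ hn, Complex.cpow_neg, Complex.cpow_natCast]
  have h3 : θ ^ ((∑ j, aL j + 1) * (∑ j, aR j + 1)) ≠ 0 := pow_ne_zero _ hθ
  have h4 : (θ ^ ((∑ j, aL j + 1) * (∑ j, aR j + 1)))⁻¹ * θ ^ ((∑ j, aL j + 1) * (∑ j, aR j + 1)) = 1 := inv_mul_cancel₀ h3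
  calc _ = ((sT ((∑ j, aL j + 1) * (∑ j, aR j + 1)) T : ℂ) ^ ((∑ j, aL j + 1) * (∑ j, aR j + 1)) * T) * ((θ ^ ((∑ j, aL j + 1) * (∑ j, aR j + 1)))⁻¹ * θ ^ ((∑ j, aL j + 1) * (∑ j, aR j + 1))) := by ring
    _ = 1 := by rw [h1, h4, one_mul]

lemma WW_real (T : ℝ) (hT : 0 < T) (θ : ℝ) (hθ : 0 < θ) : ∃ ρ : ℝ, 0 < ρ ∧ WW aL aR T θ = ρ := by
  refine ⟨tT (∑ j, aL j + 1 + (∑ j, aR j + 1)) T * θ ^ (-((((∑ j, aL j + 1) * (∑ j, aR j + 1) : ℕ) : ℝ) / ((∑ j, aL j + 1 + (∑ j, aR j + 1) : ℕ) : ℝ))),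
    mul_pos (tT_pos _ _ hT) (Real.rpow_pos_of_pos hθ _), ?_⟩
  unfold WW
  rw [Complex.ofReal_mul, Complex.ofReal_cpow hθ.le]
  push_cast
  rfl

noncomputable def asmT (T : ℝ) (x : EE L R) : Option (L ⊕ R) → ℂ :=
  asm aL aR (WW aL aR T x.2.2.2) (mu aL aR x.2.2.1) ((sT ((∑ j, aL j + 1) * (∑ j, aR j + 1)) T : ℂ) * x.2.2.2) x.2.2.1 x.1.1 x.2.1.1

end cut3
end FO

open Polynomial
open scoped Classical
set_option linter.all false
namespace FO
open Filter Topology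

section cut4
variable {L R : Type} [Fintype L] [Fintype R] (aL : L → ℕ) (aR : R → ℕ)

/-! inverse coordinates -/
noncomputable def iR (ξ : Option (L ⊕ R) → ℂ) : ℂ := (∑ j, (aR j : ℂ) * ξ (fR L R j)) / (∑ j, aR j : ℕ)
noncomputable def iL (ξ : Option (L ⊕ R) → ℂ) : ℂ :=
  if IsEmpty L then - (∑ j, aR j + 1 : ℕ) * iR aR ξ else (∑ j, (aL j : ℂ) * ξ (fL L R j)) / (∑ j, aL j : ℕ)
noncomputable def iW (ξ : Option (L ⊕ R) → ℂ) : ℂ := iR aR ξ - iL aL aR ξ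
noncomputable def iT (T : ℝ) (ξ : Option (L ⊕ R) → ℂ) : ℂ :=
  (iW aL aR ξ / tT (∑ j, aL j + 1 + (∑ j, aR j + 1)) T) ^
    (-(((∑ j, aL j + 1 + (∑ j, aR j + 1) : ℕ) : ℂ) / (((∑ j, aL j + 1) * (∑ j, aR j + 1) : ℕ) : ℂ)))
noncomputable def iS (T : ℝ) (ξ : Option (L ⊕ R) → ℂ) : ℂ := (sT ((∑ j, aL j + 1) * (∑ j, aR j + 1)) T : ℂ) * iT aL aR T ξ
noncomputable def iY (T : ℝ) (ξ : Option (L ⊕ R) → ℂ) : L → ℂ :=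
  fun i => (ξ (fL L R i) - iL aL aR ξ) / (iW aL aR ξ * iS aL aR T ξ ^ (∑ j, aR j + 1))
noncomputable def iZ (T : ℝ) (ξ : Option (L ⊕ R) → ℂ) : R → ℂ :=
  fun i => (ξ (fR L R i) - iR aR ξ) / (iW aL aR ξ * iS aL aR T ξ ^ (∑ j, aL j + 1))
noncomputable def iG (ξ : Option (L ⊕ R) → ℂ) : ℂ := (ξ none - iL aL aR ξ) / iW aL aR ξ

lemma cpow_inv_lim {I : Type*} {l : Filter I} (ω : I → ℂ) (ω0 : ℝ) (h0 : 0 < ω0) (h : Tendsto ω l (𝓝 (ω0 : ℂ))) (c d : ℂ)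
    (hc : ∃ c' : ℝ, c = c') (hcd : c * d = 1) : ∀ᶠ i in l, (ω i ^ c) ^ d = ω i := by
  obtain ⟨c', rfl⟩ := hc
  have h1 : Tendsto (fun i => (Complex.log (ω i) * c').im) l (𝓝 ((Complex.log ω0 * c').im)) := by
    have hs : (ω0 : ℂ) ∈ Complex.slitPlane := Complex.ofReal_mem_slitPlane.2 h0
    exact (Complex.continuous_im.tendsto _).comp (((continuousAt_clog hs).tendsto.comp h).mul_const _)
  have h2 : (Complex.log ω0 * c').im = 0 := by
    rw [← Complex.ofReal_log h0.le, ← Complex.ofReal_mul, Complex.ofReal_im]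
  rw [h2] at h1
  filter_upwards [h1.eventually (lt_mem_nhds (neg_lt_zero.2 Real.pi_pos)), h1.eventually (gt_mem_nhds Real.pi_pos)] with i h3 h4
  rw [← Complex.cpow_mul _ h3 h4.le, hcd, Complex.cpow_one]

lemma sum_pos_of (a : R → ℕ) (ha : ∀ j, 1 ≤ a j) (hR : Nonempty R) : ∑ j, a j ≠ 0 := by
  obtain ⟨j⟩ := hR
  have := Finset.single_le_sum (f := a) (fun i _ => Nat.zero_le _) (Finset.mem_univ j)
  have := ha j
  omega

section recover
variable (hR : Nonempty R) (haL : ∀ j, 1 ≤ aL j) (haR : ∀ j, 1 ≤ aR j)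

lemma aff_sum {ι : Type*} [Fintype ι] (a : ι → ℕ) (y : ι → ℂ) (hy : ∑ j, (a j : ℂ) * y j = 0) (A B : ℂ) :
    ∑ j, (a j : ℂ) * (A * y j + B) = B * (∑ j, a j : ℕ) := by
  have : ∑ j, (a j : ℂ) * (A * y j + B) = A * ∑ j, (a j : ℂ) * y j + B * ∑ j, (a j : ℂ) := by
    rw [Finset.mul_sum, Finset.mul_sum, ← Finset.sum_add_distrib]
    exact Finset.sum_congr rfl fun j _ => by ring
  rw [this, hy]; push_cast; ring

lemma iR_asm (hR : Nonempty R) (haR : ∀ j, 1 ≤ aR j) (w μ τ γ : ℂ) (y : L → ℂ) (z : R → ℂ) (hz : ∑ j, (aR j : ℂ) * z j = 0) :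
    iR aR (asm aL aR w μ τ γ y z) = w * (1 - μ) := by
  unfold iR
  have h := aff_sum aR z hz (w * τ ^ (∑ j, aL j + 1)) (w * (1 - μ))
  rw [div_eq_iff (Nat.cast_ne_zero.2 (sum_pos_of aR haR hR)), ← h]
  refine Finset.sum_congr rfl fun j _ => ?_
  simp only [asm]; ring

lemma iL_asm (hR : Nonempty R) (haL : ∀ j, 1 ≤ aL j) (haR : ∀ j, 1 ≤ aR j) (w τ γ : ℂ) (y : L → ℂ) (z : R → ℂ) (hy : ∑ j, (aL j : ℂ) * y j = 0) (hz : ∑ j, (aR j : ℂ) * z j = 0)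
    (hγ : IsEmpty L → ((∑ j, aL j + 1 + (∑ j, aR j + 1) : ℕ) : ℂ) * γ = (∑ j, aL j + 1 : ℕ)) :
    iL aL aR (asm aL aR w (mu aL aR γ) τ γ y z) = w * (0 - mu aL aR γ) := by
  unfold iL
  split_ifs with he
  · rw [iR_asm aL aR hR haR _ _ _ _ _ _ hz]
    have h1 := hγ he
    have h2 := mu_mul aL aR γ
    simp only [Fintype.sum_empty] at h1 h2
    have h3 : ((∑ j, aR j + 1 : ℕ) : ℂ) ≠ 0 := Nat.cast_ne_zero.2 (Nat.succ_ne_zero _)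
    apply mul_left_cancel₀ h3
    push_cast at h1 h2 ⊢
    set r : ℂ := ∑ x, (aR x : ℂ) with hr
    set m := mu aL aR γ with hm
    linear_combination w * ((1 + r + 1)) * h2 - w * (-1) * h1 + w * 0 - w * h2 * 0
  · have h := aff_sum aL y hy (w * τ ^ (∑ j, aR j + 1)) (w * (0 - mu aL aR γ))
    rw [not_isEmpty_iff] at he
    rw [div_eq_iff (Nat.cast_ne_zero.2 (sum_pos_of aL haL he)), ← h]
    refine Finset.sum_congr rfl fun j _ => ?_
    simp only [asm]; ring

lemma iW_asm (hR : Nonempty R) (haL : ∀ j, 1 ≤ aL j) (haR : ∀ j, 1 ≤ aR j) (w τ γ : ℂ) (y : L → ℂ) (z : R → ℂ) (hy : ∑ j, (aL j : ℂ) * y j = 0) (hz : ∑ j, (aR j : ℂ) * z j = 0)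
    (hγ : IsEmpty L → ((∑ j, aL j + 1 + (∑ j, aR j + 1) : ℕ) : ℂ) * γ = (∑ j, aL j + 1 : ℕ)) :
    iW aL aR (asm aL aR w (mu aL aR γ) τ γ y z) = w := by
  unfold iW
  rw [iL_asm aL aR hR haL haR w τ γ y z hy hz hγ, iR_asm aL aR hR haR _ _ _ _ _ _ hz]
  ring

lemma i_asmT (hR : Nonempty R) (haL : ∀ j, 1 ≤ aL j) (haR : ∀ j, 1 ≤ aR j) (T : ℝ) (hT : 0 < T) (x : EE L R) (hy : ∑ j, (aL j : ℂ) * x.1.1 j = 0) (hz : ∑ j, (aR j : ℂ) * x.2.1.1 j = 0)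
    (hγ : IsEmpty L → ((∑ j, aL j + 1 + (∑ j, aR j + 1) : ℕ) : ℂ) * x.2.2.1 = (∑ j, aL j + 1 : ℕ))
    (hθ : x.2.2.2 ≠ 0)
    (hinv : (x.2.2.2 ^ (-((((∑ j, aL j + 1) * (∑ j, aR j + 1) : ℕ) : ℂ) / ((∑ j, aL j + 1 + (∑ j, aR j + 1) : ℕ) : ℂ)))) ^ (-(((∑ j, aL j + 1 + (∑ j, aR j + 1) : ℕ) : ℂ) / (((∑ j, aL j + 1) * (∑ j, aR j + 1) : ℕ) : ℂ))) = x.2.2.2) :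
    iY aL aR T (asmT aL aR T x) = x.1.1 ∧ iZ aL aR T (asmT aL aR T x) = x.2.1.1 := by
  have hW := iW_asm aL aR hR haL haR (WW aL aR T x.2.2.2) ((sT ((∑ j, aL j + 1) * (∑ j, aR j + 1)) T : ℂ) * x.2.2.2) x.2.2.1 x.1.1 x.2.1.1 hy hz hγ
  have hL := iL_asm aL aR hR haL haR (WW aL aR T x.2.2.2) ((sT ((∑ j, aL j + 1) * (∑ j, aR j + 1)) T : ℂ) * x.2.2.2) x.2.2.1 x.1.1 x.2.1.1 hy hz hγ
  have hRR := iR_asm aL aR hR haR (WW aL aR T x.2.2.2) (mu aL aR x.2.2.1) ((sT ((∑ j, aL j + 1) * (∑ j, aR j + 1)) T : ℂ) * x.2.2.2) x.2.2.1 x.1.1 x.2.1.1 hz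
  have hs : (sT ((∑ j, aL j + 1) * (∑ j, aR j + 1)) T : ℂ) ≠ 0 := Complex.ofReal_ne_zero.2 (sT_pos _ _ hT).ne'
  have ht : (tT (∑ j, aL j + 1 + (∑ j, aR j + 1)) T : ℂ) ≠ 0 := Complex.ofReal_ne_zero.2 (tT_pos _ _ hT).ne'
  have hW0 : WW aL aR T x.2.2.2 ≠ 0 := by
    intro h
    have := WW_pow aL aR T hT _ hθ
    rw [h, zero_pow (by omega), zero_mul] at this
    exact zero_ne_one this
  have hS : iS aL aR T (asmT aL aR T x) = (sT ((∑ j, aL j + 1) * (∑ j, aR j + 1)) T : ℂ) * x.2.2.2 := by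
    unfold iS iT asmT
    rw [hW]
    congr 1
    conv_lhs => rw [WW, mul_div_cancel_left₀ _ ht]
    exact hinv
  have hτ0 : (sT ((∑ j, aL j + 1) * (∑ j, aR j + 1)) T : ℂ) * x.2.2.2 ≠ 0 := mul_ne_zero hs hθ
  constructor
  · ext i
    unfold iY
    rw [hS]
    unfold asmT
    rw [hW, hL, div_eq_iff (mul_ne_zero hW0 (pow_ne_zero _ hτ0))]
    simp only [asm]; ring
  · ext i
    unfold iZ
    rw [hS]
    unfold asmT
    rw [hW, hRR, div_eq_iff (mul_ne_zero hW0 (pow_ne_zero _ hτ0))]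
    simp only [asm]; ring

lemma asmT_i (hR : Nonempty R) (haL : ∀ j, 1 ≤ aL j) (haR : ∀ j, 1 ≤ aR j) (T : ℝ) (hT : 0 < T) (ξ : Option (L ⊕ R) → ℂ) (hsum : ∑ j, (aO aL aR j : ℂ) * ξ j = 0)
    (hW0 : iW aL aR ξ ≠ 0) (cL cR : ℂ)
    (hinv : (iT aL aR T ξ) ^ (-((((∑ j, aL j + 1) * (∑ j, aR j + 1) : ℕ) : ℂ) / ((∑ j, aL j + 1 + (∑ j, aR j + 1) : ℕ) : ℂ))) = iW aL aR ξ / tT (∑ j, aL j + 1 + (∑ j, aR j + 1)) T) :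
    asmT aL aR T ((iY aL aR T ξ, cL), (iZ aL aR T ξ, cR), (iG aL aR ξ, iT aL aR T ξ)) = ξ := by
  have hs : (sT ((∑ j, aL j + 1) * (∑ j, aR j + 1)) T : ℂ) ≠ 0 := Complex.ofReal_ne_zero.2 (sT_pos _ _ hT).ne'
  have ht : (tT (∑ j, aL j + 1 + (∑ j, aR j + 1)) T : ℂ) ≠ 0 := Complex.ofReal_ne_zero.2 (tT_pos _ _ hT).ne'
  have hWW : WW aL aR T (iT aL aR T ξ) = iW aL aR ξ := by
    unfold WW
    rw [hinv, mul_div_cancel₀ _ ht]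
  have hθ : iT aL aR T ξ ≠ 0 := by
    unfold iT
    rw [Ne, Complex.cpow_eq_zero_iff]
    exact fun h => div_ne_zero hW0 ht h.1
  have hS0 : iS aL aR T ξ ≠ 0 := mul_ne_zero hs hθ
  have hsR : ∑ j, (aR j : ℂ) * ξ (fR L R j) = iR aR ξ * (∑ j, aR j : ℕ) := by
    unfold iR; rw [div_mul_cancel₀ _ (Nat.cast_ne_zero.2 (sum_pos_of aR haR hR))]
  have hsL : ∑ j, (aL j : ℂ) * ξ (fL L R j) = iL aL aR ξ * (∑ j, aL j : ℕ) := by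
    by_cases he : IsEmpty L
    · simp
    · rw [iL, if_neg he, div_mul_cancel₀ _ (Nat.cast_ne_zero.2 (sum_pos_of aL haL (not_isEmpty_iff.1 he)))]
  have hc : ξ none + iL aL aR ξ * (∑ j, aL j : ℕ) + iR aR ξ * (∑ j, aR j : ℕ) = 0 := by
    rw [← hsR, ← hsL, ← hsum]
    simp only [Fintype.sum_option, Fintype.sum_sum_type, aO, fL, fR]
    push_cast; ring
  have hmu : iW aL aR ξ * (0 - mu aL aR (iG aL aR ξ)) = iL aL aR ξ := by
    have h1 := mu_mul aL aR (iG aL aR ξ)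
    have h2 : iG aL aR ξ * iW aL aR ξ = ξ none - iL aL aR ξ := div_mul_cancel₀ _ hW0
    have h3 : ((∑ j, aL j + (∑ j, aR j + 1) : ℕ) : ℂ) ≠ 0 := Nat.cast_ne_zero.2 (by omega)
    apply mul_right_cancel₀ h3
    have h4 : iW aL aR ξ = iR aR ξ - iL aL aR ξ := rfl
    push_cast at h1 hc ⊢
    linear_combination -iW aL aR ξ * h1 - h2 - hc - (∑ j, (aR j : ℂ)) * h4
  unfold asmT
  simp only [hWW]
  ext j
  rcases j with _ | j | j
  · simp only [asm]
    have h2 : iG aL aR ξ * iW aL aR ξ = ξ none - iL aL aR ξ := div_mul_cancel₀ _ hW0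
    linear_combination h2 + hmu
  · simp only [asm]
    have h2 : iY aL aR T ξ j * (iW aL aR ξ * iS aL aR T ξ ^ (∑ j, aR j + 1)) = ξ (fL L R j) - iL aL aR ξ := div_mul_cancel₀ _ (mul_ne_zero hW0 (pow_ne_zero _ hS0))
    unfold iS at h2
    linear_combination h2 + hmu
  · simp only [asm]
    have h2 : iZ aL aR T ξ j * (iW aL aR ξ * iS aL aR T ξ ^ (∑ j, aL j + 1)) = ξ (fR L R j) - iR aR ξ := div_mul_cancel₀ _ (mul_ne_zero hW0 (pow_ne_zero _ hS0))
    have h4 : iW aL aR ξ = iR aR ξ - iL aL aR ξ := rfl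
    unfold iS at h2
    linear_combination h2 + hmu + h4

lemma i_sums (hR : Nonempty R) (haL : ∀ j, 1 ≤ aL j) (haR : ∀ j, 1 ≤ aR j) (T : ℝ) (ξ : Option (L ⊕ R) → ℂ) :
    ∑ j, (aL j : ℂ) * iY aL aR T ξ j = 0 ∧ ∑ j, (aR j : ℂ) * iZ aL aR T ξ j = 0 := by
  have hsR : ∑ j, (aR j : ℂ) * ξ (fR L R j) = iR aR ξ * (∑ j, aR j : ℕ) := by
    unfold iR; rw [div_mul_cancel₀ _ (Nat.cast_ne_zero.2 (sum_pos_of aR haR hR))]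
  have hsL : ∑ j, (aL j : ℂ) * ξ (fL L R j) = iL aL aR ξ * (∑ j, aL j : ℕ) := by
    by_cases he : IsEmpty L
    · simp
    · rw [iL, if_neg he, div_mul_cancel₀ _ (Nat.cast_ne_zero.2 (sum_pos_of aL haL (not_isEmpty_iff.1 he)))]
  have gen : ∀ {ι : Type} [Fintype ι] (a : ι → ℕ) (v : ι → ℂ) (b d : ℂ), ∑ j, (a j : ℂ) * v j = b * (∑ j, a j : ℕ) →
      ∑ j, (a j : ℂ) * ((v j - b) / d) = 0 := by
    intro ι _ a v b d h
    have : ∑ j, (a j : ℂ) * ((v j - b) / d) = (∑ j, (a j : ℂ) * v j - b * ∑ j, (a j : ℂ)) / d := by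
      rw [Finset.mul_sum, ← Finset.sum_sub_distrib, Finset.sum_div]
      exact Finset.sum_congr rfl fun j _ => by ring
    rw [this, h]; push_cast; ring
  exact ⟨gen aL _ _ _ hsL, gen aR _ _ _ hsR⟩

lemma iG_empty (hR : Nonempty R) (haL : ∀ j, 1 ≤ aL j) (haR : ∀ j, 1 ≤ aR j) (ξ : Option (L ⊕ R) → ℂ) (hsum : ∑ j, (aO aL aR j : ℂ) * ξ j = 0)
    (hW0 : iW aL aR ξ ≠ 0) (he : IsEmpty L) : ((∑ j, aL j + 1 + (∑ j, aR j + 1) : ℕ) : ℂ) * iG aL aR ξ = (∑ j, aL j + 1 : ℕ) := by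
  have hsR : ∑ j, (aR j : ℂ) * ξ (fR L R j) = iR aR ξ * (∑ j, aR j : ℕ) := by
    unfold iR; rw [div_mul_cancel₀ _ (Nat.cast_ne_zero.2 (sum_pos_of aR haR hR))]
  have hc : ξ none + iR aR ξ * (∑ j, aR j : ℕ) = 0 := by
    rw [← hsR, ← hsum]
    simp only [Fintype.sum_option, Fintype.sum_sum_type, aO, fL, fR, Fintype.sum_empty]
    push_cast; ring
  have h2 : iG aL aR ξ * iW aL aR ξ = ξ none - iL aL aR ξ := div_mul_cancel₀ _ hW0
  have h4 : iW aL aR ξ = iR aR ξ - iL aL aR ξ := rfl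
  have h5 : iL aL aR ξ = - (∑ j, aR j + 1 : ℕ) * iR aR ξ := by rw [iL, if_pos he]
  apply mul_right_cancel₀ hW0
  simp only [Fintype.sum_empty]
  push_cast at hc h5 ⊢
  linear_combination (1 + (∑ j, (aR j : ℂ)) + 1) * h2 + (1 + (∑ j, (aR j : ℂ)) + 1) * hc - h4 - (1 + (∑ j, (aR j : ℂ))) * h5

end recover

end cut4
end FO

open Polynomial
open scoped Classical
set_option linter.all false
namespace FO
open Filter Topology

section cut5
variable {L R : Type} [Fintype L] [Fintype R]

section clim
variable (aL : L → ℕ) (aR : R → ℕ) (uL : L → ℝ) (uR : R → ℝ)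

lemma Phi_c_lim (hR : Nonempty R) {I : Type*} {l : Filter I} [l.NeBot] (s : I → ℂ) (x : I → EE L R) (s0 : ℂ) (x0 : EE L R)
    (hs : Tendsto s l (𝓝 s0)) (hy : ∀ j, Tendsto (fun i => (x i).1.1 j) l (𝓝 (x0.1.1 j))) (hz : ∀ j, Tendsto (fun i => (x i).2.1.1 j) l (𝓝 (x0.2.1.1 j)))
    (hγ : Tendsto (fun i => (x i).2.2.1) l (𝓝 x0.2.2.1)) (hθ : Tendsto (fun i => (x i).2.2.2) l (𝓝 x0.2.2.2))
    (h : ∀ᶠ i in l, Phi aL aR uL uR (s i, x i) = 0) (h0 : Phi aL aR uL uR (s0, x0) = 0) :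
    Tendsto (fun i => (x i).1.2) l (𝓝 x0.1.2) ∧ Tendsto (fun i => (x i).2.1.2) l (𝓝 x0.2.1.2) := by
  have hτ : Tendsto (fun i => s i * (x i).2.2.2) l (𝓝 (s0 * x0.2.2.2)) := hs.mul hθ
  have hBL : PT l (fun i => BL aL aR (s i * (x i).2.2.2) (x i).2.2.1 (x i).1.1 (x i).2.1.1) (BL aL aR (s0 * x0.2.2.2) x0.2.2.1 x0.1.1 x0.2.1.1) :=
    PT.blk _ aR aL (hτ.pow _) hγ (fun j => tendsto_const_nhds.add ((hτ.pow _).mul (hz j))) hy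
  have hBR : PT l (fun i => BR aL aR (s i * (x i).2.2.2) (x i).2.2.1 (x i).1.1 (x i).2.1.1) (BR aL aR (s0 * x0.2.2.2) x0.2.2.1 x0.1.1 x0.2.1.1) :=
    PT.blk _ aL aR (hτ.pow _) (hγ.sub tendsto_const_nhds) (fun j => ((hτ.pow _).mul (hy j)).sub tendsto_const_nhds) hz
  constructor
  · by_cases he : IsEmpty L
    · have e0 : x0.1.2 = 0 := by
        have := congrArg (fun p => p.1.2) h0
        simpa [Phi, eS, he] using this
      rw [e0]
      refine tendsto_const_nhds.congr' ?_
      filter_upwards [h] with i hi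
      have := congrArg (fun p => p.1.2) hi
      simpa [Phi, eS, he] using this.symm
    · rw [not_isEmpty_iff] at he
      obtain ⟨j⟩ := he
      have e : ∀ s : ℂ, ∀ x : EE L R, Phi aL aR uL uR (s, x) = 0 → (uL j : ℂ) - (ad (BL aL aR (s * x.2.2.2) x.2.2.1 x.1.1 x.2.1.1)).eval (x.1.1 j) = x.1.2 := by
        intro s x hx
        have := congrFun (congrArg (fun p => p.1.1) hx) j
        simp only [Phi, eL, eval_add, eval_C, Prod.fst_zero, Pi.zero_apply] at this
        linear_combination -this
      rw [← e s0 x0 h0]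
      refine Tendsto.congr' ?_ (tendsto_const_nhds.sub (hBL.ad.eval (hy j)))
      filter_upwards [h] with i hi using e _ _ hi
  · obtain ⟨j⟩ := hR
    have e : ∀ s : ℂ, ∀ x : EE L R, Phi aL aR uL uR (s, x) = 0 → (uR j : ℂ) - (ad (BR aL aR (s * x.2.2.2) x.2.2.1 x.1.1 x.2.1.1)).eval (x.2.1.1 j) = x.2.1.2 := by
      intro s x hx
      have := congrFun (congrArg (fun p => p.2.1.1) hx) j
      simp only [Phi, eR, eval_add, eval_C, Prod.fst_zero, Prod.snd_zero, Pi.zero_apply] at this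
      linear_combination -this
    rw [← e s0 x0 h0]
    refine Tendsto.congr' ?_ (tendsto_const_nhds.sub (hBR.ad.eval (hz j)))
    filter_upwards [h] with i hi using e _ _ hi

lemma Phi_c_unique (hR : Nonempty R) (s : ℂ) (y : L → ℂ) (z : R → ℂ) (cL cR cL' cR' γ θ : ℂ)
    (h : Phi aL aR uL uR (s, ((y, cL), (z, cR), (γ, θ))) = 0) (h' : Phi aL aR uL uR (s, ((y, cL'), (z, cR'), (γ, θ))) = 0) :
    cL = cL' ∧ cR = cR' := by
  have := Phi_c_lim aL aR uL uR hR (l := (⊤ : Filter Unit)) (fun _ => s) (fun _ => ((y, cL), (z, cR), (γ, θ))) s ((y, cL'), (z, cR'), (γ, θ))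
    tendsto_const_nhds (fun _ => tendsto_const_nhds) (fun _ => tendsto_const_nhds) tendsto_const_nhds tendsto_const_nhds
    (Eventually.of_forall fun _ => h) h'
  exact ⟨tendsto_nhds_unique tendsto_const_nhds this.1, tendsto_nhds_unique tendsto_const_nhds this.2⟩

lemma asm_re (ρ t : ℝ) (μ γ : ℂ) (y : L → ℂ) (z : R → ℂ) :
    (∀ i, (asm aL aR (ρ : ℂ) μ (t : ℂ) γ y z (fL L R i)).re = ρ * (((t : ℂ) ^ (∑ j, aR j + 1) * y i).re - μ.re)) ∧
    (asm aL aR (ρ : ℂ) μ (t : ℂ) γ y z none).re = ρ * (γ.re - μ.re) ∧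
    (∀ j, (asm aL aR (ρ : ℂ) μ (t : ℂ) γ y z (fR L R j)).re = ρ * (1 + ((t : ℂ) ^ (∑ j, aL j + 1) * z j).re - μ.re)) := by
  refine ⟨fun i => ?_, ?_, fun j => ?_⟩
  · simp only [asm, fL, Complex.re_ofReal_mul, Complex.sub_re]
  · simp only [asm, Complex.re_ofReal_mul, Complex.sub_re]
  · simp only [asm, fR, Complex.re_ofReal_mul, Complex.sub_re, Complex.add_re, Complex.one_re]

lemma pow_re (t : ℝ) (n : ℕ) (y : ℂ) : ((t : ℂ) ^ n * y).re = t ^ n * y.re := by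
  rw [← Complex.ofReal_pow, Complex.re_ofReal_mul]

end clim

/-- the structural facts at a real zero of the system near the limit -/
lemma asm_isSol (D : LD (Option (L ⊕ R))) (hD : D.Good) (ha1 : D.a none = 1) (hrn : D.rel none none) (hR : Nonempty R)
    (s : L → L) (t : R → R) (hs : Function.Involutive s) (ht : Function.Involutive t)
    (hsr : ∀ j, D.rel (fL L R j) (fL L R (s j))) (htr : ∀ j, D.rel (fR L R j) (fR L R (t j)))
    (T : ℝ) (hT : 0 < T) (y : L → ℂ) (z : R → ℂ) (cL cR γ θ : ℂ)
    (hPhi : Phi (D.comap (fL L R)).a (D.comap (fR L R)).a (D.comap (fL L R)).u (D.comap (fR L R)).u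
      (((sT ((∑ j, (D.comap (fL L R)).a j + 1) * (∑ j, (D.comap (fR L R)).a j + 1)) T : ℝ) : ℂ), ((y, cL), (z, cR), (γ, θ))) = 0)
    (hJ : JJ s t ((y, cL), (z, cR), (γ, θ)) = ((y, cL), (z, cR), (γ, θ)))
    (hθ : 0 < θ.re) (hyi : Function.Injective y) (hzi : Function.Injective z)
    (ho1 : ∀ i, ((((sT ((∑ j, (D.comap (fL L R)).a j + 1) * (∑ j, (D.comap (fR L R)).a j + 1)) T : ℝ) : ℂ) * θ) ^ (∑ j, (D.comap (fR L R)).a j + 1) * y i).re < γ.re)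
    (ho2 : ∀ j, γ.re < 1 + ((((sT ((∑ j, (D.comap (fL L R)).a j + 1) * (∑ j, (D.comap (fR L R)).a j + 1)) T : ℝ) : ℂ) * θ) ^ (∑ j, (D.comap (fL L R)).a j + 1) * z j).re) 
    (ξ : Option (L ⊕ R) → ℂ) (hξ : ξ = asmT (D.comap (fL L R)).a (D.comap (fR L R)).a T ((y, cL), (z, cR), (γ, θ))) :
    IsSol (D.top T) ξ ∧ sg D ξ = (-1) ^ crs D * (sg (D.comap (fL L R)) y * sg (D.comap (fR L R)) z) ∧
    (∀ i, (ξ (fL L R i)).re < (ξ none).re) ∧ (∀ j, (ξ none).re < (ξ (fR L R j)).re) := by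
  have haO := aO_eq D ha1
  set aL := (D.comap (fL L R)).a with haL
  set aR := (D.comap (fR L R)).a with haR
  set sv := sT ((∑ j, aL j + 1) * (∑ j, aR j + 1)) T with hsv
  have hsv0 : 0 < sv := sT_pos _ _ hT
  simp only [JJ, Prod.mk.injEq] at hJ
  obtain ⟨⟨hJy, -⟩, ⟨hJz, -⟩, hJγ, hJθ⟩ := hJ
  obtain ⟨θ', rfl⟩ := Complex.conj_eq_iff_real.1 hJθ
  obtain ⟨γ', rfl⟩ := Complex.conj_eq_iff_real.1 hJγ
  have hθ' : 0 < θ' := by simpa using hθ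
  obtain ⟨ρ, hρ, hW⟩ := WW_real aL aR T hT θ' hθ'
  have hτ : ((sv : ℂ) * (θ' : ℂ)) = ((sv * θ' : ℝ) : ℂ) := by push_cast; rfl
  have hτ0 : 0 < sv * θ' := mul_pos hsv0 hθ'
  have hW' := WW_pow aL aR T hT θ' (by exact_mod_cast hθ'.ne')
  have hξ' : ξ = asm aL aR (ρ : ℂ) (mu aL aR γ') ((sv * θ' : ℝ) : ℂ) γ' y z := by
    rw [hξ, asmT]
    simp only
    rw [hW, hτ]
  rw [hτ] at ho1 ho2
  obtain ⟨r1, r2, r3⟩ := asm_re aL aR ρ (sv * θ') (mu aL aR γ') γ' y z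
  rw [← hξ'] at r1 r2 r3
  have o1 : ∀ i, (ξ (fL L R i)).re < (ξ none).re := by
    intro i
    rw [r1, r2]
    have := ho1 i
    exact mul_lt_mul_of_pos_left (by linarith) hρ
  have o2 : ∀ j, (ξ none).re < (ξ (fR L R j)).re := by
    intro i
    rw [r3, r2]
    have := ho2 i
    exact mul_lt_mul_of_pos_left (by linarith) hρ
  have hμ : (starRingEnd ℂ) (mu aL aR γ') = mu aL aR γ' := by
    simp [mu]
  refine ⟨⟨?_, ?_, ?_, ?_⟩, ?_, o1, o2⟩
  · -- injective
    have o3 : ∀ i j, (ξ (fL L R i)).re < (ξ (fR L R j)).re := fun i j => (o1 i).trans (o2 j)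
    have e1 : ∀ i j, ξ (fL L R i) = ξ (fL L R j) → i = j := by
      intro i j h
      rw [hξ'] at h
      simp only [asm, fL] at h
      have hρc : (ρ : ℂ) ≠ 0 := by exact_mod_cast hρ.ne'
      have hτc : ((sv * θ' : ℝ) : ℂ) ^ (∑ j, aR j + 1) ≠ 0 := pow_ne_zero _ (by exact_mod_cast hτ0.ne')
      exact hyi (mul_left_cancel₀ hτc (sub_left_injective (mul_left_cancel₀ hρc h)))
    have e2 : ∀ i j, ξ (fR L R i) = ξ (fR L R j) → i = j := by
      intro i j h
      rw [hξ'] at h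
      simp only [asm, fR] at h
      have hρc : (ρ : ℂ) ≠ 0 := by exact_mod_cast hρ.ne'
      have hτc : ((sv * θ' : ℝ) : ℂ) ^ (∑ j, aL j + 1) ≠ 0 := pow_ne_zero _ (by exact_mod_cast hτ0.ne')
      exact hzi (mul_left_cancel₀ hτc (add_right_injective _ (sub_left_injective (mul_left_cancel₀ hρc h))))
    intro i j h
    rcases i with _ | i | i <;> rcases j with _ | j | j
    · rfl
    · exact absurd (congrArg Complex.re h) (o1 j).ne'
    · exact absurd (congrArg Complex.re h) (o2 j).ne
    · exact absurd (congrArg Complex.re h) (o1 i).ne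
    · rw [e1 i j h]
    · exact absurd (congrArg Complex.re h) (o3 i j).ne
    · exact absurd (congrArg Complex.re h) (o2 i).ne'
    · exact absurd (congrArg Complex.re h) (o3 j i).ne'
    · rw [e2 i j h]
  · -- reality
    intro i
    rcases i with _ | i | i
    · refine ⟨none, hrn, ?_⟩
      rw [hξ']; simp [asm, hμ]
    · refine ⟨fL L R (s i), hsr i, ?_⟩
      have := congrFun hJy (s i)
      simp only [Jb, hs i] at this
      rw [hξ']; simp [asm, hμ, fL, ← this]
    · refine ⟨fR L R (t i), htr i, ?_⟩
      have := congrFun hJz (t i)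
      simp only [Jb, ht i] at this
      rw [hξ']; simp [asm, hμ, fR, ← this]
  · have : (D.top T).a = aO aL aR := haO
    rw [this, hξ']
    have hP1 := congrArg (fun p => p.1.2) hPhi
    have hP2 := congrArg (fun p => p.2.1.2) hPhi
    simp only [Phi, eS, Prod.fst_zero, Prod.snd_zero] at hP1 hP2
    refine asm_sum aL aR _ _ _ _ _ _ ?_ ?_ (mu_mul _ _ _)
    · by_cases he : IsEmpty L
      · simp
      · simpa [he] using hP1
    · simpa [not_isEmpty_iff.2 hR] using hP2
  · have hsp := sT_pow ((∑ j, aL j + 1) * (∑ j, aR j + 1)) (mul_ne_zero (Nat.succ_ne_zero _) (Nat.succ_ne_zero _)) T hT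
    rw [hW] at hW'
    obtain ⟨P, hP1, hP2, hP3, hP4⟩ := link_fwd aL aR _ _ hR ρ (mu aL aR γ') sv γ' θ' T cL cR y z hsp hW' hPhi
    refine ⟨P, ?_, ?_⟩
    · have : (D.top T).a = aO aL aR := haO
      rw [this, hP1, aO_sum, hξ', hτ]
    · rw [hτ, ← hξ'] at hP2 hP3 hP4
      intro j
      rcases j with _ | j | j
      · exact hP4
      · exact hP2 j
      · exact hP3 j
  · refine sg_order D ξ y z o1 o2 ?_ ?_
    · intro i j
      rw [r1, r1, mul_lt_mul_iff_right₀ hρ, sub_lt_sub_iff_right, pow_re, pow_re, mul_lt_mul_iff_right₀ (pow_pos hτ0 _)]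
    · intro i j
      rw [r3, r3, mul_lt_mul_iff_right₀ hρ, sub_lt_sub_iff_right, pow_re, pow_re, add_lt_add_iff_left, mul_lt_mul_iff_right₀ (pow_pos hτ0 _)]

end cut5
end FO

open Polynomial
open scoped Classical
set_option linter.all false
namespace FO
open Filter Topology

section cut6
variable {L R : Type} [Fintype L] [Fintype R]

lemma nl_exps (p q : ℕ) (hp : p ≠ 0) (hq : q ≠ 0) : (-((p : ℂ) / (q : ℂ))) * (-((q : ℂ) / (p : ℂ))) = 1 := by
  have h1 : (p : ℂ) ≠ 0 := Nat.cast_ne_zero.2 hp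
  have h2 : (q : ℂ) ≠ 0 := Nat.cast_ne_zero.2 hq
  field_simp

lemma CUT_cont (D : LD (Option (L ⊕ R))) (hD : D.Good) (ha1 : D.a none = 1) (hrn : D.rel none none)
    (hr : Odd (∑ j, (D.comap (fR L R)).a j)) (y0 : L → ℂ) (z0 : R → ℂ)
    (hy : IsSol (D.comap (fL L R)) y0) (hz : IsSol (D.comap (fR L R)) z0) :
    ∃ ψ : ℝ → Option (L ⊕ R) → ℂ,
      (∀ᶠ T in atTop, IsSol (D.top T) (ψ T) ∧
        sg D (ψ T) = (-1) ^ crs D * (sg (D.comap (fL L R)) y0 * sg (D.comap (fR L R)) z0) ∧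
        (∀ i, (ψ T (fL L R i)).re < (ψ T none).re) ∧ (∀ j, (ψ T none).re < (ψ T (fR L R j)).re)) ∧
      Tendsto (fun T => iY (D.comap (fL L R)).a (D.comap (fR L R)).a T (ψ T)) atTop (𝓝 y0) ∧
      Tendsto (fun T => iZ (D.comap (fL L R)).a (D.comap (fR L R)).a T (ψ T)) atTop (𝓝 z0) ∧
      ∀ U : Ultrafilter ℝ, (U : Filter ℝ) ≤ atTop → ∀ ξ : ℝ → Option (L ⊕ R) → ℂ, (∀ᶠ T in U, IsSol (D.top T) (ξ T)) →
        Tendsto (fun T => iY (D.comap (fL L R)).a (D.comap (fR L R)).a T (ξ T)) U (𝓝 y0) →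
        Tendsto (fun T => iZ (D.comap (fL L R)).a (D.comap (fR L R)).a T (ξ T)) U (𝓝 z0) →
        Tendsto (fun T => iG (D.comap (fL L R)).a (D.comap (fR L R)).a (ξ T)) U (𝓝 (gam (D.comap (fL L R)).a (D.comap (fR L R)).a : ℂ)) →
        Tendsto (fun T => iT (D.comap (fL L R)).a (D.comap (fR L R)).a T (ξ T)) U (𝓝 (tht (D.comap (fL L R)).a (D.comap (fR L R)).a : ℂ)) →
        ∀ ω0 : ℝ, 0 < ω0 → Tendsto (fun T => iW (D.comap (fL L R)).a (D.comap (fR L R)).a (ξ T) /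
          tT (∑ j, (D.comap (fL L R)).a j + 1 + (∑ j, (D.comap (fR L R)).a j + 1)) T) U (𝓝 (ω0 : ℂ)) → 
        ∀ᶠ T in U, ξ T = ψ T := by
  have haO := aO_eq D ha1
  have hDL := hD.comap _ (fL_inj (L := L) (R := R))
  have hDR := hD.comap _ (fR_inj (L := L) (R := R))
  have hRne : Nonempty R := by
    by_contra h
    rw [not_nonempty_iff] at h
    simp at hr
  obtain ⟨cL, cR, h0⟩ := cut_zero D hr hD y0 z0 hy hz
  obtain ⟨s, hs, hsr, hsa, hsu, hsy⟩ := hy.2.1.exists_sigma hDL hy.1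
  obtain ⟨t, ht, htr, hta, htu, htz⟩ := hz.2.1.exists_sigma hDR hz.1
  have hai := asm_isSol D hD ha1 hrn hRne s t hs ht hsr htr
  have hposL := hDL.pos
  have hposR := hDR.pos
  have hγ0 := gam_pos (D.comap (fL L R)).a (D.comap (fR L R)).a
  have hγ1 := gam_lt (D.comap (fL L R)).a (D.comap (fR L R)).a
  have hθ0 := tht_pos (D.comap (fL L R)).a (D.comap (fR L R)).a
  have hγm := gam_mulC (D.comap (fL L R)).a (D.comap (fR L R)).a
  set aL := (D.comap (fL L R)).a with haL
  set aR := (D.comap (fR L R)).a with haR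
  set uL := (D.comap (fL L R)).u with huL
  set uR := (D.comap (fR L R)).u with huR
  set N := (∑ j, aL j + 1) * (∑ j, aR j + 1) with hN
  set n := ∑ j, aL j + 1 + (∑ j, aR j + 1) with hn
  have hN0 : N ≠ 0 := mul_ne_zero (Nat.succ_ne_zero _) (Nat.succ_ne_zero _)
  have hn0 : n ≠ 0 := by omega
  set g := gam aL aR with hg
  set h := tht aL aR with hh
  set x0 : EE L R := ((y0, cL), (z0, cR), ((g : ℂ), (h : ℂ))) with hx0
  obtain ⟨φ, hφ1, hφ2, hφ3⟩ := IFT (Phi aL aR uL uR) 0 x0 (Phi_smooth aL aR uL uR) h0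
    (fun v hv => Phi_ker aL aR uL uR hposL hposR hRne y0 z0 cL cR g h hy.1 hz.1 hγm (by exact_mod_cast hθ0.ne') v hv)
  have hJc := Phi_conj aL aR uL uR s t hs ht hsa hta hsu htu
  have hJ0 : JJ s t x0 = x0 := by
    have h1 : Jb s y0 = y0 := by ext j; simp [Jb, hsy]
    have h2 : Jb t z0 = z0 := by ext j; simp [Jb, htz]
    have h3 := hJc 0 x0 (by simpa using h0)
    simp only [hx0, JJ, h1, h2, Complex.conj_ofReal, Complex.ofReal_zero] at h3 ⊢
    obtain ⟨e1, e2⟩ := Phi_c_unique aL aR uL uR hRne 0 y0 z0 _ _ _ _ _ _ h3 h0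
    rw [e1, e2]
  have hJ := IFT_conj (Phi aL aR uL uR) 0 x0 φ hφ1 hφ2 hφ3 (JJ s t) (JJ_cont s t) hJ0 hJc
  have hsl : Tendsto (fun T : ℝ => ((sT N T : ℝ) : ℂ)) atTop (𝓝 0) := by
    have := (Complex.continuous_ofReal.tendsto 0).comp (sT_lim N hN0)
    rw [Complex.ofReal_zero] at this
    exact this
  set x : ℝ → EE L R := fun T => φ (sT N T : ℂ) with hx
  have hxl : Tendsto x atTop (𝓝 x0) := hφ1.comp hsl
  have hxy : Tendsto (fun T => (x T).1.1) atTop (𝓝 y0) := 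
    (((continuous_fst.comp continuous_fst).tendsto x0).comp hxl)
  have hxz : Tendsto (fun T => (x T).2.1.1) atTop (𝓝 z0) := 
    (((continuous_fst.comp (continuous_fst.comp continuous_snd)).tendsto x0).comp hxl)
  have hxγ : Tendsto (fun T => (x T).2.2.1) atTop (𝓝 (g : ℂ)) := 
    (((continuous_fst.comp (continuous_snd.comp continuous_snd)).tendsto x0).comp hxl)
  have hxθ : Tendsto (fun T => (x T).2.2.2) atTop (𝓝 (h : ℂ)) := 
    (((continuous_snd.comp (continuous_snd.comp continuous_snd)).tendsto x0).comp hxl)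
  have hτl : Tendsto (fun T => ((sT N T : ℝ) : ℂ) * (x T).2.2.2) atTop (𝓝 0) := by
    have := hsl.mul hxθ
    simpa using this
  have hPhi : ∀ᶠ T in atTop, Phi aL aR uL uR ((sT N T : ℂ), x T) = 0 := hsl.eventually hφ3
  have hJe : ∀ᶠ T in atTop, JJ s t (x T) = x T := by
    filter_upwards [hsl.eventually hJ] with T hT using hT _ rfl
  have hre : ∀ {f : ℝ → ℂ} {c : ℂ}, Tendsto f atTop (𝓝 c) → Tendsto (fun T => (f T).re) atTop (𝓝 c.re) :=
    fun hf => (Complex.continuous_re.tendsto _).comp hf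
  have hxyj := tendsto_pi_nhds.1 hxy
  have hxzj := tendsto_pi_nhds.1 hxz
  have ho1 : ∀ᶠ T in atTop, ∀ i, ((((sT N T : ℝ) : ℂ) * (x T).2.2.2) ^ (∑ j, aR j + 1) * (x T).1.1 i).re < (x T).2.2.1.re := by
    refine eventually_all.2 fun i => ?_
    have h1 := hre ((hτl.pow (∑ j, aR j + 1)).mul (hxyj i))
    refine h1.eventually_lt (hre hxγ) ?_
    rw [zero_pow (Nat.succ_ne_zero _)]
    simpa using hγ0
  have ho2 : ∀ᶠ T in atTop, ∀ j, (x T).2.2.1.re < 1 + ((((sT N T : ℝ) : ℂ) * (x T).2.2.2) ^ (∑ j, aL j + 1) * (x T).2.1.1 j).re := by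
    refine eventually_all.2 fun i => ?_
    have h1 := hre ((hτl.pow (∑ j, aL j + 1)).mul (hxzj i))
    refine (hre hxγ).eventually_lt (tendsto_const_nhds.add h1) ?_
    rw [zero_pow (Nat.succ_ne_zero _)]
    simpa using hγ1
  have hθp : ∀ᶠ T in atTop, 0 < (x T).2.2.2.re := (hre hxθ).eventually (lt_mem_nhds (by simpa using hθ0))
  have hyi := inj_ev _ _ _ hxyj hy.1
  have hzi := inj_ev _ _ _ hxzj hz.1
  have hsy := sg_ev hDL _ _ _ hxyj hy.1 hy.2.1
  have hsz := sg_ev hDR _ _ _ hxzj hz.1 hz.2.1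
  have hsums : ∀ᶠ T in atTop, ∑ j, (aL j : ℂ) * (x T).1.1 j = 0 ∧ ∑ j, (aR j : ℂ) * (x T).2.1.1 j = 0 ∧ 
      (IsEmpty L → (n : ℂ) * (x T).2.2.1 = (∑ j, aL j + 1 : ℕ)) := by
    filter_upwards [hPhi] with T hT
    have hP1 := congrArg (fun p => p.1.2) hT
    have hP2 := congrArg (fun p => p.2.1.2) hT
    have hP3 := congrArg (fun p => p.2.2.1) hT
    simp only [Phi, eS, eC, Prod.fst_zero, Prod.snd_zero] at hP1 hP2 hP3
    refine ⟨?_, ?_, ?_⟩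
    · by_cases he : IsEmpty L
      · simp
      · simpa [he] using hP1
    · simpa [not_isEmpty_iff.2 hRne] using hP2
    · intro he
      rw [if_pos he] at hP3
      exact sub_eq_zero.1 hP3
  have hinv : ∀ᶠ T in atTop, ((x T).2.2.2 ^ (-((N : ℂ) / (n : ℂ)))) ^ (-((n : ℂ) / (N : ℂ))) = (x T).2.2.2 :=
    cpow_inv_lim _ h hθ0 hxθ _ _ ⟨-((N : ℝ) / (n : ℝ)), by simp only [Complex.ofReal_neg, Complex.ofReal_div, Complex.ofReal_natCast]⟩ (nl_exps N n hN0 hn0)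
  have hrec : ∀ᶠ T in atTop, iY aL aR T (asmT aL aR T (x T)) = (x T).1.1 ∧ iZ aL aR T (asmT aL aR T (x T)) = (x T).2.1.1 := by
    filter_upwards [hinv, hsums, hθp, eventually_gt_atTop 0] with T h1 h2 h3 h4
    refine i_asmT aL aR hRne hposL hposR T h4 (x T) h2.1 h2.2.1 h2.2.2 ?_ h1
    intro e
    rw [e] at h3; simp at h3
  refine ⟨fun T => asmT aL aR T (x T), ?_, ?_, ?_, ?_⟩
  · filter_upwards [hPhi, hJe, ho1, ho2, hθp, hyi, hzi, hsy, hsz, eventually_gt_atTop 0] with T k1 k2 k3 k4 k5 k6 k7 k8 k9 k10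
    obtain ⟨m1, m2, m3, m4⟩ := hai T k10 (x T).1.1 (x T).2.1.1 (x T).1.2 (x T).2.1.2 (x T).2.2.1 (x T).2.2.2 k1 k2 k5 k6 k7 k3 k4 _ rfl
    refine ⟨m1, ?_, m3, m4⟩
    rw [← k8, ← k9]
    exact m2
  · exact hxy.congr' (by filter_upwards [hrec] with T hT using hT.1.symm)
  · exact hxz.congr' (by filter_upwards [hrec] with T hT using hT.2.symm)
  · intro U hU ξ hsol hY hZ hG hθ ω0 hω0 hω
    have hP : ∀ T, ∃ P : ℂ[X], IsSol (D.top T) (ξ T) → derivative P = C ((∑ j, (D.top T).a j + 1 : ℕ):ℂ) * cp (D.top T).a (ξ T) ∧ 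
        ∀ j, P.eval (ξ T j) = ((D.top T).u j:ℂ) := by
      intro T
      by_cases hh : IsSol (D.top T) (ξ T)
      · obtain ⟨P, hP⟩ := hh.2.2.2
        exact ⟨P, fun _ => hP⟩
      · exact ⟨0, fun h' => absurd h' hh⟩
    choose P hP using hP
    set w : ℝ → ℂ := fun T => WW aL aR T (iT aL aR T (ξ T)) with hw
    set X : ℝ → EE L R := fun T => ((iY aL aR T (ξ T), if IsEmpty L then 0 else (P T).eval (w T * (0 - mu aL aR (iG aL aR (ξ T))))), 
      (iZ aL aR T (ξ T), (P T).eval (w T * (1 - mu aL aR (iG aL aR (ξ T))))), (iG aL aR (ξ T), iT aL aR T (ξ T))) with hX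
    have hpos : ∀ᶠ T in (U : Filter ℝ), 0 < T := hU (eventually_gt_atTop 0)
    have hW0 : ∀ᶠ T in (U : Filter ℝ), iW aL aR (ξ T) ≠ 0 := by
      filter_upwards [hω.eventually_ne (by exact_mod_cast hω0.ne' : (ω0 : ℂ) ≠ 0)] with T hT e
      rw [e, zero_div] at hT
      exact hT rfl
    have hθne : ∀ᶠ T in (U : Filter ℝ), iT aL aR T (ξ T) ≠ 0 := hθ.eventually_ne (by exact_mod_cast hθ0.ne')
    have hinv2 : ∀ᶠ T in (U : Filter ℝ), (iT aL aR T (ξ T)) ^ (-((N : ℂ) / (n : ℂ))) = iW aL aR (ξ T) / tT n T :=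
      cpow_inv_lim _ ω0 hω0 hω _ _ ⟨-((n : ℝ) / (N : ℝ)), by simp only [Complex.ofReal_neg, Complex.ofReal_div, Complex.ofReal_natCast]; rfl⟩ (nl_exps n N hn0 hN0)
    have hasm : ∀ᶠ T in (U : Filter ℝ), asmT aL aR T (X T) = ξ T := by
      filter_upwards [hpos, hsol, hW0, hinv2] with T k1 k2 k3 k4
      have hsum := k2.2.2.1
      have e : (D.top T).a = aO aL aR := haO
      rw [e] at hsum
      exact asmT_i aL aR hRne hposL hposR T k1 (ξ T) hsum k3 _ _ k4
    have hPhiX : ∀ᶠ T in (U : Filter ℝ), Phi aL aR uL uR ((sT N T : ℂ), X T) = 0 := by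
      filter_upwards [hpos, hsol, hW0, hasm, hθne] with T k1 k2 k3 k4 k5
      have hsum := k2.2.2.1
      have e : (D.top T).a = aO aL aR := haO
      rw [e] at hsum
      obtain ⟨p1, p2⟩ := hP T k2
      rw [e, aO_sum] at p1
      have s1 := i_sums aL aR hRne hposL hposR T (ξ T)
      have k4' : asm aL aR (w T) (mu aL aR (iG aL aR (ξ T))) ((sT N T : ℂ) * iT aL aR T (ξ T)) (iG aL aR (ξ T)) (iY aL aR T (ξ T)) (iZ aL aR T (ξ T)) = ξ T := k4
      refine link_back aL aR uL uR hRne (w T) (mu aL aR (iG aL aR (ξ T))) (sT N T) (iG aL aR (ξ T)) (iT aL aR T (ξ T)) T _ _ (P T) 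
        (sT_pow N hN0 T k1) (WW_pow aL aR T k1 _ k5) ?_ ?_ ?_ ?_ s1.1 s1.2 (iG_empty aL aR hRne hposL hposR (ξ T) hsum k3)
      · rw [k4', p1]
      · rw [k4']; intro j; exact p2 _
      · rw [k4']; intro j; exact p2 _
      · rw [k4']; exact p2 none
    have hslU := hsl.mono_left hU
    have hclim := Phi_c_lim aL aR uL uR hRne (l := (U : Filter ℝ)) (fun T => (sT N T : ℂ)) X 0 x0 hslU (tendsto_pi_nhds.1 hY) (tendsto_pi_nhds.1 hZ) hG hθ hPhiX h0
    have hXl : Tendsto (fun T => (((sT N T : ℝ) : ℂ), X T)) U (𝓝 ((0 : ℂ), x0)) :=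
      hslU.prodMk_nhds ((hY.prodMk_nhds hclim.1).prodMk_nhds ((hZ.prodMk_nhds hclim.2).prodMk_nhds (hG.prodMk_nhds hθ)))
    filter_upwards [hXl.eventually hφ2, hPhiX, hasm] with T k1 k2 k3
    have := k1.1 k2
    rw [← k3, ← this]

end cut6
end FO

open Polynomial
open scoped Classical
set_option linter.all false
namespace FO
open Filter Topology

section cut7
variable {L R : Type} [Fintype L] [Fintype R]

lemma Rl_sum {ι : Type*} [Fintype ι] {D : LD ι} (hD : D.Good) {ξ : ι → ℂ} (h : Rl D ξ) (hi : Function.Injective ξ) :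
    (starRingEnd ℂ) (∑ j, (D.a j : ℂ) * ξ j) = ∑ j, (D.a j : ℂ) * ξ j := by
  obtain ⟨s, hs, -, ha, -, hξ⟩ := h.exists_sigma hD hi
  rw [map_sum, ← Equiv.sum_comp hs.toPerm (fun j => (D.a j : ℂ) * ξ j)]
  refine Finset.sum_congr rfl fun j _ => ?_
  simp [ha, hξ]

lemma Rl_lim {ι : Type*} [Finite ι] {D : LD ι} {I : Type*} (U : Ultrafilter I) (y : I → ι → ℂ) (y0 : ι → ℂ)
    (hy : Tendsto y U (𝓝 y0)) (h : ∀ᶠ i in U, Rl D (y i)) : Rl D y0 := by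
  intro i
  obtain ⟨j, hj⟩ := ultra_exists U (fun j t => D.rel i j ∧ y t j = (starRingEnd ℂ) (y t i)) (h.mono fun t ht => ht i)
  have hyj := tendsto_pi_nhds.1 hy
  obtain ⟨t, ht⟩ := hj.exists
  refine ⟨j, ht.1, tendsto_nhds_unique (hyj j) ?_⟩
  exact ((Complex.continuous_conj.tendsto _).comp (hyj i)).congr' (hj.mono fun t ht => ht.2.symm)

lemma Rl_aff {ι : Type*} {D : LD ι} (ξ : ι → ℂ) (b d : ℂ) (hb : (starRingEnd ℂ) b = b) (hd : (starRingEnd ℂ) d = d) (h : Rl D ξ) :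
    Rl D (fun i => (ξ i - b) / d) := by
  intro i
  obtain ⟨j, h1, h2⟩ := h i
  exact ⟨j, h1, by simp [h2, hb, hd]⟩

lemma ratio_lim {ι : Type*} [Fintype ι] {I : Type*} {l : Filter I} (a : ι → ℕ) (ha : ∑ j, a j ≠ 0) (v : I → ι → ℂ) (t : I → ℂ) (b : ℂ)
    (h : ∀ j, Tendsto (fun i => v i j / t i) l (𝓝 b)) :
    Tendsto (fun i => ((∑ j, (a j : ℂ) * v i j) / (∑ j, a j : ℕ)) / t i) l (𝓝 b) := by
  have h1 : Tendsto (fun i => (∑ j, (a j : ℂ) * (v i j / t i)) / (∑ j, a j : ℕ)) l (𝓝 ((∑ j, (a j : ℂ) * b) / (∑ j, a j : ℕ))) :=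
    (tendsto_finsetSum _ fun j _ => (h j).const_mul _).div_const _
  have e : (∑ j, (a j : ℂ) * b) / (∑ j, a j : ℕ) = b := by
    rw [← Finset.sum_mul]
    have : ((∑ j, a j : ℕ) : ℂ) ≠ 0 := Nat.cast_ne_zero.2 ha
    push_cast at this ⊢
    field_simp
  rw [e] at h1
  refine h1.congr fun i => ?_
  rw [Finset.sum_div, Finset.sum_div, Finset.sum_div]
  exact Finset.sum_congr rfl fun j _ => by ring

lemma CUT_compact (D : LD (Option (L ⊕ R))) (hD : D.Good) (ha1 : D.a none = 1) (hrn : D.rel none none)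
    (hr : Odd (∑ j, (D.comap (fR L R)).a j)) (U : Ultrafilter ℝ) (hU : (U : Filter ℝ) ≤ atTop)
    (ξ : ℝ → Option (L ⊕ R) → ℂ) (hsol : ∀ᶠ T in U, IsSol (D.top T) (ξ T)) (α β c0 : ℝ) (hαβ : α < β)
    (hl : ∀ i, Tendsto (fun T => ξ T (fL L R i) / (tT (∑ j, (D.comap (fL L R)).a j + 1 + (∑ j, (D.comap (fR L R)).a j + 1)) T : ℂ)) U (𝓝 (α : ℂ)))
    (hrt : ∀ i, Tendsto (fun T => ξ T (fR L R i) / (tT (∑ j, (D.comap (fL L R)).a j + 1 + (∑ j, (D.comap (fR L R)).a j + 1)) T : ℂ)) U (𝓝 (β : ℂ)))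
    (hct : Tendsto (fun T => ξ T none / (tT (∑ j, (D.comap (fL L R)).a j + 1 + (∑ j, (D.comap (fR L R)).a j + 1)) T : ℂ)) U (𝓝 (c0 : ℂ)))
    (hα : IsEmpty L → α = - ((∑ j, (D.comap (fR L R)).a j + 1 : ℕ) : ℝ) * β)
    (hc0 : c0 - α = gam (D.comap (fL L R)).a (D.comap (fR L R)).a * (β - α))
    (hβ : (β - α) ^ (∑ j, (D.comap (fL L R)).a j + 1 + (∑ j, (D.comap (fR L R)).a j + 1)) * 
      (gam (D.comap (fL L R)).a (D.comap (fR L R)).a ^ (∑ j, (D.comap (fL L R)).a j + 1) * 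
       (1 - gam (D.comap (fL L R)).a (D.comap (fR L R)).a) ^ (∑ j, (D.comap (fR L R)).a j + 1)) = 1) :
    ∃ y0 z0, IsSol (D.comap (fL L R)) y0 ∧ IsSol (D.comap (fR L R)) z0 ∧
        Tendsto (fun T => iY (D.comap (fL L R)).a (D.comap (fR L R)).a T (ξ T)) U (𝓝 y0) ∧
        Tendsto (fun T => iZ (D.comap (fL L R)).a (D.comap (fR L R)).a T (ξ T)) U (𝓝 z0) ∧
        Tendsto (fun T => iG (D.comap (fL L R)).a (D.comap (fR L R)).a (ξ T)) U (𝓝 (gam (D.comap (fL L R)).a (D.comap (fR L R)).a : ℂ)) ∧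
        Tendsto (fun T => iT (D.comap (fL L R)).a (D.comap (fR L R)).a T (ξ T)) U (𝓝 (tht (D.comap (fL L R)).a (D.comap (fR L R)).a : ℂ)) ∧
        Tendsto (fun T => iW (D.comap (fL L R)).a (D.comap (fR L R)).a (ξ T) /
          tT (∑ j, (D.comap (fL L R)).a j + 1 + (∑ j, (D.comap (fR L R)).a j + 1)) T) U (𝓝 ((β - α : ℝ) : ℂ)) := by
  have haO := aO_eq D ha1
  have hDL := hD.comap _ (fL_inj (L := L) (R := R))
  have hDR := hD.comap _ (fR_inj (L := L) (R := R))
  have hRne : Nonempty R := by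
    by_contra h
    rw [not_nonempty_iff] at h
    simp at hr
  have hposL := hDL.pos
  have hposR := hDR.pos
  have hγ0 := gam_pos (D.comap (fL L R)).a (D.comap (fR L R)).a
  have hγ1 := gam_lt (D.comap (fL L R)).a (D.comap (fR L R)).a
  have hθ0 := tht_pos (D.comap (fL L R)).a (D.comap (fR L R)).a
  have hθN := tht_pow (D.comap (fL L R)).a (D.comap (fR L R)).a
  have hγm := gam_mulC (D.comap (fL L R)).a (D.comap (fR L R)).a
  have RsL : ∀ ξ : L → ℂ, Rl (D.comap (fL L R)) ξ → Function.Injective ξ → (starRingEnd ℂ) (∑ j, ((D.comap (fL L R)).a j : ℂ) * ξ j) = ∑ j, ((D.comap (fL L R)).a j : ℂ) * ξ j :=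
    fun ξ => Rl_sum hDL
  have RsR : ∀ ξ : R → ℂ, Rl (D.comap (fR L R)) ξ → Function.Injective ξ → (starRingEnd ℂ) (∑ j, ((D.comap (fR L R)).a j : ℂ) * ξ j) = ∑ j, ((D.comap (fR L R)).a j : ℂ) * ξ j :=
    fun ξ => Rl_sum hDR
  set aL := (D.comap (fL L R)).a with haL
  set aR := (D.comap (fR L R)).a with haR
  set N := (∑ j, aL j + 1) * (∑ j, aR j + 1) with hN
  set n := ∑ j, aL j + 1 + (∑ j, aR j + 1) with hn
  have hN0 : N ≠ 0 := mul_ne_zero (Nat.succ_ne_zero _) (Nat.succ_ne_zero _)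
  have hn0 : n ≠ 0 := by omega
  have hNR : (N : ℝ) ≠ 0 := Nat.cast_ne_zero.2 hN0
  set g := gam aL aR with hg
  set h := tht aL aR with hh
  have hω0 : 0 < β - α := sub_pos.2 hαβ
  have hpos : ∀ᶠ T in (U : Filter ℝ), 0 < T := hU (eventually_gt_atTop 0)
  have hiR : Tendsto (fun T => iR aR (ξ T) / (tT n T : ℂ)) U (𝓝 (β : ℂ)) := 
    ratio_lim aR (sum_pos_of aR hposR hRne) (fun T j => ξ T (fR L R j)) _ _ hrt
  have hiL : Tendsto (fun T => iL aL aR (ξ T) / (tT n T : ℂ)) U (𝓝 (α : ℂ)) := by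
    unfold iL
    by_cases he : IsEmpty L
    · simp only [if_pos he, mul_div_assoc]
      rw [hα he]
      push_cast
      have := hiR.const_mul (-((∑ j, aR j + 1 : ℕ) : ℂ))
      push_cast at this
      exact this
    · simp only [if_neg he]
      exact ratio_lim aL (sum_pos_of aL hposL (not_isEmpty_iff.1 he)) (fun T j => ξ T (fL L R j)) _ _ hl
  have hiW : Tendsto (fun T => iW aL aR (ξ T) / (tT n T : ℂ)) U (𝓝 ((β - α : ℝ) : ℂ)) := by
    have := hiR.sub hiL
    unfold iW
    simp only [sub_div]
    push_cast
    exact this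
  have hωc : ((β - α : ℝ) : ℂ) ≠ 0 := by exact_mod_cast hω0.ne'
  have hiG : Tendsto (fun T => iG aL aR (ξ T)) U (𝓝 (g : ℂ)) := by
    have h1 := (hct.sub hiL).div hiW hωc
    have e : ((c0 : ℂ) - α) / ((β - α : ℝ) : ℂ) = g := by
      rw [div_eq_iff hωc]
      exact_mod_cast congrArg (fun x : ℝ => (x : ℂ)) hc0
    rw [e] at h1
    refine h1.congr' ?_
    filter_upwards [hpos] with T hT
    have ht : (tT n T : ℂ) ≠ 0 := Complex.ofReal_ne_zero.2 (tT_pos _ _ hT).ne'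
    unfold iG
    simp only [Pi.div_apply]
    rw [← sub_div, div_div_div_cancel_right₀ ht]
  have hthe : ((β - α : ℝ) : ℂ) ^ (-((n : ℂ) / (N : ℂ))) = (h : ℂ) := by
    have e1 : ((((β - α) ^ (-((n : ℝ) / (N : ℝ))) : ℝ)) : ℂ) = ((β - α : ℝ) : ℂ) ^ (-((n : ℂ) / (N : ℂ))) := by
      rw [Complex.ofReal_cpow hω0.le]
      simp only [Complex.ofReal_neg, Complex.ofReal_div, Complex.ofReal_natCast]
    rw [← e1]
    congr 1
    refine (pow_left_inj₀ (Real.rpow_nonneg hω0.le _) hθ0.le hN0).1 ?_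
    rw [hθN, ← Real.rpow_natCast, ← Real.rpow_mul hω0.le, neg_mul, div_mul_cancel₀ _ hNR, Real.rpow_neg hω0.le, Real.rpow_natCast]
    exact inv_eq_of_mul_eq_one_right hβ
  have hiT : Tendsto (fun T => iT aL aR T (ξ T)) U (𝓝 (h : ℂ)) := by
    rw [← hthe]
    have hs : ((β - α : ℝ) : ℂ) ∈ Complex.slitPlane := Complex.ofReal_mem_slitPlane.2 hω0
    exact (continuousAt_cpow_const hs).tendsto.comp hiW
  have hsl : Tendsto (fun T : ℝ => ((sT N T : ℝ) : ℂ)) U (𝓝 0) := by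
    have := ((Complex.continuous_ofReal.tendsto 0).comp (sT_lim N hN0)).mono_left hU
    rw [Complex.ofReal_zero] at this
    exact this
  have hiS : Tendsto (fun T => iS aL aR T (ξ T)) U (𝓝 0) := by
    have := hsl.mul hiT
    rw [zero_mul] at this
    exact this
  have hθne : ∀ᶠ T in (U : Filter ℝ), iT aL aR T (ξ T) ≠ 0 := hiT.eventually_ne (by exact_mod_cast hθ0.ne')
  have hSne : ∀ᶠ T in (U : Filter ℝ), iS aL aR T (ξ T) ≠ 0 := by
    filter_upwards [hpos, hθne] with T h1 h2
    exact mul_ne_zero (Complex.ofReal_ne_zero.2 (sT_pos _ _ h1).ne') h2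
  have hW0 : ∀ᶠ T in (U : Filter ℝ), iW aL aR (ξ T) ≠ 0 := by
    filter_upwards [hiW.eventually_ne hωc] with T hT e
    rw [e, zero_div] at hT
    exact hT rfl
  have hty : ∀ j, Tendsto (fun T => iS aL aR T (ξ T) ^ (∑ j, aR j + 1) * iY aL aR T (ξ T) j) U (𝓝 0) := by
    intro j
    have h1 := ((hl j).sub hiL).div hiW hωc
    rw [sub_self, zero_div] at h1
    refine h1.congr' ?_
    filter_upwards [hpos, hSne] with T hT hS
    have ht : (tT n T : ℂ) ≠ 0 := Complex.ofReal_ne_zero.2 (tT_pos _ _ hT).ne'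
    have hS' : iS aL aR T (ξ T) ^ (∑ j, aR j + 1) ≠ 0 := pow_ne_zero _ hS
    unfold iY
    simp only [Pi.div_apply]
    rw [← sub_div, div_div_div_cancel_right₀ ht, mul_comm (iW aL aR (ξ T)), ← mul_div_assoc, mul_div_mul_left _ _ hS']
  have htz : ∀ j, Tendsto (fun T => iS aL aR T (ξ T) ^ (∑ j, aL j + 1) * iZ aL aR T (ξ T) j) U (𝓝 0) := by
    intro j
    have h1 := ((hrt j).sub hiR).div hiW hωc
    rw [sub_self, zero_div] at h1
    refine h1.congr' ?_
    filter_upwards [hpos, hSne] with T hT hS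
    have ht : (tT n T : ℂ) ≠ 0 := Complex.ofReal_ne_zero.2 (tT_pos _ _ hT).ne'
    have hS' : iS aL aR T (ξ T) ^ (∑ j, aL j + 1) ≠ 0 := pow_ne_zero _ hS
    unfold iZ
    simp only [Pi.div_apply]
    rw [← sub_div, div_div_div_cancel_right₀ ht, mul_comm (iW aL aR (ξ T)), ← mul_div_assoc, mul_div_mul_left _ _ hS']
  -- order
  have hc0' : α < c0 ∧ c0 < β := by
    constructor <;> nlinarith
  have hord : ∀ p q (x y : ℝ), x < y → Tendsto (fun T => ξ T p / (tT n T : ℂ)) U (𝓝 (x : ℂ)) → Tendsto (fun T => ξ T q / (tT n T : ℂ)) U (𝓝 (y : ℂ)) →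
      ∀ᶠ T in U, (ξ T p).re < (ξ T q).re := by
    intro p q x y hxy hp hq
    have h1 := ((Complex.continuous_re.tendsto _).comp hp).eventually_lt ((Complex.continuous_re.tendsto _).comp hq) (by simpa using hxy)
    filter_upwards [h1, hpos] with T h1 hT
    simp only [Function.comp, Complex.div_ofReal_re] at h1
    exact (div_lt_div_iff_of_pos_right (tT_pos n T hT)).1 h1
  have hordL : ∀ᶠ T in U, ∀ i, (ξ T (fL L R i)).re < (ξ T none).re := 
    eventually_all.2 fun i => hord _ _ α c0 hc0'.1 (hl i) hct
  have hordR : ∀ᶠ T in U, ∀ i, (ξ T none).re < (ξ T (fR L R i)).re := 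
    eventually_all.2 fun i => hord _ _ c0 β hc0'.2 hct (hrt i)
  have hRlL : ∀ᶠ T in U, Rl (D.comap (fL L R)) (fun i => ξ T (fL L R i)) := by
    filter_upwards [hsol, hordL, hordR] with T k1 k2 k3 i
    obtain ⟨j, h1, h2⟩ := k1.2.1 (fL L R i)
    have h3 := congrArg Complex.re h2
    rw [Complex.conj_re] at h3
    rcases j with _ | j | j
    · exact absurd h3 (k2 i).ne'
    · exact ⟨j, h1, h2⟩
    · exact absurd h3 ((k2 i).trans (k3 j)).ne'
  have hRlR : ∀ᶠ T in U, Rl (D.comap (fR L R)) (fun i => ξ T (fR L R i)) := by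
    filter_upwards [hsol, hordL, hordR] with T k1 k2 k3 i
    obtain ⟨j, h1, h2⟩ := k1.2.1 (fR L R i)
    have h3 := congrArg Complex.re h2
    rw [Complex.conj_re] at h3
    rcases j with _ | j | j
    · exact absurd h3 (k3 i).ne
    · exact absurd h3 ((k2 j).trans (k3 i)).ne
    · exact ⟨j, h1, h2⟩
  have hcR : ∀ᶠ T in U, (starRingEnd ℂ) (iR aR (ξ T)) = iR aR (ξ T) := by
    filter_upwards [hsol, hRlR] with T k1 k2
    have := RsR _ k2 (k1.1.comp fR_inj)
    unfold iR
    rw [map_div₀, this, Complex.conj_natCast]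
  have hcL : ∀ᶠ T in U, (starRingEnd ℂ) (iL aL aR (ξ T)) = iL aL aR (ξ T) := by
    filter_upwards [hsol, hRlL, hcR] with T k1 k2 k3
    unfold iL
    split_ifs
    · rw [map_mul, k3, map_neg, Complex.conj_natCast]
    · have := RsL _ k2 (k1.1.comp fL_inj)
      rw [map_div₀, this, Complex.conj_natCast]
  have hcW : ∀ᶠ T in U, (starRingEnd ℂ) (iW aL aR (ξ T)) = iW aL aR (ξ T) := by
    filter_upwards [hcR, hcL] with T k1 k2
    unfold iW
    rw [map_sub, k1, k2]
  have hcS : ∀ᶠ T in U, (starRingEnd ℂ) (iS aL aR T (ξ T)) = iS aL aR T (ξ T) := by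
    have hp := ((Complex.continuous_re.tendsto _).comp hiW).eventually (lt_mem_nhds (a := 0) (by simpa using hω0))
    filter_upwards [hcW, hp] with T k1 k2
    obtain ⟨w, hw⟩ := Complex.conj_eq_iff_real.1 k1
    simp only [Function.comp] at k2
    rw [hw] at k2
    have k3 : 0 < w / tT n T := by
      rw [← Complex.ofReal_div] at k2
      simpa using k2
    unfold iS iT
    rw [map_mul, Complex.conj_ofReal, hw, ← Complex.ofReal_div]
    have e1 : ((((w / tT n T) ^ (-((n : ℝ) / (N : ℝ))) : ℝ)) : ℂ) = ((w / tT n T : ℝ) : ℂ) ^ (-((n : ℂ) / (N : ℂ))) := by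
      rw [Complex.ofReal_cpow k3.le]
      simp only [Complex.ofReal_neg, Complex.ofReal_div, Complex.ofReal_natCast]
    rw [← e1, Complex.conj_ofReal]
  have hRy : ∀ᶠ T in U, Rl (D.comap (fL L R)) (iY aL aR T (ξ T)) := by
    filter_upwards [hRlL, hcL, hcW, hcS] with T k1 k2 k3 k4
    exact Rl_aff _ _ _ k2 (by rw [map_mul, map_pow, k3, k4]) k1
  have hRz : ∀ᶠ T in U, Rl (D.comap (fR L R)) (iZ aL aR T (ξ T)) := by
    filter_upwards [hRlR, hcR, hcW, hcS] with T k1 k2 k3 k4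
    exact Rl_aff _ _ _ k2 (by rw [map_mul, map_pow, k3, k4]) k1
  have hP : ∀ T, ∃ P : ℂ[X], IsSol (D.top T) (ξ T) → derivative P = C ((∑ j, (D.top T).a j + 1 : ℕ):ℂ) * cp (D.top T).a (ξ T) ∧ 
      ∀ j, P.eval (ξ T j) = ((D.top T).u j:ℂ) := by
    intro T
    by_cases hh : IsSol (D.top T) (ξ T)
    · obtain ⟨P, hP⟩ := hh.2.2.2
      exact ⟨P, fun _ => hP⟩
    · exact ⟨0, fun h' => absurd h' hh⟩
  choose P hP using hP
  have hinv2 : ∀ᶠ T in (U : Filter ℝ), (iT aL aR T (ξ T)) ^ (-((N : ℂ) / (n : ℂ))) = iW aL aR (ξ T) / tT n T :=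
    cpow_inv_lim _ (β - α) hω0 hiW _ _ ⟨-((n : ℝ) / (N : ℝ)), by simp only [Complex.ofReal_neg, Complex.ofReal_div, Complex.ofReal_natCast]; rfl⟩ (nl_exps n N hn0 hN0)
  set w : ℝ → ℂ := fun T => WW aL aR T (iT aL aR T (ξ T)) with hw
  set μ : ℝ → ℂ := fun T => mu aL aR (iG aL aR (ξ T)) with hμ
  set τ : ℝ → ℂ := fun T => iS aL aR T (ξ T) with hτ
  set γ : ℝ → ℂ := fun T => iG aL aR (ξ T) with hγ
  set y : ℝ → L → ℂ := fun T => iY aL aR T (ξ T) with hyd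
  set z : ℝ → R → ℂ := fun T => iZ aL aR T (ξ T) with hzd
  have hasm : ∀ᶠ T in (U : Filter ℝ), asm aL aR (w T) (μ T) (τ T) (γ T) (y T) (z T) = ξ T := by
    filter_upwards [hpos, hsol, hW0, hinv2] with T k1 k2 k3 k4
    have hsum := k2.2.2.1
    have e : (D.top T).a = aO aL aR := haO
    rw [e] at hsum
    exact asmT_i aL aR hRne hposL hposR T k1 (ξ T) hsum k3 0 0 k4
  have hPd : ∀ᶠ T in (U : Filter ℝ), derivative (P T) = C (n : ℂ) * cp (aO aL aR) (asm aL aR (w T) (μ T) (τ T) (γ T) (y T) (z T)) := by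
    filter_upwards [hsol, hasm] with T k2 k4
    have e : (D.top T).a = aO aL aR := haO
    obtain ⟨p1, p2⟩ := hP T k2
    rw [e, aO_sum] at p1
    rw [k4, p1]
  have hww : ∀ᶠ T in (U : Filter ℝ), (w T) ^ n * (τ T) ^ N = 1 := by
    filter_upwards [hpos, hθne] with T k1 k2 using WW_pow aL aR T k1 _ k2
  have hnc : ((n : ℕ) : ℂ) ≠ 0 := Nat.cast_ne_zero.2 hn0
  have hγl : Tendsto γ U (𝓝 (g : ℂ)) := hiG
  have hτl : Tendsto τ U (𝓝 0) := hiS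
  have hpl : ∀ k, Tendsto (fun T => τ T ^ (k + 1)) U (𝓝 0) := by
    intro k
    have := hτl.pow (k + 1)
    rwa [zero_pow (Nat.succ_ne_zero _)] at this
  obtain ⟨y0, hy1, hy2, hy3, hy4⟩ := COMPACT U aL hposL y (Eventually.of_forall fun T => (i_sums aL aR hRne hposL hposR T (ξ T)).1)
    (fun T => (P T).comp (C (w T) * (C (τ T ^ (∑ j, aR j + 1)) * X - C (μ T)))) 
    (fun T => C (n : ℂ) * (X - C (γ T)) * cp aR (fun j => 1 + τ T ^ (∑ j, aL j + 1) * z T j)) (fun T => τ T ^ (∑ j, aR j + 1))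
    (C (n : ℂ) * (X - C (g : ℂ)) * cp aR (fun j => 1 + 0)) 
    (((PT.const _).mul ((PT.const _).sub (PT.C hγl))).mul (PT.cp aR fun j => tendsto_const_nhds.add (htz j))) 
    (by
      simp only [eval_mul, eval_C, eval_sub, eval_X, cp_eval, zero_sub, add_zero]
      refine mul_ne_zero (mul_ne_zero hnc (neg_ne_zero.2 (by exact_mod_cast hγ0.ne'))) (Finset.prod_ne_zero_iff.2 fun j _ => pow_ne_zero _ (by norm_num)))
    (hpl _) hty (by
      filter_upwards [hPd, hww] with T k1 k2
      rw [asm_L aL aR (w T) (μ T) (τ T) (γ T) (y T) (z T) (P T) k2 k1, BL, Blk, cpl_comp]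
      simp only [mul_comp, sub_comp, C_comp, X_comp]
      rfl)
    (by
      filter_upwards [hsol, hasm] with T k1 k2 i j hij
      refine fL_inj (k1.1 ?_)
      rw [← k2]
      simp only [asm, fL]
      rw [hij])
    (fun T j => ((D.comap (fL L R)).u j : ℂ)) (fun j => ((D.comap (fL L R)).u j : ℂ)) (fun j => tendsto_const_nhds)
    (by
      filter_upwards [hsol, hasm] with T k1 k2 j
      have := (hP T k1).2 (fL L R j)
      rw [← k2] at this
      simp only [asm, fL] at this
      simp only [eval_comp, eval_mul, eval_C, eval_sub, eval_X]
      exact this)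
    (fun j k hjk => Eventually.of_forall fun _ => hjk)
  obtain ⟨z0, hz1, hz2, hz3, hz4⟩ := COMPACT U aR hposR z (Eventually.of_forall fun T => (i_sums aL aR hRne hposL hposR T (ξ T)).2)
    (fun T => (P T).comp (C (w T) * (C (τ T ^ (∑ j, aL j + 1)) * X + 1 - C (μ T)))) 
    (fun T => C (n : ℂ) * (X - C (γ T - 1)) * cp aL (fun j => τ T ^ (∑ j, aR j + 1) * y T j - 1)) (fun T => τ T ^ (∑ j, aL j + 1))
    (C (n : ℂ) * (X - C ((g : ℂ) - 1)) * cp aL (fun j => 0 - 1)) 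
    (((PT.const _).mul ((PT.const _).sub (PT.C (hγl.sub tendsto_const_nhds)))).mul (PT.cp aL fun j => (hty j).sub tendsto_const_nhds)) 
    (by
      simp only [eval_mul, eval_C, eval_sub, eval_X, cp_eval, zero_sub, add_zero]
      refine mul_ne_zero (mul_ne_zero hnc (neg_ne_zero.2 (sub_ne_zero.2 (by exact_mod_cast hγ1.ne)))) (Finset.prod_ne_zero_iff.2 fun j _ => pow_ne_zero _ (by norm_num)))
    (hpl _) htz (by
      filter_upwards [hPd, hww] with T k1 k2
      rw [asm_R aL aR (w T) (μ T) (τ T) (γ T) (y T) (z T) (P T) k2 k1, BR, Blk, cpl_comp]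
      simp only [mul_comp, sub_comp, C_comp, X_comp]
      rfl)
    (by
      filter_upwards [hsol, hasm] with T k1 k2 i j hij
      refine fR_inj (k1.1 ?_)
      rw [← k2]
      simp only [asm, fR]
      rw [hij])
    (fun T j => ((D.comap (fR L R)).u j : ℂ)) (fun j => ((D.comap (fR L R)).u j : ℂ)) (fun j => tendsto_const_nhds)
    (by
      filter_upwards [hsol, hasm] with T k1 k2 j
      have := (hP T k1).2 (fR L R j)
      rw [← k2] at this
      simp only [asm, fR] at this
      simp only [eval_comp, eval_mul, eval_C, eval_sub, eval_X, eval_add, eval_one]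
      rw [add_comm (_ * _) (1 : ℂ)]
      exact this)
    (fun j k hjk => Eventually.of_forall fun _ => hjk)
  refine ⟨y0, z0, ⟨hy2, Rl_lim U _ _ hy1 hRy, hy3, ?_⟩, ⟨hz2, Rl_lim U _ _ hz1 hRz, hz3, ?_⟩, hy1, hz1, hiG, hiT, hiW⟩
  · obtain ⟨K, hK1, hK2⟩ := hy4
    refine ⟨K, ?_, hK2⟩
    rw [hK1]
    congr 2
    simp only [eval_mul, eval_C, eval_sub, eval_X, cp_eval, zero_sub, add_zero, Finset.prod_pow_eq_pow_sum, hr.neg_one_pow]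
    rw [← hγm]; ring
  · obtain ⟨K, hK1, hK2⟩ := hz4
    refine ⟨K, ?_, hK2⟩
    rw [hK1]
    congr 2
    simp only [eval_mul, eval_C, eval_sub, eval_X, cp_eval, zero_sub, add_zero, Finset.prod_pow_eq_pow_sum, neg_neg, one_pow, Finset.prod_const_one, mul_one]
    have e : (n : ℂ) = ((∑ j, aL j + 1 : ℕ) : ℂ) + ((∑ j, aR j + 1 : ℕ) : ℂ) := by rw [hn]; push_cast; ring
    linear_combination e - hγm

end cut7
end FO

open Polynomial
open scoped Classical
set_option linter.all false
namespace FO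
open Filter Topology

lemma two_roots {ι : Type*} [Fintype ι] (a : ι → ℕ) (η : ι → ℂ) (c : ℂ) (P : ℂ[X])
    (hP : derivative P = C ((∑ j, a j + 2 : ℕ) : ℂ) * ((X - C c) * cp a η)) (h0 : ∀ j, P.eval (η j) = 0) (hc : P.eval c = 1) :
    ∃ α β : ℂ, α ≠ β ∧ (∀ j, η j = α ∨ η j = β) ∧
      P.eval c = (c - α) ^ (∑ j, (if η j = α then a j else 0) + 1) * (c - β) ^ (∑ j, (if η j = β then a j else 0) + 1) ∧
      (((∑ j, (if η j = α then a j else 0) + 1 : ℕ) : ℂ)) * (c - β) + ((∑ j, (if η j = β then a j else 0) + 1 : ℕ) : ℂ) * (c - α) = 0 := by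
  have hn : ((∑ j, a j + 2 : ℕ) : ℂ) ≠ 0 := Nat.cast_ne_zero.2 (Nat.succ_ne_zero _)
  have hmon : ((X - C c) * cp a η).Monic := (monic_X_sub_C c).mul (cp_monic a η)
  have hdeg' : ((X - C c) * cp a η).natDegree = ∑ j, a j + 1 := by
    rw [(monic_X_sub_C c).natDegree_mul (cp_monic a η), natDegree_X_sub_C, cp_natDegree]; ring
  have hd0 : derivative P ≠ 0 := by
    rw [hP]; exact mul_ne_zero (C_ne_zero.2 hn) hmon.ne_zero
  have hP0 : P ≠ 0 := by rintro rfl; simp at hd0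
  have hdd : (derivative P).natDegree = ∑ j, a j + 1 := by
    rw [hP, natDegree_C_mul hn, hdeg']
  have hdegP : P.natDegree = ∑ j, a j + 2 := by
    have h1 : 0 < P.natDegree := by
      rw [Nat.pos_iff_ne_zero]; intro h
      exact hd0 (derivative_of_natDegree_zero h)
    have := degree_derivative_eq P h1
    rw [degree_eq_natDegree hd0, hdd] at this
    have : ∑ j, a j + 1 = P.natDegree - 1 := by exact_mod_cast this
    omega
  have hPm : P.Monic := by
    have h1 : (derivative P).coeff (∑ j, a j + 1) = ((∑ j, a j + 2 : ℕ) : ℂ) := by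
      rw [hP, coeff_C_mul, ← hdeg', hmon.coeff_natDegree, mul_one]
    rw [coeff_derivative] at h1
    unfold Monic leadingCoeff
    rw [hdegP]
    refine mul_right_cancel₀ hn ?_
    rw [one_mul]
    convert h1 using 2
    push_cast; ring
  have hsp : P = (P.roots.map fun x => X - C x).prod := by
    exact (IsAlgClosed.splits P).eq_prod_roots_of_monic hPm
  have hmult : ∀ v, P.eval v = 0 → P.rootMultiplicity v = ∑ j, (if η j = v then a j else 0) + 1 := by
    intro v hv
    have h1 := derivative_rootMultiplicity_of_root (p := P) (t := v) hv
    have h2 : 0 < P.rootMultiplicity v := (rootMultiplicity_pos hP0).2 hv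
    have hvc : c ≠ v := by rintro rfl; rw [hv] at hc; exact zero_ne_one hc
    have h3 : (derivative P).rootMultiplicity v = ∑ j, (if η j = v then a j else 0) := by
      rw [hP, rootMultiplicity_mul (hP ▸ hd0), rootMultiplicity_C, zero_add, rootMultiplicity_mul hmon.ne_zero, cp_rootMult,
        rootMultiplicity_X_sub_C, if_neg (Ne.symm hvc), zero_add]
    omega
  have hcard : P.roots.toFinset.card = 2 := by
    have h1 : P.roots.card = ∑ j, a j + 2 := by rw [← hdegP]; exact (IsAlgClosed.splits P).natDegree_eq_card_roots.symm
    rw [← Multiset.toFinset_sum_count_eq] at h1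
    have h2 : ∑ v ∈ P.roots.toFinset, P.roots.count v = ∑ v ∈ P.roots.toFinset, (∑ j, (if η j = v then a j else 0) + 1) := by
      refine Finset.sum_congr rfl fun v hv => ?_
      rw [count_roots, hmult v (by simpa [hP0] using hv)]
    rw [h2, Finset.sum_add_distrib, Finset.sum_comm] at h1
    have h3 : ∀ j, ∑ v ∈ P.roots.toFinset, (if η j = v then a j else 0) = a j := by
      intro j
      rw [Finset.sum_ite_eq, if_pos]
      simp [hP0, h0 j]
    simp only [h3] at h1
    simp at h1
    omega
  obtain ⟨α, β, hne, hαβ⟩ := Finset.card_eq_two.1 hcard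
  have hα : P.eval α = 0 := by
    have : α ∈ P.roots.toFinset := by rw [hαβ]; simp
    simpa [hP0] using this
  have hβ : P.eval β = 0 := by
    have : β ∈ P.roots.toFinset := by rw [hαβ]; simp
    simpa [hP0] using this
  have hfac : P = (X - C α) ^ (∑ j, (if η j = α then a j else 0) + 1) * (X - C β) ^ (∑ j, (if η j = β then a j else 0) + 1) := by
    rw [← hmult α hα, ← hmult β hβ, ← count_roots, ← count_roots]
    conv_lhs => rw [hsp, Finset.prod_multiset_map_count, hαβ, Finset.prod_pair hne]
  have hcα : c ≠ α := by rintro rfl; rw [hα] at hc; exact zero_ne_one hc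
  have hcβ : c ≠ β := by rintro rfl; rw [hβ] at hc; exact zero_ne_one hc
  refine ⟨α, β, hne, fun j => ?_, ?_, ?_⟩
  · have : η j ∈ P.roots.toFinset := by simp [hP0, h0 j]
    rw [hαβ] at this
    simpa using this
  · conv_lhs => rw [hfac]
    simp only [eval_mul, eval_pow, eval_sub, eval_X, eval_C]
  · have h1 : (derivative P).eval c = 0 := by rw [hP]; simp
    set l := ∑ j, (if η j = α then a j else 0)
    set r := ∑ j, (if η j = β then a j else 0)
    rw [hfac, derivative_mul, derivative_pow_succ, derivative_pow_succ] at h1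
    simp only [eval_mul, eval_pow, eval_sub, eval_X, eval_C, eval_add, derivative_sub, derivative_X, derivative_C, sub_zero, mul_one, eval_one] at h1
    have h2 : (c - α) ^ l * (c - β) ^ r ≠ 0 := mul_ne_zero (pow_ne_zero _ (sub_ne_zero.2 hcα)) (pow_ne_zero _ (sub_ne_zero.2 hcβ))
    refine mul_left_cancel₀ h2 ?_
    rw [mul_zero, ← h1]
    push_cast
    ring
end FO

open Polynomial
open scoped Classical
set_option linter.all false
namespace FO
open Filter Topology

lemma LIM_real {ι : Type*} [Fintype ι] (a : ι → ℕ) (η : ι → ℂ) (c α β : ℝ) (hαβ : α < β)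
    (hη : ∀ j, η j = (α : ℂ) ∨ η j = (β : ℂ)) (hs : (c : ℂ) + ∑ j, (a j : ℂ) * η j = 0)
    (l r : ℕ) (hl : l = ∑ j, (if η j = (α : ℂ) then a j else 0)) (hr : r = ∑ j, (if η j = (β : ℂ) then a j else 0))
    (h1 : ((c : ℂ) - α) ^ (l + 1) * ((c : ℂ) - β) ^ (r + 1) = 1)
    (h2 : ((l + 1 : ℕ) : ℂ) * ((c : ℂ) - β) + ((r + 1 : ℕ) : ℂ) * ((c : ℂ) - α) = 0)
    (hsum : ∑ j, (a j : ℂ) * η j = l * α + r * β) :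
    Odd r ∧ c - α = ((l + 1 : ℕ) : ℝ) / ((l + 1 + (r + 1) : ℕ) : ℝ) * (β - α) ∧
      (β - α) ^ (l + 1 + (r + 1)) * ((((l + 1 : ℕ) : ℝ) / ((l + 1 + (r + 1) : ℕ) : ℝ)) ^ (l + 1) * (1 - ((l + 1 : ℕ) : ℝ) / ((l + 1 + (r + 1) : ℕ) : ℝ)) ^ (r + 1)) = 1 ∧
      (l = 0 → α = -((r + 1 : ℕ) : ℝ) * β) := by
  have h1' : (c - α) ^ (l + 1) * (c - β) ^ (r + 1) = 1 := by exact_mod_cast h1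
  have h2' : ((l : ℝ) + 1) * (c - β) + ((r : ℝ) + 1) * (c - α) = 0 := by exact_mod_cast h2
  have hs' : c + (l * α + r * β) = 0 := by
    rw [hsum] at hs
    exact_mod_cast hs
  have hn : (0 : ℝ) < (l : ℝ) + 1 + (r + 1) := by positivity
  have e1 : c - α = ((l + 1 : ℕ) : ℝ) / ((l + 1 + (r + 1) : ℕ) : ℝ) * (β - α) := by
    push_cast
    field_simp
    linear_combination h2'
  have e2 : c - β = - ((1 - ((l + 1 : ℕ) : ℝ) / ((l + 1 + (r + 1) : ℕ) : ℝ)) * (β - α)) := by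
    linear_combination e1
  set g := ((l + 1 : ℕ) : ℝ) / ((l + 1 + (r + 1) : ℕ) : ℝ) with hg
  have hg0 : 0 < g := by positivity
  have hg1 : g < 1 := by
    rw [hg, div_lt_one (by positivity)]
    exact_mod_cast (by omega)
  have hw : 0 < β - α := sub_pos.2 hαβ
  rw [e1, e2] at h1'
  have hev : Even (r + 1) := by
    by_contra h
    rw [Nat.not_even_iff_odd] at h
    rw [h.neg_pow] at h1'
    have : 0 < (g * (β - α)) ^ (l + 1) * ((1 - g) * (β - α)) ^ (r + 1) := by
      have : 0 < 1 - g := by linarith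
      positivity
    linarith
  refine ⟨by rcases Nat.even_or_odd r with h | h; exact absurd hev (Nat.not_even_iff_odd.2 h.add_one); exact h, e1, ?_, ?_⟩
  · rw [hev.neg_pow] at h1'
    rw [mul_pow, mul_pow] at h1'
    rw [pow_add]
    linear_combination h1'
  · intro h0
    have h3 : ((r : ℝ) + 1) ≠ 0 := by positivity
    refine mul_left_cancel₀ h3 ?_
    rw [h0] at hs' h2'
    push_cast at hs' h2' ⊢
    linear_combination (-1) * h2' + (r + 2) * hs'

lemma LIM {ι : Type*} [Fintype ι] (a : ι → ℕ) (η : ι → ℂ) (c : ℝ) (P : ℂ[X])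
    (hP : derivative P = C ((∑ j, a j + 2 : ℕ) : ℂ) * ((X - C (c : ℂ)) * cp a η)) (h0 : ∀ j, P.eval (η j) = 0) (hc : P.eval (c : ℂ) = 1) 
    (hs : (c : ℂ) + ∑ j, (a j : ℂ) * η j = 0) (hconj : ∀ i, ∃ j, η j = (starRingEnd ℂ) (η i)) (hneg : (∏ j, ((c : ℂ) - η j) ^ a j).re ≤ 0) :
    ∃ α β : ℝ, α < β ∧ (∀ j, η j = (α : ℂ) ∨ η j = (β : ℂ)) ∧ ∃ l r : ℕ, l = ∑ j, (if η j = (α : ℂ) then a j else 0) ∧ r = ∑ j, (if η j = (β : ℂ) then a j else 0) ∧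
      Odd r ∧ c - α = ((l + 1 : ℕ) : ℝ) / ((l + 1 + (r + 1) : ℕ) : ℝ) * (β - α) ∧
      (β - α) ^ (l + 1 + (r + 1)) * ((((l + 1 : ℕ) : ℝ) / ((l + 1 + (r + 1) : ℕ) : ℝ)) ^ (l + 1) * (1 - ((l + 1 : ℕ) : ℝ) / ((l + 1 + (r + 1) : ℕ) : ℝ)) ^ (r + 1)) = 1 ∧
      (l = 0 → α = -((r + 1 : ℕ) : ℝ) * β) := by
  obtain ⟨α, β, hne, hη, h1, h2⟩ := two_roots a η c P hP h0 hc
  rw [hc] at h1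
  have ite_β : ∀ j (x y : ℂ), (if η j = α then x else y) = (if η j = β then y else x) := by
    intro j x y
    rcases hη j with h | h
    · rw [if_pos h, if_neg (by rw [h]; exact hne)]
    · rw [if_pos h, if_neg (by rw [h]; exact hne.symm)]
  have hsum : ∑ j, (a j : ℂ) * η j = (∑ j, (if η j = α then a j else 0) : ℕ) * α + (∑ j, (if η j = β then a j else 0) : ℕ) * β := by
    push_cast
    rw [Finset.sum_mul, Finset.sum_mul, ← Finset.sum_add_distrib]
    refine Finset.sum_congr rfl fun j _ => ?_
    rcases hη j with h | h
    · rw [if_pos h, if_neg (by rw [h]; exact hne), h]; ring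
    · rw [if_pos h, if_neg (by rw [h]; exact hne.symm), h]; ring
  have hprod : ∏ j, ((c : ℂ) - η j) ^ a j = ((c : ℂ) - α) ^ (∑ j, (if η j = α then a j else 0)) * ((c : ℂ) - β) ^ (∑ j, (if η j = β then a j else 0)) := by
    rw [← Finset.prod_pow_eq_pow_sum, ← Finset.prod_pow_eq_pow_sum, ← Finset.prod_mul_distrib]
    refine Finset.prod_congr rfl fun j _ => ?_
    rcases hη j with h | h
    · rw [if_pos h, if_neg (by rw [h]; exact hne), h]; ring
    · rw [if_pos h, if_neg (by rw [h]; exact hne.symm), h]; ring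
  rw [hprod] at hneg
  suffices real_case : ∃ α' β' : ℝ, α = (α' : ℂ) ∧ β = (β' : ℂ) by
    obtain ⟨α', β', ea, eb⟩ := real_case
    rw [ea, eb] at hη h1 h2 hne hsum
    have hne' : α' ≠ β' := fun h => hne (by rw [h])
    rcases lt_or_gt_of_ne hne' with h | h
    · exact ⟨α', β', h, hη, _, _, rfl, rfl, LIM_real a η c α' β' h hη hs _ _ rfl rfl h1.symm h2 hsum⟩
    · exact ⟨β', α', h, fun j => (hη j).symm, _, _, rfl, rfl, LIM_real a η c β' α' h (fun j => (hη j).symm) hs _ _ rfl rfl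
        (by rw [h1, mul_comm]) (by rw [← h2]; ring) (by rw [hsum, add_comm])⟩
  set l := ∑ j, (if η j = α then a j else 0) with hl
  set r := ∑ j, (if η j = β then a j else 0) with hr
  rw [hsum] at hs
  have hcl : ∀ x, (∃ j, η j = x) → (∃ j, η j = (starRingEnd ℂ) x) := by
    rintro x ⟨j, rfl⟩
    exact hconj j
  have none_l : ∀ x, (¬ ∃ j, η j = x) → ∑ j, (if η j = x then a j else 0) = 0 := by
    intro x hx
    refine Finset.sum_eq_zero fun j _ => if_neg fun h => hx ⟨j, h⟩
  have one_real : ∀ x y : ℂ, (∀ j, η j = x ∨ η j = y) → (∃ j, η j = x) → (¬ ∃ j, η j = y) → (starRingEnd ℂ) x = x := by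
    intro x y hxy hx hy
    obtain ⟨j, hj⟩ := hcl x hx
    rcases hxy j with h | h
    · rw [← hj, h]
    · exact absurd ⟨j, h⟩ hy
  by_cases hA : ∃ j, η j = α <;> by_cases hB : ∃ j, η j = β
  · obtain ⟨j, hj⟩ := hcl α hA
    obtain ⟨k, hk⟩ := hcl β hB
    by_cases hαr : (starRingEnd ℂ) α = α
    · have hβr : (starRingEnd ℂ) β = β := by
        rcases hη k with h | h
        · exfalso
          apply hne
          have : β = (starRingEnd ℂ) α := by rw [← h, hk, Complex.conj_conj]
          rw [this, hαr]
        · rw [← hk, h]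
      obtain ⟨α', ea⟩ := Complex.conj_eq_iff_real.1 hαr
      obtain ⟨β', eb⟩ := Complex.conj_eq_iff_real.1 hβr
      exact ⟨_, _, ea, eb⟩
    · exfalso
      have hβ : β = (starRingEnd ℂ) α := by
        rcases hη j with h | h
        · exact absurd (hj.symm.trans h) hαr
        · exact h.symm.trans hj
      -- product times |c-α|^2 = 1
      have h3 : ((c : ℂ) - α) * ((c : ℂ) - β) = (Complex.normSq ((c : ℂ) - α) : ℂ) := by
        rw [← Complex.mul_conj, map_sub, Complex.conj_ofReal, hβ]
      have h4 : (((c : ℂ) - α) ^ l * ((c : ℂ) - β) ^ r) * (Complex.normSq ((c : ℂ) - α) : ℂ) = 1 := by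
        rw [← h3, h1]; ring
      have h5 := congrArg Complex.re h4
      rw [Complex.re_mul_ofReal, Complex.one_re] at h5
      nlinarith [Complex.normSq_nonneg ((c : ℂ) - α)]
  · have hαr := one_real α β hη hA hB
    have hr0 : r = 0 := none_l _ hB
    obtain ⟨α', ea⟩ := Complex.conj_eq_iff_real.1 hαr
    rw [hr0] at h2 hs
    have eb : β = ((-((l : ℝ) + 1) * α' : ℝ) : ℂ) := by
      have h3 : ((l : ℂ) + 1) ≠ 0 := by exact_mod_cast Nat.succ_ne_zero l
      refine mul_left_cancel₀ h3 ?_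
      push_cast at hs h2 ⊢
      rw [← ea]
      linear_combination (-1) * h2 + (l + 2) * hs
    exact ⟨_, _, ea, eb⟩
  · have hβr := one_real β α (fun j => (hη j).symm) hB hA
    have hl0 : l = 0 := none_l _ hA
    obtain ⟨β', eb⟩ := Complex.conj_eq_iff_real.1 hβr
    rw [hl0] at h2 hs
    have ea : α = ((-((r : ℝ) + 1) * β' : ℝ) : ℂ) := by
      have h3 : ((r : ℂ) + 1) ≠ 0 := by exact_mod_cast Nat.succ_ne_zero r
      refine mul_left_cancel₀ h3 ?_
      push_cast at hs h2 ⊢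
      rw [← eb]
      linear_combination (-1) * h2 + (r + 2) * hs
    exact ⟨_, _, ea, eb⟩
  · exfalso
    have hr0 : r = 0 := none_l _ hB
    have hl0 : l = 0 := none_l _ hA
    rw [hr0, hl0] at hneg
    norm_num at hneg
end FO

open Polynomial
open scoped Classical
set_option linter.all false
namespace FO
open Filter Topology

lemma sum_sub_ite {ι : Type*} [Fintype ι] (p : ι → Prop) [DecidablePred p] [Fintype {j // p j}] (f : ι → ℕ) : ∑ j : {j // p j}, f j = ∑ j, if p j then f j else 0 := by
  rw [← Finset.sum_filter]
  exact (Finset.sum_subtype _ (by simp) f).symm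

lemma CUT_lim {κ : Type} [Fintype κ] (D : LD (Option κ)) (hD : D.Good) (ha1 : D.a none = 1) (hrn : D.rel none none)
    (U : Ultrafilter ℝ) (hU : (U : Filter ℝ) ≤ atTop)
    (ξ : ℝ → Option κ → ℂ) (hsol : ∀ᶠ T in U, IsSol (D.top T) (ξ T))
    (hstar : ∀ᶠ T in U, (∏ j : κ, (ξ T none - ξ T (some j)) ^ D.a (some j)).re < 0) :
    ∃ α β c : ℝ, α < β ∧ ∃ A : Finset κ, ∃ l r n : ℕ, n = l + 1 + (r + 1) ∧ l = ∑ j : {j // j ∉ A}, D.a (some j) ∧ r = ∑ j : {j // ¬ j ∉ A}, D.a (some j) ∧ 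
      (∀ j, j ∉ A → Tendsto (fun T => ξ T (some j) / (tT n T : ℂ)) U (𝓝 (α : ℂ))) ∧
      (∀ j, ¬ j ∉ A → Tendsto (fun T => ξ T (some j) / (tT n T : ℂ)) U (𝓝 (β : ℂ))) ∧
      Tendsto (fun T => ξ T none / (tT n T : ℂ)) U (𝓝 (c : ℂ)) ∧
      Odd r ∧ c - α = ((l + 1 : ℕ) : ℝ) / (n : ℝ) * (β - α) ∧
      (β - α) ^ n * ((((l + 1 : ℕ) : ℝ) / (n : ℝ)) ^ (l + 1) * (1 - ((l + 1 : ℕ) : ℝ) / (n : ℝ)) ^ (r + 1)) = 1 ∧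
      (l = 0 → α = -((r + 1 : ℕ) : ℝ) * β) := by
  set n := ∑ j, D.a j + 1 with hn
  have hn0 : n ≠ 0 := Nat.succ_ne_zero _
  have hnn : n = ∑ j : κ, D.a (some j) + 2 := by
    rw [hn, Fintype.sum_option, ha1]; ring
  have hnc : (n : ℂ) ≠ 0 := Nat.cast_ne_zero.2 hn0
  have hpos : ∀ᶠ T in (U : Filter ℝ), 0 < T := hU (eventually_gt_atTop 0)
  have hP : ∀ T, ∃ P : ℂ[X], IsSol (D.top T) (ξ T) → derivative P = C (n : ℂ) * cp D.a (ξ T) ∧ 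
      ∀ j, P.eval (ξ T j) = ((D.top T).u j:ℂ) := by
    intro T
    by_cases hh : IsSol (D.top T) (ξ T)
    · obtain ⟨P, hP⟩ := hh.2.2.2
      exact ⟨P, fun _ => hP⟩
    · exact ⟨0, fun h' => absurd h' hh⟩
  choose P hP using hP
  set y : ℝ → Option κ → ℂ := fun T j => ξ T j / (tT n T : ℂ) with hy
  set K : ℝ → ℂ[X] := fun T => C (((tT n T : ℂ) ^ n)⁻¹) * (P T).comp (C 0 + C (tT n T : ℂ) * X) with hK
  have hKd : ∀ᶠ T in (U : Filter ℝ), derivative (K T) = C (n : ℂ) * cp D.a (y T) := by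
    filter_upwards [hpos, hsol] with T h1 h2
    have := scaled_deriv D.a (ξ T) 0 (tT n T : ℂ) (Complex.ofReal_ne_zero.2 (tT_pos n T h1).ne') (P T) _ (hP T h2).1
    simp only [sub_zero, C_comp] at this
    exact this
  have hKv : ∀ᶠ T in (U : Filter ℝ), ∀ j, (K T).eval (y T j) = ((D.top T).u j : ℂ) / (T : ℂ) := by
    filter_upwards [hpos, hsol] with T h1 h2 j
    have ht : (tT n T : ℂ) ≠ 0 := Complex.ofReal_ne_zero.2 (tT_pos n T h1).ne'
    simp only [hK, hy, eval_mul, eval_C, eval_comp, eval_add, eval_X, zero_add]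
    rw [mul_div_cancel₀ _ ht, (hP T h2).2 j, tT_pow n hn0 T h1, div_eq_inv_mul]
  have hTinv : Tendsto (fun T : ℝ => (T : ℂ)⁻¹) U (𝓝 0) := by
    have h1 : Tendsto (fun T : ℝ => T⁻¹) U (𝓝 0) := tendsto_inv_atTop_zero.mono_left hU
    have := (Complex.continuous_ofReal.tendsto 0).comp h1
    simpa [Function.comp_def] using this
  have hKs : ∀ j, Tendsto (fun T => (K T).eval (y T (some j))) U (𝓝 0) := by
    intro j
    have h1 := hTinv.const_mul (D.u (some j) : ℂ)
    rw [mul_zero] at h1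
    refine h1.congr' ?_
    filter_upwards [hKv] with T hT
    rw [hT, div_eq_mul_inv]; rfl
  have hKn : Tendsto (fun T => (K T).eval (y T none)) U (𝓝 1) := by
    refine tendsto_const_nhds.congr' ?_
    filter_upwards [hKv, hpos] with T hT h1
    rw [hT]
    exact (div_self (Complex.ofReal_ne_zero.2 h1.ne')).symm
  have hys : ∀ᶠ T in (U : Filter ℝ), ∑ j, (D.a j : ℂ) * y T j = 0 := by
    filter_upwards [hsol] with T h2
    have : ∑ j, (D.a j : ℂ) * ξ T j = 0 := h2.2.2.1
    simp only [hy, ← mul_div_assoc]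
    rw [← Finset.sum_div, this, zero_div]
  obtain ⟨y0, hy0⟩ := BD U D.a hD.pos y hys K (fun _ => C (n : ℂ)) (fun _ => 0) (C (n : ℂ)) (PT.const _) (by simpa using hnc)
    (fun j => by simp) (by filter_upwards [hKd] with T hT; rw [hT, C_comp]) ⟨2, fun j => by
      rcases j with _ | j
      · exact hKn.norm.eventually_le_const (by norm_num)
      · exact (hKs j).norm.eventually_le_const (by norm_num)⟩
  have hy0j := tendsto_pi_nhds.1 hy0
  have hRy : Rl D y0 := by
    refine Rl_lim U y y0 hy0 ?_
    filter_upwards [hsol] with T h2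
    have := Rl_aff (ξ T) 0 (tT n T : ℂ) (by simp) (Complex.conj_ofReal _) h2.2.1
    simp only [sub_zero] at this
    exact this
  obtain ⟨c, hc⟩ := Complex.conj_eq_iff_real.1 (Complex.conj_eq_iff_im.2 (hRy.real hD hrn))
  have hsum0 : ∑ j, (D.a j : ℂ) * y0 j = 0 := by
    refine tendsto_nhds_unique (tendsto_finsetSum _ fun j _ => (hy0j j).const_mul _) (tendsto_const_nhds.congr' ?_)
    exact hys.mono fun T h => h.symm
  set Q := ad (C (n : ℂ) * cp D.a y0) with hQ
  set P0 := Q + C (1 - Q.eval (y0 none)) with hP0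
  have hP0d : derivative P0 = C (n : ℂ) * cp D.a y0 := by
    rw [hP0, derivative_add, derivative_C, add_zero, hQ, derivative_ad]
  have hP0n : P0.eval (y0 none) = 1 := by simp [hP0]
  have hP0s : ∀ j, P0.eval (y0 (some j)) = 0 := by
    intro j
    have h1 : PT (U : Filter ℝ) (fun T => ad (C (n : ℂ) * cp D.a (y T))) Q := ((PT.const _).mul (PT.cp _ hy0j)).ad
    have h2 := (h1.eval (hy0j (some j))).sub (h1.eval (hy0j none))
    have h3 := (hKs j).sub hKn
    have h4 : Q.eval (y0 (some j)) - Q.eval (y0 none) = 0 - 1 := by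
      refine tendsto_nhds_unique h2 (h3.congr' ?_)
      filter_upwards [hKd] with T hT
      exact eval_sub_eq (by rw [hT, derivative_ad]) _ _
    simp only [hP0, eval_add, eval_C]
    linear_combination h4
  have hcp : cp D.a y0 = (X - C (c : ℂ)) * cp (fun j => D.a (some j)) (fun j => y0 (some j)) := by
    unfold cp
    rw [Fintype.prod_option, ha1, pow_one, hc]
  rw [hc] at hP0n
  have hnegl : (∏ j : κ, ((c : ℂ) - y0 (some j)) ^ D.a (some j)).re ≤ 0 := by
    have h1 : Tendsto (fun T => ∏ j : κ, (y T none - y T (some j)) ^ D.a (some j)) U (𝓝 (∏ j : κ, ((c : ℂ) - y0 (some j)) ^ D.a (some j))) := by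
      refine tendsto_finsetProd _ fun j _ => Tendsto.pow ?_ _
      have := (hy0j none).sub (hy0j (some j))
      rwa [hc] at this
    refine le_of_tendsto ((Complex.continuous_re.tendsto _).comp h1) ?_
    filter_upwards [hstar, hpos] with T h2 hT
    simp only [Function.comp, hy, ← sub_div, div_pow]
    rw [Finset.prod_div_distrib, Finset.prod_pow_eq_pow_sum, ← Complex.ofReal_pow, Complex.div_ofReal_re]
    exact div_nonpos_of_nonpos_of_nonneg h2.le (pow_nonneg (tT_pos n T hT).le _)
  obtain ⟨α, β, hαβ, hη, l, r, hl, hr, h1, h2, h3, h4⟩ := LIM (fun j => D.a (some j)) (fun j => y0 (some j)) c P0 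
    (by rw [hP0d, hcp, hnn]) hP0s hP0n 
    (by rw [Fintype.sum_option, ha1, hc] at hsum0; simpa using hsum0)
    (by
      intro i
      obtain ⟨j, -, hj⟩ := hRy (some i)
      rcases j with _ | j
      · exfalso
        have h5 := congrArg (starRingEnd ℂ) hj
        rw [Complex.conj_conj, hc, Complex.conj_ofReal] at h5
        have h6 := hP0s i
        rw [← h5, hP0n] at h6
        exact one_ne_zero h6
      · exact ⟨j, hj⟩) hnegl
  have hne : (α : ℂ) ≠ β := fun h => hαβ.ne (by exact_mod_cast h)
  have hA : ∀ j, y0 (some j) = (α : ℂ) ↔ j ∉ Finset.univ.filter (fun j => y0 (some j) = (β : ℂ)) := by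
    intro j
    simp only [Finset.mem_filter, Finset.mem_univ, true_and]
    constructor
    · intro h h'; exact hne (h.symm.trans h')
    · intro h; exact (hη j).resolve_right h
  have hB : ∀ j, y0 (some j) = (β : ℂ) ↔ ¬ j ∉ Finset.univ.filter (fun j => y0 (some j) = (β : ℂ)) := by
    intro j
    simp only [Finset.mem_filter, Finset.mem_univ, true_and, not_not]
  have hl' : l = ∑ j : {j // j ∉ Finset.univ.filter (fun j => y0 (some j) = (β : ℂ))}, D.a (some j) := by
    rw [sum_sub_ite _ (fun j => D.a (some j)), hl]
    exact Finset.sum_congr rfl fun j _ => if_congr (hA j) rfl rfl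
  have hr' : r = ∑ j : {j // ¬ j ∉ Finset.univ.filter (fun j => y0 (some j) = (β : ℂ))}, D.a (some j) := by
    rw [sum_sub_ite _ (fun j => D.a (some j)), hr]
    exact Finset.sum_congr rfl fun j _ => if_congr (hB j) rfl rfl
  have hnl : n = l + 1 + (r + 1) := by
    rw [hnn, hl, hr]
    have : ∑ j : κ, D.a (some j) = ∑ j, (if y0 (some j) = (α : ℂ) then D.a (some j) else 0) + ∑ j, (if y0 (some j) = (β : ℂ) then D.a (some j) else 0) := by
      rw [← Finset.sum_add_distrib]
      refine Finset.sum_congr rfl fun j _ => ?_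
      rcases hη j with h | h
      · rw [if_pos h, if_neg (by rw [h]; exact hne), add_zero]
      · rw [if_pos h, if_neg (by rw [h]; exact hne.symm), zero_add]
    omega
  rw [← hnl] at h2 h3
  refine ⟨α, β, c, hαβ, _, l, r, n, hnl, hl', hr', ?_, ?_, ?_, h1, h2, h3, h4⟩
  · intro j hj
    have := hy0j (some j)
    rwa [(hA j).2 hj] at this
  · intro j hj
    have := hy0j (some j)
    rwa [(hB j).2 hj] at this
  · have := hy0j none
    rwa [hc] at this
end FO

open Polynomial
open scoped Classical
set_option linter.all false
namespace FO
open Filter Topology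

noncomputable def eA {κ : Type} (A : Finset κ) : Option ({j // j ∉ A} ⊕ {j // ¬ j ∉ A}) ≃ Option κ :=
  Equiv.optionCongr (Equiv.sumCompl (fun j => j ∉ A))

lemma top_comap {κ κ' : Type} (D : LD (Option κ)) (e : κ' ≃ κ) (T : ℝ) :
    (D.comap (Equiv.optionCongr e)).top T = (D.top T).comap (Equiv.optionCongr e) := by
  unfold LD.top LD.comap
  congr 1
  funext j
  rcases j with _ | j <;> rfl

def outD {κ : Type} (D : LD (Option κ)) (A : Finset κ) : LD {j // j ∉ A} := D.comap (fun j => some j.1)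
def inD {κ : Type} (D : LD (Option κ)) (A : Finset κ) : LD {j // ¬ j ∉ A} := D.comap (fun j => some j.1)

lemma comap_fL {κ : Type} (D : LD (Option κ)) (A : Finset κ) : (D.comap (eA A)).comap (fL _ _) = outD D A := rfl
lemma comap_fR {κ : Type} (D : LD (Option κ)) (A : Finset κ) : (D.comap (eA A)).comap (fR _ _) = inD D A := rfl

lemma SS_sum {ι : Type*} [Fintype ι] (D : LD ι) (hf : Fintype {ξ | IsSol D ξ}) : SS D = ∑ ξ : {ξ | IsSol D ξ}, sg D ξ.1 := by
  unfold SS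
  rw [← finsum_set_coe_eq_finsum_mem, finsum_eq_sum_of_fintype]

lemma tendsto_ne {X Y : Type*} [TopologicalSpace Y] [T2Space Y] {l : Filter X} {f g : X → Y} {y z : Y} (hf : Tendsto f l (𝓝 y)) (hg : Tendsto g l (𝓝 z)) (h : y ≠ z) :
    ∀ᶠ x in l, f x ≠ g x := by
  obtain ⟨u, v, hu, hv, hyu, hzv, huv⟩ := t2_separation h
  filter_upwards [hf (hu.mem_nhds hyu), hg (hv.mem_nhds hzv)] with x h1 h2 he
  exact Set.disjoint_left.1 huv h1 (by show f x ∈ v; rw [he]; exact h2)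

lemma CUT {κ : Type} [Fintype κ] (D : LD (Option κ)) (hD : D.Good) (ha1 : D.a none = 1) (hrn : D.rel none none)
    (hu : ∀ j, D.u (some j) < D.u none)
    (hstar : ∀ᶠ T in atTop, ∀ ξ, IsSol (D.top T) ξ → (∏ j : κ, (ξ none - ξ (some j)) ^ D.a (some j)).re < 0) :
    SS D = ∑ A : Finset κ, if Odd (∑ j, (inD D A).a j) then (-1) ^ crs (D.comap (eA A)) * (SS (outD D A) * SS (inD D A)) else 0 := by
  have hDA : ∀ A : Finset κ, (D.comap (eA A)).Good := fun A => hD.comap _ (eA A).injective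
  have hDo : ∀ A : Finset κ, (outD D A).Good := fun A => (hDA A).comap _ (fL_inj)
  have hDi : ∀ A : Finset κ, (inD D A).Good := fun A => (hDA A).comap _ (fR_inj)
  let fo : ∀ A : Finset κ, Fintype {ξ | IsSol (outD D A) ξ} := fun A => (sol_finite (hDo A)).fintype
  let fi : ∀ A : Finset κ, Fintype {ξ | IsSol (inD D A) ξ} := fun A => (sol_finite (hDi A)).fintype
  let Z := Σ A : {A : Finset κ // Odd (∑ j, (inD D A).a j)}, {ξ | IsSol (outD D A.1) ξ} × {ξ | IsSol (inD D A.1) ξ}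
  have hcont : ∀ z : Z, _ := fun z => CUT_cont (D.comap (eA z.1.1)) (hDA _) ha1 hrn z.1.2 z.2.1.1 z.2.2.1 z.2.1.2 z.2.2.2
  choose ψ hψ1 hψY hψZ hψu using hcont
  have hisol : ∀ (A : Finset κ) T (ξ : _ → ℂ), IsSol ((D.comap (eA A)).top T) ξ ↔ IsSol (D.top T) (ξ ∘ (eA A).symm) := by
    intro A T ξ
    have e : ξ = (ξ ∘ (eA A).symm) ∘ eA A := by funext j; simp
    conv_lhs => rw [e]
    show IsSol ((D.comap (Equiv.optionCongr _)).top T) _ ↔ _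
    rw [top_comap]
    exact isSol_equiv (eA A) (D.top T) _
  have hAL := AL (I := ℝ) (Z := Z) atTop (fun T => {ξ | IsSol (D.top T) ξ}) (fun ξ => sg D ξ)
    (fun z => (-1) ^ crs (D.comap (eA z.1.1)) * (sg (outD D z.1.1) z.2.1.1 * sg (inD D z.1.1) z.2.2.1))
    (fun z T => ψ z T ∘ (eA z.1.1).symm) ?_ ?_ ?_
  · -- conclude
    obtain ⟨T, hT1, hT2⟩ := (hAL.and (eventually_all.2 fun j => eventually_gt_atTop (D.u (some j)))).exists
    have h1 : SS (D.top T) = SS D := by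
      refine LV hD (D.top T) rfl rfl rfl ?_
      intro i j
      rcases i with _ | i <;> rcases j with _ | j
      · simp
      · have := hu j; have := hT2 j
        simp only [LD.top]; constructor <;> intro h <;> linarith
      · have := hu i; have := hT2 i
        simp only [LD.top]; constructor <;> intro h <;> linarith
      · simp [LD.top]
    rw [← h1]
    have h2 : SS (D.top T) = ∑ᶠ y ∈ {ξ | IsSol (D.top T) ξ}, sg D y := rfl
    rw [h2, hT1, Fintype.sum_sigma]
    rw [← Finset.sum_filter]
    rw [Finset.sum_subtype (Finset.univ.filter _) (p := fun A => Odd (∑ j, (inD D A).a j)) (by simp)]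
    refine Finset.sum_congr rfl fun A _ => ?_
    rw [Fintype.sum_prod_type, SS_sum (outD D A.1) (fo A.1), SS_sum (inD D A.1) (fi A.1), Finset.sum_mul_sum, Finset.mul_sum]
    simp only [Finset.mul_sum]
  · intro z
    filter_upwards [hψ1 z] with T hT
    refine ⟨(hisol _ _ _).1 hT.1, ?_⟩
    have := sg_equiv (eA z.1.1) D (ψ z T ∘ (eA z.1.1).symm)
    rw [← this]
    have e : (ψ z T ∘ (eA z.1.1).symm) ∘ (eA z.1.1) = ψ z T := by funext j; simp
    rw [e]
    exact hT.2.1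
  · intro z z' hzz
    have side : ∀ z : Z, ∀ᶠ T in atTop, (∀ j, j ∉ z.1.1 → ((ψ z T ∘ (eA z.1.1).symm) (some j)).re < ((ψ z T ∘ (eA z.1.1).symm) none).re) ∧
        (∀ j, j ∈ z.1.1 → ((ψ z T ∘ (eA z.1.1).symm) none).re < ((ψ z T ∘ (eA z.1.1).symm) (some j)).re) := by
      intro z
      filter_upwards [hψ1 z] with T hT
      have en : (eA z.1.1).symm none = none := by rw [Equiv.symm_apply_eq]; rfl
      refine ⟨fun j hj => ?_, fun j hj => ?_⟩
      · have e2 : (eA z.1.1).symm (some j) = fL _ _ ⟨j, hj⟩ := by rw [Equiv.symm_apply_eq]; rfl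
        simp only [Function.comp, en, e2]
        exact hT.2.2.1 ⟨j, hj⟩
      · have e2 : (eA z.1.1).symm (some j) = fR _ _ ⟨j, not_not.2 hj⟩ := by rw [Equiv.symm_apply_eq]; rfl
        simp only [Function.comp, en, e2]
        exact hT.2.2.2 ⟨j, not_not.2 hj⟩
    obtain ⟨⟨A, hA⟩, ⟨y, hy⟩, ⟨w, hw⟩⟩ := z
    obtain ⟨⟨A', hA'⟩, ⟨y', hy'⟩, ⟨w', hw'⟩⟩ := z'
    by_cases hAA : A = A'
    · subst hAA
      by_cases hyy : y = y'
      · subst hyy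
        have hww : w ≠ w' := by rintro rfl; exact hzz rfl
        filter_upwards [tendsto_ne (hψZ ⟨⟨A, hA⟩, ⟨y, hy⟩, ⟨w, hw⟩⟩) (hψZ ⟨⟨A, hA'⟩, ⟨y, hy'⟩, ⟨w', hw'⟩⟩) hww] with T hT he
        apply hT
        rw [(eA A).symm.surjective.injective_comp_right he]
      · filter_upwards [tendsto_ne (hψY ⟨⟨A, hA⟩, ⟨y, hy⟩, ⟨w, hw⟩⟩) (hψY ⟨⟨A, hA'⟩, ⟨y', hy'⟩, ⟨w', hw'⟩⟩) hyy] with T hT he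
        apply hT
        rw [(eA A).symm.surjective.injective_comp_right he]
    · filter_upwards [side ⟨⟨A, hA⟩, ⟨y, hy⟩, ⟨w, hw⟩⟩, side ⟨⟨A', hA'⟩, ⟨y', hy'⟩, ⟨w', hw'⟩⟩] with T h1 h2 he
      apply hAA
      ext j
      rw [show _ = _ from he] at h1
      constructor
      · intro hj
        by_contra hj'
        exact lt_asymm (h1.2 j hj) (h2.1 j hj')
      · intro hj
        by_contra hj'
        exact lt_asymm (h2.2 j hj) (h1.1 j hj')
  · intro U hU ξ hsol
    have hst : ∀ᶠ T in (U : Filter ℝ), (∏ j : κ, (ξ T none - ξ T (some j)) ^ D.a (some j)).re < 0 := by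
      filter_upwards [hU hstar, hsol] with T h1 h2
      exact h1 _ h2
    obtain ⟨α, β, c, hαβ, A, l, r, n, hn, hl, hr, hlim1, hlim2, hlim3, hodd, hc, hβ, hl0⟩ := CUT_lim D hD ha1 hrn U hU ξ hsol hst
    subst hn hl hr
    have hsolA : ∀ᶠ T in (U : Filter ℝ), IsSol ((D.comap (eA A)).top T) (ξ T ∘ eA A) := by
      filter_upwards [hsol] with T hT
      rw [hisol]
      have e : (ξ T ∘ eA A) ∘ (eA A).symm = ξ T := by funext j; simp
      rw [e]; exact hT
    obtain ⟨y0, z0, hy0, hz0, hY, hZ, hG, hT, hW⟩ := CUT_compact (D.comap (eA A)) (hDA A) ha1 hrn hodd U hU (fun T => ξ T ∘ eA A) hsolA α β c hαβ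
      (fun i => hlim1 i.1 i.2) (fun i => hlim2 i.1 i.2) hlim3 
      (fun he => hl0 (by rw [Finset.univ_eq_empty, Finset.sum_empty])) hc hβ
    refine ⟨⟨⟨A, hodd⟩, ⟨y0, hy0⟩, ⟨z0, hz0⟩⟩, ?_⟩
    have := hψu ⟨⟨A, hodd⟩, ⟨y0, hy0⟩, ⟨z0, hz0⟩⟩ U hU (fun T => ξ T ∘ eA A) hsolA hY hZ hG hT (β - α) (sub_pos.2 hαβ) hW
    filter_upwards [this] with T hT'
    rw [← hT']
    funext j; simp
end FO

open Polynomial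
open scoped Classical
set_option linter.all false
namespace FO
open Filter Topology

lemma starL (p h : ℝ → ℝ) (c N : ℝ) (hN : 0 < N) (hp : ∀ x, HasDerivAt p (N * (x - c) * h x) x) (hh : Continuous h)
    (hc : 0 < h c) (hz : ∀ z, h z = 0 → p z < p c) (d : ℝ) (hd : h d = 0) (hdc : d < c) : False := by
  have hcp : IsCompact (Set.Icc d c ∩ {x | h x = 0}) := isCompact_Icc.inter_right (isClosed_eq hh continuous_const)
  obtain ⟨e, he, hemax⟩ := hcp.exists_isGreatest ⟨d, ⟨le_refl _, hdc.le⟩, hd⟩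
  have hec : e < c := lt_of_le_of_ne he.1.2 (by rintro rfl; exact hc.ne' he.2)
  have hpos : ∀ x ∈ Set.Ioo e c, 0 < h x := by
    intro x hx
    by_contra hneg
    push Not at hneg
    obtain ⟨y, hy, hy0⟩ := intermediate_value_Icc hx.2.le hh.continuousOn (show (0:ℝ) ∈ Set.Icc (h x) (h c) from ⟨hneg, hc.le⟩)
    have : y ≤ e := hemax ⟨⟨by linarith [he.1.1, hx.1, hy.1], hy.2⟩, hy0⟩
    linarith [hx.1, hy.1]
  have hanti : StrictAntiOn p (Set.Icc e c) := by
    refine strictAntiOn_of_deriv_neg (convex_Icc e c) (fun x _ => (hp x).continuousAt.continuousWithinAt) ?_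
    intro x hx
    rw [interior_Icc] at hx
    rw [(hp x).deriv]
    have h1 := hpos x hx
    have h2 : x - c < 0 := by linarith [hx.2]
    nlinarith [mul_pos (mul_pos hN h1) (neg_pos.2 h2)]
  have := hanti ⟨le_refl _, hec.le⟩ ⟨hec.le, le_refl _⟩ hec
  linarith [hz e he.2]

lemma starR (p h : ℝ → ℝ) (c N : ℝ) (hN : 0 < N) (hp : ∀ x, HasDerivAt p (N * (x - c) * h x) x) (hh : Continuous h)
    (hc : 0 < h c) (hz : ∀ z, h z = 0 → p z < p c) (d : ℝ) (hd : h d = 0) : False := by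
  rcases lt_trichotomy d c with hdc | hdc | hdc
  · exact starL p h c N hN hp hh hc hz d hd hdc
  · subst hdc; exact hc.ne' hd
  · refine starL (fun x => p (2 * c - x)) (fun x => h (2 * c - x)) c N hN ?_ (by fun_prop) ?_ ?_ (2 * c - d) (by simpa using hd) (by linarith)
    · intro x
      have h1 : HasDerivAt (fun x : ℝ => 2 * c - x) (-1) x := by
        simpa using (hasDerivAt_id x).const_sub (2 * c)
      refine ((hp (2 * c - x)).comp x h1).congr_deriv ?_
      ring
    · have : 2 * c - c = c := by ring
      simpa [this] using hc
    · intro z hz'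
      have : 2 * c - c = c := by ring
      simpa [this] using hz _ hz'

lemma even_of_free {ι : Type*} (s : Finset ι) (g : ι → ι) (a : ι → ℕ) (hg : ∀ i ∈ s, g i ∈ s) (hinv : ∀ i ∈ s, g (g i) = i)
    (hne : ∀ i ∈ s, g i ≠ i) (ha : ∀ i ∈ s, a (g i) = a i) : Even (∑ i ∈ s, a i) := by
  rw [← ZMod.natCast_eq_zero_iff_even]
  push_cast
  refine Finset.sum_involution (fun i _ => g i) ?_ ?_ ?_ ?_
  · intro i hi
    rw [ha i hi, ← two_mul]
    rw [show (2 : ZMod 2) = 0 from rfl, zero_mul]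
  · intro i hi _; exact hne i hi
  · intro i hi; exact hg i hi
  · intro i hi; exact hinv i hi

lemma star {κ : Type} [Fintype κ] (D : LD (Option κ)) (hD : D.Good) (ha1 : D.a none = 1) (hrn : D.rel none none)
    (hreal : (∃ j, D.rel (some j) (some j)) ∨ Odd (∑ j, D.a (some j))) :
    ∀ᶠ T in atTop, ∀ ξ, IsSol (D.top T) ξ → (∏ j : κ, (ξ none - ξ (some j)) ^ D.a (some j)).re < 0 := by
  filter_upwards [eventually_all.2 fun j => eventually_gt_atTop (D.u (some j))] with T hT ξ hsol
  obtain ⟨hinj, hrl, -, P, hP, hv⟩ := hsol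
  have hrl' : Rl D ξ := hrl
  obtain ⟨s, hs, hsrel, hsa, -, hsc⟩ := hrl'.exists_sigma hD hinj
  have hcim : (ξ none).im = 0 := hrl'.real hD hrn
  have hsn : s none = none := hD.func _ _ _ (hsrel none) hrn
  have hex : ∃ j, D.rel (some j) (some j) := by
    rcases hreal with h | h
    · exact h
    · by_contra hno
      push Not at hno
      have hss : ∀ j : κ, ∃ k : κ, s (some j) = some k := by
        intro j
        rcases hk : s (some j) with _ | k
        · have := congrArg s hk
          rw [hs, hsn] at this
          cases this
        · exact ⟨k, rfl⟩
      choose g hg using hss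
      refine Nat.not_even_iff_odd.2 h (even_of_free Finset.univ g (fun j => D.a (some j)) (fun _ _ => Finset.mem_univ _) ?_ ?_ ?_)
      · intro i _
        apply Option.some_injective
        rw [← hg, ← hg, hs]
      · intro i _ he
        have := hsrel (some i)
        rw [hg, he] at this
        exact hno i this
      · intro i _
        have := hsa (some i)
        rw [hg] at this
        exact this
  obtain ⟨j0, hj0⟩ := hex
  set c := (ξ none).re with hcdef
  have hc : ξ none = (c : ℂ) := Complex.ext rfl (by simp [hcim])
  set H : ℝ → ℂ := fun x => ∏ j : κ, ((x : ℂ) - ξ (some j)) ^ D.a (some j) with hH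
  have hHc : Continuous H := by fun_prop
  have hG : ∀ x : ℝ, (cp D.a ξ).eval (x : ℂ) = ((x : ℂ) - c) * H x := by
    intro x
    rw [cp_eval, Fintype.prod_option, ha1, pow_one, hc]
  have hGr : ∀ x : ℝ, (starRingEnd ℂ) ((cp D.a ξ).eval (x : ℂ)) = (cp D.a ξ).eval (x : ℂ) := by
    intro x
    rw [cp_eval, map_prod, ← Equiv.prod_comp hs.toPerm]
    refine Finset.prod_congr rfl fun j _ => ?_
    simp only [map_pow, map_sub, Complex.conj_ofReal, Function.Involutive.coe_toPerm]
    rw [hsa, hsc, Complex.conj_conj]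
  have hHim : ∀ x, (H x).im = 0 := by
    have : (fun x => (H x).im) = fun _ => 0 := by
      refine Continuous.ext_on (dense_compl_singleton c) (Complex.continuous_im.comp hHc) continuous_const ?_
      intro x hx
      have h1 := hGr x
      rw [Complex.conj_eq_iff_im, hG] at h1
      rw [← Complex.ofReal_sub, Complex.im_ofReal_mul] at h1
      rcases mul_eq_zero.1 h1 with h2 | h2
      · exact absurd (sub_eq_zero.1 h2) hx
      · exact h2
    exact congrFun this
  have hH0 : ∀ x, (H x).re = 0 → ∃ j, ξ (some j) = (x : ℂ) := by
    intro x hx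
    have h0 : H x = 0 := Complex.ext hx (hHim x)
    obtain ⟨j, -, hj⟩ := Finset.prod_eq_zero_iff.1 h0
    exact ⟨j, (sub_eq_zero.1 ((pow_eq_zero_iff (Nat.ne_of_gt (hD.pos _))).1 hj)).symm⟩
  by_contra hneg
  rw [hc] at hneg
  have hHcpos : 0 < (H c).re := by
    refine lt_of_le_of_ne (not_lt.1 hneg) fun h0 => ?_
    obtain ⟨j, hj⟩ := hH0 c h0.symm
    have := hinj (hj.trans hc.symm)
    cases this
  refine starR (fun x => (P.eval (x : ℂ)).re) (fun x => (H x).re) c ((∑ j, D.a j + 1 : ℕ) : ℝ) (by positivity) ?_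
    (Complex.continuous_re.comp hHc) hHcpos ?_ (ξ (some j0)).re ?_
  · intro x
    have h1 := (P.hasDerivAt (x : ℂ)).real_of_complex
    refine h1.congr_deriv ?_
    rw [show derivative P = _ from hP, eval_mul, eval_C]
    show ((((∑ j, D.a j + 1 : ℕ) : ℂ)) * (cp D.a ξ).eval (x : ℂ)).re = _
    rw [hG, ← Complex.ofReal_sub, ← Complex.ofReal_natCast, Complex.re_ofReal_mul, Complex.re_ofReal_mul]
    ring
  · intro z hz
    obtain ⟨j, hj⟩ := hH0 z hz
    have h1 := hv (some j)
    have h2 := hv none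
    rw [hj] at h1
    rw [hc] at h2
    show (P.eval (z : ℂ)).re < (P.eval (c : ℂ)).re
    rw [h1, h2, Complex.ofReal_re, Complex.ofReal_re]
    exact hT j
  · have him := hrl'.real hD hj0
    have e : (((ξ (some j0)).re : ℝ) : ℂ) = ξ (some j0) := Complex.ext rfl (by simp [him])
    show (H _).re = 0
    rw [hH]
    simp only
    rw [Finset.prod_eq_zero (Finset.mem_univ j0)]
    · rfl
    · rw [e, sub_self, zero_pow (Nat.ne_of_gt (hD.pos _))]
end FO

open Polynomial
open scoped Classical
set_option linter.all false
namespace FO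
open Filter Topology

section
variable {Ω : Type}

noncomputable def SF (E : LD Ω) (s : Finset Ω) : ℤ := SS (E.comap (fun j : {j // j ∈ s} => j.1))

noncomputable def crsF (E : LD Ω) (L : Finset Ω) (t : Ω) (R : Finset Ω) : ℕ :=
  ∑ i ∈ L, E.κ i t + ∑ j ∈ R, E.κ t j + ∑ i ∈ L, ∑ j ∈ R, E.κ i j

lemma SF_of_inj [DecidableEq Ω] (E : LD Ω) {ι : Type} [Fintype ι] (f : ι → Ω) (hf : Function.Injective f) (s : Finset Ω)
    (hs : Finset.univ.image f = s) : SS (E.comap f) = SF E s := by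
  subst hs
  let e : ι ≃ {j // j ∈ Finset.univ.image f} := Equiv.ofBijective (fun i => ⟨f i, Finset.mem_image_of_mem _ (Finset.mem_univ _)⟩)
    ⟨fun i j h => hf (congrArg Subtype.val h), fun ⟨x, hx⟩ => by
      obtain ⟨i, -, hi⟩ := Finset.mem_image.1 hx
      exact ⟨i, Subtype.ext hi⟩⟩
  exact SS_equiv e (E.comap (fun j : {j // j ∈ Finset.univ.image f} => j.1))

lemma CUT_F [DecidableEq Ω] (E : LD Ω) (hE : E.Good) (s : Finset Ω) (t : Ω) (ht : t ∉ s) (ha : E.a t = 1) (hrel : E.rel t t)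
    (hu : ∀ j ∈ s, E.u j < E.u t) (hreal : (∃ j ∈ s, E.rel j j) ∨ Odd (∑ j ∈ s, E.a j)) :
    SF E (insert t s) = ∑ A ∈ s.powerset, if Odd (∑ j ∈ A, E.a j) then (-1) ^ crsF E (s \ A) t A * (SF E (s \ A) * SF E A) else 0 := by
  let g : Option {j // j ∈ s} → Ω := fun o => o.elim t (fun j => j.1)
  have hg : Function.Injective g := by
    rintro (_ | i) (_ | j) h
    · rfl
    · exact absurd j.2 (show j.1 ∉ s from (show t = j.1 from h) ▸ ht)
    · exact absurd i.2 (show i.1 ∉ s from (show i.1 = t from h).symm ▸ ht)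
    · exact congrArg some (Subtype.ext h)
  have himg : Finset.univ.image g = insert t s := by
    ext x
    simp only [Finset.mem_image, Finset.mem_univ, true_and, Finset.mem_insert]
    constructor
    · rintro ⟨_ | i, rfl⟩
      · exact Or.inl rfl
      · exact Or.inr i.2
    · rintro (rfl | h)
      · exact ⟨none, rfl⟩
      · exact ⟨some ⟨x, h⟩, rfl⟩
  rw [← SF_of_inj E g hg _ himg]
  have hsum : ∑ j : {j // j ∈ s}, E.a j.1 = ∑ j ∈ s, E.a j := Finset.sum_coe_sort s E.a
  rw [CUT (E.comap g) (hE.comap g hg) ha hrel (fun j => hu j.1 j.2) (star (E.comap g) (hE.comap g hg) ha hrel ?_)]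
  · refine Finset.sum_nbij (fun A => A.image Subtype.val) ?_ ?_ ?_ ?_
    · intro A _
      rw [Finset.mem_powerset]
      intro x hx
      obtain ⟨y, -, rfl⟩ := Finset.mem_image.1 hx
      exact y.2
    · intro A _ B _ h
      exact Finset.image_injective Subtype.val_injective h
    · intro B hB
      rw [Finset.mem_coe, Finset.mem_powerset] at hB
      refine ⟨B.subtype (· ∈ s), by simp, ?_⟩
      ext x
      simp only [Finset.mem_image, Finset.mem_subtype]
      exact ⟨fun ⟨y, hy, e⟩ => e ▸ hy, fun h => ⟨⟨x, hB h⟩, h, rfl⟩⟩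
    · intro A _
      let fo : {j : {j // j ∈ s} // j ∉ A} → Ω := fun j => j.1.1
      let fi : {j : {j // j ∈ s} // ¬ j ∉ A} → Ω := fun j => j.1.1
      have hfo : Function.Injective fo := fun i j h => Subtype.ext (Subtype.ext h)
      have hfi : Function.Injective fi := fun i j h => Subtype.ext (Subtype.ext h)
      have ho : Finset.univ.image fo = s \ A.image Subtype.val := by
        ext x
        simp only [Finset.mem_image, Finset.mem_univ, true_and, Finset.mem_sdiff]
        constructor
        · rintro ⟨j, rfl⟩
          refine ⟨j.1.2, ?_⟩
          rintro ⟨y, hy, hyj⟩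
          exact j.2 (Subtype.ext hyj ▸ hy)
        · rintro ⟨h1, h2⟩
          exact ⟨⟨⟨x, h1⟩, fun h => h2 ⟨_, h, rfl⟩⟩, rfl⟩
      have hi : Finset.univ.image fi = A.image Subtype.val := by
        ext x
        simp only [Finset.mem_image, Finset.mem_univ, true_and]
        constructor
        · rintro ⟨j, rfl⟩
          exact ⟨j.1, not_not.1 j.2, rfl⟩
        · rintro ⟨y, hy, rfl⟩
          exact ⟨⟨y, not_not.2 hy⟩, rfl⟩
      have so : ∀ φ : Ω → ℕ, ∑ i, φ (fo i) = ∑ x ∈ s \ A.image Subtype.val, φ x := by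
        intro φ
        rw [← ho, Finset.sum_image (fun _ _ _ _ h => hfo h)]
      have si : ∀ φ : Ω → ℕ, ∑ i, φ (fi i) = ∑ x ∈ A.image Subtype.val, φ x := by
        intro φ
        rw [← hi, Finset.sum_image (fun _ _ _ _ h => hfi h)]
      have e1 : ∑ j, (inD (E.comap g) A).a j = ∑ j ∈ A.image Subtype.val, E.a j := si E.a
      have e2 : crs ((E.comap g).comap (eA A)) = crsF E (s \ A.image Subtype.val) t (A.image Subtype.val) := by
        unfold crs crsF
        rw [← so, ← si, ← so]
        congr 1
        refine Finset.sum_congr rfl fun i _ => ?_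
        rw [← si]
        rfl
      have e3 : SS (outD (E.comap g) A) = SF E (s \ A.image Subtype.val) := SF_of_inj E fo hfo _ ho
      have e4 : SS (inD (E.comap g) A) = SF E (A.image Subtype.val) := SF_of_inj E fi hfi _ hi
      simp only [← e1, ← e2, ← e3, ← e4]
      congr!
  · rcases hreal with ⟨j, hj, h⟩ | h
    · exact Or.inl ⟨⟨j, hj⟩, h⟩
    · right
      show Odd (∑ j : {j // j ∈ s}, E.a j.1)
      rw [hsum]; exact h

lemma SF_image [DecidableEq Ω] (E : LD Ω) (hE : E.Good) (s : Finset Ω) (φ : Ω → Ω) (hφ : Set.InjOn φ s)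
    (ha : ∀ i ∈ s, E.a (φ i) = E.a i) (hr : ∀ i ∈ s, ∀ j ∈ s, E.rel (φ i) (φ j) ↔ E.rel i j)
    (hk : ∀ i ∈ s, ∀ j ∈ s, E.κ (φ i) (φ j) = E.κ i j) (hu : ∀ i ∈ s, ∀ j ∈ s, E.u i < E.u j ↔ E.u (φ i) < E.u (φ j)) :
    SF E (s.image φ) = SF E s := by
  have h1 : SS (E.comap (fun j : {j // j ∈ s} => φ j.1)) = SF E (s.image φ) := by
    refine SF_of_inj E _ (fun i j h => Subtype.ext (hφ i.2 j.2 h)) _ ?_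
    ext x
    simp
  rw [← h1]
  unfold SF
  refine LV (hE.comap _ Subtype.val_injective) _ ?_ ?_ ?_ ?_
  · funext i; exact ha _ i.2
  · funext i j; exact propext (hr _ i.2 _ j.2)
  · funext i j; exact hk _ i.2 _ j.2
  · intro i j; exact hu _ i.2 _ j.2

lemma SF_stable (E : LD Ω) (s : Finset Ω) (h : SF E s ≠ 0) : ∀ i ∈ s, ∃ j ∈ s, E.rel i j := by
  unfold SF SS at h
  obtain ⟨ξ, hξ, -⟩ := exists_ne_zero_of_finsum_mem_ne_zero h
  intro i hi
  obtain ⟨j, hj, -⟩ := hξ.2.1 ⟨i, hi⟩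
  exact ⟨j.1, j.2, hj⟩
end
end FO

open Polynomial
open scoped Classical
set_option linter.all false
namespace FO
open Filter Topology

section
variable {W : Type} (a : W → ℕ) (u : W → ℝ) (σ : W → W) (K : ℝ)

def SgS : W ⊕ ℕ → W ⊕ ℕ := Sum.map σ id
def aS : W ⊕ ℕ → ℕ := Sum.elim a (fun _ => 1)
def uS : W ⊕ ℕ → ℝ := Sum.elim u (fun j => K + (j : ℝ))

noncomputable def amb : LD (W ⊕ ℕ) where
  a := aS a
  u := uS u K
  rel := fun i j => j = SgS σ i
  κ := fun i j => if SgS σ i = i ∧ SgS σ j = j then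
    aS a i + (if uS u K i = uS u K j then aS a i + 1 + (if aS a i < aS a j then 1 else 0) else 0) else 0

noncomputable def Bf (i j : W) : ℕ := if σ i = i ∧ σ j = j then
    (if u i = u j then a i + 1 + (if a i < a j then 1 else 0) else 0) else 0
noncomputable def BS (L R : Finset W) : ℕ := ∑ i ∈ L, ∑ j ∈ R, Bf a u σ i j
noncomputable def rc (R : Finset W) : ℕ := (R.filter (fun i => σ i = i)).card
noncomputable def FF (m : ℕ) (D : Finset W) : ℤ := SF (amb a u σ K) (D.disjSum (Finset.range m))

structure AH : Prop where
  pos : ∀ w, 0 < a w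
  lt : ∀ w, u w < K
  inv : ∀ w, σ (σ w) = w
  sa : ∀ w, a (σ w) = a w
  su : ∀ w, u (σ w) = u w

variable {a u σ K}

lemma SgS_inr (j : ℕ) : SgS σ (Sum.inr j) = Sum.inr j := rfl
lemma SgS_inl (w : W) : SgS σ (Sum.inl w) = Sum.inl (σ w) := rfl

lemma amb_good (h : AH a u σ K) : (amb a u σ K).Good := by
  refine ⟨?_, ?_, ?_, ?_, ?_⟩
  · rintro (w | j)
    · exact h.pos w
    · exact Nat.one_pos
  · rintro (w | j) k rfl
    · exact (h.sa w).symm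
    · rfl
  · rintro (w | j) k rfl
    · exact (h.su w).symm
    · rfl
  · rintro i j k rfl rfl; rfl
  · intro i j hk
    have : SgS σ i = i ∧ SgS σ j = j := by
      by_contra hh
      exact hk (if_neg hh)
    exact ⟨this.1.symm, this.2.symm⟩

lemma aS_sum (R : Finset W) (J : Finset ℕ) : ∑ i ∈ R.disjSum J, aS a i = ∑ i ∈ R, a i + J.card := by
  rw [Finset.sum_disjSum]
  simp [aS]

lemma uS_ne (h : AH a u σ K) (w : W) (j : ℕ) : uS u K (Sum.inl w) < uS u K (Sum.inr j) := by
  have := h.lt w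
  simp only [uS, Sum.elim_inl, Sum.elim_inr]
  have : (0:ℝ) ≤ (j:ℝ) := Nat.cast_nonneg _
  linarith

lemma uS_inr (i j : ℕ) : uS u K (Sum.inr i) < uS u K (Sum.inr j) ↔ i < j := by
  simp [uS]

lemma uS_inr_eq (i j : ℕ) : uS u K (Sum.inr i) = uS u K (Sum.inr j) ↔ i = j := by
  simp [uS]

lemma kap_eq (i j : W ⊕ ℕ) : (amb a u σ K).κ i j = (if SgS σ i = i ∧ SgS σ j = j then
    aS a i + (if uS u K i = uS u K j then aS a i + 1 + (if aS a i < aS a j then 1 else 0) else 0) else 0) := rfl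

lemma FF_image (h : AH a u σ K) (D : Finset W) (J : Finset ℕ) :
    SF (amb a u σ K) (D.disjSum J) = FF a u σ K J.card D := by
  let f : ℕ → ℕ := fun i => if hi : i < J.card then J.orderEmbOfFin rfl ⟨i, hi⟩ else 0
  have hf : ∀ i ∈ Finset.range J.card, ∀ j ∈ Finset.range J.card, f i < f j ↔ i < j := by
    intro i hi j hj
    rw [Finset.mem_range] at hi hj
    simp only [f, hi, hj, dif_pos]
    simp
  have hfe : ∀ i ∈ Finset.range J.card, ∀ j ∈ Finset.range J.card, f i = f j ↔ i = j := by
    intro i hi j hj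
    have h1 := hf i hi j hj
    have h2 := hf j hj i hi
    omega
  have hfi : (Finset.range J.card).image f = J := by
    ext x
    have := Finset.range_orderEmbOfFin J rfl
    have hx : x ∈ J ↔ x ∈ Set.range (J.orderEmbOfFin rfl) := by rw [this]; rfl
    rw [hx]
    simp only [Finset.mem_image, Finset.mem_range, Set.mem_range]
    constructor
    · rintro ⟨i, hi, rfl⟩
      exact ⟨⟨i, hi⟩, by simp [f, hi]⟩
    · rintro ⟨i, rfl⟩
      exact ⟨i.1, i.2, by simp [f]⟩
  have himg : (D.disjSum (Finset.range J.card)).image (Sum.map id f) = D.disjSum J := by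
    ext x
    rcases x with w | x
    · simp
    · have hx : x ∈ J ↔ x ∈ (Finset.range J.card).image f := by rw [hfi]
      rw [Finset.inr_mem_disjSum, hx]
      simp
  rw [← himg]
  refine SF_image _ (amb_good h) _ _ ?_ ?_ ?_ ?_ ?_
  · rintro (i | i) hi (j | j) hj hij
    · simpa using hij
    · simp at hij
    · simp at hij
    · simp only [Sum.map_inr, Sum.inr.injEq] at hij
      rw [Finset.mem_coe, Finset.inr_mem_disjSum] at hi hj
      rw [(hfe i hi j hj).1 hij]
  · rintro (i | i) hi <;> rfl
  · rintro (i | i) hi (j | j) hj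
    · exact Iff.rfl
    · simp [amb, SgS]
    · simp [amb, SgS]
    · rw [Finset.inr_mem_disjSum] at hi hj
      simp only [amb, SgS, Sum.map_inr, Sum.inr.injEq, id]
      exact hfe j hj i hi
  · rintro (i | i) hi (j | j) hj
    · rfl
    · simp only [kap_eq, Sum.map_inl, Sum.map_inr, SgS_inr, id, (uS_ne h i _).ne, if_false]
    · simp only [kap_eq, Sum.map_inl, Sum.map_inr, SgS_inr, id, (uS_ne h j _).ne', if_false, aS, Sum.elim_inr, Sum.elim_inl]
    · rw [Finset.inr_mem_disjSum] at hi hj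
      simp only [kap_eq, Sum.map_inr, SgS_inr, uS_inr_eq, hfe i hi j hj]
      simp [aS]
  · rintro (i | i) hi (j | j) hj
    · exact Iff.rfl
    · simp only [Sum.map_inl, Sum.map_inr]
      exact iff_of_true (uS_ne h _ _) (uS_ne h _ _)
    · simp only [Sum.map_inl, Sum.map_inr]
      exact iff_of_false (uS_ne h _ _).not_gt (uS_ne h _ _).not_gt
    · rw [Finset.inr_mem_disjSum] at hi hj
      exact (uS_inr (u := u) i j).trans ((hf i hi j hj).symm.trans (uS_inr (u := u) (f i) (f j)).symm)

lemma pow_congr2 (p q : ℕ) (h : (p : ZMod 2) = q) : (-1 : ℤ) ^ p = (-1) ^ q := by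
  rw [ZMod.natCast_eq_natCast_iff'] at h
  rw [neg_one_pow_eq_pow_mod_two, h, ← neg_one_pow_eq_pow_mod_two]

lemma crs_sign (h : AH a u σ K) (L R : Finset W) (I J : Finset ℕ) (t : ℕ) (hI : t ∉ I) (hJ : t ∉ J) (hIJ : Disjoint I J)
    (hst : ∀ i ∈ L.disjSum I, ∃ j ∈ L.disjSum I, (amb a u σ K).rel i j) :
    (-1 : ℤ) ^ crsF (amb a u σ K) (L.disjSum I) (Sum.inr t) (R.disjSum J) =
      (-1) ^ ((∑ i ∈ L, a i + I.card) + (1 + (∑ i ∈ L, a i + I.card)) * (rc σ R + J.card) + BS a u σ L R) := by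
  set lr := ∑ i ∈ (L.disjSum I).filter (fun i => SgS σ i = i), aS a i with hlr
  have hpar : (lr : ZMod 2) = ((∑ i ∈ L, a i + I.card : ℕ) : ZMod 2) := by
    rw [← aS_sum, ← Finset.sum_filter_add_sum_filter_not (L.disjSum I) (fun i => SgS σ i = i), Nat.cast_add]
    have : Even (∑ i ∈ (L.disjSum I).filter (fun i => ¬ SgS σ i = i), aS a i) := by
      have hinv : ∀ i, SgS σ (SgS σ i) = i := by
        rintro (i | i)
        · simp [SgS, h.inv]
        · rfl
      refine even_of_free _ (SgS σ) _ ?_ (fun i _ => hinv i) ?_ ?_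
      · intro i hi
        rw [Finset.mem_filter] at hi ⊢
        obtain ⟨j, hj, rfl⟩ := hst i hi.1
        refine ⟨hj, fun h' => hi.2 ?_⟩
        rw [hinv] at h'
        exact h'.symm
      · intro i hi; exact (Finset.mem_filter.1 hi).2
      · rintro (i | i) hi
        · exact h.sa i
        · rfl
    rw [(ZMod.natCast_eq_zero_iff_even).2 this, add_zero]
  have hrr : ∑ j ∈ R.disjSum J, (if SgS σ j = j then 1 else 0) = rc σ R + J.card := by
    rw [Finset.sum_disjSum]
    unfold rc
    rw [Finset.card_filter]
    simp only [SgS_inl, SgS_inr, Sum.inl.injEq, if_true, Finset.sum_const, smul_eq_mul, mul_one]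
  have e1 : ∑ i ∈ L.disjSum I, (amb a u σ K).κ i (Sum.inr t) = lr := by
    rw [hlr, Finset.sum_filter]
    refine Finset.sum_congr rfl fun i hi => ?_
    have : uS u K i ≠ uS u K (Sum.inr t) := by
      rcases i with i | i
      · exact (uS_ne h _ _).ne
      · rw [Ne, uS_inr_eq]; rintro rfl
        exact hI (Finset.inr_mem_disjSum.1 hi)
    simp only [kap_eq, SgS_inr, and_true, this, if_false, add_zero]
  have e2 : ∑ j ∈ R.disjSum J, (amb a u σ K).κ (Sum.inr t) j = rc σ R + J.card := by
    rw [← hrr]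
    refine Finset.sum_congr rfl fun i hi => ?_
    have : uS u K (Sum.inr t) ≠ uS u K i := by
      rcases i with i | i
      · exact (uS_ne h _ _).ne'
      · rw [Ne, uS_inr_eq]; rintro rfl
        exact hJ (Finset.inr_mem_disjSum.1 hi)
    simp only [kap_eq, SgS_inr, true_and, this, if_false, add_zero]
    rfl
  have e3 : ∑ i ∈ L.disjSum I, ∑ j ∈ R.disjSum J, (amb a u σ K).κ i j = lr * (rc σ R + J.card) + BS a u σ L R := by
    have hb : BS a u σ L R = ∑ i ∈ L.disjSum I, ∑ j ∈ R.disjSum J, (if SgS σ i = i ∧ SgS σ j = j then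
        (if uS u K i = uS u K j then aS a i + 1 + (if aS a i < aS a j then 1 else 0) else 0) else 0) := by
      rw [Finset.sum_disjSum]
      have z2 : ∑ i ∈ I, ∑ j ∈ R.disjSum J, (if SgS σ (Sum.inr i) = Sum.inr i ∧ SgS σ j = j then
        (if uS u K (Sum.inr i) = uS u K j then aS a (Sum.inr i) + 1 + (if aS a (Sum.inr i) < aS a j then 1 else 0) else 0) else 0) = 0 := by
        refine Finset.sum_eq_zero fun i hi => Finset.sum_eq_zero fun j hj => ?_
        have : uS u K (Sum.inr i) ≠ uS u K j := by
          rcases j with j | j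
          · exact (uS_ne h _ _).ne'
          · rw [Ne, uS_inr_eq]; rintro rfl
            exact Finset.disjoint_left.1 hIJ hi (Finset.inr_mem_disjSum.1 hj)
        simp [this]
      rw [z2, add_zero]
      unfold BS
      refine Finset.sum_congr rfl fun i hi => ?_
      rw [Finset.sum_disjSum]
      have z3 : ∑ j ∈ J, (if SgS σ (Sum.inl i) = Sum.inl i ∧ SgS σ (Sum.inr j) = Sum.inr j then
        (if uS u K (Sum.inl i) = uS u K (Sum.inr j) then aS a (Sum.inl i) + 1 + (if aS a (Sum.inl i) < aS a (Sum.inr j) then 1 else 0) else 0) else 0) = 0 := by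
        refine Finset.sum_eq_zero fun j hj => ?_
        simp [(uS_ne h i j).ne]
      rw [z3, add_zero]
      refine Finset.sum_congr rfl fun j hj => ?_
      simp only [Bf, SgS_inl, Sum.inl.injEq]
      rfl
    rw [hb, hlr, ← hrr, Finset.sum_filter, Finset.sum_mul_sum, ← Finset.sum_add_distrib]
    refine Finset.sum_congr rfl fun i hi => ?_
    rw [← Finset.sum_add_distrib]
    refine Finset.sum_congr rfl fun j hj => ?_
    rw [kap_eq]
    by_cases h1 : SgS σ i = i <;> by_cases h2 : SgS σ j = j <;> simp [h1, h2]
  apply pow_congr2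
  unfold crsF
  rw [e1, e2, e3]
  push_cast at hpar ⊢
  rw [hpar]
  ring

variable (a u σ K) in
noncomputable def tm (D R : Finset W) (i j : ℕ) : ℤ := if Odd (∑ w ∈ R, a w + i) then
        (-1) ^ ((∑ w ∈ D \ R, a w + j) + (1 + (∑ w ∈ D \ R, a w + j)) * (rc σ R + i) + BS a u σ (D \ R) R) *
          (FF a u σ K j (D \ R) * FF a u σ K i R) else 0

lemma REC (h : AH a u σ K) (D : Finset W) (m : ℕ) (hm : 0 < m ∨ Odd (∑ i ∈ D, a i + m)) :
    FF a u σ K (m + 1) D = ∑ R ∈ D.powerset, ∑ ij ∈ Finset.HasAntidiagonal.antidiagonal m,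
      m.choose ij.1 • tm a u σ K D R ij.1 ij.2 := by
  have hins : D.disjSum (Finset.range (m + 1)) = insert (Sum.inr m) (D.disjSum (Finset.range m)) := by
    ext x
    rcases x with x | x
    · simp
    · simp; omega
  rw [FF, hins, CUT_F (amb a u σ K) (amb_good h) _ (Sum.inr m) (by simp) rfl rfl]
  · rw [Finset.sum_nbij' (t := D.powerset ×ˢ (Finset.range m).powerset) (fun A => (A.toLeft, A.toRight)) (fun p => p.1.disjSum p.2)
      (g := fun p => tm a u σ K D p.1 p.2.card (m - p.2.card))]
    · rw [Finset.sum_product]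
      refine Finset.sum_congr rfl fun R hR => ?_
      rw [Finset.sum_powerset_apply_card (fun c => tm a u σ K D R c (m - c)), Finset.card_range]
      rw [Finset.Nat.sum_antidiagonal_eq_sum_range_succ (fun i j => m.choose i • tm a u σ K D R i j)]
    · intro A hA
      rw [Finset.mem_powerset] at hA
      simp only [Finset.mem_product, Finset.mem_powerset]
      constructor
      · intro x hx
        exact Finset.inl_mem_disjSum.1 (hA (Finset.mem_toLeft.1 hx))
      · intro x hx
        exact Finset.inr_mem_disjSum.1 (hA (Finset.mem_toRight.1 hx))
    · intro p hp
      simp only [Finset.mem_product, Finset.mem_powerset] at hp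
      rw [Finset.mem_powerset]
      exact Finset.disjSum_mono hp.1 hp.2
    · intro A _; exact Finset.toLeft_disjSum_toRight
    · intro p _; simp
    · intro A hA
      rw [Finset.mem_powerset] at hA
      obtain ⟨R, J, rfl⟩ : ∃ R J, A = Finset.disjSum R J := ⟨A.toLeft, A.toRight, Finset.toLeft_disjSum_toRight.symm⟩
      simp only [Finset.toLeft_disjSum, Finset.toRight_disjSum, tm]
      have hJ : J ⊆ Finset.range m := fun x hx => Finset.inr_mem_disjSum.1 (hA (Finset.inr_mem_disjSum.2 hx))
      have hsd : D.disjSum (Finset.range m) \ R.disjSum J = (D \ R).disjSum (Finset.range m \ J) := by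
        ext x
        rcases x with x | x <;> simp
      have hcard : (Finset.range m \ J).card = m - J.card := by
        rw [Finset.card_sdiff_of_subset hJ, Finset.card_range]
      have ha : ∑ j ∈ R.disjSum J, (amb a u σ K).a j = ∑ i ∈ R, a i + J.card := aS_sum _ _
      rw [hsd, ha]
      split_ifs with ho
      · by_cases h0 : SF (amb a u σ K) ((D \ R).disjSum (Finset.range m \ J)) = 0
        · have h0' := h0
          rw [FF_image h, hcard] at h0'
          rw [h0, h0']
          simp
        · have hs := SF_stable _ _ h0
          rw [crs_sign h _ _ _ _ m (by simp) (fun hh => by simpa using hJ hh) Finset.sdiff_disjoint hs, hcard, FF_image h, FF_image h, hcard]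
      · rfl
  · rintro (j | j) hj
    · exact uS_ne h _ _
    · exact (uS_inr (u := u) j m).2 (by simpa using hj)
  · rcases hm with hm | hm
    · left
      exact ⟨Sum.inr 0, by simpa using hm, rfl⟩
    · right
      have := aS_sum (a := a) D (Finset.range m)
      rw [Finset.card_range] at this
      show Odd (∑ j ∈ D.disjSum (Finset.range m), aS a j)
      rw [this]; exact hm
end
end FO

open Polynomial
open scoped Classical
set_option linter.all false
namespace FO
open Filter Topology

lemma reix {W : Type} [Fintype W] (D D' : Finset W) (hDD : D' ⊆ D) (g : Finset W → ℤ) (h : ∀ E, g E ≠ 0 → D' ⊆ E ∧ E ⊆ D) :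
    ∑ E, g E = ∑ R ∈ (D \ D').powerset, g (D \ R) := by
  symm
  refine Finset.sum_bij_ne_zero (fun R _ _ => D \ R) (fun _ _ _ => Finset.mem_univ _) ?_ ?_ (fun _ _ _ => rfl)
  · intro R hR _ R' hR' _ he
    rw [Finset.mem_powerset] at hR hR'
    have h1 := hR.trans Finset.sdiff_subset
    have h2 := hR'.trans Finset.sdiff_subset
    rw [← Finset.sdiff_sdiff_eq_self h1, he, Finset.sdiff_sdiff_eq_self h2]
  · intro E _ hE
    obtain ⟨h1, h2⟩ := h E hE
    refine ⟨D \ E, ?_, ?_, ?_⟩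
    · rw [Finset.mem_powerset]; exact Finset.sdiff_subset_sdiff (le_refl _) h1
    · rw [Finset.sdiff_sdiff_eq_self h2]; exact hE
    · exact Finset.sdiff_sdiff_eq_self h2

section
variable {W : Type} (a : W → ℕ) (u : W → ℝ) (σ : W → W) (K : ℝ)

noncomputable def chi (R : Finset W) : ℤ := (-1) ^ (∑ w ∈ R, a w + rc σ R)

noncomputable def MZ (m : ℕ) : Matrix (Finset W) (Finset W) ℤ := fun D D' =>
  if D' ⊆ D ∧ Odd (∑ w ∈ D \ D', a w + m) then (-1) ^ BS a u σ D' (D \ D') * chi a σ (D \ D') * FF a u σ K m (D \ D') else 0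

noncomputable def fZ (m : ℕ) (D : Finset W) : ℤ := if Even (∑ w ∈ D, a w + m) then FF a u σ K m D else 0

variable {a u σ K}

lemma rc_union (R S : Finset W) (h : Disjoint R S) : rc σ (R ∪ S) = rc σ R + rc σ S := by
  unfold rc
  rw [Finset.filter_union, Finset.card_union_of_disjoint (Finset.disjoint_filter_filter h)]

lemma chi_union (R S : Finset W) (h : Disjoint R S) : chi a σ (R ∪ S) = chi a σ R * chi a σ S := by
  unfold chi
  rw [rc_union _ _ h, Finset.sum_union h, ← pow_add]
  congr 1; ring

lemma BS_union_left (R S T : Finset W) (h : Disjoint R S) : BS a u σ (R ∪ S) T = BS a u σ R T + BS a u σ S T := by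
  unfold BS
  rw [Finset.sum_union h]

lemma BS_union_right (R S T : Finset W) (h : Disjoint R S) : BS a u σ T (R ∪ S) = BS a u σ T R + BS a u σ T S := by
  unfold BS
  rw [← Finset.sum_add_distrib]
  exact Finset.sum_congr rfl fun i _ => Finset.sum_union h

lemma chi_sq (R : Finset W) : chi a σ R * chi a σ R = 1 := by
  unfold chi
  rw [← pow_add, ← two_mul, pow_mul]; simp

lemma even_odd_cast (p : ℕ) : (Even p ↔ (p : ZMod 2) = 0) ∧ (Odd p ↔ (p : ZMod 2) = 1) :=
  ⟨ZMod.natCast_eq_zero_iff_even.symm, ZMod.natCast_eq_one_iff_odd.symm⟩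

lemma tm_odd (E R : Finset W) (hR : R ⊆ E) (i j : ℕ) (hn : Odd (∑ w ∈ E, a w + (i + j) + 1)) :
    tm a u σ K E R i j = -(if Odd (∑ w ∈ R, a w + i) ∧ Odd (∑ w ∈ E \ R, a w + j) then
      (-1) ^ BS a u σ (E \ R) R * (FF a u σ K j (E \ R) * FF a u σ K i R) else 0) := by
  have hs := Finset.sum_sdiff (f := a) hR
  unfold tm
  by_cases h1 : Odd (∑ w ∈ R, a w + i)
  · have h2 : Odd (∑ w ∈ E \ R, a w + j) := by
      obtain ⟨p, hp⟩ := h1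
      obtain ⟨q, hq⟩ := hn
      rcases Nat.even_or_odd (∑ w ∈ E \ R, a w + j) with ⟨r, hr⟩ | h
      · omega
      · exact h
    rw [if_pos h1, if_pos ⟨h1, h2⟩]
    have : (-1 : ℤ) ^ (∑ w ∈ E \ R, a w + j + (1 + (∑ w ∈ E \ R, a w + j)) * (rc σ R + i) + BS a u σ (E \ R) R) = (-1) ^ (1 + BS a u σ (E \ R) R) := by
      apply pow_congr2
      rw [(even_odd_cast _).2] at h2
      push_cast at h2 ⊢
      rw [h2, show (1 + 1 : ZMod 2) = 0 from rfl, zero_mul, add_zero]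
    rw [this, pow_add]
    ring
  · rw [if_neg h1, if_neg (fun h => h1 h.1), neg_zero]

lemma tm_even (E R : Finset W) (hR : R ⊆ E) (i j : ℕ) (hn : Odd (∑ w ∈ E, a w + (i + j))) :
    tm a u σ K E R i j = -(if Odd (∑ w ∈ R, a w + i) ∧ Even (∑ w ∈ E \ R, a w + j) then
      (-1) ^ BS a u σ (E \ R) R * chi a σ R * (FF a u σ K j (E \ R) * FF a u σ K i R) else 0) := by
  have hs := Finset.sum_sdiff (f := a) hR
  unfold tm
  by_cases h1 : Odd (∑ w ∈ R, a w + i)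
  · have h2 : Even (∑ w ∈ E \ R, a w + j) := by
      obtain ⟨p, hp⟩ := h1
      obtain ⟨q, hq⟩ := hn
      rcases Nat.even_or_odd (∑ w ∈ E \ R, a w + j) with h | ⟨r, hr⟩
      · exact h
      · omega
    rw [if_pos h1, if_pos ⟨h1, h2⟩]
    have : (-1 : ℤ) ^ (∑ w ∈ E \ R, a w + j + (1 + (∑ w ∈ E \ R, a w + j)) * (rc σ R + i) + BS a u σ (E \ R) R) = (-1) ^ (1 + BS a u σ (E \ R) R + (∑ w ∈ R, a w + rc σ R)) := by
      apply pow_congr2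
      rw [(even_odd_cast _).1] at h2
      rw [(even_odd_cast _).2] at h1
      push_cast at h1 h2 ⊢
      rw [h2]
      have h3 : (2 : ZMod 2) = 0 := rfl
      linear_combination (-1 : ZMod 2) * h1 + ((i : ZMod 2) - 1) * h3
    unfold chi
    rw [this, pow_add, pow_add]
    ring
  · rw [if_neg h1, if_neg (fun h => h1 h.1), neg_zero]

variable [Fintype W]

lemma fZ_rec (h : AH a u σ K) (m : ℕ) (D : Finset W) : fZ a u σ K (m + 1) D =
    - ∑ ij ∈ Finset.HasAntidiagonal.antidiagonal m, m.choose ij.1 • ∑ E, MZ a u σ K ij.1 D E * fZ a u σ K ij.2 E := by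
  have hre : ∀ ij : ℕ × ℕ, ∑ E, MZ a u σ K ij.1 D E * fZ a u σ K ij.2 E = ∑ R ∈ D.powerset, (MZ a u σ K ij.1 D (D \ R) * fZ a u σ K ij.2 (D \ R)) := by
    intro ij
    rw [reix D ∅ (Finset.empty_subset _), Finset.sdiff_empty]
    intro E hE
    refine ⟨Finset.empty_subset _, ?_⟩
    by_contra hh
    apply hE
    rw [MZ, if_neg (fun h' => hh h'.1), zero_mul]
  have hterm : ∀ ij ∈ Finset.HasAntidiagonal.antidiagonal m, ∀ R ∈ D.powerset, MZ a u σ K ij.1 D (D \ R) * fZ a u σ K ij.2 (D \ R) = 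
      if Odd (∑ w ∈ R, a w + ij.1) ∧ Even (∑ w ∈ D \ R, a w + ij.2) then
      (-1) ^ BS a u σ (D \ R) R * chi a σ R * (FF a u σ K ij.2 (D \ R) * FF a u σ K ij.1 R) else 0 := by
    intro ij _ R hR
    rw [Finset.mem_powerset] at hR
    unfold MZ fZ
    rw [Finset.sdiff_sdiff_eq_self hR]
    by_cases h1 : Odd (∑ w ∈ R, a w + ij.1) <;> by_cases h2 : Even (∑ w ∈ D \ R, a w + ij.2) <;> simp [h1, h2]
    ring
  by_cases hn : Even (∑ w ∈ D, a w + (m + 1))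
  · have hn' : Odd (∑ w ∈ D, a w + m) := by
      rcases Nat.even_or_odd (∑ w ∈ D, a w + m) with h' | h'
      · obtain ⟨p, hp⟩ := hn
        obtain ⟨q, hq⟩ := h'
        omega
      · exact h'
    rw [fZ, if_pos hn, REC h D m (Or.inr hn'), Finset.sum_comm, ← Finset.sum_neg_distrib]
    refine Finset.sum_congr rfl fun ij hij => ?_
    rw [hre, Finset.smul_sum, ← Finset.sum_neg_distrib]
    refine Finset.sum_congr rfl fun R hR => ?_
    rw [hterm ij hij R hR, tm_even D R (Finset.mem_powerset.1 hR) _ _ (by rw [Finset.HasAntidiagonal.mem_antidiagonal.1 hij]; exact hn'), smul_neg]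
  · rw [fZ, if_neg hn]
    symm
    rw [neg_eq_zero]
    refine Finset.sum_eq_zero fun ij hij => ?_
    rw [hre, Finset.sum_eq_zero, smul_zero]
    intro R hR
    rw [hterm ij hij R hR, if_neg]
    rintro ⟨⟨p, hp⟩, ⟨q, hq⟩⟩
    have hs := Finset.sum_sdiff (f := a) (Finset.mem_powerset.1 hR)
    have := Finset.HasAntidiagonal.mem_antidiagonal.1 hij
    exact hn ⟨p + q + 1, by omega⟩

lemma MZ_rec (h : AH a u σ K) (m : ℕ) (D D' : Finset W) : MZ a u σ K (m + 2) D D' =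
    - ∑ ij ∈ Finset.HasAntidiagonal.antidiagonal (m + 1), (m + 1).choose ij.1 • ∑ E, MZ a u σ K ij.1 D E * MZ a u σ K ij.2 E D' := by
  have hsub : ∀ (ij : ℕ × ℕ) E, MZ a u σ K ij.1 D E * MZ a u σ K ij.2 E D' ≠ 0 → D' ⊆ E ∧ E ⊆ D := by
    intro ij E hE
    constructor
    · by_contra hh
      apply hE
      rw [MZ, MZ, if_neg (c := D' ⊆ E ∧ _) (fun h' => hh h'.1), mul_zero]
    · by_contra hh
      apply hE
      rw [MZ, if_neg (fun h' => hh h'.1), zero_mul]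
  by_cases hDD : D' ⊆ D
  · have hre : ∀ ij : ℕ × ℕ, ∑ E, MZ a u σ K ij.1 D E * MZ a u σ K ij.2 E D' = ∑ R ∈ (D \ D').powerset, (MZ a u σ K ij.1 D (D \ R) * MZ a u σ K ij.2 (D \ R) D') := 
      fun ij => reix D D' hDD _ (hsub ij)
    have hterm : ∀ ij ∈ Finset.HasAntidiagonal.antidiagonal (m + 1), ∀ R ∈ (D \ D').powerset, MZ a u σ K ij.1 D (D \ R) * MZ a u σ K ij.2 (D \ R) D' = 
        ((-1) ^ BS a u σ D' (D \ D') * chi a σ (D \ D')) * if Odd (∑ w ∈ R, a w + ij.1) ∧ Odd (∑ w ∈ (D \ D') \ R, a w + ij.2) then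
        (-1) ^ BS a u σ ((D \ D') \ R) R * (FF a u σ K ij.2 ((D \ D') \ R) * FF a u σ K ij.1 R) else 0 := by
      intro ij _ R hR
      rw [Finset.mem_powerset] at hR
      have hRD : R ⊆ D := hR.trans Finset.sdiff_subset
      have hRD' : Disjoint R D' := Finset.disjoint_of_subset_left hR Finset.sdiff_disjoint
      have e1 : (D \ R) \ D' = (D \ D') \ R := by rw [sdiff_right_comm]
      have e2 : D \ R = D' ∪ ((D \ D') \ R) := by
        ext x
        simp only [Finset.mem_sdiff, Finset.mem_union]
        constructor
        · intro ⟨h1, h2⟩; by_cases h3 : x ∈ D'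
          · exact Or.inl h3
          · exact Or.inr ⟨⟨h1, h3⟩, h2⟩
        · rintro (h1 | h1)
          · exact ⟨hDD h1, fun h2 => Finset.disjoint_left.1 hRD' h2 h1⟩
          · exact ⟨h1.1.1, h1.2⟩
      have hd1 : Disjoint D' ((D \ D') \ R) := by
        rw [Finset.disjoint_left]
        intro x hx hx'
        exact (Finset.mem_sdiff.1 (Finset.mem_sdiff.1 hx').1).2 hx
      have hd2 : Disjoint R ((D \ D') \ R) := Finset.disjoint_sdiff
      have e3 : D \ D' = R ∪ ((D \ D') \ R) := (Finset.union_sdiff_of_subset hR).symm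
      have hsub1 : D' ⊆ D \ R := by rw [e2]; exact Finset.subset_union_left
      have eB : BS a u σ (D \ R) R = BS a u σ D' R + BS a u σ ((D \ D') \ R) R := by
        rw [e2, BS_union_left _ _ _ hd1]
      have eB2 : BS a u σ D' (D \ D') = BS a u σ D' R + BS a u σ D' ((D \ D') \ R) := by
        conv_lhs => rw [e3]
        rw [BS_union_right _ _ _ hd2]
      have eC : chi a σ (D \ D') = chi a σ R * chi a σ ((D \ D') \ R) := by
        conv_lhs => rw [e3]
        rw [chi_union _ _ hd2]
      unfold MZ
      rw [Finset.sdiff_sdiff_eq_self hRD, e1, eB, eB2, eC]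
      by_cases h1 : Odd (∑ w ∈ R, a w + ij.1) <;> by_cases h2 : Odd (∑ w ∈ (D \ D') \ R, a w + ij.2) <;> simp [h1, h2, hsub1]
      rw [pow_add, pow_add]
      ring
    by_cases hn : Odd (∑ w ∈ D \ D', a w + (m + 2))
    · rw [MZ, if_pos ⟨hDD, hn⟩, REC h _ (m + 1) (Or.inl (Nat.succ_pos m)), Finset.sum_comm, ← Finset.sum_neg_distrib, Finset.mul_sum]
      refine Finset.sum_congr rfl fun ij hij => ?_
      rw [hre, Finset.smul_sum, ← Finset.sum_neg_distrib, Finset.mul_sum]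
      refine Finset.sum_congr rfl fun R hR => ?_
      rw [hterm ij hij R hR, tm_odd (D \ D') R (Finset.mem_powerset.1 hR) _ _ (by rw [Finset.HasAntidiagonal.mem_antidiagonal.1 hij]; exact hn), smul_neg, mul_neg, mul_smul_comm]
    · rw [MZ, if_neg (fun hh => hn hh.2)]
      symm
      rw [neg_eq_zero]
      refine Finset.sum_eq_zero fun ij hij => ?_
      rw [hre, Finset.sum_eq_zero, smul_zero]
      intro R hR
      rw [hterm ij hij R hR, if_neg, mul_zero]
      rintro ⟨⟨p, hp⟩, ⟨q, hq⟩⟩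
      have hs := Finset.sum_sdiff (f := a) (Finset.mem_powerset.1 hR)
      have := Finset.HasAntidiagonal.mem_antidiagonal.1 hij
      exact hn ⟨p + q + 1, by omega⟩
  · rw [MZ, if_neg (fun hh => hDD hh.1)]
    symm
    rw [neg_eq_zero]
    refine Finset.sum_eq_zero fun ij hij => ?_
    rw [Finset.sum_eq_zero, smul_zero]
    intro E _
    by_contra hne
    exact hDD ((hsub ij E hne).1.trans (hsub ij E hne).2)

end

lemma FF_one {W : Type} {a : W → ℕ} {u : W → ℝ} {σ : W → W} {K : ℝ} : FF a u σ K 1 ∅ = 1 := by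
  letI hun : Unique {j : W ⊕ ℕ // j ∈ (∅ : Finset W).disjSum (Finset.range 1)} :=
    { default := ⟨Sum.inr 0, by simp⟩, uniq := by rintro ⟨x | x, hx⟩ <;> simp at hx; subst hx; rfl }
  unfold FF SF SS
  set D := (amb a u σ K).comap (fun j : {j : W ⊕ ℕ // j ∈ (∅ : Finset W).disjSum (Finset.range 1)} => j.1) with hD
  have ha : ∀ j, D.a j = 1 := by
    intro j; rw [Subsingleton.elim j default]; rfl
  have hset : {ξ | IsSol D ξ} = {fun _ => 0} := by
    ext ξ
    simp only [Set.mem_setOf_eq, Set.mem_singleton_iff]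
    constructor
    · rintro ⟨-, -, h, -⟩
      funext j
      rw [Fintype.sum_unique, ha] at h
      rw [Subsingleton.elim j default]
      simpa using h
    · rintro rfl
      refine ⟨Function.injective_of_subsingleton _, ?_, by simp, X ^ 2 + C (K : ℂ), ?_, ?_⟩
      · intro i
        refine ⟨i, ?_, by simp⟩
        rw [Subsingleton.elim i default]; rfl
      · rw [Fintype.sum_unique, ha]
        unfold cp
        rw [Fintype.prod_unique, ha]
        simp
        rw [show (1 + 1 : ℂ[X]) = C (1 + 1) by simp]
        norm_num
      · intro j
        rw [Subsingleton.elim j default]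
        have : D.u default = K := by
          show K + ((0 : ℕ) : ℝ) = K
          simp
        rw [this]
        simp
  rw [hset, finsum_mem_singleton]
  unfold sg
  simp

lemma ALGfin {W : Type} [Fintype W] {a : W → ℕ} {u : W → ℝ} {σ : W → W} {K : ℝ} (h : AH a u σ K) :
    ∃ Q : MvPolynomial (Fin 2) ℚ, ∀ m : ℕ, iteratedDeriv m (fun q : ℝ => MvPolynomial.aeval ![q, Real.tanh q] Q / Real.cosh q) 0 = ((fZ a u σ K m Finset.univ : ℤ) : ℝ) := by
  have key := alg_main (X := Finset W) Finset.card (fun m => (MZ a u σ K m).map (Int.cast : ℤ → ℚ)) (fun m D => (fZ a u σ K m D : ℚ)) ?_ ?_ ?_ ?_ Finset.univ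
  · obtain ⟨Q, hQ⟩ := key
    refine ⟨Q, fun m => ?_⟩
    rw [hQ m]
    push_cast
    rfl
  · intro m
    ext D D'
    simp only [Matrix.neg_apply, Matrix.sum_apply, Matrix.smul_apply, Matrix.mul_apply, Matrix.map_apply]
    rw [MZ_rec h]
    simp only [nsmul_eq_mul]
    push_cast
    rfl
  · intro m
    ext D
    simp only [Pi.neg_apply, Finset.sum_apply, Pi.smul_apply, Matrix.mulVec, dotProduct, Matrix.map_apply]
    rw [fZ_rec h]
    simp only [nsmul_eq_mul]
    push_cast
    rfl
  · intro D D' hne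
    simp only [Matrix.map_apply, MZ] at hne
    by_cases hc : D' ⊆ D ∧ Odd (∑ w ∈ D \ D', a w + 0)
    · refine Finset.card_lt_card (lt_of_le_of_ne hc.1 ?_)
      rintro rfl
      have := hc.2
      simp at this
    · rw [if_neg hc] at hne
      simp at hne
  · intro D D' hne
    by_cases hDD : D' = D
    · subst hDD
      exfalso
      apply hne
      have : MZ a u σ K 1 D' D' = 1 := by
        rw [MZ, if_pos]
        · rw [Finset.sdiff_self, FF_one]
          simp [BS, chi, rc]
        · simp
      simp [Matrix.sub_apply, this]
    · simp only [Matrix.sub_apply, Matrix.one_apply, if_neg (Ne.symm hDD), sub_zero] at hne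
      simp only [Matrix.map_apply, MZ] at hne
      by_cases hc : D' ⊆ D ∧ Odd (∑ w ∈ D \ D', a w + 1)
      · exact Finset.card_lt_card (lt_of_le_of_ne hc.1 hDD)
      · rw [if_neg hc] at hne
        simp at hne
end FO

open Polynomial
open scoped Classical
set_option linter.all false
namespace FO
open Filter Topology

lemma pos_noroot (q : ℝ[X]) (hl : 0 < q.leadingCoeff) (h : q.roots = 0) (x : ℝ) : 0 < q.eval x := by
  have hq : q ≠ 0 := by rintro rfl; simp at hl
  have hr : ∀ y, q.eval y ≠ 0 := by
    intro y hy
    have : y ∈ q.roots := (mem_roots hq).2 hy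
    rw [h] at this
    simp at this
  by_contra hx
  push Not at hx
  by_cases hd : 0 < q.degree
  · have ht := q.tendsto_atTop_of_leadingCoeff_nonneg hd hl.le
    obtain ⟨y, hy1, hy2⟩ := ((ht.eventually_ge_atTop 0).and (eventually_ge_atTop x)).exists
    obtain ⟨z, -, hz⟩ := intermediate_value_Icc hy2 q.continuous.continuousOn (show (0:ℝ) ∈ Set.Icc (q.eval x) (q.eval y) from ⟨hx, hy1⟩)
    exact hr z hz
  · push Not at hd
    rw [eq_C_of_degree_le_zero hd] at hx hl
    simp at hx hl
    linarith

lemma prod_sign (x : ℝ) (s : Multiset ℝ) (hs : ∀ r ∈ s, r ≠ x) : 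
    0 < (-1 : ℝ) ^ (Multiset.card (s.filter (x < ·))) * (s.map (fun r => x - r)).prod := by
  induction s using Multiset.induction_on with
  | empty => simp
  | cons r s ih =>
    have h1 := ih (fun r hr => hs r (Multiset.mem_cons_of_mem hr))
    have h2 := hs r (Multiset.mem_cons_self r s)
    rw [Multiset.map_cons, Multiset.prod_cons]
    rcases lt_or_gt_of_ne h2 with h3 | h3
    · rw [Multiset.filter_cons_of_neg _ (not_lt.2 h3.le)]
      have := mul_pos (sub_pos.2 h3) h1
      nlinarith [this]
    · rw [Multiset.filter_cons_of_pos _ h3, Multiset.card_cons, pow_succ]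
      have := mul_pos (sub_pos.2 h3) h1
      nlinarith [this]

lemma sign_par (p : ℝ[X]) (hl : 0 < p.leadingCoeff) (x : ℝ) (hx : p.eval x ≠ 0) :
    0 < (-1 : ℝ) ^ (Multiset.card (p.roots.filter (x < ·))) * p.eval x := by
  obtain ⟨q, hq1, hq2, hq3⟩ := p.exists_prod_multiset_X_sub_C_mul
  have hql : 0 < q.leadingCoeff := by
    have hm : ((p.roots.map fun a => X - C a).prod).Monic := monic_multisetProd_X_sub_C p.roots
    rw [← hq1, leadingCoeff_mul, hm.leadingCoeff, one_mul] at hl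
    exact hl
  have h1 := pos_noroot q hql hq3 x
  have h2 := prod_sign x p.roots (by
    rintro r hr rfl
    exact hx (isRoot_of_mem_roots hr))
  have h3 : p.eval x = (p.roots.map (fun r => x - r)).prod * q.eval x := by
    conv_lhs => rw [← hq1]
    rw [eval_mul, eval_multiset_prod, Multiset.map_map]
    simp
  rw [h3, ← mul_assoc]
  exact mul_pos h2 h1

lemma PAR (P : ℝ[X]) (hm : P.Monic) (hd : 0 < P.natDegree) (x : ℝ) :
    (-1 : ℝ) ^ (Multiset.card ((P - C (P.eval x)).roots.filter (x < ·))) = (-1) ^ (Multiset.card ((derivative P).roots.filter (x < ·))) := by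
  set f := P - C (P.eval x) with hf
  have hfm : f.Monic := hm.sub_of_left (by
    refine lt_of_le_of_lt degree_C_le ?_
    rw [← natDegree_pos_iff_degree_pos]; exact hd)
  have hfd : derivative f = derivative P := by simp [hf]
  have hf0 : f ≠ 0 := hfm.ne_zero
  have hfx : f.IsRoot x := by simp [hf]
  obtain ⟨g, hg, hgd⟩ := exists_eq_pow_rootMultiplicity_mul_and_not_dvd f hf0 x
  have hmpos : 0 < f.rootMultiplicity x := (rootMultiplicity_pos hf0).2 hfx
  obtain ⟨a, ha⟩ : ∃ a, f.rootMultiplicity x = a + 1 := ⟨f.rootMultiplicity x - 1, by omega⟩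
  rw [ha] at hg
  have hgx : g.eval x ≠ 0 := fun h => hgd (dvd_iff_isRoot.2 h)
  have hg0 : g ≠ 0 := by rintro rfl; simp at hgx
  set h := C ((a + 1 : ℕ) : ℝ) * g + (X - C x) * derivative g with hh
  have hP' : derivative P = (X - C x) ^ a * h := by
    rw [← hfd, hg, derivative_mul, derivative_X_sub_C_pow, hh]
    simp only [Nat.add_sub_cancel]
    rw [pow_succ]; ring
  have hhx : h.eval x = (a + 1 : ℕ) * g.eval x := by
    rw [hh]; simp
  have hap : (0:ℝ) < ((a + 1 : ℕ) : ℝ) := by positivity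
  have hhx0 : h.eval x ≠ 0 := by rw [hhx]; exact mul_ne_zero hap.ne' hgx
  have hh0 : h ≠ 0 := by rintro h'; rw [h'] at hhx0; simp at hhx0
  have mon : ∀ k : ℕ, ((X - C x) ^ k : ℝ[X]).Monic := fun k => (monic_X_sub_C x).pow k
  have hgl : 0 < g.leadingCoeff := by
    have := hfm.leadingCoeff
    rw [hg, leadingCoeff_mul, (mon _).leadingCoeff, one_mul] at this
    rw [this]; exact one_pos
  have hhl : 0 < h.leadingCoeff := by
    have : (derivative P).leadingCoeff = P.natDegree := by
      rw [leadingCoeff, natDegree_derivative, coeff_derivative]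
      rw [Nat.sub_add_cancel hd, hm.coeff_natDegree, one_mul, Nat.cast_sub (by omega)]
      simp
    rw [hP', leadingCoeff_mul, (mon _).leadingCoeff, one_mul] at this
    rw [this]; exact Nat.cast_pos.2 hd
  have hfr : f.roots.filter (x < ·) = g.roots.filter (x < ·) := by
    rw [hg, roots_mul (mul_ne_zero (mon _).ne_zero hg0), roots_pow, roots_X_sub_C, Multiset.filter_add, Multiset.filter_nsmul]
    simp
  have hPr : (derivative P).roots.filter (x < ·) = h.roots.filter (x < ·) := by
    rw [hP', roots_mul (mul_ne_zero (mon _).ne_zero hh0), roots_pow, roots_X_sub_C, Multiset.filter_add, Multiset.filter_nsmul]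
    simp
  rw [hfr, hPr]
  have s1 := sign_par g hgl x hgx
  have s2 := sign_par h hhl x hhx0
  rw [hhx] at s2
  rcases neg_one_pow_eq_or ℝ (Multiset.card (g.roots.filter (x < ·))) with e1 | e1 <;>
  rcases neg_one_pow_eq_or ℝ (Multiset.card (h.roots.filter (x < ·))) with e2 | e2 <;> rw [e1, e2] <;> rw [e1] at s1 <;> rw [e2] at s2
  · nlinarith [mul_pos hap s1]
  · nlinarith [mul_pos hap s1]

lemma card_filter_roots (p : ℝ[X]) (x : ℝ) : Multiset.card (p.roots.filter (x < ·)) = ∑ y ∈ p.roots.toFinset.filter (x < ·), p.rootMultiplicity y := by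
  rw [← Multiset.toFinset_sum_count_eq, Multiset.toFinset_filter]
  refine Finset.sum_congr rfl fun y hy => ?_
  rw [Multiset.count_filter_of_pos (Finset.mem_filter.1 hy).2, count_roots]
end FO

open Polynomial
open scoped Classical
set_option linter.all false
namespace FO
open Filter Topology

/-- complexification of a real polynomial -/
noncomputable abbrev cx (P : ℝ[X]) : ℂ[X] := P.map (algebraMap ℝ ℂ)

def Lab {ι : Type*} [Fintype ι] (a : ι → ℕ) (u : ι → ℝ) (P : ℝ[X]) (η : ι → ℂ) : Prop :=
  Function.Injective η ∧ derivative (cx P) = C ((∑ j, a j + 1 : ℕ) : ℂ) * cp a η ∧ ∀ j, (cx P).eval (η j) = ((- u j : ℝ) : ℂ)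

lemma cp_next {ι : Type*} [Fintype ι] (a : ι → ℕ) (η : ι → ℂ) : (cp a η).nextCoeff = - ∑ j, (a j : ℂ) * η j := by
  unfold cp
  rw [Monic.nextCoeff_prod _ _ (fun j _ => (monic_X_sub_C _).pow _)]
  rw [← Finset.sum_neg_distrib]
  refine Finset.sum_congr rfl fun j _ => ?_
  rw [Monic.nextCoeff_pow (monic_X_sub_C _), nextCoeff_X_sub_C]
  simp

lemma der_rm {ι : Type*} [Fintype ι] {a : ι → ℕ} {η : ι → ℂ} {p : ℂ[X]}
    (h : derivative p = C ((∑ j, a j + 1 : ℕ) : ℂ) * cp a η) (z : ℂ) :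
    (derivative p).rootMultiplicity z = ∑ j, if η j = z then a j else 0 := by
  rw [h, ← cp_rootMult, ← count_roots, roots_C_mul, count_roots]
  exact Nat.cast_ne_zero.2 (Nat.succ_ne_zero _)

lemma M1 {ι : Type*} [Fintype ι] {a : ι → ℕ} {η : ι → ℂ} {p : ℂ[X]}
    (h : derivative p = C ((∑ j, a j + 1 : ℕ) : ℂ) * cp a η) (z w : ℂ) (hz : p.eval z = w) :
    (p - C w).rootMultiplicity z = 1 + ∑ j, if η j = z then a j else 0 := by
  have hr : (p - C w).IsRoot z := by simp [hz]
  have h0 : p - C w ≠ 0 := by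
    intro h0
    have : derivative (p - C w) = 0 := by rw [h0]; simp
    simp only [derivative_sub, derivative_C, sub_zero, h] at this
    rcases mul_eq_zero.1 this with h1 | h1
    · exact (Nat.cast_ne_zero (R := ℂ)).2 (Nat.succ_ne_zero _) (C_eq_zero.1 h1)
    · exact (cp_monic a η).ne_zero h1
  have h1 := derivative_rootMultiplicity_of_root hr
  have h2 := (rootMultiplicity_pos h0).2 hr
  have h3 : derivative (p - C w) = derivative p := by simp
  rw [h3, der_rm h] at h1
  omega

lemma M1r {ι : Type*} [Fintype ι] {a : ι → ℕ} {η : ι → ℂ} {P : ℝ[X]}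
    (h : derivative (cx P) = C ((∑ j, a j + 1 : ℕ) : ℂ) * cp a η) (x w : ℝ) (hx : P.eval x = w) :
    (P - C w).rootMultiplicity x = 1 + ∑ j, if η j = (x : ℂ) then a j else 0 := by
  have hw : (cx P).eval (x : ℂ) = (w : ℂ) := by
    have := Polynomial.eval_map_apply (p := P) (f := algebraMap ℝ ℂ) x
    rw [← hx]; exact this
  rw [← M1 h (x : ℂ) (w : ℂ) hw, eq_rootMultiplicity_map (algebraMap ℝ ℂ).injective x]
  simp

lemma der_rmr {ι : Type*} [Fintype ι] {a : ι → ℕ} {η : ι → ℂ} {P : ℝ[X]}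
    (h : derivative (cx P) = C ((∑ j, a j + 1 : ℕ) : ℂ) * cp a η) (x : ℝ) :
    (derivative P).rootMultiplicity x = ∑ j, if η j = (x : ℂ) then a j else 0 := by
  rw [← der_rm h (x : ℂ), eq_rootMultiplicity_map (algebraMap ℝ ℂ).injective x, derivative_map]
  rfl

lemma sum_lab {ι : Type*} [Fintype ι] {M : Type*} [AddCommMonoid M] (a : ι → ℕ) (η : ι → ℂ) (hi : Function.Injective η) 
    (h : ℕ → M) (h0 : h 0 = 0) (z : ℂ) :
    h (∑ j, if η j = z then a j else 0) = ∑ j, if η j = z then h (a j) else 0 := by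
  by_cases hz : ∃ j, η j = z
  · obtain ⟨j, rfl⟩ := hz
    simp [hi.eq_iff]
  · push Not at hz
    simp [hz, h0]

lemma RAM {ι : Type*} [Fintype ι] {a : ι → ℕ} {u : ι → ℝ} {P : ℝ[X]} {η : ι → ℂ} (ha : ∀ j, 1 ≤ a j) (hL : Lab a u P η) (w : ℝ) :
    redRamType P w = ((Finset.univ.filter (fun j => - u j = w)).val).map a := by
  obtain ⟨hi, hd, hu⟩ := hL
  have h0 : cx P - C (w : ℂ) ≠ 0 := by
    intro h0
    have : derivative (cx P - C (w : ℂ)) = 0 := by rw [h0]; simp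
    simp only [derivative_sub, derivative_C, sub_zero, hd] at this
    rcases mul_eq_zero.1 this with h1 | h1
    · exact (Nat.cast_ne_zero (R := ℂ)).2 (Nat.succ_ne_zero _) (C_eq_zero.1 h1)
    · exact (cp_monic a η).ne_zero h1
  unfold redRamType ramType
  rw [Multiset.map_map, Multiset.filter_map]
  have hs : Multiset.filter ((fun a => a ≠ 0) ∘ (fun a => a - 1) ∘ fun z => (cx P - C (w : ℂ)).rootMultiplicity z)
      (cx P - C (w : ℂ)).roots.toFinset.val = ((Finset.univ.filter (fun j => - u j = w)).image η).val := by
    rw [← Finset.filter_val]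
    congr 1
    ext z
    simp only [Finset.mem_filter, Multiset.mem_toFinset, mem_roots h0, Finset.mem_image, Finset.mem_univ, true_and, Function.comp]
    constructor
    · rintro ⟨h1, h2⟩
      have h1' : (cx P).eval z = w := by simpa [sub_eq_zero] using h1
      rw [M1 hd z w h1'] at h2
      have : ∃ j, η j = z := by
        by_contra hn
        push Not at hn
        simp [hn] at h2
      obtain ⟨j, rfl⟩ := this
      refine ⟨j, ?_, rfl⟩
      rw [hu j] at h1'
      exact_mod_cast h1'
    · rintro ⟨j, hj, rfl⟩
      have h1 : (cx P).eval (η j) = w := by rw [hu j, hj]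
      refine ⟨by simp [h1], ?_⟩
      rw [M1 hd _ w h1]
      have := ha j
      simp [hi.eq_iff]
      omega
  rw [hs, Finset.image_val_of_injOn (hi.injOn), Multiset.map_map]
  refine Multiset.map_congr rfl fun j hj => ?_
  have hj' : - u j = w := by simpa using hj
  have h1 : (cx P).eval (η j) = w := by rw [hu j, hj']
  simp only [Function.comp]
  rw [M1 hd _ w h1]
  simp [hi.eq_iff]

lemma deg_of_der {p : ℂ[X]} {N : ℕ} {q : ℂ[X]} (hq : q.Monic) (hN : q.natDegree = N) (h : derivative p = C ((N + 1 : ℕ) : ℂ) * q) :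
    p.natDegree = N + 1 ∧ p.Monic := by
  have hn0 : ((N + 1 : ℕ) : ℂ) ≠ 0 := Nat.cast_ne_zero.2 (Nat.succ_ne_zero _)
  have h1 : (derivative p).natDegree = N := by rw [h, natDegree_C_mul hn0, hN]
  have h2 : p.natDegree ≠ 0 := by
    intro h2
    obtain ⟨c, hc⟩ := natDegree_eq_zero.1 h2
    rw [← hc, derivative_C] at h
    rcases mul_eq_zero.1 h.symm with h3 | h3
    · exact hn0 (C_eq_zero.1 h3)
    · exact hq.ne_zero h3
  rw [natDegree_derivative] at h1
  have h3 : p.natDegree = N + 1 := by omega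
  refine ⟨h3, ?_⟩
  rw [Monic, leadingCoeff, h3]
  have h4 : (derivative p).coeff N = ((N + 1 : ℕ) : ℂ) := by
    rw [h, coeff_C_mul, ← hN, hq.coeff_natDegree, mul_one]
  rw [coeff_derivative] at h4
  have : p.coeff (N + 1) * ((N + 1 : ℕ) : ℂ) = 1 * ((N + 1 : ℕ) : ℂ) := by rw [one_mul]; push_cast at h4 ⊢; exact h4
  exact mul_right_cancel₀ hn0 this

lemma next_of_der {p : ℂ[X]} {N : ℕ} {q : ℂ[X]} (hN : q.natDegree = N + 1) (h : derivative p = C ((N + 1 + 1 : ℕ) : ℂ) * q) :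
    p.coeff (N + 1) = 0 ↔ q.nextCoeff = 0 := by
  have h4 : (derivative p).coeff N = ((N + 1 + 1 : ℕ) : ℂ) * q.coeff N := by
    rw [h, coeff_C_mul]
  rw [coeff_derivative] at h4
  rw [nextCoeff, if_neg (by omega), hN]
  simp only [Nat.add_sub_cancel]
  constructor
  · intro h5
    rw [h5, zero_mul] at h4
    exact (mul_eq_zero.1 h4.symm).resolve_left (Nat.cast_ne_zero.2 (Nat.succ_ne_zero _))
  · intro h5
    rw [h5, mul_zero] at h4
    exact (mul_eq_zero.1 h4).resolve_right (by exact_mod_cast Nat.succ_ne_zero N)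

lemma norm_of_lab {ι : Type*} [Fintype ι] [Nonempty ι] {a : ι → ℕ} {P : ℝ[X]} {η : ι → ℂ} (ha : ∀ j, 1 ≤ a j)
    (hd : derivative (cx P) = C ((∑ j, a j + 1 : ℕ) : ℂ) * cp a η) :
    IsNormalized (∑ j, a j + 1) P ↔ ∑ j, (a j : ℂ) * η j = 0 := by
  obtain ⟨h1, h2⟩ := deg_of_der (cp_monic a η) (cp_natDegree a η) hd
  have h3 : P.natDegree = ∑ j, a j + 1 := by rwa [natDegree_map] at h1
  have h4 : P.Monic := by
    have := h2
    exact monic_of_injective (algebraMap ℝ ℂ).injective h2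
  obtain ⟨N, hN⟩ : ∃ N, ∑ j, a j = N + 1 := by
    have j := Classical.arbitrary ι
    have := Finset.single_le_sum (f := a) (fun i _ => Nat.zero_le _) (Finset.mem_univ j)
    have := ha j
    exact ⟨∑ j, a j - 1, by omega⟩
  have h5 := next_of_der (p := cx P) (N := N) (q := cp a η) (by rw [cp_natDegree, hN]) (by rw [hd, hN])
  rw [cp_next, neg_eq_zero, coeff_map] at h5
  rw [← h5]
  unfold IsNormalized
  rw [hN] at h3 ⊢
  simp [h3, h4]

lemma norm_one {P : ℝ[X]} : IsNormalized 1 P ↔ P = X := by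
  constructor
  · rintro ⟨h1, h2, h3⟩
    have := eq_X_add_C_of_natDegree_le_one (le_of_eq h1)
    have h4 : P.coeff 1 = 1 := by rw [← h1]; exact h2.coeff_natDegree
    rw [this, h4]
    simp at h3
    simp [h3]
  · rintro rfl
    exact ⟨natDegree_X, monic_X, by simp⟩

lemma F3 {ι : Type*} [Fintype ι] {a : ι → ℕ} {u : ι → ℝ} {P P' : ℝ[X]} {η : ι → ℂ}
    (hP : IsNormalized (∑ j, a j + 1) P) (hP' : IsNormalized (∑ j, a j + 1) P') (h : Lab a u P η) (h' : Lab a u P' η) : P = P' := by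
  rcases isEmpty_or_nonempty ι with hι | ⟨⟨j⟩⟩
  · simp only [Finset.univ_eq_empty, Finset.sum_empty, zero_add] at hP hP'
    rw [norm_one.1 hP, norm_one.1 hP']
  · obtain ⟨c, hc⟩ := eq_add_C (h.2.1.trans h'.2.1.symm)
    have h1 := h.2.2 j
    have h2 := h'.2.2 j
    rw [hc, eval_add, eval_C, h2] at h1
    have : c = 0 := by simpa using h1
    rw [this, C_0, add_zero] at hc
    exact map_injective _ (algebraMap ℝ ℂ).injective hc

lemma F1 {ι : Type*} [Fintype ι] {D : LD ι} (hD : D.Good) {ξ : ι → ℂ} (hs : IsSol D ξ) (he : Even (∑ j, D.a j)) :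
    ∃ P, IsNormalized (∑ j, D.a j + 1) P ∧ Lab D.a D.u P (fun j => - ξ j) := by
  obtain ⟨hinj, hrl, hsum, Q, hQ, hQu⟩ := hs
  have hni : Function.Injective (fun j => - ξ j) := fun i j hij => hinj (neg_injective hij)
  rcases isEmpty_or_nonempty ι with hι | hι
  · refine ⟨X, ?_, hni, ?_, fun j => (hι.false j).elim⟩
    · simp only [Finset.univ_eq_empty, Finset.sum_empty, zero_add]
      exact norm_one.2 rfl
    · simp [cp]
  obtain ⟨s, hs, hsr, hsa, hsu, hsc⟩ := hrl.exists_sigma hD hinj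
  set p : ℂ[X] := - Q.comp (-X) with hp
  have hd : derivative p = C ((∑ j, D.a j + 1 : ℕ) : ℂ) * cp D.a (fun j => - ξ j) := by
    have h1 := cp_comp D.a ξ 0 (-1) (by norm_num)
    rw [he.neg_one_pow, C_1, one_mul] at h1
    simp only [C_0, zero_add, C_neg, C_1, neg_mul, one_mul, sub_zero, div_neg, div_one] at h1
    rw [hp, derivative_neg, derivative_comp, hQ, mul_comp, C_comp, h1]
    simp
  have hev : ∀ j, p.eval (- ξ j) = ((- D.u j : ℝ) : ℂ) := by
    intro j
    rw [hp]
    simp [eval_comp, hQu]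
  have hcj : p.map (starRingEnd ℂ) = p := by
    have h1 : derivative (p.map (starRingEnd ℂ)) = derivative p := by
      rw [derivative_map, hd, Polynomial.map_mul, cp_map, map_C, map_natCast]
      congr 1
      rw [← cp_perm D.a (fun j => - ξ j) s hs hsa]
      congr 1
      funext j
      rw [hsc, map_neg]
    obtain ⟨c, hc⟩ := eq_add_C h1
    have j := Classical.arbitrary ι
    have h2 : (p.map (starRingEnd ℂ)).eval (- ξ (s j)) = (starRingEnd ℂ) (p.eval (- ξ j)) := by
      rw [← Polynomial.eval_map_apply, hsc, map_neg]
    rw [hc, eval_add, eval_C, hev, hev, hsu, Complex.conj_ofReal] at h2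
    have : c = 0 := by simpa using h2
    rw [hc, this, C_0, add_zero]
  obtain ⟨P, hP⟩ : ∃ P : ℝ[X], cx P = p := by
    have : p ∈ lifts (algebraMap ℝ ℂ) := by
      rw [lifts_iff_coeff_lifts]
      intro n
      have h1 : (p.map (starRingEnd ℂ)).coeff n = p.coeff n := by rw [hcj]
      rw [coeff_map] at h1
      obtain ⟨r, hr⟩ := Complex.conj_eq_iff_real.1 h1
      exact ⟨r, hr.symm⟩
    rwa [mem_lifts] at this
  rw [← hP] at hd hev
  refine ⟨P, (norm_of_lab hD.pos hd).2 ?_, hni, hd, hev⟩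
  simp [hsum]
end FO

open Polynomial
open scoped Classical
set_option linter.all false
namespace FO
open Filter Topology

lemma z2_of_pow (p q : ℕ) (h : (-1 : ℝ) ^ p = (-1) ^ q) : (p : ZMod 2) = q := by
  rcases Nat.even_or_odd p with hp | hp <;> rcases Nat.even_or_odd q with hq | hq
  · rw [(ZMod.natCast_eq_zero_iff_even).2 hp, (ZMod.natCast_eq_zero_iff_even).2 hq]
  · rw [hp.neg_one_pow, hq.neg_one_pow] at h; norm_num at h
  · rw [hp.neg_one_pow, hq.neg_one_pow] at h; norm_num at h
  · rw [(ZMod.natCast_eq_one_iff_odd).2 hp, (ZMod.natCast_eq_one_iff_odd).2 hq]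

lemma sumR {ι : Type*} [Fintype ι] {M : Type*} [AddCommMonoid M] (a : ι → ℕ) (η : ι → ℂ) (hi : Function.Injective η) 
    (h : ℕ → M) (h0 : h 0 = 0) (R : Finset ℝ) :
    ∑ y ∈ R, h (∑ j, if η j = (y : ℂ) then a j else 0) = ∑ j, if (η j).im = 0 ∧ (η j).re ∈ R then h (a j) else 0 := by
  rw [Finset.sum_congr rfl fun (y : ℝ) _ => sum_lab a η hi h h0 (y : ℂ), Finset.sum_comm]
  refine Finset.sum_congr rfl fun j _ => ?_
  have : ∀ y : ℝ, η j = (y : ℂ) ↔ (η j).re = y ∧ (η j).im = 0 := by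
    intro y
    rw [Complex.ext_iff]; simp
  simp only [this]
  by_cases hj : (η j).im = 0
  · simp [hj]
  · simp [hj]

lemma F5a {ι : Type*} [Fintype ι] {a : ι → ℕ} {u : ι → ℝ} {P : ℝ[X]} {η : ι → ℂ} (ha : ∀ j, 1 ≤ a j) (hL : Lab a u P η) (hm : P.Monic)
    (hdeg : 0 < P.natDegree) (j : ι) (hj : (η j).im = 0) :
    (((((P - C (P.eval (η j).re)).roots.toFinset.filter ((η j).re < ·)).filter (fun y => 
      (P - C (P.eval y)).rootMultiplicity y < (P - C (P.eval (η j).re)).rootMultiplicity (η j).re)).card : ℕ) : ZMod 2)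
      = ∑ i, if (η j).re < (η i).re ∧ (η i).im = 0 then ((a i + if u i = u j then a i + 1 + (if a i < a j then 1 else 0) else 0 : ℕ) : ZMod 2) else 0 := by
  obtain ⟨hi, hd, hu⟩ := hL
  set x := (η j).re with hx
  have hηx : η j = (x : ℂ) := by
    rw [Complex.ext_iff]; simp [hx, hj]
  have evr : ∀ i, (η i).im = 0 → P.eval (η i).re = - u i := by
    intro i h0
    have h1 : η i = ((η i).re : ℂ) := by rw [Complex.ext_iff]; simp [h0]
    have h2 := hu i
    rw [h1] at h2
    have h3 := Polynomial.eval_map_apply (p := P) (f := algebraMap ℝ ℂ) (η i).re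
    have h4 : ((P.eval (η i).re : ℝ) : ℂ) = ((- u i : ℝ) : ℂ) := by rw [← h2]; exact h3.symm
    exact_mod_cast h4
  set f := P - C (P.eval x) with hf
  have hf0 : f ≠ 0 := by
    intro h0
    rw [hf, sub_eq_zero] at h0
    rw [h0] at hdeg
    simp at hdeg
  set R := f.roots.toFinset.filter (x < ·) with hR
  have memR : ∀ y, y ∈ R ↔ P.eval y = P.eval x ∧ x < y := by
    intro y
    rw [hR, Finset.mem_filter, Multiset.mem_toFinset, mem_roots hf0, hf]
    simp [sub_eq_zero]
  set mu : ℝ → ℕ := fun y => ∑ i, if η i = (y : ℂ) then a i else 0 with hmu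
  have mmul : ∀ y ∈ R, f.rootMultiplicity y = 1 + mu y := by
    intro y hy
    rw [hf, M1r hd y _ ((memR y).1 hy).1]
  have mux : f.rootMultiplicity x = 1 + a j := by
    rw [hf, M1r hd x _ rfl, ← hηx]
    simp [hi.eq_iff]
  have hP'0 : derivative P ≠ 0 := by
    intro h0
    have := natDegree_eq_zero_of_derivative_eq_zero h0
    omega
  rw [mux]
  have e1 : ((R.filter (fun y => (P - C (P.eval y)).rootMultiplicity y < 1 + a j)).card : ZMod 2) 
      = ∑ y ∈ R, (if mu y < a j then 1 else 0) := by
    rw [Finset.card_filter]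
    push_cast
    refine Finset.sum_congr rfl fun y hy => ?_
    rw [((memR y).1 hy).1, ← hf, mmul y hy]
    simp
  rw [e1]
  have e2 : ∑ y ∈ R, (if mu y < a j then (1 : ZMod 2) else 0) = ∑ y ∈ R, ((1 + mu y : ℕ) : ZMod 2) + 
      ∑ y ∈ R, ((mu y : ZMod 2) + 1 + if mu y < a j then (1 : ZMod 2) else 0) := by
    rw [← Finset.sum_add_distrib]
    refine Finset.sum_congr rfl fun y hy => ?_
    have h2 : ∀ t s : ZMod 2, s = 1 + t + (t + 1 + s) := by decide
    push_cast
    exact h2 _ _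
  rw [e2]
  have e3 : ∑ y ∈ R, ((1 + mu y : ℕ) : ZMod 2) = ∑ i, if (η i).im = 0 ∧ (η i).re ∈ (derivative P).roots.toFinset.filter (x < ·) then (a i : ZMod 2) else 0 := by
    have h1 := z2_of_pow _ _ (PAR P hm hdeg x)
    rw [card_filter_roots, card_filter_roots, ← hf, ← hR, Finset.sum_congr rfl mmul, Finset.sum_congr rfl fun y _ => der_rmr hd y] at h1
    rw [← sumR a η hi (fun n => (n : ZMod 2)) (by simp), ← Nat.cast_sum, h1, Nat.cast_sum]
  have e4 := sumR a η hi (fun n => (n : ZMod 2) + 1 + if n < a j then (1 : ZMod 2) else 0) (by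
    have := ha j
    rw [if_pos (by omega)]; decide) R
  rw [e3, e4, ← Finset.sum_add_distrib]
  refine Finset.sum_congr rfl fun i _ => ?_
  by_cases hi0 : (η i).im = 0
  · by_cases hlt : x < (η i).re
    · have m1 : (η i).re ∈ (derivative P).roots.toFinset.filter (x < ·) := by
        rw [Finset.mem_filter, Multiset.mem_toFinset, mem_roots hP'0, ← rootMultiplicity_pos hP'0, der_rmr hd]
        have h1 : η i = ((η i).re : ℂ) := by rw [Complex.ext_iff]; simp [hi0]
        rw [← h1]
        have := ha i
        simp [hi.eq_iff, hlt]; omega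
      have m2 : (η i).re ∈ R ↔ u i = u j := by
        rw [memR, evr i hi0, hx, evr j hj, neg_inj]
        simp [← hx, hlt]
      by_cases hui : u i = u j
      · rw [if_pos ⟨hi0, m1⟩, if_pos (show (η i).im = 0 ∧ (η i).re ∈ R from ⟨hi0, m2.2 hui⟩), if_pos (show x < (η i).re ∧ (η i).im = 0 from ⟨hlt, hi0⟩), if_pos hui]
        push_cast
        rfl
      · rw [if_pos ⟨hi0, m1⟩, if_neg (fun h => hui (m2.1 h.2)), if_pos (show x < (η i).re ∧ (η i).im = 0 from ⟨hlt, hi0⟩), if_neg hui]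
        simp
    · have m2 : (η i).re ∉ R := fun h => hlt ((memR _).1 h).2
      simp [hlt, m2]
  · simp [hi0]

lemma F5 {ι : Type*} [Fintype ι] {D : LD ι} (ha : ∀ j, 1 ≤ D.a j) {P : ℝ[X]} {η : ι → ℂ} (hL : Lab D.a D.u P η) (hm : P.Monic)
    (hdeg : 0 < P.natDegree) (hr : ∀ j, D.rel j j ↔ (η j).im = 0)
    (hκ : ∀ i j, D.κ i j = if D.rel i i ∧ D.rel j j then D.a i + (if D.u i = D.u j then D.a i + 1 + (if D.a i < D.a j then 1 else 0) else 0) else 0) :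
    sg D (fun j => - η j) = epsilonP P := by
  set T : Finset ι := Finset.univ.filter (fun j => (η j).im = 0) with hT
  set N : ι → Finset ℝ := fun j => ((P - C (P.eval (η j).re)).roots.toFinset.filter ((η j).re < ·)).filter (fun y => 
      (P - C (P.eval y)).rootMultiplicity y < (P - C (P.eval (η j).re)).rootMultiplicity (η j).re) with hN
  have hf0 : ∀ c, P - C c ≠ 0 := by
    intro c h0
    rw [sub_eq_zero] at h0
    rw [h0] at hdeg
    simp at hdeg
  have memN : ∀ j y, y ∈ N j ↔ (P.eval y = P.eval (η j).re ∧ (η j).re < y) ∧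
      (P - C (P.eval y)).rootMultiplicity y < (P - C (P.eval (η j).re)).rootMultiplicity (η j).re := by
    intro j y
    rw [hN, Finset.mem_filter, Finset.mem_filter, Multiset.mem_toFinset, mem_roots (hf0 _)]
    simp [sub_eq_zero]
  have hcard : Nat.card (disorders P) = ∑ j ∈ T, (N j).card := by
    rw [← Finset.card_sigma, ← Nat.card_eq_finsetCard]
    symm
    refine Nat.card_congr (Equiv.ofBijective (fun s => (⟨((η s.1.1).re, s.1.2), ?_⟩ : disorders P)) ⟨?_, ?_⟩)
    · have h := s.2
      rw [Finset.mem_sigma, memN] at h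
      obtain ⟨h1, ⟨h2, h3⟩, h4⟩ := h
      exact ⟨h3, h2.symm, h4⟩
    · rintro ⟨⟨j, y⟩, h⟩ ⟨⟨j', y'⟩, h'⟩ he
      have h2 := (Finset.mem_filter.1 (Finset.mem_sigma.1 h).1).2
      have h2' := (Finset.mem_filter.1 (Finset.mem_sigma.1 h').1).2
      simp only [Subtype.mk.injEq, Prod.mk.injEq] at he
      have : j = j' := hL.1 (Complex.ext he.1 (h2.trans h2'.symm))
      obtain rfl := this
      simp [he.2]
    · rintro ⟨⟨x, y⟩, h1, h2, h3⟩
      dsimp only at h1 h2 h3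
      rw [M1r hL.2.1 x _ rfl, M1r hL.2.1 y _ rfl] at h3
      have : ∃ j, η j = (x : ℂ) := by
        by_contra hn
        push Not at hn
        simp [hn] at h3
      obtain ⟨j, hj⟩ := this
      have hre : (η j).re = x := by rw [hj]; simp
      have him : (η j).im = 0 := by rw [hj]; simp
      refine ⟨⟨⟨j, y⟩, ?_⟩, ?_⟩
      · rw [Finset.mem_sigma, memN]
        dsimp only
        rw [hre, M1r hL.2.1 x _ rfl, M1r hL.2.1 y _ rfl]
        exact ⟨Finset.mem_filter.2 ⟨Finset.mem_univ _, him⟩, ⟨h2.symm, h1⟩, h3⟩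
      · simp [hre]
  unfold sg epsilonP
  refine pow_congr2 _ _ ?_
  rw [hcard, Finset.sum_comm]
  push_cast
  have h5 : ∀ j ∈ T, ((N j).card : ZMod 2) = _ := fun j hj => F5a ha hL hm hdeg j (Finset.mem_filter.1 hj).2
  rw [Finset.sum_congr rfl h5, hT, Finset.sum_filter]
  refine Finset.sum_congr rfl fun j _ => ?_
  by_cases hj : (η j).im = 0
  · rw [if_pos hj]
    refine Finset.sum_congr rfl fun i _ => ?_
    simp only [Complex.neg_re, neg_lt_neg_iff, hκ, hr]
    by_cases h1 : (η j).re < (η i).re <;> by_cases h2 : (η i).im = 0 <;> simp [h1, h2, hj]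
  · rw [if_neg hj]
    refine Finset.sum_eq_zero fun i _ => ?_
    simp [hκ, hr, hj]
end FO

open Polynomial
open scoped Classical
set_option linter.all false
namespace FO
open Filter Topology

lemma sameLab {ι : Type*} [Fintype ι] {a : ι → ℕ} {u : ι → ℝ} {P : ℝ[X]} {η η' : ι → ℂ} (ha : ∀ j, 1 ≤ a j)
    (h : Lab a u P η) (h' : Lab a u P η') : ∃ s : ι → ι, ∀ j, η' j = η (s j) ∧ a (s j) = a j ∧ u (s j) = u j := by
  have : ∀ j, ∃ i, η' j = η i ∧ a i = a j ∧ u i = u j := by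
    intro j
    have h1 := (der_rm h.2.1 (η' j)).symm.trans (der_rm h'.2.1 (η' j))
    have e1 : (∑ i, if η' i = η' j then a i else 0) = a j := by simp [h'.1.eq_iff]
    rw [e1] at h1
    have hj := ha j
    have : ∃ i, η i = η' j := by
      by_contra hn
      push Not at hn
      simp [hn] at h1
      omega
    obtain ⟨i, hi⟩ := this
    refine ⟨i, hi.symm, ?_, ?_⟩
    · rw [← hi] at h1
      simpa [h.1.eq_iff] using h1
    · have h2 := h.2.2 i
      rw [hi, h'.2.2 j] at h2
      have h3 : - u j = - u i := by exact_mod_cast h2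
      linarith
  choose s hs using this
  exact ⟨s, hs⟩

lemma labConj {ι : Type*} [Fintype ι] {a : ι → ℕ} {u : ι → ℝ} {P : ℝ[X]} {η : ι → ℂ} 
    (h : Lab a u P η) : Lab a u P (fun j => (starRingEnd ℂ) (η j)) := by
  have hc : (cx P).map (starRingEnd ℂ) = cx P := by
    rw [Polynomial.map_map]
    congr 1
    ext x
    simp
  refine ⟨fun i j hij => h.1 ((starRingEnd ℂ).injective hij), ?_, fun j => ?_⟩
  · rw [← cp_map, ← hc, derivative_map, h.2.1, Polynomial.map_mul, map_C, map_natCast]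
  · rw [← hc, Polynomial.eval_map_apply, h.2.2, Complex.conj_ofReal]

section
variable {W : Type} [Fintype W] {a : W → ℕ} {u : W → ℝ} {K : ℝ} {m : ℕ}

def vS (m : ℕ) : W ⊕ Fin m → W ⊕ ℕ := Sum.map id Fin.val

lemma vS_inj : Function.Injective (vS m : W ⊕ Fin m → W ⊕ ℕ) := by
  exact Sum.map_injective.2 ⟨Function.injective_id, Fin.val_injective⟩

lemma splitS (hu : ∀ w, u w < K) (s : W ⊕ Fin m → W ⊕ Fin m) (hA : ∀ j, aS a (vS m (s j)) = aS a (vS m j))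
    (hU : ∀ j, uS u K (vS m (s j)) = uS u K (vS m j)) : 
    ∃ f : W → W, (∀ w, s (Sum.inl w) = Sum.inl (f w)) ∧ (∀ j, s (Sum.inr j) = Sum.inr j) ∧ (∀ w, a (f w) = a w) ∧ ∀ w, u (f w) = u w := by
  have h1 : ∀ w, ∃ w', s (Sum.inl w) = Sum.inl w' := by
    intro w
    rcases hw : s (Sum.inl w) with w' | j
    · exact ⟨w', rfl⟩
    · have := hU (Sum.inl w)
      rw [hw] at this
      simp only [vS, uS, Sum.map_inr, Sum.elim_inr, Sum.map_inl, Sum.elim_inl, id] at this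
      have h2 := hu w
      have : (0:ℝ) ≤ ((j : ℕ) : ℝ) := Nat.cast_nonneg _
      linarith
  choose f hf using h1
  refine ⟨f, hf, ?_, ?_, ?_⟩
  · intro j
    have := hU (Sum.inr j)
    rcases hw : s (Sum.inr j) with w | j'
    · rw [hw] at this
      simp only [vS, uS, Sum.map_inr, Sum.elim_inr, Sum.map_inl, Sum.elim_inl, id] at this
      have h2 := hu w
      have : (0:ℝ) ≤ ((j : ℕ) : ℝ) := Nat.cast_nonneg _
      linarith
    · rw [hw] at this
      simp only [vS, uS, Sum.map_inr, Sum.elim_inr, add_right_inj, Nat.cast_inj] at this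
      rw [Fin.ext this]
  · intro w
    have := hA (Sum.inl w)
    rwa [hf] at this
  · intro w
    have := hU (Sum.inl w)
    rwa [hf] at this

noncomputable def DS (a : W → ℕ) (u : W → ℝ) (K : ℝ) (m : ℕ) (σ : W → W) : LD (W ⊕ Fin m) := (amb a u σ K).comap (vS m)

lemma DS_good {σ : W → W} (h : AH a u σ K) : (DS a u K m σ).Good := (amb_good h).comap _ vS_inj

lemma aS_pos (ha : ∀ w, 0 < a w) (j : W ⊕ ℕ) : 1 ≤ aS a j := by
  rcases j with w | j
  · exact ha w
  · exact le_refl _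

lemma F2 (ha : ∀ w, 0 < a w) (hu : ∀ w, u w < K) (he : Even (∑ j : W ⊕ Fin m, aS a (vS m j))) {P : ℝ[X]} {η : W ⊕ Fin m → ℂ} 
    (hP : IsNormalized (∑ j : W ⊕ Fin m, aS a (vS m j) + 1) P)
    (hL : Lab (aS a ∘ vS m) (uS u K ∘ vS m) P η) : ∃ σ : W → W, AH a u σ K ∧ IsSol (DS a u K m σ) (fun j => - η j) := by
  obtain ⟨s, hs⟩ := sameLab (fun j => aS_pos ha _) hL (labConj hL)
  obtain ⟨σ, h1, h2, h3, h4⟩ := splitS hu s (fun j => (hs j).2.1) (fun j => (hs j).2.2)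
  have hinv : ∀ j, s (s j) = j := by
    intro j
    apply hL.1
    rw [← (hs (s j)).1, ← (hs j).1]
    simp
  refine ⟨σ, ⟨ha, hu, fun w => ?_, h3, h4⟩, fun i j hij => hL.1 (neg_injective hij), ?_, ?_, - (cx P).comp (-X), ?_, ?_⟩
  · have := hinv (Sum.inl w)
    rw [h1, h1] at this
    exact Sum.inl_injective this
  · intro i
    refine ⟨s i, ?_, ?_⟩
    · change vS m (s i) = SgS σ (vS m i)
      rcases i with w | j
      · rw [h1]; rfl
      · rw [h2]; rfl
    · change - η (s i) = (starRingEnd ℂ) (- η i)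
      rw [← (hs i).1, map_neg]
  · rcases isEmpty_or_nonempty (W ⊕ Fin m) with hι | hι
    · simp
    · have := (norm_of_lab (fun j => aS_pos ha _) hL.2.1).1 hP
      change ∑ j, ((aS a ∘ vS m) j : ℂ) * _ = 0
      simp only [mul_neg, Finset.sum_neg_distrib]
      exact neg_eq_zero.2 this
  · have h1 := cp_comp (aS a ∘ vS m) η 0 (-1) (by norm_num)
    change Even (∑ j : W ⊕ Fin m, (aS a ∘ vS m) j) at he
    rw [he.neg_one_pow, C_1, one_mul] at h1
    simp only [C_0, zero_add, C_neg, C_1, neg_mul, one_mul, sub_zero, div_neg, div_one] at h1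
    rw [derivative_neg, derivative_comp, hL.2.1, mul_comp, C_comp, h1]
    simp
    rfl
  · intro j
    simp only [eval_neg, eval_comp, eval_X, neg_neg]
    rw [hL.2.2 j]
    simp
    rfl

lemma F2u {σ σ' : W → W} {ξ : W ⊕ Fin m → ℂ} (h : IsSol (DS a u K m σ) ξ) (h' : IsSol (DS a u K m σ') ξ) : σ = σ' := by
  funext w
  obtain ⟨j, hj, hc⟩ := h.2.1 (Sum.inl w)
  obtain ⟨j', hj', hc'⟩ := h'.2.1 (Sum.inl w)
  have e : j = j' := h.1 (hc.trans hc'.symm)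
  have hj1 : vS m j = SgS σ (Sum.inl w) := hj
  have hj2 : vS m j' = SgS σ' (Sum.inl w) := hj'
  rw [← e, hj1] at hj2
  exact Sum.inl_injective hj2

lemma FF_eq (σ : W → W) : FF a u σ K m Finset.univ = SS (DS a u K m σ) := by
  symm
  refine SF_of_inj _ _ vS_inj _ ?_
  ext (w | j)
  · simp [vS]
  · simp [vS]
    constructor
    · rintro ⟨i, rfl⟩; exact i.2
    · intro h; exact ⟨⟨j, h⟩, rfl⟩

abbrev GS (a : W → ℕ) (u : W → ℝ) := {π : Equiv.Perm W // (∀ w, a (π w) = a w) ∧ ∀ w, u (π w) = u w}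

lemma card_lab (ha : ∀ w, 0 < a w) (hu : ∀ w, u w < K) {P : ℝ[X]} {η : W ⊕ Fin m → ℂ} 
    (hL : Lab (aS a ∘ vS m) (uS u K ∘ vS m) P η) :
    Nat.card {η' // Lab (aS a ∘ vS m) (uS u K ∘ vS m) P η'} = Nat.card (GS a u) := by
  symm
  refine Nat.card_congr (Equiv.ofBijective (fun π => ⟨η ∘ (Equiv.sumCongr π.1 (Equiv.refl _)), ?_⟩) ⟨?_, ?_⟩)
  · set e : (W ⊕ Fin m) ≃ (W ⊕ Fin m) := Equiv.sumCongr π.1 (Equiv.refl _) with he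
    have e1 : (aS a ∘ vS m) ∘ e = aS a ∘ vS m := by
      funext j
      rcases j with w | j
      · exact π.2.1 w
      · rfl
    have e2 : ∀ j, (uS u K ∘ vS m) (e j) = (uS u K ∘ vS m) j := by
      intro j
      rcases j with w | j
      · exact π.2.2 w
      · rfl
    refine ⟨hL.1.comp e.injective, ?_, fun j => ?_⟩
    · rw [hL.2.1]
      congr 1
      conv_rhs => rw [← e1]
      rw [cp_equiv]
    · rw [Function.comp, hL.2.2, e2]
  · intro π π' h
    have h1 := congrArg Subtype.val h
    apply Subtype.ext
    ext w
    have h2 := hL.1 (congrFun h1 (Sum.inl w))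
    exact Sum.inl_injective h2
  · rintro ⟨η', hL'⟩
    obtain ⟨s, hs⟩ := sameLab (fun j => aS_pos ha _) hL hL'
    obtain ⟨f, h1, h2, h3, h4⟩ := splitS hu s (fun j => (hs j).2.1) (fun j => (hs j).2.2)
    have hf : Function.Injective f := by
      intro w w' hw
      have : η' (Sum.inl w) = η' (Sum.inl w') := by rw [(hs _).1, (hs (Sum.inl w')).1, h1, h1, hw]
      exact Sum.inl_injective (hL'.1 this)
    refine ⟨⟨Equiv.ofBijective f (Finite.injective_iff_bijective.1 hf), h3, h4⟩, ?_⟩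
    apply Subtype.ext
    funext j
    refine Eq.trans ?_ (hs j).1.symm
    rcases j with w | j
    · rw [h1]; rfl
    · rw [h2]; rfl

lemma COUNT (ha : ∀ w, 0 < a w) (hu : ∀ w, u w < K) (he : Even (∑ j : W ⊕ Fin m, aS a (vS m j))) :
    ∑ σ : {σ : W → W // AH a u σ K}, FF a u σ.1 K m Finset.univ = (Nat.card (GS a u) : ℤ) *
      ∑ᶠ P ∈ {P : ℝ[X] | IsNormalized (∑ j : W ⊕ Fin m, aS a (vS m j) + 1) P ∧ ∃ η, Lab (aS a ∘ vS m) (uS u K ∘ vS m) P η}, epsilonP P := by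
  let ft : ∀ σ : {σ : W → W // AH a u σ K}, Fintype {ξ | IsSol (DS a u K m σ.1) ξ} := fun σ => (sol_finite (DS_good σ.2)).fintype
  let T := Σ σ : {σ : W → W // AH a u σ K}, {ξ | IsSol (DS a u K m σ.1) ξ}
  have hF1 : ∀ t : T, ∃ P, IsNormalized (∑ j : W ⊕ Fin m, aS a (vS m j) + 1) P ∧ Lab (aS a ∘ vS m) (uS u K ∘ vS m) P (fun j => - t.2.1 j) :=
    fun t => F1 (DS_good t.1.2) t.2.2 he
  choose g hg using hF1
  have e1 : ∑ σ : {σ : W → W // AH a u σ K}, FF a u σ.1 K m Finset.univ = ∑ t : T, epsilonP (g t) := by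
    rw [Fintype.sum_sigma]
    refine Finset.sum_congr rfl fun σ _ => ?_
    rw [FF_eq, SS_sum _ (ft σ)]
    refine Finset.sum_congr rfl fun ξ _ => ?_
    have hgood := DS_good (m := m) σ.2
    have hN := (hg ⟨σ, ξ⟩).1
    have := F5 (D := DS a u K m σ.1) hgood.pos (hg ⟨σ, ξ⟩).2 hN.2.1 (by rw [hN.1]; omega) ?_ ?_
    · rw [← this]
      congr 1
      funext j
      simp
    · intro j
      simp only [Complex.neg_im, neg_eq_zero]
      refine ⟨fun h => ξ.2.2.1.real hgood h, fun h => ?_⟩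
      obtain ⟨i, h1, h2⟩ := ξ.2.2.1 j
      have h3 : (starRingEnd ℂ) (ξ.1 j) = ξ.1 j := Complex.conj_eq_iff_im.2 h
      rw [h3] at h2
      rw [ξ.2.1 h2] at h1
      exact h1
    · intro i j
      have hrel : ∀ i, (DS a u K m σ.1).rel i i ↔ SgS σ.1 (vS m i) = vS m i := fun i => ⟨Eq.symm, Eq.symm⟩
      simp only [hrel]
      change (amb a u σ.1 K).κ (vS m i) (vS m j) = _
      unfold amb
      dsimp only
      congr!
  have himg : {P : ℝ[X] | IsNormalized (∑ j : W ⊕ Fin m, aS a (vS m j) + 1) P ∧ ∃ η, Lab (aS a ∘ vS m) (uS u K ∘ vS m) P η} = ((Finset.univ.image g : Finset ℝ[X]) : Set ℝ[X]) := by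
    ext P
    simp only [Set.mem_setOf_eq, Finset.coe_image, Finset.coe_univ, Set.image_univ, Set.mem_range]
    constructor
    · rintro ⟨hP, η, hη⟩
      obtain ⟨σ, hσ, hs⟩ := F2 ha hu he hP hη
      refine ⟨⟨⟨σ, hσ⟩, ⟨_, hs⟩⟩, ?_⟩
      have h2 := hg ⟨⟨σ, hσ⟩, ⟨_, hs⟩⟩
      simp only [neg_neg] at h2
      exact F3 h2.1 hP h2.2 hη
    · rintro ⟨t, rfl⟩
      exact ⟨(hg t).1, _, (hg t).2⟩
  rw [e1, himg, finsum_mem_coe_finset, Finset.sum_comp epsilonP g, Finset.mul_sum]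
  refine Finset.sum_congr rfl fun P hP => ?_
  rw [nsmul_eq_mul]
  congr 2
  obtain ⟨t0, -, rfl⟩ := Finset.mem_image.1 hP
  rw [← card_lab ha hu (hg t0).2, ← Nat.card_eq_finsetCard]
  refine Nat.card_congr (Equiv.ofBijective (fun t => ⟨fun j => - t.1.2.1 j, ?_⟩) ⟨?_, ?_⟩)
  · have h1 := (hg t.1).2
    rw [(Finset.mem_filter.1 t.2).2] at h1
    exact h1
  · rintro ⟨⟨σ, ξ⟩, h⟩ ⟨⟨σ', ξ'⟩, h'⟩ hh
    have h1 : ξ.1 = ξ'.1 := by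
      have := congrArg Subtype.val hh
      funext j
      exact neg_injective (congrFun this j)
    have h2 : σ = σ' := by
      have h3 := ξ'.2
      rw [← h1] at h3
      exact Subtype.ext (F2u ξ.2 h3)
    subst h2
    have h3 : ξ = ξ' := Subtype.ext h1
    subst h3
    rfl
  · rintro ⟨η, hη⟩
    obtain ⟨σ, hσ, hs⟩ := F2 ha hu he (hg t0).1 hη
    refine ⟨⟨⟨⟨σ, hσ⟩, ⟨_, hs⟩⟩, ?_⟩, ?_⟩
    · rw [Finset.mem_filter]
      refine ⟨Finset.mem_univ _, ?_⟩
      have h2 := hg ⟨⟨σ, hσ⟩, ⟨_, hs⟩⟩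
      simp only [neg_neg] at h2
      exact F3 h2.1 (hg t0).1 h2.2 hη
    · simp
end
end FO

open Polynomial
open scoped Classical
set_option linter.all false
namespace FO
open Filter Topology

lemma enum_finset (F : Finset ℂ) (f : ℂ → ℕ) (L : Multiset ℕ) (h : F.val.map f = L) :
    ∃ e : L.ToType → ℂ, Function.Injective e ∧ ∀ x, e x ∈ F ∧ f (e x) = x.1 := by
  have hc : ∀ n, (F.filter (fun z => n = f z)).card = L.count n := by
    intro n
    rw [← h, Multiset.count_map]
    rfl
  let e : L.ToType → ℂ := fun x => (((F.filter (fun z => x.1 = f z)).equivFinOfCardEq (hc x.1)).symm x.2).1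
  have he : ∀ x, e x ∈ F.filter (fun z => x.1 = f z) := fun x => (((F.filter (fun z => x.1 = f z)).equivFinOfCardEq (hc x.1)).symm x.2).2
  refine ⟨e, ?_, fun x => ⟨(Finset.mem_filter.1 (he x)).1, (Finset.mem_filter.1 (he x)).2.symm⟩⟩
  rintro ⟨n, i⟩ ⟨n', i'⟩ hxy
  have h1 : n = n' := by
    have h2 := (Finset.mem_filter.1 (he ⟨n, i⟩)).2
    have h3 := (Finset.mem_filter.1 (he ⟨n', i'⟩)).2
    rw [hxy, ← h3] at h2
    exact h2
  subst h1
  have h2 := (Equiv.injective _) (Subtype.ext hxy)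
  exact congrArg (fun i => (⟨n, i⟩ : L.ToType)) h2

lemma enum_ram (P : ℝ[X]) (w : ℝ) (L : Multiset ℕ) (h : redRamType P w = L) :
    ∃ e : L.ToType → ℂ, Function.Injective e ∧ ∀ x, (cx P).eval (e x) = w ∧ (cx P - C (w : ℂ)).rootMultiplicity (e x) - 1 = x.1 := by
  unfold redRamType ramType at h
  rw [Multiset.map_map, Multiset.filter_map, ← Finset.filter_val] at h
  obtain ⟨e, he, hx⟩ := enum_finset _ _ _ h
  refine ⟨e, he, fun x => ⟨?_, (hx x).2⟩⟩
  have h1 := (Finset.mem_filter.1 (hx x).1).1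
  rw [Multiset.mem_toFinset] at h1
  have h2 := isRoot_of_mem_roots h1
  simpa [sub_eq_zero] using h2

lemma lab_of {ι : Type*} [Fintype ι] (a : ι → ℕ) (u : ι → ℝ) (P : ℝ[X]) (hP : IsNormalized (∑ j, a j + 1) P) (η : ι → ℂ)
    (hi : Function.Injective η) (hu : ∀ j, (cx P).eval (η j) = ((- u j : ℝ) : ℂ))
    (hm : ∀ j, (cx P - C ((- u j : ℝ) : ℂ)).rootMultiplicity (η j) - 1 = a j) : Lab a u P η := by
  refine ⟨hi, ?_, hu⟩
  have hcm : (cx P).Monic := hP.2.1.map _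
  have hcd : (cx P).natDegree = ∑ j, a j + 1 := by rw [natDegree_map, hP.1]
  have hdvd : cp a η ∣ derivative (cx P) := by
    unfold cp
    refine Fintype.prod_dvd_of_coprime (fun i j hij => (pairwise_coprime_X_sub_C hi hij).pow) fun j => ?_
    have hr : (cx P - C ((- u j : ℝ) : ℂ)).IsRoot (η j) := by simp [hu j]
    have h1 := derivative_rootMultiplicity_of_root hr
    rw [hm j] at h1
    have h2 := pow_rootMultiplicity_dvd (derivative (cx P - C ((- u j : ℝ) : ℂ))) (η j)
    rw [h1] at h2
    simpa using h2
  have h1 := eq_leadingCoeff_mul_of_monic_of_dvd_of_natDegree_le (cp_monic a η) hdvd (by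
    rw [cp_natDegree, natDegree_derivative, hcd]; simp)
  rw [h1]
  congr 2
  rw [leadingCoeff, natDegree_derivative, coeff_derivative, hcd]
  have := hcm.coeff_natDegree
  rw [hcd] at this
  simp only [Nat.add_sub_cancel, this]
  push_cast; ring

section
variable {k : ℕ} (lam : Fin k → Multiset ℕ)

abbrev WL := Σ i : Fin k, (lam i).ToType
def aL (w : WL lam) : ℕ := w.2.1
def uL (w : WL lam) : ℝ := (w.1 : ℕ) + 1

lemma sum_aL : ∑ w, aL lam w = ∑ i, (lam i).sum := by
  rw [Fintype.sum_sigma]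
  refine Finset.sum_congr rfl fun i _ => ?_
  conv_rhs => rw [← Multiset.map_univ_coe (lam i)]
  rfl

lemma sum_aS (m : ℕ) : ∑ j : WL lam ⊕ Fin m, aS (aL lam) (vS m j) = ∑ i, (lam i).sum + m := by
  rw [Fintype.sum_sum_type, ← sum_aL]
  congr 1
  change ∑ _ : Fin m, 1 = m
  simp

lemma S_eq (hlam : ∀ i, (0 : ℕ) ∉ lam i) (m : ℕ) : {P : Polynomial ℝ |
      IsNormalized (m + (∑ i, (lam i).sum) + 1) P ∧
      (∀ i : Fin k, redRamType P (-(((i : ℕ) + 1 : ℕ) : ℝ)) = lam i) ∧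
      ∀ j : Fin m, redRamType P (-((k + (j : ℕ) + 1 : ℕ) : ℝ)) = ({1} : Multiset ℕ)} = 
    {P : ℝ[X] | IsNormalized (∑ j : WL lam ⊕ Fin m, aS (aL lam) (vS m j) + 1) P ∧ ∃ η, Lab (aS (aL lam) ∘ vS m) (uS (uL lam) (k + 1) ∘ vS m) P η} := by
  have hpos : ∀ w, 0 < aL lam w := by
    rintro ⟨i, x⟩
    have h1 : x.1 ∈ lam i := Multiset.coe_mem
    have h2 : x.1 ≠ 0 := fun h => hlam i (h ▸ h1)
    exact Nat.pos_of_ne_zero h2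
  have hn : m + ∑ i, (lam i).sum + 1 = ∑ j : WL lam ⊕ Fin m, aS (aL lam) (vS m j) + 1 := by rw [sum_aS]; ring
  rw [hn]
  have ui : ∀ i x, (uS (uL lam) (k + 1) ∘ vS m) (Sum.inl (⟨i, x⟩ : WL lam)) = (((i : ℕ) + 1 : ℕ) : ℝ) := by
    intro i x
    simp [uS, vS, uL]
  have uj : ∀ j : Fin m, (uS (uL lam) (k + 1) ∘ vS m) (Sum.inr j) = ((k + (j : ℕ) + 1 : ℕ) : ℝ) := by
    intro j
    simp [uS, vS]; ring
  ext P
  simp only [Set.mem_setOf_eq]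
  refine and_congr_right fun hP => ⟨?_, ?_⟩
  · rintro ⟨h1, h2⟩
    have g1 := fun i => enum_ram P _ _ (h1 i)
    have g2 := fun j => enum_ram P _ _ (h2 j)
    choose e he hx using g1
    choose f hf hy using g2
    let o : Multiset.ToType ({1} : Multiset ℕ) := ⟨1, ⟨0, by simp⟩⟩
    let η : WL lam ⊕ Fin m → ℂ := Sum.elim (fun w => e w.1 w.2) (fun j => f j o)
    have hu : ∀ j, (cx P).eval (η j) = ((- (uS (uL lam) (k + 1) ∘ vS m) j : ℝ) : ℂ) := by
      rintro (⟨i, x⟩ | j)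
      · rw [ui]; exact (hx i x).1
      · rw [uj]; exact (hy j o).1
    refine ⟨η, lab_of _ _ P hP η ?_ hu ?_⟩
    · intro s t hst
      have h3 := hu s
      rw [hst, hu t, Complex.ofReal_inj, neg_inj] at h3
      rcases s with ⟨i, x⟩ | j <;> rcases t with ⟨i', x'⟩ | j'
      · rw [ui, ui, Nat.cast_inj] at h3
        have : i' = i := Fin.ext (by omega)
        subst this
        exact congrArg (fun x => Sum.inl (⟨i', x⟩ : WL lam)) (he i' hst)
      · rw [ui, uj, Nat.cast_inj] at h3
        have := i.2
        omega
      · rw [ui, uj, Nat.cast_inj] at h3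
        have := i'.2
        omega
      · rw [uj, uj, Nat.cast_inj] at h3
        have : j' = j := Fin.ext (by omega)
        rw [this]
    · rintro (⟨i, x⟩ | j)
      · rw [ui]; exact (hx i x).2
      · rw [uj]; exact (hy j o).2
  · rintro ⟨η, hη⟩
    have R := RAM (fun j => aS_pos hpos _) hη
    refine ⟨fun i => ?_, fun j => ?_⟩
    · rw [R]
      let em : (lam i).ToType ↪ WL lam ⊕ Fin m := ⟨fun x => Sum.inl ⟨i, x⟩, fun x y h => by simpa using h⟩
      have : (Finset.univ.filter (fun s : WL lam ⊕ Fin m => - (uS (uL lam) (k + 1) ∘ vS m) s = -(((i : ℕ) + 1 : ℕ) : ℝ))) = Finset.univ.map em := by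
        ext s
        simp only [Finset.mem_filter, Finset.mem_univ, true_and, Finset.mem_map, neg_inj]
        rcases s with ⟨i', x⟩ | j
        · rw [ui, Nat.cast_inj]
          constructor
          · intro h
            have : i' = i := Fin.ext (by omega)
            subst this
            exact ⟨x, rfl⟩
          · rintro ⟨y, hy⟩
            have := congrArg Sigma.fst (Sum.inl_injective hy)
            change i = i' at this
            rw [this]
        · rw [uj, Nat.cast_inj]
          constructor
          · intro h
            have := i.2
            omega
          · rintro ⟨y, hy⟩
            exact absurd hy Sum.inl_ne_inr
      rw [this, Finset.map_val, Multiset.map_map]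
      conv_rhs => rw [← Multiset.map_univ_coe (lam i)]
      rfl
    · rw [R]
      have : (Finset.univ.filter (fun s : WL lam ⊕ Fin m => - (uS (uL lam) (k + 1) ∘ vS m) s = -((k + (j : ℕ) + 1 : ℕ) : ℝ))) = {Sum.inr j} := by
        ext s
        simp only [Finset.mem_filter, Finset.mem_univ, true_and, Finset.mem_singleton, neg_inj]
        rcases s with ⟨i', x⟩ | j'
        · rw [ui, Nat.cast_inj]
          have := i'.2
          constructor
          · intro h; omega
          · intro h; exact absurd h Sum.inl_ne_inr
        · rw [uj, Nat.cast_inj]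
          constructor
          · intro h
            rw [Fin.ext (show (j' : ℕ) = j by omega)]
          · intro h
            rw [Sum.inr_injective h]
      rw [this]
      rfl

lemma smooth_Q (Q : MvPolynomial (Fin 2) ℚ) (n : WithTop ℕ∞) : ContDiff ℝ n (fun q : ℝ => MvPolynomial.aeval ![q, Real.tanh q] Q / Real.cosh q) := by
  have ht : ContDiff ℝ n Real.tanh := by
    have e : Real.tanh = fun x => Real.sinh x / Real.cosh x := funext Real.tanh_eq_sinh_div_cosh
    rw [e]
    exact Real.contDiff_sinh.div Real.contDiff_cosh (fun x => (Real.cosh_pos x).ne')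
  refine ContDiff.div ?_ Real.contDiff_cosh (fun x => (Real.cosh_pos x).ne')
  induction Q using MvPolynomial.induction_on with
  | C a => simp only [MvPolynomial.aeval_C]; exact contDiff_const
  | add p q hp hq => simp only [map_add]; exact hp.add hq
  | mul_X p i hp =>
    simp only [map_mul, MvPolynomial.aeval_X]
    refine hp.mul ?_
    fin_cases i
    · exact contDiff_id
    · exact ht

lemma FINAL (hlam : ∀ i, (0 : ℕ) ∉ lam i) :
    ∃ Q : MvPolynomial (Fin 2) ℚ,
      ∀ m : ℕ,
        iteratedDeriv m
            (fun q : ℝ => (MvPolynomial.aeval ![q, Real.tanh q]) Q / Real.cosh q) 0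
          = (sOdd lam m : ℝ) := by
  have hpos : ∀ w, 0 < aL lam w := by
    rintro ⟨i, x⟩
    have h1 : x.1 ∈ lam i := Multiset.coe_mem
    have h2 : x.1 ≠ 0 := fun h => hlam i (h ▸ h1)
    exact Nat.pos_of_ne_zero h2
  have hlt : ∀ w, uL lam w < (k : ℝ) + 1 := by
    rintro ⟨i, x⟩
    have : ((i : ℕ) : ℝ) < k := Nat.cast_lt.2 i.2
    change ((i : ℕ) : ℝ) + 1 < k + 1
    linarith
  have hA := fun σ : {σ : WL lam → WL lam // AH (aL lam) (uL lam) σ ((k : ℝ) + 1)} => ALGfin σ.2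
  choose Q hQ using hA
  set M := Nat.card (GS (aL lam) (uL lam)) with hM
  have hM0 : (M : ℝ) ≠ 0 := by
    have : Nonempty (GS (aL lam) (uL lam)) := ⟨⟨1, fun _ => rfl, fun _ => rfl⟩⟩
    have : 0 < M := Nat.card_pos
    exact Nat.cast_ne_zero.2 this.ne'
  refine ⟨MvPolynomial.C (1 / (M : ℚ)) * ∑ σ, Q σ, fun m => ?_⟩
  have e1 : (fun q : ℝ => (MvPolynomial.aeval ![q, Real.tanh q]) (MvPolynomial.C (1 / (M : ℚ)) * ∑ σ, Q σ) / Real.cosh q)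
      = fun q : ℝ => (1 / (M : ℝ)) * ∑ σ, ((MvPolynomial.aeval ![q, Real.tanh q]) (Q σ) / Real.cosh q) := by
    funext q
    rw [map_mul, MvPolynomial.aeval_C, map_sum, mul_div_assoc, Finset.sum_div]
    simp
  rw [e1, iteratedDeriv_const_mul_field, iteratedDeriv_fun_sum (fun σ _ => (smooth_Q (Q σ) _).contDiffAt)]
  rw [Finset.sum_congr rfl fun σ _ => hQ σ m, one_div, inv_mul_eq_iff_eq_mul₀ hM0]
  unfold fZ sOdd
  rw [sum_aL]
  by_cases hev : Even (∑ i, (lam i).sum + m)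
  · have hod : Odd (m + ∑ i, (lam i).sum + 1) := by
      rw [add_comm m]; exact hev.add_one
    rw [if_pos hod]
    simp only [if_pos hev]
    have := COUNT (m := m) hpos hlt (by rw [sum_aS]; exact hev)
    rw [← S_eq lam hlam m] at this
    change _ = (M : ℤ) * sNum lam m at this
    rw [← Int.cast_sum, ← Int.cast_natCast (R := ℝ) M, ← Int.cast_mul, ← this]
    congr!
  · have hod : ¬ Odd (m + ∑ i, (lam i).sum + 1) := by
      intro h
      apply hev
      rw [add_comm m] at h
      rcases Nat.even_or_odd (∑ i, (lam i).sum + m) with h' | h'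
      · exact h'
      · exact absurd h (Nat.not_odd_iff_even.2 h'.add_one)
    rw [if_neg hod]
    simp [hev]
end
end FO

/-- `F^odd_{λ₁,…,λ_k}` equals `g(q) = 1/cosh q` times a polynomial in `q` and
`f(q) = tanh q` with rational coefficients: there is a two-variable rational polynomial
`Q` such that the `m`-th derivative at `0` of `q ↦ Q(q, tanh q)/cosh q` is `s^odd(m)`
for all `m`. -/
theorem Fodd_poly_in_q_tanh (k : ℕ) (lam : Fin k → Multiset ℕ)
    (hlam : ∀ i, (0 : ℕ) ∉ lam i) :
    ∃ Q : MvPolynomial (Fin 2) ℚ,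
      ∀ m : ℕ,
        iteratedDeriv m
            (fun q : ℝ => (MvPolynomial.aeval ![q, Real.tanh q]) Q / Real.cosh q) 0
          = (sOdd lam m : ℝ) := by
  exact FO.FINAL lam hlam
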